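/- The Banach representation Π := B(α)/L(α) is topologically irreducible already as a representation of the Borel subgroup B(ℚ_p) of upper triangular matrices in GL₂(ℚ_p): every closed subspace of Π stable under B(ℚ_p) is 0 or Π. -/

import Mathlib

open Filter Topology Classical

noncomputable section

namespace Paper

variable (p : ℕ) [Fact p.Prime]
variable (L : Type) [NontriviallyNormedField L] [NormedAlgebra ℚ_[p] L]

/-- The canonical embedding `ℚ_p → L`. -/
noncomputable def iotaL : ℚ_[p] → L := algebraMap ℚ_[p] L

/-- The binomial coefficient `binom(z, n) = z(z-1)⋯(z-n+1)/n!` of a `p`-adic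
integer, computed in `ℚ_p`. -/
noncomputable def binomQ (z : ℤ_[p]) (n : ℕ) : ℚ_[p] :=
  (∏ i ∈ Finset.range n, ((z : ℚ_[p]) - (i : ℚ_[p]))) / (n.factorial : ℚ_[p])

/-- The Mahler coefficients `a_n(f) = ∑_{i=0}^n (-1)^i binom(n,i) f(n-i)`. -/
noncomputable def mahlerCoeff (f : ℤ_[p] → L) (n : ℕ) : L :=
  ∑ i ∈ Finset.range (n + 1), (-1 : L) ^ i * (n.choose i : L) * f (((n - i : ℕ) : ℤ_[p]))

/-- `f : ℤ_p → L` is of class `C^r` : the scaled Mahler coefficients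
`n^r a_n(f)` tend to `0`, and `f` is the sum of its Mahler expansion. -/
def IsCr (r : ℝ) (f : ℤ_[p] → L) : Prop :=
  Tendsto (fun n : ℕ => (n : ℝ) ^ r * ‖mahlerCoeff p L f n‖) atTop (nhds 0) ∧
  ∀ z : ℤ_[p], HasSum (fun n : ℕ => mahlerCoeff p L f n * iotaL p L (binomQ p z n)) (f z)

/-- The norm `‖f‖_r = sup_n (n+1)^r ‖a_n(f)‖` on `C^r(ℤ_p, L)`. -/
noncomputable def crNorm (r : ℝ) (f : ℤ_[p] → L) : ℝ :=
  ⨆ n : ℕ, ((n : ℝ) + 1) ^ r * ‖mahlerCoeff p L f n‖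

/-- A continuous (= bounded) linear functional on `C^r(ℤ_p, L)`, i.e. a tempered
distribution of order `r`. -/
structure CrDual (r : ℝ) where
  toFun : (ℤ_[p] → L) → L
  map_add' : ∀ f g : ℤ_[p] → L, IsCr p L r f → IsCr p L r g →
    toFun (f + g) = toFun f + toFun g
  map_smul' : ∀ (c : L) (f : ℤ_[p] → L), IsCr p L r f → toFun (c • f) = c * toFun f
  bound' : ∃ C : ℝ, ∀ f : ℤ_[p] → L, IsCr p L r f → ‖toFun f‖ ≤ C * crNorm p L r f

/-- The function `z ↦ 1_{a + pⁿℤ_p}(z) (z - a)^j`. -/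
noncomputable def indPoly (a : ℤ_[p]) (n : ℕ) (j : ℕ) : ℤ_[p] → L := fun z =>
  if ‖z - a‖ ≤ (p : ℝ) ^ (-(n : ℤ)) then (iotaL p L ((z : ℚ_[p]) - (a : ℚ_[p]))) ^ j else 0

/-- The norm `‖μ‖_{r,d} = sup_{a, 0 ≤ j ≤ d, n} p^{n(j-r)} ‖∫_{a+pⁿℤ_p} (z-a)^j dμ‖`. -/
noncomputable def dualNormRD (r : ℝ) (d : ℕ) (μ : CrDual p L r) : ℝ :=
  ⨆ (a : ℤ_[p]) (j : Fin (d + 1)) (n : ℕ),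
    (p : ℝ) ^ ((n : ℝ) * (((j : ℕ) : ℝ) - r)) * ‖μ.toFun (indPoly p L a n j)‖

/-- `f : ℤ_p → L` is locally polynomial of local degree at most `d`. -/
def IsLocPoly (d : ℕ) (f : ℤ_[p] → L) : Prop :=
  ∃ n : ℕ, ∀ a : ℤ_[p], ∃ P : Polynomial L, P.natDegree ≤ d ∧
    ∀ z : ℤ_[p], ‖z - a‖ ≤ (p : ℝ) ^ (-(n : ℤ)) → f z = Polynomial.eval (iotaL p L (z : ℚ_[p])) P

/-- A linear functional on `Pol^d(ℤ_p, L)`. -/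
structure PolDual (d : ℕ) where
  toFun : (ℤ_[p] → L) → L
  map_add' : ∀ f g : ℤ_[p] → L, IsLocPoly p L d f → IsLocPoly p L d g →
    toFun (f + g) = toFun f + toFun g
  map_smul' : ∀ (c : L) (f : ℤ_[p] → L), IsLocPoly p L d f → toFun (c • f) = c * toFun f

/-- The valuation `val(x) = -log_p ‖x‖` on `L`, normalized by `val(p) = 1`. -/
noncomputable def valL (x : L) : ℝ := -Real.logb p ‖x‖

/-- `g : ℤ_p → L` is a class-`C^{val α}` extension of
`z ↦ (αp/β)^{val z} z^{k-2} f(1/z)` from `ℤ_p ∖ {0}` to `ℤ_p`. -/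
def Ext2 (k : ℕ) (α β : L) (f : ℚ_[p] → L) (g : ℤ_[p] → L) : Prop :=
  IsCr p L (valL p L α) g ∧ ∀ z : ℤ_[p], z ≠ 0 →
    g z = (α * (p : L) / β) ^ ((z : ℚ_[p]).valuation) *
      (iotaL p L (z : ℚ_[p])) ^ (k - 2) * f (((z : ℚ_[p]))⁻¹)

/-- Membership in the Banach space `B(α)`. -/
def MemB (k : ℕ) (α β : L) (f : ℚ_[p] → L) : Prop :=
  IsCr p L (valL p L α) (fun z : ℤ_[p] => f ((p : ℚ_[p]) * (z : ℚ_[p]))) ∧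
  ∃ g : ℤ_[p] → L, Ext2 p L k α β f g

/-- The extension `f₂` of `z ↦ (αp/β)^{val z} z^{k-2} f(1/z)` to `ℤ_p`
(it is unique when it exists). -/
noncomputable def ext2 (k : ℕ) (α β : L) (f : ℚ_[p] → L) : ℤ_[p] → L :=
  if h : ∃ g : ℤ_[p] → L, Ext2 p L k α β f g then h.choose else 0

/-- The norm `‖f‖ = max(‖f₁‖_{val α}, ‖f₂‖_{val α})` on `B(α)`. -/
noncomputable def bNorm (k : ℕ) (α β : L) (f : ℚ_[p] → L) : ℝ :=
  max (crNorm p L (valL p L α) (fun z : ℤ_[p] => f ((p : ℚ_[p]) * (z : ℚ_[p]))))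
      (crNorm p L (valL p L α) (ext2 p L k α β f))

/-- Determinant of a 2×2 matrix. -/
noncomputable def det2 (m : Matrix (Fin 2) (Fin 2) ℚ_[p]) : ℚ_[p] :=
  m 0 0 * m 1 1 - m 0 1 * m 1 0

/-- The action of `g = (a b; c d) ∈ GL₂(ℚ_p)` on `B(α)`:
`(g·f)(z) = α^{-val(ad-bc)} (αp/β)^{val(-cz+a)} (-cz+a)^{k-2} f((dz-b)/(-cz+a))`,
the value at the pole `-cz+a = 0` being the one prescribed by the extension `f₂`. -/
noncomputable def gAct (k : ℕ) (α β : L) (m : Matrix (Fin 2) (Fin 2) ℚ_[p])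
    (f : ℚ_[p] → L) : ℚ_[p] → L := fun z =>
  if -(m 1 0) * z + m 0 0 = 0 then
    α ^ (-(det2 p m).valuation) * (α * (p : L) / β) ^ ((det2 p m / m 1 0).valuation) *
      (iotaL p L (det2 p m / m 1 0)) ^ (k - 2) * ext2 p L k α β f 0
  else
    α ^ (-(det2 p m).valuation) * (α * (p : L) / β) ^ ((-(m 1 0) * z + m 0 0).valuation) *
      (iotaL p L (-(m 1 0) * z + m 0 0)) ^ (k - 2) *
      f ((m 1 1 * z - m 0 1) / (-(m 1 0) * z + m 0 0))

/-- The monomial function `z ↦ z^j` on `ℚ_p`. -/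
noncomputable def monomialFun (j : ℕ) : ℚ_[p] → L := fun z => (iotaL p L z) ^ j

/-- The function `z ↦ (αp/β)^{val(z-a)} (z-a)^{k-2-j}` (extended by `0` at `z = a`). -/
noncomputable def specFun (k : ℕ) (α β : L) (a : ℚ_[p]) (j : ℕ) : ℚ_[p] → L := fun z =>
  if z = a then 0 else
    (α * (p : L) / β) ^ ((z - a).valuation) * (iotaL p L (z - a)) ^ (k - 2 - j)

/-- The generators of `L(α)` : the functions `z^j` and
`(αp/β)^{val(z-a)}(z-a)^{k-2-j}` for `0 ≤ j < val(α)` and `a ∈ ℚ_p`. -/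
def lGen (k : ℕ) (α β : L) : Set (ℚ_[p] → L) :=
  {f | ∃ j : ℕ, (j : ℝ) < valL p L α ∧
    (f = monomialFun p L j ∨ ∃ a : ℚ_[p], f = specFun p L k α β a j)}

/-- Membership in `L(α)`, the closure in `B(α)` of the span of the special
functions. -/
def MemLalpha (k : ℕ) (α β : L) (f : ℚ_[p] → L) : Prop :=
  MemB p L k α β f ∧ ∀ ε : ℝ, 0 < ε →
    ∃ g ∈ Submodule.span L (lGen p L k α β), bNorm p L k α β (f - g) < ε

/-- The quotient (semi)norm on `Π(V) = B(α)/L(α)`. -/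
noncomputable def qNorm (k : ℕ) (α β : L) (f : ℚ_[p] → L) : ℝ :=
  sInf {x : ℝ | ∃ g : ℚ_[p] → L, MemLalpha p L k α β g ∧ x = bNorm p L k α β (f - g)}

/-- `h : ℚ_p → L` is locally constant. -/
def LocConst (h : ℚ_[p] → L) : Prop :=
  ∀ x : ℚ_[p], ∃ n : ℕ, ∀ y : ℚ_[p], ‖y - x‖ ≤ (p : ℝ) ^ (-(n : ℤ)) → h y = h x

/-- `h` belongs to the smooth induced representation: `h` is locally constant and
`z ↦ (αp/β)^{val z} h(1/z)` extends to a locally constant function on `ℚ_p`. -/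
def IndCond (α β : L) (h : ℚ_[p] → L) : Prop :=
  LocConst p L h ∧ ∃ h' : ℚ_[p] → L, LocConst p L h' ∧
    ∀ z : ℚ_[p], z ≠ 0 → h' z = (α * (p : L) / β) ^ z.valuation * h z⁻¹

/-- The generators `z ↦ P(z) h(z)` of the locally algebraic representation `π(α)`. -/
def piGen (k : ℕ) (α β : L) : Set (ℚ_[p] → L) :=
  {f | ∃ (P : Polynomial L) (h : ℚ_[p] → L), P.natDegree ≤ k - 2 ∧ IndCond p L α β h ∧
    f = fun z => Polynomial.eval (iotaL p L z) P * h z}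

/-- The locally algebraic representation `π(α)`, as a subspace of functions
`ℚ_p → L`. -/
noncomputable def piRep (k : ℕ) (α β : L) : Submodule L (ℚ_[p] → L) :=
  Submodule.span L (piGen p L k α β)

/-- The standing hypotheses on `(k, α, β)` coming from an absolutely irreducible,
`φ`-semisimple crystalline representation: `k ≥ 2`, `α ≠ β`,
`0 < val(β) ≤ val(α)` and `val(α) + val(β) = k - 1`. -/
def Hyps (k : ℕ) (α β : L) : Prop :=
  2 ≤ k ∧ α ≠ β ∧ 0 < valL p L α ∧ 0 < valL p L β ∧
    valL p L α + valL p L β = (k : ℝ) - 1 ∧ valL p L β ≤ valL p L α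

/-- `Λ` is a `GL₂(ℚ_p)`-stable `𝒪_L`-lattice in `π(α)`: an `𝒪_L`-submodule of
`π(α)` generating it over `L`, containing no `L`-line and stable by the action. -/
def IsLatticeStable (k : ℕ) (α β : L) (Λ : Set (ℚ_[p] → L)) : Prop :=
  (∀ f ∈ Λ, f ∈ piRep p L k α β) ∧ ((0 : ℚ_[p] → L) ∈ Λ) ∧
  (∀ f ∈ Λ, ∀ g ∈ Λ, f + g ∈ Λ) ∧
  (∀ c : L, ‖c‖ ≤ 1 → ∀ f ∈ Λ, c • f ∈ Λ) ∧
  (∀ f ∈ piRep p L k α β, ∃ c : L, c ≠ 0 ∧ c • f ∈ Λ) ∧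
  (∀ f, f ∈ piRep p L k α β → f ≠ 0 → ¬ ∀ c : L, c • f ∈ Λ) ∧
  (∀ m : Matrix (Fin 2) (Fin 2) ℚ_[p], det2 p m ≠ 0 → ∀ f ∈ Λ, gAct p L k α β m f ∈ Λ)

end Paper

namespace Paper

set_option linter.unusedSectionVars false
set_option linter.style.haveILetI false
set_option linter.unusedVariables false
set_option linter.unusedTactic false
set_option linter.unreachableTactic false
set_option linter.unusedSimpArgs false

section Basics

variable {p : ℕ} [hp : Fact p.Prime]
variable {L : Type} [NontriviallyNormedField L] [NormedAlgebra ℚ_[p] L]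

lemma norm_iotaL (x : ℚ_[p]) : ‖iotaL p L x‖ = ‖x‖ := norm_algebraMap' L x

lemma one_lt_p : (1 : ℝ) < p := by exact_mod_cast hp.out.one_lt

lemma p_pos : (0 : ℝ) < p := by exact_mod_cast hp.out.pos

lemma norm_pL : ‖(p : L)‖ = (p : ℝ)⁻¹ := by
  have := norm_iotaL (L := L) (p : ℚ_[p])
  simpa [iotaL] using this

lemma pL_ne_zero : (p : L) ≠ 0 := by
  have := norm_pL (p := p) (L := L)
  intro h
  rw [h, norm_zero] at this
  have := p_pos (p := p)
  simp_all

lemma charZero_L (p : ℕ) [Fact p.Prime] (L : Type) [NontriviallyNormedField L]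
    [NormedAlgebra ℚ_[p] L] : CharZero L := by
  exact charZero_of_injective_algebraMap (algebraMap ℚ_[p] L).injective

/-- The `n`-th binomial function on `ℤ_p` with values in `L`. -/
def bn (L : Type) [NontriviallyNormedField L] [NormedAlgebra ℚ_[p] L] (n : ℕ) : ℤ_[p] → L :=
  fun z => iotaL p L (binomQ p z n)

lemma binomQ_eq (z : ℤ_[p]) (n : ℕ) : binomQ p z n = ((Ring.choose z n : ℤ_[p]) : ℚ_[p]) := by
  have hc : Continuous fun z : ℤ_[p] => binomQ p z n := by
    unfold binomQ
    fun_prop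
  have hc' : Continuous fun z : ℤ_[p] => ((Ring.choose z n : ℤ_[p]) : ℚ_[p]) :=
    continuous_subtype_val.comp (g := fun z : ℤ_[p] => (z : ℚ_[p])) (PadicInt.continuous_choose n)
  refine congrFun (PadicInt.denseRange_natCast.equalizer hc hc' (funext fun m => ?_)) z
  simp only [Function.comp_apply, binomQ, Ring.choose_natCast, PadicInt.coe_natCast]
  rw [← descPochhammer_eval_eq_prod_range, descPochhammer_eval_eq_descFactorial,
    Nat.descFactorial_eq_factorial_mul_choose, Nat.cast_mul, mul_div_cancel_left₀]
  exact_mod_cast n.factorial_ne_zero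

lemma norm_bn_le (n : ℕ) (z : ℤ_[p]) : ‖bn L n z‖ ≤ 1 := by
  rw [bn, norm_iotaL, binomQ_eq]
  exact PadicInt.norm_le_one _

lemma continuous_iotaL : Continuous (iotaL p L) := continuous_algebraMap ℚ_[p] L

lemma continuous_bn (n : ℕ) : Continuous (bn (p := p) L n) := by
  unfold bn
  simp_rw [binomQ_eq]
  exact continuous_iotaL.comp (continuous_subtype_val.comp (PadicInt.continuous_choose n))

lemma bn_natCast (n m : ℕ) : bn (p := p) L n (m : ℤ_[p]) = (m.choose n : L) := by
  simp [bn, binomQ_eq, Ring.choose_natCast, iotaL]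

lemma eq_of_eq_nat {f g : ℤ_[p] → L} (hf : Continuous f) (hg : Continuous g)
    (h : ∀ n : ℕ, f n = g n) : f = g :=
  PadicInt.denseRange_natCast.equalizer hf hg (funext h)

lemma norm_le_of_nat {f : ℤ_[p] → L} (hf : Continuous f) {c : ℝ}
    (h : ∀ n : ℕ, ‖f n‖ ≤ c) (z : ℤ_[p]) : ‖f z‖ ≤ c := by
  have hc : IsClosed {z | ‖f z‖ ≤ c} := isClosed_le hf.norm continuous_const
  exact PadicInt.denseRange_natCast.induction_on z hc h

lemma bn_add (n : ℕ) (x y : ℤ_[p]) :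
    bn L n (x + y) = ∑ ij ∈ Finset.HasAntidiagonal.antidiagonal n, bn L ij.1 x * bn L ij.2 y := by
  have h1 : ∀ (m : ℕ), ∀ y : ℤ_[p], bn L n ((m : ℤ_[p]) + y) =
      ∑ ij ∈ Finset.HasAntidiagonal.antidiagonal n, bn L ij.1 (m : ℤ_[p]) * bn L ij.2 y := by
    intro m y
    refine congrFun (eq_of_eq_nat (f := fun y : ℤ_[p] => bn L n ((m : ℤ_[p]) + y)) (g := fun y =>
      ∑ ij ∈ Finset.HasAntidiagonal.antidiagonal n, bn L ij.1 (m : ℤ_[p]) * bn L ij.2 y)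
      ((continuous_bn n).comp (by fun_prop)) ?_ ?_) y
    · exact continuous_finsetSum _ fun i _ => continuous_const.mul (continuous_bn _)
    · intro k
      rw [← Nat.cast_add, bn_natCast, Nat.add_choose_eq]
      simp [bn_natCast]
  refine congrFun (eq_of_eq_nat (f := fun x : ℤ_[p] => bn L n (x + y)) (g := fun x =>
      ∑ ij ∈ Finset.HasAntidiagonal.antidiagonal n, bn L ij.1 x * bn L ij.2 y)
      ((continuous_bn n).comp (by fun_prop)) ?_ (fun m => h1 m y)) x
  exact continuous_finsetSum _ fun i _ => (continuous_bn _).mul continuous_const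

lemma mahlerCoeff_eq (f : ℤ_[p] → L) (n : ℕ) : mahlerCoeff p L f n = (fwdDiff 1)^[n] f 0 := by
  rw [fwdDiff_iter_eq_sum_shift, mahlerCoeff, ← Finset.sum_range_reflect]
  refine Finset.sum_congr rfl fun i hi => ?_
  have : i ≤ n := by simpa [Nat.lt_succ_iff] using hi
  have h2 : n + 1 - 1 - i = n - i := by omega
  have h3 : n - (n - i) = i := by omega
  rw [h2, h3, Nat.choose_symm this]
  simp

lemma mahlerCoeff_add (f g : ℤ_[p] → L) (n : ℕ) :
    mahlerCoeff p L (f + g) n = mahlerCoeff p L f n + mahlerCoeff p L g n := by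
  simp [mahlerCoeff, mul_add, Finset.sum_add_distrib]

lemma mahlerCoeff_smul (c : L) (f : ℤ_[p] → L) (n : ℕ) :
    mahlerCoeff p L (c • f) n = c * mahlerCoeff p L f n := by
  simp [mahlerCoeff, Finset.mul_sum]
  exact Finset.sum_congr rfl fun i _ => by ring

variable [IsUltrametricDist L]

variable [CompleteSpace L]

lemma hasSum_of_continuous {f : ℤ_[p] → L} (hf : Continuous f) (z : ℤ_[p]) :
    HasSum (fun n => mahlerCoeff p L f n * bn L n z) (f z) := by
  letI : Module ℤ_[p] L := Module.compHom L (algebraMap ℤ_[p] ℚ_[p])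
  have hsm : ∀ (x : ℤ_[p]) (y : L), x • y = iotaL p L (x : ℚ_[p]) * y := fun x y => by
    change (x : ℚ_[p]) • y = _
    rw [Algebra.smul_def]; rfl
  haveI : IsBoundedSMul ℤ_[p] L := IsBoundedSMul.of_norm_smul_le fun x y => by
    rw [hsm, norm_mul, norm_iotaL]; rfl
  have h := PadicInt.hasSum_mahler (⟨f, hf⟩ : C(ℤ_[p], L))
  have h2 := ContinuousMap.hasSum_apply h z
  have h3 : (fun n => mahlerCoeff p L f n * bn L n z) = fun n =>
      (PadicInt.mahlerTerm ((fwdDiff 1)^[n] (⇑(⟨f, hf⟩ : C(ℤ_[p], L))) 0) n) z := by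
    funext n
    simp only [mahlerCoeff_eq, bn, binomQ_eq]
    rw [mul_comm, ← hsm]
    rfl
  rw [h3]
  exact h2

end Basics

section Operators

open Polynomial

variable {p : ℕ} [hp : Fact p.Prime]
variable {L : Type} [NontriviallyNormedField L] [NormedAlgebra ℚ_[p] L]

/-- The action of `ℤ[X]` on functions on `ℤ_p`, with `X` acting as the shift by one. -/
def shiftOp (P : ℤ[X]) (f : ℤ_[p] → L) : ℤ_[p] → L :=
  Polynomial.aeval (fwdDiff_aux.shiftₗ ℤ_[p] L 1) P f

lemma shiftOp_mul (P Q : ℤ[X]) (f : ℤ_[p] → L) :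
    shiftOp (P * Q) f = shiftOp P (shiftOp Q f) := by
  simp [shiftOp]

lemma shiftOp_add (P Q : ℤ[X]) (f : ℤ_[p] → L) :
    shiftOp (P + Q) f = shiftOp P f + shiftOp Q f := by
  simp [shiftOp]

lemma shiftOp_one (f : ℤ_[p] → L) : shiftOp 1 f = f := by
  simp [shiftOp]

lemma shiftOp_add_right (P : ℤ[X]) (f g : ℤ_[p] → L) :
    shiftOp P (f + g) = shiftOp P f + shiftOp P g := by
  simp [shiftOp]

lemma shiftOp_zero (P : ℤ[X]) : shiftOp P (0 : ℤ_[p] → L) = 0 := by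
  simp [shiftOp]

lemma shiftOp_C (n : ℤ) (f : ℤ_[p] → L) (x : ℤ_[p]) : shiftOp (C n) f x = n * f x := by
  simp [shiftOp]

lemma shiftOp_X_pow (m : ℕ) (f : ℤ_[p] → L) (x : ℤ_[p]) :
    shiftOp (X ^ m) f x = f (x + m) := by
  simp only [shiftOp, map_pow, aeval_X]
  rw [fwdDiff_aux.shiftₗ_pow_apply]
  simp

lemma shiftOp_fwdDiff (m : ℕ) (f : ℤ_[p] → L) :
    shiftOp (X ^ m - 1) f = fwdDiff (m : ℤ_[p]) f := by
  funext x
  have := shiftOp_X_pow m f x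
  simp only [shiftOp, map_sub, map_one, LinearMap.sub_apply, fwdDiff, Pi.sub_apply] at this ⊢
  rw [this]
  rfl

lemma shiftOp_fwdDiff_iter (m i : ℕ) (f : ℤ_[p] → L) :
    shiftOp ((X ^ m - 1) ^ i) f = (fwdDiff (m : ℤ_[p]))^[i] f := by
  induction i generalizing f with
  | zero => simp [shiftOp_one]
  | succ i ih => rw [pow_succ, shiftOp_mul, ih, shiftOp_fwdDiff, Function.iterate_succ_apply]

lemma exists_frobenius_lift (N : ℕ) :
    ∃ R : ℤ[X], (X - 1 : ℤ[X]) ^ p ^ N = X ^ p ^ N - 1 + C (p : ℤ) * R := by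
  have h : C (p : ℤ) ∣ (X - 1 : ℤ[X]) ^ p ^ N - (X ^ p ^ N - 1) := by
    rw [C_dvd_iff_dvd_coeff]
    intro i
    rw [← ZMod.intCast_zmod_eq_zero_iff_dvd]
    have h2 : Polynomial.map (Int.castRingHom (ZMod p))
        ((X - 1 : ℤ[X]) ^ p ^ N - (X ^ p ^ N - 1)) = 0 := by
      simp [sub_pow_char_pow]
    have h3 := congrArg (fun q => q.coeff i) h2
    simpa only [coeff_map, eq_intCast, coeff_zero] using h3
  obtain ⟨R, hR⟩ := h
  exact ⟨R, by rw [← hR]; ring⟩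

variable [IsUltrametricDist L]

lemma norm_shiftOp_le (P : ℤ[X]) {f : ℤ_[p] → L} {c : ℝ} (hc : 0 ≤ c) (h : ∀ z, ‖f z‖ ≤ c)
    (x : ℤ_[p]) : ‖shiftOp P f x‖ ≤ c := by
  induction P using Polynomial.induction_on' generalizing x with
  | add P Q hP hQ =>
    rw [shiftOp_add, Pi.add_apply]
    exact (IsUltrametricDist.norm_add_le_max _ _).trans (max_le (hP x) (hQ x))
  | monomial n a =>
    rw [← C_mul_X_pow_eq_monomial, shiftOp_mul, shiftOp_C, shiftOp_X_pow, norm_mul]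
    calc _ ≤ 1 * c := mul_le_mul (IsUltrametricDist.norm_intCast_le_one L _) (h _)
          (norm_nonneg _) zero_le_one
      _ = c := one_mul c

lemma norm_fwdDiff_iter_le (m i : ℕ) {f : ℤ_[p] → L} {c : ℝ} (hc : 0 ≤ c) (h : ∀ z, ‖f z‖ ≤ c)
    (x : ℤ_[p]) : ‖(fwdDiff (m : ℤ_[p]))^[i] f x‖ ≤ c := by
  rw [← shiftOp_fwdDiff_iter]
  exact norm_shiftOp_le _ hc h x

lemma norm_shiftOp_pow_le (N e M : ℕ) {f : ℤ_[p] → L} {c : ℝ} (hc : 0 ≤ c) (h : ∀ z, ‖f z‖ ≤ c)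
    (he : (fwdDiff ((p ^ N : ℕ) : ℤ_[p]))^[e] f = 0) (x : ℤ_[p]) :
    ‖shiftOp (((X - 1) ^ p ^ N) ^ M) f x‖ ≤ c * ((p : ℝ)⁻¹) ^ (M + 1 - e) := by
  have hp0 : (0 : ℝ) ≤ (p : ℝ)⁻¹ := by positivity
  have hp1 : (p : ℝ)⁻¹ ≤ 1 := inv_le_one_of_one_le₀ one_lt_p.le
  induction M generalizing e f c x with
  | zero =>
    rcases e with _ | e
    · simp only [Function.iterate_zero, id_eq] at he
      rw [he, shiftOp_zero]
      simpa using by positivity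
    · simpa [shiftOp_one] using h x
  | succ M ih =>
    rcases e with _ | e
    · simp only [Function.iterate_zero, id_eq] at he
      rw [he, shiftOp_zero]
      simpa using by positivity
    obtain ⟨R, hR⟩ := exists_frobenius_lift (p := p) N
    have h1 : shiftOp (((X - 1) ^ p ^ N) ^ (M + 1)) f =
        shiftOp (((X - 1) ^ p ^ N) ^ M) (fwdDiff ((p ^ N : ℕ) : ℤ_[p]) f) +
        shiftOp (((X - 1) ^ p ^ N) ^ M) (shiftOp (C (p : ℤ) * R) f) := by
      rw [← shiftOp_fwdDiff, ← shiftOp_add_right, ← shiftOp_add, ← shiftOp_mul, pow_succ, hR]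
    rw [h1, Pi.add_apply]
    refine (IsUltrametricDist.norm_add_le_max _ _).trans (max_le ?_ ?_)
    · have := ih e hc (fun z => norm_fwdDiff_iter_le (p ^ N) 1 hc h z)
        (by rw [← he, Function.iterate_succ_apply]; rfl) x
      simpa only [Function.iterate_one, Nat.add_sub_add_right] using this
    · have hb : ∀ z, ‖shiftOp (C (p : ℤ) * R) f z‖ ≤ (p : ℝ)⁻¹ * c := fun z => by
        rw [shiftOp_mul, shiftOp_C, norm_mul]
        have := norm_pL (p := p) (L := L)
        refine mul_le_mul ?_ (norm_shiftOp_le R hc h z) (norm_nonneg _) hp0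
        simp [this]
      have hk : (fwdDiff ((p ^ N : ℕ) : ℤ_[p]))^[e + 1] (shiftOp (C (p : ℤ) * R) f) = 0 := by
        rw [← shiftOp_fwdDiff_iter, ← shiftOp_mul, mul_comm, shiftOp_mul, shiftOp_fwdDiff_iter, he,
          shiftOp_zero]
      refine (ih (e + 1) (by positivity) hb hk x).trans ?_
      calc (p : ℝ)⁻¹ * c * (p : ℝ)⁻¹ ^ (M + 1 - (e + 1)) = c * (p : ℝ)⁻¹ ^ (M + 1 - (e + 1) + 1) := by ring
        _ ≤ _ := mul_le_mul_of_nonneg_left (pow_le_pow_of_le_one hp0 hp1 (by omega)) hc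

/-- Mahler coefficients of a function killed by a power of a difference operator of step `p ^ N`
decay exponentially. -/
lemma norm_mahlerCoeff_le_of_killed (N e : ℕ) {f : ℤ_[p] → L} {c : ℝ} (hc : 0 ≤ c)
    (h : ∀ z, ‖f z‖ ≤ c) (he : (fwdDiff ((p ^ N : ℕ) : ℤ_[p]))^[e] f = 0) (n : ℕ) :
    ‖mahlerCoeff p L f n‖ ≤ c * ((p : ℝ)⁻¹) ^ (n / p ^ N + 1 - e) := by
  have h1 : mahlerCoeff p L f n =
      shiftOp ((X - 1) ^ (n % p ^ N)) (shiftOp (((X - 1) ^ p ^ N) ^ (n / p ^ N)) f) 0 := by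
    have := shiftOp_fwdDiff_iter 1 n f
    rw [mahlerCoeff_eq, ← shiftOp_mul, ← pow_mul, ← pow_add, Nat.mod_add_div]
    simp only [pow_one, Nat.cast_one] at this
    rw [this]
  rw [h1]
  exact norm_shiftOp_le _ (by positivity) (norm_shiftOp_pow_le N e _ hc h he) 0

end Operators

section Cr

variable {p : ℕ} [hp : Fact p.Prime]
variable {L : Type} [NontriviallyNormedField L] [NormedAlgebra ℚ_[p] L] [IsUltrametricDist L]

lemma norm_le_of_hasSum {ι : Type*} {E : Type*} [NormedAddCommGroup E] [IsUltrametricDist E]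
    {g : ι → E} {x : E} (h : HasSum g x) {c : ℝ} (hc : 0 ≤ c) (hg : ∀ i, ‖g i‖ ≤ c) : ‖x‖ ≤ c :=
  le_of_tendsto h.norm (Eventually.of_forall fun _ =>
    IsUltrametricDist.norm_sum_le_of_forall_le_of_nonneg hc fun i _ => hg i)

lemma succ_rpow_le (σ : ℝ) (hσ : 0 ≤ σ) (n : ℕ) (hn : 1 ≤ n) :
    ((n : ℝ) + 1) ^ σ ≤ 2 ^ σ * (n : ℝ) ^ σ := by
  have h1 : (1 : ℝ) ≤ n := by exact_mod_cast hn
  rw [← Real.mul_rpow (by norm_num) (by positivity)]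
  exact Real.rpow_le_rpow (by positivity) (by linarith) hσ

lemma IsCr.tendsto {σ : ℝ} (hσ : 0 ≤ σ) {f : ℤ_[p] → L} (hf : IsCr p L σ f) :
    Tendsto (fun n : ℕ => ((n : ℝ) + 1) ^ σ * ‖mahlerCoeff p L f n‖) atTop (𝓝 0) := by
  have h := hf.1.const_mul ((2 : ℝ) ^ σ)
  rw [mul_zero] at h
  refine squeeze_zero' (Eventually.of_forall fun n => by positivity) ?_ h
  filter_upwards [eventually_ge_atTop 1] with n hn
  rw [← mul_assoc]
  exact mul_le_mul_of_nonneg_right (succ_rpow_le σ hσ n hn) (norm_nonneg _)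

lemma IsCr.le_crNorm {σ : ℝ} (hσ : 0 ≤ σ) {f : ℤ_[p] → L} (hf : IsCr p L σ f) (n : ℕ) :
    ((n : ℝ) + 1) ^ σ * ‖mahlerCoeff p L f n‖ ≤ crNorm p L σ f :=
  le_ciSup (hf.tendsto hσ).bddAbove_range n

lemma crNorm_nonneg (σ : ℝ) (f : ℤ_[p] → L) : 0 ≤ crNorm p L σ f :=
  Real.iSup_nonneg fun n => by positivity

lemma crNorm_le {σ : ℝ} {f : ℤ_[p] → L} {A : ℝ}
    (h : ∀ n : ℕ, ((n : ℝ) + 1) ^ σ * ‖mahlerCoeff p L f n‖ ≤ A) : crNorm p L σ f ≤ A :=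
  ciSup_le h

lemma one_le_succ_rpow {σ : ℝ} (hσ : 0 ≤ σ) (n : ℕ) : (1 : ℝ) ≤ ((n : ℝ) + 1) ^ σ :=
  Real.one_le_rpow (by linarith [(Nat.cast_nonneg n : (0 : ℝ) ≤ n)]) hσ

lemma IsCr.norm_mahlerCoeff_le {σ : ℝ} (hσ : 0 ≤ σ) {f : ℤ_[p] → L} (hf : IsCr p L σ f) (n : ℕ) :
    ‖mahlerCoeff p L f n‖ ≤ crNorm p L σ f :=
  (le_mul_of_one_le_left (norm_nonneg _) (one_le_succ_rpow hσ n)).trans (hf.le_crNorm hσ n)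

lemma IsCr.norm_le {σ : ℝ} (hσ : 0 ≤ σ) {f : ℤ_[p] → L} (hf : IsCr p L σ f) (z : ℤ_[p]) :
    ‖f z‖ ≤ crNorm p L σ f := by
  refine norm_le_of_hasSum (hf.2 z) (crNorm_nonneg _ _) fun n => ?_
  rw [norm_mul]
  calc _ ≤ crNorm p L σ f * 1 := mul_le_mul (hf.norm_mahlerCoeff_le hσ n) (norm_bn_le n z)
        (norm_nonneg _) (crNorm_nonneg _ _)
    _ = _ := mul_one _

lemma IsCr.continuous {σ : ℝ} (hσ : 0 ≤ σ) {f : ℤ_[p] → L} (hf : IsCr p L σ f) :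
    Continuous f := by
  have h0 : Tendsto (fun n => ‖mahlerCoeff p L f n‖) atTop (𝓝 0) :=
    squeeze_zero (fun _ => norm_nonneg _)
      (fun n => le_mul_of_one_le_left (norm_nonneg _) (one_le_succ_rpow hσ n)) (hf.tendsto hσ)
  refine continuous_of_uniform_approx_of_continuous fun u hu => ?_
  obtain ⟨ε, hε, hu⟩ := Metric.mem_uniformity_dist.1 hu
  obtain ⟨M, hM⟩ := (eventually_atTop.1 (h0.eventually (gt_mem_nhds (half_pos hε))))
  refine ⟨fun z => ∑ n ∈ Finset.range M, mahlerCoeff p L f n * bn L n z,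
    continuous_finsetSum _ fun i _ => continuous_const.mul (continuous_bn i), fun z => hu ?_⟩
  rw [dist_eq_norm]
  have h1 := (hasSum_nat_add_iff' M).2 (hf.2 z)
  refine lt_of_le_of_lt (norm_le_of_hasSum h1 (half_pos hε).le fun n => ?_) (half_lt_self hε)
  rw [norm_mul]
  calc _ ≤ ε / 2 * 1 := mul_le_mul (hM _ (by omega)).le (norm_bn_le _ z)
        (norm_nonneg _) (half_pos hε).le
    _ = _ := mul_one _

lemma isCr_of [CompleteSpace L] {σ : ℝ} (hσ : 0 ≤ σ) {f : ℤ_[p] → L} (hc : Continuous f)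
    (h : Tendsto (fun n : ℕ => ((n : ℝ) + 1) ^ σ * ‖mahlerCoeff p L f n‖) atTop (𝓝 0)) :
    IsCr p L σ f := by
  refine ⟨squeeze_zero (fun n => by positivity) (fun n => ?_) h, fun z => hasSum_of_continuous hc z⟩
  exact mul_le_mul_of_nonneg_right
    (Real.rpow_le_rpow (by positivity) (by linarith) hσ) (norm_nonneg _)

lemma IsCr.add {σ : ℝ} {f g : ℤ_[p] → L} (hf : IsCr p L σ f) (hg : IsCr p L σ g) :
    IsCr p L σ (f + g) := by
  refine ⟨squeeze_zero (fun n => by positivity) (fun n => ?_) ((hf.1.add hg.1).trans (by simp)),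
    fun z => ?_⟩
  · rw [mahlerCoeff_add, ← mul_add]
    exact mul_le_mul_of_nonneg_left (norm_add_le _ _) (by positivity)
  · simpa only [mahlerCoeff_add, add_mul, Pi.add_apply] using (hf.2 z).add (hg.2 z)

lemma IsCr.smul {σ : ℝ} {f : ℤ_[p] → L} (hf : IsCr p L σ f) (c : L) :
    IsCr p L σ (c • f) := by
  refine ⟨?_, fun z => ?_⟩
  · have := hf.1.const_mul ‖c‖
    simp only [mahlerCoeff_smul, norm_mul]
    simpa only [mul_zero, mul_left_comm] using this
  · simpa only [mahlerCoeff_smul, mul_assoc, Pi.smul_apply, smul_eq_mul] using (hf.2 z).mul_left c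

lemma isCr_zero (σ : ℝ) : IsCr p L σ 0 := by
  refine ⟨by simp [mahlerCoeff], fun z => ?_⟩
  simp only [mahlerCoeff, Pi.zero_apply, mul_zero, Finset.sum_const_zero, zero_mul]
  exact hasSum_zero

/-- The functions of class `C^σ` as a subspace. -/
def crSub (p : ℕ) [Fact p.Prime] (L : Type) [NontriviallyNormedField L] [NormedAlgebra ℚ_[p] L]
    [IsUltrametricDist L] (σ : ℝ) : Submodule L (ℤ_[p] → L) where
  carrier := {f | IsCr p L σ f}
  add_mem' hf hg := hf.add hg
  zero_mem' := isCr_zero σ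
  smul_mem' c _ hf := hf.smul c

lemma IsCr.sub {σ : ℝ} {f g : ℤ_[p] → L} (hf : IsCr p L σ f) (hg : IsCr p L σ g) :
    IsCr p L σ (f - g) := (crSub p L σ).sub_mem hf hg

lemma IsCr.sum {σ : ℝ} {ι : Type*} {s : Finset ι} {f : ι → ℤ_[p] → L}
    (hf : ∀ i ∈ s, IsCr p L σ (f i)) : IsCr p L σ (∑ i ∈ s, f i) :=
  (crSub p L σ).sum_mem hf

lemma crNorm_add_le {σ : ℝ} (hσ : 0 ≤ σ) {f g : ℤ_[p] → L} (hf : IsCr p L σ f)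
    (hg : IsCr p L σ g) : crNorm p L σ (f + g) ≤ max (crNorm p L σ f) (crNorm p L σ g) := by
  refine crNorm_le fun n => ?_
  rw [mahlerCoeff_add]
  have h := IsUltrametricDist.norm_add_le_max (mahlerCoeff p L f n) (mahlerCoeff p L g n)
  rcases le_max_iff.1 h with h | h
  · exact ((mul_le_mul_of_nonneg_left h (by positivity)).trans (hf.le_crNorm hσ n)).trans
      (le_max_left _ _)
  · exact ((mul_le_mul_of_nonneg_left h (by positivity)).trans (hg.le_crNorm hσ n)).trans
      (le_max_right _ _)

lemma crNorm_smul_le {σ : ℝ} (hσ : 0 ≤ σ) {f : ℤ_[p] → L} (hf : IsCr p L σ f) (c : L) :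
    crNorm p L σ (c • f) ≤ ‖c‖ * crNorm p L σ f := by
  refine crNorm_le fun n => ?_
  rw [mahlerCoeff_smul, norm_mul, mul_left_comm]
  exact mul_le_mul_of_nonneg_left (hf.le_crNorm hσ n) (norm_nonneg _)

lemma exists_decay_bound (p : ℕ) [Fact p.Prime] (σ : ℝ) (e : ℕ) :
    ∃ C : ℝ, 0 < C ∧ ∀ M : ℕ, ((M : ℝ) + 1) ^ σ * ((p : ℝ)⁻¹) ^ (M + 1 - e) ≤ C := by
  have hr0 : (0 : ℝ) < (p : ℝ)⁻¹ := inv_pos.2 p_pos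
  have hr1 : (p : ℝ)⁻¹ < 1 := inv_lt_one_of_one_lt₀ one_lt_p
  have h := tendsto_pow_const_mul_const_pow_of_abs_lt_one ⌈σ⌉₊
    (show |(p : ℝ)⁻¹| < 1 by rwa [abs_of_pos hr0])
  obtain ⟨C, hC⟩ := h.bddAbove_range
  have hC' : ∀ n : ℕ, (n : ℝ) ^ ⌈σ⌉₊ * (p : ℝ)⁻¹ ^ n ≤ C := fun n => hC ⟨n, rfl⟩
  refine ⟨(C + 1) * (p : ℝ) ^ e, ?_, fun M => ?_⟩
  · have h1 : 0 ≤ C := le_trans (by positivity) (hC' 0)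
    have := p_pos (p := p)
    positivity
  have h1 : ((p : ℝ)⁻¹) ^ (M + 1 - e) ≤ (p : ℝ)⁻¹ ^ (M + 1) * (p : ℝ) ^ e := by
    have h2 : (p : ℝ)⁻¹ ^ (M + 1 - e) * (p : ℝ)⁻¹ ^ e ≤ (p : ℝ)⁻¹ ^ (M + 1) := by
      rw [← pow_add]
      exact pow_le_pow_of_le_one hr0.le hr1.le (by omega)
    have h3 : (p : ℝ)⁻¹ ^ e * (p : ℝ) ^ e = 1 := by
      rw [← mul_pow, inv_mul_cancel₀ p_pos.ne', one_pow]
    calc _ = (p : ℝ)⁻¹ ^ (M + 1 - e) * ((p : ℝ)⁻¹ ^ e * (p : ℝ) ^ e) := by rw [h3, mul_one]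
      _ = ((p : ℝ)⁻¹ ^ (M + 1 - e) * (p : ℝ)⁻¹ ^ e) * (p : ℝ) ^ e := by ring
      _ ≤ _ := mul_le_mul_of_nonneg_right h2 (by positivity)
  have h2 : ((M : ℝ) + 1) ^ σ ≤ ((M + 1 : ℕ) : ℝ) ^ ⌈σ⌉₊ := by
    rw [← Real.rpow_natCast]
    push_cast
    exact Real.rpow_le_rpow_of_exponent_le (by linarith [(Nat.cast_nonneg M : (0 : ℝ) ≤ M)])
      (Nat.le_ceil σ)
  calc _ ≤ ((M + 1 : ℕ) : ℝ) ^ ⌈σ⌉₊ * ((p : ℝ)⁻¹ ^ (M + 1) * (p : ℝ) ^ e) :=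
        mul_le_mul h2 h1 (by positivity) (by positivity)
    _ = ((M + 1 : ℕ) : ℝ) ^ ⌈σ⌉₊ * (p : ℝ)⁻¹ ^ (M + 1) * (p : ℝ) ^ e := by ring
    _ ≤ _ := mul_le_mul_of_nonneg_right (by linarith [hC' (M + 1)]) (by positivity)

lemma exists_bound_of_killed (p : ℕ) [Fact p.Prime] (L : Type) [NontriviallyNormedField L]
    [NormedAlgebra ℚ_[p] L] [IsUltrametricDist L] (σ : ℝ) (hσ : 0 ≤ σ) (e : ℕ) :
    ∃ C : ℝ, 0 < C ∧ ∀ (N : ℕ) (f : ℤ_[p] → L) (c : ℝ), 0 ≤ c → (∀ z, ‖f z‖ ≤ c) →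
      (fwdDiff ((p ^ N : ℕ) : ℤ_[p]))^[e] f = 0 →
      ∀ n : ℕ, ((n : ℝ) + 1) ^ σ * ‖mahlerCoeff p L f n‖ ≤ C * (p : ℝ) ^ (N * σ) * c := by
  obtain ⟨C, hC0, hC⟩ := exists_decay_bound p σ e
  refine ⟨C, hC0, fun N f c hc h he n => ?_⟩
  have h1 := norm_mahlerCoeff_le_of_killed N e hc h he n
  have h2 : ((n : ℝ) + 1) ^ σ ≤ (p : ℝ) ^ (N * σ) * (((n / p ^ N : ℕ) : ℝ) + 1) ^ σ := by
    rw [Real.rpow_mul p_pos.le, Real.rpow_natCast, ← Real.mul_rpow (by positivity) (by positivity)]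
    refine Real.rpow_le_rpow (by positivity) ?_ hσ
    have : n + 1 ≤ p ^ N * (n / p ^ N + 1) := Nat.lt_mul_div_succ n (pow_pos (Fact.out : p.Prime).pos N)
    exact_mod_cast this
  calc _ ≤ ((p : ℝ) ^ (N * σ) * (((n / p ^ N : ℕ) : ℝ) + 1) ^ σ) *
        (c * ((p : ℝ)⁻¹) ^ (n / p ^ N + 1 - e)) := mul_le_mul h2 h1 (norm_nonneg _) (by positivity)
    _ = ((((n / p ^ N : ℕ) : ℝ) + 1) ^ σ * ((p : ℝ)⁻¹) ^ (n / p ^ N + 1 - e)) *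
        ((p : ℝ) ^ (N * σ) * c) := by ring
    _ ≤ C * ((p : ℝ) ^ (N * σ) * c) := mul_le_mul_of_nonneg_right (hC _) (by positivity)
    _ = _ := by ring

lemma tendsto_of_bound_succ {σ : ℝ} {f : ℤ_[p] → L} {K : ℝ}
    (h : ∀ n : ℕ, ((n : ℝ) + 1) ^ (σ + 1) * ‖mahlerCoeff p L f n‖ ≤ K) :
    Tendsto (fun n : ℕ => ((n : ℝ) + 1) ^ σ * ‖mahlerCoeff p L f n‖) atTop (𝓝 0) := by
  have h1 : Tendsto (fun n : ℕ => K * (1 / ((n : ℝ) + 1))) atTop (𝓝 0) := by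
    simpa using tendsto_one_div_add_atTop_nhds_zero_nat.const_mul K
  refine squeeze_zero (fun n => by positivity) (fun n => ?_) h1
  have hn : (0 : ℝ) < (n : ℝ) + 1 := by positivity
  rw [mul_one_div, le_div_iff₀ hn]
  have := h n
  rw [Real.rpow_add_one hn.ne'] at this
  linarith

lemma isCr_of_killed [CompleteSpace L] {σ : ℝ} (hσ : 0 ≤ σ) {N e : ℕ} {f : ℤ_[p] → L}
    (hf : Continuous f) {c : ℝ} (h : ∀ z, ‖f z‖ ≤ c)
    (he : (fwdDiff ((p ^ N : ℕ) : ℤ_[p]))^[e] f = 0) : IsCr p L σ f := by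
  obtain ⟨C, -, hC⟩ := exists_bound_of_killed p L (σ + 1) (by positivity) e
  have hc : 0 ≤ c := (norm_nonneg _).trans (h 0)
  exact isCr_of hσ hf (tendsto_of_bound_succ (hC N f c hc h he))

lemma mahlerCoeff_hasSum {f : ℤ_[p] → L} {F : ℕ → ℤ_[p] → L}
    (h : ∀ z, HasSum (fun i => F i z) (f z)) (n : ℕ) :
    HasSum (fun i => mahlerCoeff p L (F i) n) (mahlerCoeff p L f n) := by
  unfold mahlerCoeff
  exact hasSum_sum fun i _ => (h _).mul_left _

lemma crNorm_le_of_hasSum {σ : ℝ} (hσ : 0 ≤ σ) {f : ℤ_[p] → L} {F : ℕ → ℤ_[p] → L}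
    (h : ∀ z, HasSum (fun i => F i z) (f z)) {c : ℝ} (hc : 0 ≤ c)
    (hF : ∀ i, IsCr p L σ (F i)) (hFc : ∀ i, crNorm p L σ (F i) ≤ c) : crNorm p L σ f ≤ c := by
  refine crNorm_le fun n => ?_
  have hn : (0 : ℝ) < ((n : ℝ) + 1) ^ σ := by positivity
  rw [mul_comm, ← le_div_iff₀ hn]
  refine norm_le_of_hasSum (mahlerCoeff_hasSum h n) (by positivity) fun i => ?_
  rw [le_div_iff₀ hn, mul_comm]
  exact ((hF i).le_crNorm hσ n).trans (hFc i)

lemma isCr_of_hasSum [CompleteSpace L] {σ : ℝ} (hσ : 0 ≤ σ) {f : ℤ_[p] → L} {F : ℕ → ℤ_[p] → L}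
    (h : ∀ z, HasSum (fun i => F i z) (f z)) {c : ℕ → ℝ} (hc : Tendsto c atTop (𝓝 0))
    (hF : ∀ i, IsCr p L σ (F i)) (hFc : ∀ i, crNorm p L σ (F i) ≤ c i) : IsCr p L σ f := by
  have key : ∀ ε : ℝ, 0 < ε → ∃ M, ∀ n : ℕ, ((n : ℝ) + 1) ^ σ *
      ‖mahlerCoeff p L (f - ∑ i ∈ Finset.range M, F i) n‖ ≤ ε := by
    intro ε hε
    obtain ⟨M, hM⟩ := eventually_atTop.1 (hc.eventually (gt_mem_nhds hε))
    refine ⟨M, fun n => ?_⟩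
    have hn : (0 : ℝ) < ((n : ℝ) + 1) ^ σ := by positivity
    have h1 : ∀ z, HasSum (fun i => F (i + M) z) ((f - ∑ i ∈ Finset.range M, F i) z) := fun z => by
      have := (hasSum_nat_add_iff' M).2 (h z)
      simpa [Finset.sum_apply] using this
    rw [mul_comm, ← le_div_iff₀ hn]
    refine norm_le_of_hasSum (mahlerCoeff_hasSum h1 n) (by positivity) fun i => ?_
    rw [le_div_iff₀ hn, mul_comm]
    exact (((hF _).le_crNorm hσ n).trans (hFc _)).trans (hM _ (by omega)).le
  have hcont : Continuous f := by
    refine continuous_of_uniform_approx_of_continuous fun u hu => ?_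
    obtain ⟨ε, hε, hu⟩ := Metric.mem_uniformity_dist.1 hu
    obtain ⟨M, hM⟩ := eventually_atTop.1 (hc.eventually (gt_mem_nhds (half_pos hε)))
    refine ⟨∑ i ∈ Finset.range M, F i, (IsCr.sum fun i _ => hF i).continuous hσ, fun z => hu ?_⟩
    rw [dist_eq_norm, Finset.sum_apply]
    refine lt_of_le_of_lt (norm_le_of_hasSum ((hasSum_nat_add_iff' M).2 (h z)) (half_pos hε).le
      fun n => ?_) (half_lt_self hε)
    exact (((hF _).norm_le hσ z).trans (hFc _)).trans (hM _ (by omega)).le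
  refine isCr_of hσ hcont ?_
  rw [Metric.tendsto_atTop]
  intro ε hε
  obtain ⟨M, hM⟩ := key (ε / 2) (half_pos hε)
  have hs : IsCr p L σ (∑ i ∈ Finset.range M, F i) := IsCr.sum fun i _ => hF i
  obtain ⟨n0, hn0⟩ := eventually_atTop.1 ((hs.tendsto hσ).eventually (gt_mem_nhds (half_pos hε)))
  refine ⟨n0, fun n hn => ?_⟩
  rw [dist_zero_right, Real.norm_of_nonneg (by positivity)]
  have h1 : mahlerCoeff p L f n = mahlerCoeff p L (f - ∑ i ∈ Finset.range M, F i) n +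
      mahlerCoeff p L (∑ i ∈ Finset.range M, F i) n := by
    rw [← mahlerCoeff_add, sub_add_cancel]
  calc _ ≤ ((n : ℝ) + 1) ^ σ * (‖mahlerCoeff p L (f - ∑ i ∈ Finset.range M, F i) n‖ +
      ‖mahlerCoeff p L (∑ i ∈ Finset.range M, F i) n‖) := by
        rw [h1]
        exact mul_le_mul_of_nonneg_left (norm_add_le _ _) (by positivity)
    _ < ε := by
      rw [mul_add]
      linarith [hM n, hn0 n hn]

end Cr

section Newton

open Polynomial

variable {p : ℕ} [hp : Fact p.Prime]
variable {L : Type} [NontriviallyNormedField L] [NormedAlgebra ℚ_[p] L]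

/-- The function equal to the polynomial `Q` on `a + p ^ N ℤ_p` and zero elsewhere. -/
def box (a : ℤ_[p]) (N : ℕ) (Q : L[X]) : ℤ_[p] → L := fun z =>
  if (p : ℤ_[p]) ^ N ∣ z - a then Q.eval (iotaL p L (z : ℚ_[p])) else 0

lemma box_add (a : ℤ_[p]) (N : ℕ) (Q R : L[X]) : box a N (Q + R) = box a N Q + box a N R := by
  funext z
  simp only [box, Pi.add_apply, eval_add]
  split_ifs <;> simp

lemma box_smul (a : ℤ_[p]) (N : ℕ) (c : L) (Q : L[X]) : box a N (c • Q) = c • box a N Q := by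
  funext z
  simp only [box, Pi.smul_apply, eval_smul]
  split_ifs <;> simp

/-- `box` as a linear map in the polynomial. -/
def boxLin (a : ℤ_[p]) (N : ℕ) : L[X] →ₗ[L] (ℤ_[p] → L) where
  toFun := box a N
  map_add' := box_add a N
  map_smul' := box_smul a N

lemma isClopen_coset (a : ℤ_[p]) (N : ℕ) : IsClopen {z : ℤ_[p] | (p : ℤ_[p]) ^ N ∣ z - a} := by
  have : {z : ℤ_[p] | (p : ℤ_[p]) ^ N ∣ z - a} = Metric.closedBall a ((p : ℝ) ^ (-(N : ℤ))) := by
    ext z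
    rw [Set.mem_ofPred_eq, Metric.mem_closedBall, dist_eq_norm,
      PadicInt.norm_le_pow_iff_mem_span_pow, Ideal.mem_span_singleton]
  rw [this]
  exact IsUltrametricDist.isClopen_closedBall a (by have := p_pos (p := p); positivity)

lemma continuous_coe_iotaL : Continuous fun z : ℤ_[p] => iotaL p L (z : ℚ_[p]) :=
  continuous_iotaL.comp continuous_subtype_val

lemma continuous_box (a : ℤ_[p]) (N : ℕ) (Q : L[X]) : Continuous (box a N Q) := by
  have h := Continuous.indicator (s := {z : ℤ_[p] | (p : ℤ_[p]) ^ N ∣ z - a})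
    (by rw [(isClopen_coset a N).frontier_eq]; simp) ((Q.continuous).comp (continuous_coe_iotaL (L := L)))
  exact h

lemma fwdDiff_iter_box (a : ℤ_[p]) {N M : ℕ} (hNM : N ≤ M) {Q : L[X]} {J : ℕ}
    (hQ : Q.natDegree < J) : (fwdDiff ((p ^ M : ℕ) : ℤ_[p]))^[J] (box a N Q) = 0 := by
  funext z
  have hd : ∀ k : ℕ, (p : ℤ_[p]) ^ N ∣ k • ((p ^ M : ℕ) : ℤ_[p]) := fun k => by
    rw [nsmul_eq_mul]
    push_cast
    exact (pow_dvd_pow _ hNM).mul_left _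
  rw [fwdDiff_iter_eq_sum_shift]
  by_cases hz : (p : ℤ_[p]) ^ N ∣ z - a
  · have hs : ∀ k : ℕ, box a N Q (z + k • ((p ^ M : ℕ) : ℤ_[p])) =
        (Q.comp (C (iotaL p L (z : ℚ_[p])) + C ((p : L) ^ M) * X)).eval (k : L) := fun k => by
      have : (p : ℤ_[p]) ^ N ∣ z + k • ((p ^ M : ℕ) : ℤ_[p]) - a := by
        have := dvd_add hz (hd k)
        rwa [show z - a + k • ((p ^ M : ℕ) : ℤ_[p]) = z + k • ((p ^ M : ℕ) : ℤ_[p]) - a by ring]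
          at this
      rw [box, if_pos this, eval_comp]
      congr 1
      simp [iotaL]
      ring
    simp only [hs]
    set R := Q.comp (C (iotaL p L (z : ℚ_[p])) + C ((p : L) ^ M) * X) with hR
    have hdeg : R.natDegree < J := by
      refine lt_of_le_of_lt ?_ hQ
      rw [hR]
      refine natDegree_comp_le.trans ?_
      have : (C (iotaL p L (z : ℚ_[p])) + C ((p : L) ^ M) * X).natDegree ≤ 1 := by
        rw [add_comm]; exact natDegree_linear_le
      calc _ ≤ Q.natDegree * 1 := Nat.mul_le_mul_left _ this
        _ = _ := mul_one _
    have h0 := congrFun (Polynomial.fwdDiff_iter_eq_zero_of_degree_lt hdeg) 0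
    rw [fwdDiff_iter_eq_sum_shift] at h0
    simpa using h0
  · refine Finset.sum_eq_zero fun k _ => ?_
    have : ¬ (p : ℤ_[p]) ^ N ∣ z + k • ((p ^ M : ℕ) : ℤ_[p]) - a := fun h => hz <| by
      have := dvd_sub h (hd k)
      rwa [show z + k • ((p ^ M : ℕ) : ℤ_[p]) - a - k • ((p ^ M : ℕ) : ℤ_[p]) = z - a by ring]
        at this
    rw [box, if_neg this, smul_zero]

/-- The polynomial `binom((T - a) / p ^ N, i)`. -/
def newtonPoly (L : Type) [NontriviallyNormedField L] [NormedAlgebra ℚ_[p] L]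
    (a : ℤ_[p]) (N i : ℕ) : L[X] :=
  C ((i.factorial : L)⁻¹) *
    (descPochhammer L i).comp (C (((p : L) ^ N)⁻¹) * (X - C (iotaL p L (a : ℚ_[p]))))

lemma natDegree_newtonPoly_le (a : ℤ_[p]) (N i : ℕ) : (newtonPoly L a N i).natDegree ≤ i := by
  unfold newtonPoly
  refine (natDegree_C_mul_le _ _).trans (natDegree_comp_le.trans ?_)
  have h1 : (C (((p : L) ^ N)⁻¹) * (X - C (iotaL p L (a : ℚ_[p])))).natDegree ≤ 1 :=
    (natDegree_C_mul_le _ _).trans (natDegree_X_sub_C_le _)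
  calc _ ≤ (descPochhammer L i).natDegree * 1 := Nat.mul_le_mul_left _ h1
    _ = i := by rw [mul_one, descPochhammer_natDegree]

lemma eval_newtonPoly (a y : ℤ_[p]) (N i : ℕ) :
    (newtonPoly L a N i).eval (iotaL p L ((a + (p : ℤ_[p]) ^ N * y : ℤ_[p]) : ℚ_[p])) =
      bn L i y := by
  have h1 : (iotaL p L ((a + (p : ℤ_[p]) ^ N * y : ℤ_[p]) : ℚ_[p])) =
      iotaL p L (a : ℚ_[p]) + (p : L) ^ N * iotaL p L (y : ℚ_[p]) := by
    simp [iotaL]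
  have hpN : ((p : L) ^ N) ≠ 0 := pow_ne_zero _ (pL_ne_zero (p := p))
  rw [newtonPoly, eval_mul, eval_C, eval_comp, h1]
  have h2 : eval (iotaL p L (a : ℚ_[p]) + (p : L) ^ N * iotaL p L (y : ℚ_[p]))
      (C (((p : L) ^ N)⁻¹) * (X - C (iotaL p L (a : ℚ_[p])))) = iotaL p L (y : ℚ_[p]) := by
    simp only [eval_mul, eval_C, eval_sub, eval_X]
    field_simp
    ring
  rw [h2, descPochhammer_eval_eq_prod_range, bn, binomQ, div_eq_inv_mul]
  simp [iotaL]

lemma box_newtonPoly (a y : ℤ_[p]) (N i : ℕ) :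
    box a N (newtonPoly L a N i) (a + (p : ℤ_[p]) ^ N * y) = bn L i y := by
  rw [box, if_pos (by rw [add_sub_cancel_left]; exact dvd_mul_right _ _), eval_newtonPoly]

lemma exists_natCast_add (N : ℕ) (z : ℤ_[p]) :
    ∃ a < p ^ N, ∃ y : ℤ_[p], z = (a : ℤ_[p]) + (p : ℤ_[p]) ^ N * y := by
  refine ⟨z.appr N, PadicInt.appr_lt z N, ?_⟩
  obtain ⟨y, hy⟩ := Ideal.mem_span_singleton.1 (PadicInt.appr_spec N z)
  exact ⟨y, by rw [← hy]; ring⟩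

lemma dvd_natCast_sub {N a b : ℕ} (ha : a < p ^ N) (hb : b < p ^ N) {y : ℤ_[p]}
    (h : (p : ℤ_[p]) ^ N ∣ (a : ℤ_[p]) + (p : ℤ_[p]) ^ N * y - b) : a = b := by
  have h1 : (p : ℤ_[p]) ^ N ∣ ((a - b : ℤ) : ℤ_[p]) := by
    have := dvd_sub h (dvd_mul_right ((p : ℤ_[p]) ^ N) y)
    push_cast
    rwa [show (a : ℤ_[p]) + (p : ℤ_[p]) ^ N * y - b - (p : ℤ_[p]) ^ N * y = a - b by ring] at this
  have h2 : ((p ^ N : ℕ) : ℤ) ∣ (a - b : ℤ) := by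
    rw [← Ideal.mem_span_singleton, ← PadicInt.norm_le_pow_iff_mem_span_pow,
      PadicInt.norm_int_le_pow_iff_dvd] at h1
    exact h1
  have h3 := Int.eq_zero_of_abs_lt_dvd h2 (by
    rw [abs_lt]; constructor <;> push_cast <;> (have : (a : ℤ) < (p : ℤ) ^ N := by exact_mod_cast ha) <;>
      (have : (b : ℤ) < (p : ℤ) ^ N := by exact_mod_cast hb) <;> omega)
  omega

/-- Newton interpolation of degree `J` on the cosets of `p ^ N ℤ_p`. -/
def interp (J N : ℕ) (f : ℤ_[p] → L) : ℤ_[p] → L :=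
  ∑ a ∈ Finset.range (p ^ N), ∑ i ∈ Finset.range (J + 1),
    (fwdDiff ((p ^ N : ℕ) : ℤ_[p]))^[i] f (a : ℤ_[p]) •
      box (a : ℤ_[p]) N (newtonPoly L (a : ℤ_[p]) N i)

lemma interp_apply (J N : ℕ) (f : ℤ_[p] → L) {a : ℕ} (ha : a < p ^ N) (y : ℤ_[p]) :
    interp J N f ((a : ℤ_[p]) + (p : ℤ_[p]) ^ N * y) = ∑ i ∈ Finset.range (J + 1),
      (fwdDiff ((p ^ N : ℕ) : ℤ_[p]))^[i] f (a : ℤ_[p]) * bn L i y := by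
  rw [interp, Finset.sum_apply, Finset.sum_eq_single_of_mem a (Finset.mem_range.2 ha)]
  · simp only [Finset.sum_apply, Pi.smul_apply, smul_eq_mul, box_newtonPoly]
  · intro b hb hab
    rw [Finset.sum_apply]
    refine Finset.sum_eq_zero fun i _ => ?_
    rw [Pi.smul_apply, box, if_neg, smul_zero]
    exact fun h => hab (dvd_natCast_sub ha (Finset.mem_range.1 hb) h).symm

lemma continuous_interp (J N : ℕ) (f : ℤ_[p] → L) : Continuous (interp J N f) := by
  have : interp J N f = fun z => ∑ a ∈ Finset.range (p ^ N), ∑ i ∈ Finset.range (J + 1),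
      ((fwdDiff ((p ^ N : ℕ) : ℤ_[p]))^[i] f (a : ℤ_[p]) •
        box (a : ℤ_[p]) N (newtonPoly L (a : ℤ_[p]) N i)) z := by
    funext z
    simp only [interp, Finset.sum_apply]
  rw [this]
  exact continuous_finsetSum _ fun a _ => continuous_finsetSum _ fun i _ =>
    (continuous_box _ _ _).const_smul _

lemma fwdDiff_iter_interp (J : ℕ) {N M : ℕ} (hNM : N ≤ M) (f : ℤ_[p] → L) {e : ℕ} (he : J < e) :
    (fwdDiff ((p ^ M : ℕ) : ℤ_[p]))^[e] (interp J N f) = 0 := by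
  rw [interp, fwdDiff_iter_finsetSum]
  refine Finset.sum_eq_zero fun a _ => ?_
  rw [fwdDiff_iter_finsetSum]
  refine Finset.sum_eq_zero fun i hi => ?_
  rw [fwdDiff_iter_const_smul, fwdDiff_iter_box _ hNM, smul_zero]
  have := natDegree_newtonPoly_le (L := L) (a : ℤ_[p]) N i
  have := Finset.mem_range.1 hi
  omega

variable [IsUltrametricDist L]

lemma norm_sub_interp_le (J N : ℕ) {f : ℤ_[p] → L} (hf : Continuous f) {c : ℝ} (hc : 0 ≤ c)
    (h : ∀ z, ‖(fwdDiff ((p ^ N : ℕ) : ℤ_[p]))^[J + 1] f z‖ ≤ c) (z : ℤ_[p]) :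
    ‖f z - interp J N f z‖ ≤ c := by
  obtain ⟨a, ha, y, rfl⟩ := exists_natCast_add N z
  refine norm_le_of_nat (f := fun y : ℤ_[p] => f ((a : ℤ_[p]) + (p : ℤ_[p]) ^ N * y) -
    interp J N f ((a : ℤ_[p]) + (p : ℤ_[p]) ^ N * y)) ?_ (fun m => ?_) y
  · exact (hf.comp (by fun_prop)).sub ((continuous_interp J N f).comp (by fun_prop))
  rw [interp_apply J N f ha]
  have h1 := shift_eq_sum_fwdDiff_iter ((p ^ N : ℕ) : ℤ_[p]) f m (a : ℤ_[p])
  rw [show (a : ℤ_[p]) + (p : ℤ_[p]) ^ N * (m : ℤ_[p]) = a + m • ((p ^ N : ℕ) : ℤ_[p]) by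
    rw [nsmul_eq_mul]; push_cast; ring, h1]
  set t : ℕ → L := fun i => (m.choose i : L) * (fwdDiff ((p ^ N : ℕ) : ℤ_[p]))^[i] f a with ht
  have h2 : ∑ k ∈ Finset.range (m + 1), m.choose k • (fwdDiff ((p ^ N : ℕ) : ℤ_[p]))^[k] f a =
      ∑ k ∈ Finset.range (m + 1 + (J + 1)), t k := by
    rw [Finset.sum_range_add _ (m + 1), Finset.sum_eq_zero (s := Finset.range (J + 1)), add_zero]
    · exact Finset.sum_congr rfl fun k _ => nsmul_eq_mul _ _
    · intro k _
      simp only [ht]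
      rw [Nat.choose_eq_zero_of_lt (by omega), Nat.cast_zero, zero_mul]
  have h3 : ∑ i ∈ Finset.range (J + 1), (fwdDiff ((p ^ N : ℕ) : ℤ_[p]))^[i] f a *
      bn L i (m : ℤ_[p]) = ∑ i ∈ Finset.range (J + 1), t i :=
    Finset.sum_congr rfl fun i _ => by rw [bn_natCast, mul_comm]
  rw [h2, h3, add_comm (m + 1), Finset.sum_range_add, add_sub_cancel_left]
  refine IsUltrametricDist.norm_sum_le_of_forall_le_of_nonneg hc fun i _ => ?_
  simp only [ht]
  rw [norm_mul, add_comm (J + 1), Function.iterate_add_apply]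
  calc _ ≤ 1 * c := mul_le_mul (IsUltrametricDist.norm_natCast_le_one L _)
        (norm_fwdDiff_iter_le (p ^ N) i hc h _) (norm_nonneg _) zero_le_one
    _ = c := one_mul c

lemma interp_eq_self (J N : ℕ) {f : ℤ_[p] → L} (hf : Continuous f)
    (h : (fwdDiff ((p ^ N : ℕ) : ℤ_[p]))^[J + 1] f = 0) : interp J N f = f := by
  funext z
  have := norm_sub_interp_le J N hf le_rfl (fun z => by rw [h]; simp) z
  exact (sub_eq_zero.1 (norm_le_zero_iff.1 this)).symm

lemma norm_interp_le (J N : ℕ) {f : ℤ_[p] → L} {c : ℝ} (hc : 0 ≤ c) (h : ∀ z, ‖f z‖ ≤ c)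
    (z : ℤ_[p]) : ‖interp J N f z‖ ≤ c := by
  obtain ⟨a, ha, y, rfl⟩ := exists_natCast_add N z
  rw [interp_apply J N f ha]
  refine IsUltrametricDist.norm_sum_le_of_forall_le_of_nonneg hc fun i _ => ?_
  rw [norm_mul]
  calc _ ≤ c * 1 := mul_le_mul (norm_fwdDiff_iter_le (p ^ N) i hc h _) (norm_bn_le i y)
        (norm_nonneg _) hc
    _ = c := mul_one c

lemma norm_natCast_ge (p : ℕ) [Fact p.Prime] (L : Type) [NontriviallyNormedField L]
    [NormedAlgebra ℚ_[p] L] {m : ℕ} (hm : m ≠ 0) : (m : ℝ)⁻¹ ≤ ‖(m : L)‖ := by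
  obtain ⟨v, u, hu, rfl⟩ := Nat.exists_eq_pow_mul_and_not_dvd hm p (Fact.out : p.Prime).ne_one
  have h1 : ‖((u : ℕ) : L)‖ = 1 := by
    have := norm_iotaL (L := L) (u : ℚ_[p])
    simp only [iotaL, map_natCast] at this
    rw [this, Padic.norm_natCast_eq_one_iff]
    exact (Nat.Prime.coprime_iff_not_dvd Fact.out).2 hu
  have h2 : (1 : ℝ) ≤ u := by
    have : u ≠ 0 := fun h => by simp [h] at hm
    exact_mod_cast Nat.one_le_iff_ne_zero.2 this
  rw [Nat.cast_mul, Nat.cast_mul, norm_mul, h1, mul_one, Nat.cast_pow, Nat.cast_pow, norm_pow,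
    norm_pL (p := p), mul_inv, inv_pow]
  have := p_pos (p := p)
  calc _ ≤ ((p : ℝ) ^ v)⁻¹ * 1 := mul_le_mul_of_nonneg_left (inv_le_one_of_one_le₀ h2) (by positivity)
    _ = _ := mul_one _

lemma norm_choose_pow_le (N : ℕ) {m n : ℕ} (hm : m ≠ 0) (hmn : m ≤ n) :
    ‖((p ^ N).choose m : L)‖ ≤ min 1 (n * ((p : ℝ)⁻¹) ^ N) := by
  refine le_min (IsUltrametricDist.norm_natCast_le_one L _) ?_
  obtain ⟨k, rfl⟩ := Nat.exists_eq_succ_of_ne_zero hm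
  obtain ⟨q, hq⟩ := Nat.exists_eq_succ_of_ne_zero (pow_pos hp.out.pos N).ne'
  have h1 := Nat.add_one_mul_choose_eq q k
  have h2 : ‖(p : L)‖ ^ N * ‖(q.choose k : L)‖ = ‖((p ^ N).choose (k + 1) : L)‖ * ‖((k + 1 : ℕ) : L)‖ := by
    rw [← norm_pow, ← norm_mul, ← norm_mul]
    congr 1
    rw [hq]
    have : ((p : L) ^ N) = ((q + 1 : ℕ) : L) := by rw [← Nat.succ_eq_add_one, ← hq]; push_cast; rfl
    rw [this]
    rw [Nat.succ_eq_add_one, ← Nat.cast_mul, ← Nat.cast_mul, h1]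
  have h3 := norm_natCast_ge p L hm
  have h4 : (0 : ℝ) < ((k + 1 : ℕ) : ℝ) := by positivity
  have h5 : ‖((p ^ N).choose (k + 1) : L)‖ * ((k + 1 : ℕ) : ℝ)⁻¹ ≤ (p : ℝ)⁻¹ ^ N := by
    calc _ ≤ ‖((p ^ N).choose (k + 1) : L)‖ * ‖((k + 1 : ℕ) : L)‖ :=
          mul_le_mul_of_nonneg_left h3 (norm_nonneg _)
      _ = ‖(p : L)‖ ^ N * ‖(q.choose k : L)‖ := h2.symm
      _ ≤ (p : ℝ)⁻¹ ^ N * 1 := by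
        rw [norm_pL (p := p)]
        exact mul_le_mul_of_nonneg_left (IsUltrametricDist.norm_natCast_le_one L _) (by positivity)
      _ = _ := mul_one _
  rw [← div_eq_mul_inv, div_le_iff₀ h4] at h5
  refine h5.trans ?_
  rw [mul_comm]
  exact mul_le_mul_of_nonneg_right (by exact_mod_cast hmn) (by positivity)

lemma norm_fwdDiff_iter_bn_le (N j n : ℕ) (x : ℤ_[p]) :
    ‖(fwdDiff ((p ^ N : ℕ) : ℤ_[p]))^[j] (bn L n) x‖ ≤ (min 1 (n * ((p : ℝ)⁻¹) ^ N)) ^ j := by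
  induction j generalizing n x with
  | zero => simpa using norm_bn_le n x
  | succ j ih =>
    have h1 : fwdDiff ((p ^ N : ℕ) : ℤ_[p]) (bn L n) = ∑ m ∈ Finset.range n,
        ((p ^ N).choose (m + 1) : L) • bn (p := p) L (n - (m + 1)) := by
      funext z
      rw [fwdDiff, add_comm z, bn_add, Finset.Nat.sum_antidiagonal_eq_sum_range_succ
        (fun i j => bn L i ((p ^ N : ℕ) : ℤ_[p]) * bn L j z), Finset.sum_range_succ']
      simp only [bn_natCast]
      simp [Finset.sum_apply]
    rw [Function.iterate_succ_apply, h1, fwdDiff_iter_finsetSum, Finset.sum_apply]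
    refine IsUltrametricDist.norm_sum_le_of_forall_le_of_nonneg (by positivity) fun m hm => ?_
    have hm' : m + 1 ≤ n := Finset.mem_range.1 hm
    rw [fwdDiff_iter_const_smul, Pi.smul_apply, norm_smul, pow_succ, mul_comm]
    refine mul_le_mul ((ih _ _).trans ?_) (norm_choose_pow_le N (by omega) hm') (norm_nonneg _)
      (by positivity)
    gcongr
    omega

end Newton

section Wavelets

variable {p : ℕ} [hp : Fact p.Prime]
variable {L : Type} [NontriviallyNormedField L] [NormedAlgebra ℚ_[p] L] [IsUltrametricDist L]
  [CompleteSpace L]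

lemma norm_sub_le_max_norm {E : Type*} [SeminormedAddCommGroup E] [IsUltrametricDist E] (x y : E) :
    ‖x - y‖ ≤ max ‖x‖ ‖y‖ := by
  rw [sub_eq_add_neg, ← norm_neg y]
  exact IsUltrametricDist.norm_add_le_max _ _

lemma hasSum_fwdDiff_iter {f : ℤ_[p] → L} (hf : Continuous f) (h : ℤ_[p]) (i : ℕ) (x : ℤ_[p]) :
    HasSum (fun n => mahlerCoeff p L f n * (fwdDiff h)^[i] (bn L n) x) ((fwdDiff h)^[i] f x) := by
  simp_rw [fwdDiff_iter_eq_sum_shift, Finset.mul_sum]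
  refine hasSum_sum fun k _ => ?_
  have := (hasSum_of_continuous hf (x + k • h)).const_smul ((-1 : ℤ) ^ (i - k) * (i.choose k))
  simpa only [mul_smul_comm] using this

lemma min_pow_le_rpow {y σ : ℝ} {j : ℕ} (hy : 0 ≤ y) (hσ : 0 ≤ σ) (hj : σ ≤ j) :
    (min 1 y) ^ j ≤ y ^ σ := by
  rcases le_total y 1 with h | h
  · rw [min_eq_right h]
    rcases hy.eq_or_lt with rfl | hy
    · rcases Nat.eq_zero_or_pos j with rfl | hj0
      · have : σ = 0 := le_antisymm (by simpa using hj) hσ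
        simp [this]
      · rw [zero_pow hj0.ne']
        exact Real.rpow_nonneg le_rfl _
    · rw [← Real.rpow_natCast]
      exact Real.rpow_le_rpow_of_exponent_ge hy h hj
  · rw [min_eq_left h, one_pow]
    exact Real.one_le_rpow h hσ

lemma mul_inv_pow_rpow (p : ℕ) [Fact p.Prime] (n N : ℕ) (σ : ℝ) :
    ((n : ℝ) * ((p : ℝ)⁻¹) ^ N) ^ σ = (n : ℝ) ^ σ * (p : ℝ) ^ (-((N : ℝ) * σ)) := by
  have hp0 := (p_pos (p := p)).le
  rw [Real.mul_rpow (by positivity) (by positivity), inv_pow, Real.inv_rpow (by positivity),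
    ← Real.rpow_natCast, ← Real.rpow_mul hp0, Real.rpow_neg hp0]

lemma IsCr.norm_fwdDiff_iter_le {σ : ℝ} (hσ : 0 ≤ σ) {f : ℤ_[p] → L} (hf : IsCr p L σ f) {j : ℕ}
    (hj : σ ≤ j) (N : ℕ) (x : ℤ_[p]) :
    ‖(fwdDiff ((p ^ N : ℕ) : ℤ_[p]))^[j] f x‖ ≤ crNorm p L σ f * (p : ℝ) ^ (-((N : ℝ) * σ)) := by
  have hp0 := p_pos (p := p)
  refine norm_le_of_hasSum (hasSum_fwdDiff_iter (hf.continuous hσ) _ j x)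
    (mul_nonneg (crNorm_nonneg _ _) (by positivity)) fun n => ?_
  rw [norm_mul]
  calc _ ≤ ‖mahlerCoeff p L f n‖ * ((n : ℝ) ^ σ * (p : ℝ) ^ (-((N : ℝ) * σ))) := by
        refine mul_le_mul_of_nonneg_left ((norm_fwdDiff_iter_bn_le N j n x).trans ?_) (norm_nonneg _)
        rw [← mul_inv_pow_rpow]
        exact min_pow_le_rpow (by positivity) hσ hj
    _ ≤ (((n : ℝ) + 1) ^ σ * ‖mahlerCoeff p L f n‖) * (p : ℝ) ^ (-((N : ℝ) * σ)) := by
        rw [mul_comm _ ‖_‖, mul_assoc]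
        gcongr
        linarith
    _ ≤ _ := by gcongr; exact hf.le_crNorm hσ n

lemma IsCr.exists_fwdDiff_bound {σ : ℝ} (hσ : 0 ≤ σ) {f : ℤ_[p] → L} (hf : IsCr p L σ f) {j : ℕ}
    (hj : σ < j) : ∃ A : ℕ → ℝ, Tendsto A atTop (𝓝 0) ∧ (∀ N, 0 ≤ A N) ∧
      (∀ N, A N ≤ crNorm p L σ f) ∧ ∀ N x,
      ‖(fwdDiff ((p ^ N : ℕ) : ℤ_[p]))^[j] f x‖ ≤ A N * (p : ℝ) ^ (-((N : ℝ) * σ)) := by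
  have hp0 := p_pos (p := p)
  have hpw : ∀ N : ℕ, (0 : ℝ) < (p : ℝ) ^ (-((N : ℝ) * σ)) := fun N => by positivity
  have hb : ∀ N : ℕ, BddAbove (Set.range fun x : ℤ_[p] =>
      ‖(fwdDiff ((p ^ N : ℕ) : ℤ_[p]))^[j] f x‖ / (p : ℝ) ^ (-((N : ℝ) * σ))) := fun N => by
    refine ⟨crNorm p L σ f, ?_⟩
    rintro _ ⟨x, rfl⟩
    exact (div_le_iff₀ (hpw N)).2 (hf.norm_fwdDiff_iter_le hσ hj.le N x)
  refine ⟨fun N => ⨆ x : ℤ_[p],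
      ‖(fwdDiff ((p ^ N : ℕ) : ℤ_[p]))^[j] f x‖ / (p : ℝ) ^ (-((N : ℝ) * σ)), ?_,
    fun N => Real.iSup_nonneg fun x => by positivity,
    fun N => ciSup_le fun x => (div_le_iff₀ (hpw N)).2 (hf.norm_fwdDiff_iter_le hσ hj.le N x),
    fun N x => (div_le_iff₀ (hpw N)).1 (le_ciSup (hb N) x)⟩
  rw [Metric.tendsto_atTop]
  intro ε hε
  obtain ⟨n0, hn0⟩ := eventually_atTop.1 ((hf.tendsto hσ).eventually (gt_mem_nhds (half_pos hε)))
  have ht : Tendsto (fun N : ℕ => crNorm p L σ f * (((n0 : ℝ) * ((p : ℝ)⁻¹) ^ N) ^ ((j : ℝ) - σ)))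
      atTop (𝓝 0) := by
    have h1 : Tendsto (fun N : ℕ => (n0 : ℝ) * ((p : ℝ)⁻¹) ^ N) atTop (𝓝 0) := by
      have := (tendsto_pow_atTop_nhds_zero_of_lt_one (r := (p : ℝ)⁻¹) (by positivity)
        (inv_lt_one_of_one_lt₀ one_lt_p)).const_mul (n0 : ℝ)
      rwa [mul_zero] at this
    have h2 := (h1.rpow_const (p := (j : ℝ) - σ) (Or.inr (by linarith))).const_mul (crNorm p L σ f)
    rwa [Real.zero_rpow (by linarith), mul_zero] at h2
  obtain ⟨N0, hN0⟩ := eventually_atTop.1 (ht.eventually (gt_mem_nhds (half_pos hε)))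
  refine ⟨N0, fun N hN => ?_⟩
  rw [dist_zero_right, Real.norm_of_nonneg (Real.iSup_nonneg fun x => by positivity)]
  refine lt_of_le_of_lt (ciSup_le fun x => ?_) (half_lt_self hε)
  rw [div_le_iff₀ (hpw N)]
  refine norm_le_of_hasSum (hasSum_fwdDiff_iter (hf.continuous hσ) _ j x) (by positivity) fun n => ?_
  rw [norm_mul]
  rcases le_or_gt n0 n with h | h
  · calc _ ≤ ‖mahlerCoeff p L f n‖ * ((n : ℝ) ^ σ * (p : ℝ) ^ (-((N : ℝ) * σ))) := by
          refine mul_le_mul_of_nonneg_left ((norm_fwdDiff_iter_bn_le N j n x).trans ?_)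
            (norm_nonneg _)
          rw [← mul_inv_pow_rpow]
          exact min_pow_le_rpow (by positivity) hσ hj.le
      _ ≤ (((n : ℝ) + 1) ^ σ * ‖mahlerCoeff p L f n‖) * (p : ℝ) ^ (-((N : ℝ) * σ)) := by
          rw [mul_comm _ ‖_‖, mul_assoc]
          gcongr
          linarith
      _ ≤ _ := by gcongr; exact (hn0 n h).le
  · have hy : (0 : ℝ) ≤ (n : ℝ) * ((p : ℝ)⁻¹) ^ N := by positivity
    calc _ ≤ ‖mahlerCoeff p L f n‖ * (((n : ℝ) * ((p : ℝ)⁻¹) ^ N) ^ σ *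
          ((n : ℝ) * ((p : ℝ)⁻¹) ^ N) ^ ((j : ℝ) - σ)) := by
          refine mul_le_mul_of_nonneg_left ((norm_fwdDiff_iter_bn_le N j n x).trans ?_)
            (norm_nonneg _)
          rw [← Real.rpow_add_of_nonneg hy hσ (by linarith)]
          exact min_pow_le_rpow hy (by linarith) (by linarith)
      _ ≤ ‖mahlerCoeff p L f n‖ * ((((n : ℝ) + 1) ^ σ * (p : ℝ) ^ (-((N : ℝ) * σ))) *
          ((n0 : ℝ) * ((p : ℝ)⁻¹) ^ N) ^ ((j : ℝ) - σ)) := by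
          rw [mul_inv_pow_rpow]
          have : (n : ℝ) ≤ n0 := by exact_mod_cast h.le
          gcongr
          linarith
      _ = (((n : ℝ) + 1) ^ σ * ‖mahlerCoeff p L f n‖) *
          (((n0 : ℝ) * ((p : ℝ)⁻¹) ^ N) ^ ((j : ℝ) - σ)) * (p : ℝ) ^ (-((N : ℝ) * σ)) := by ring
      _ ≤ ε / 2 * (p : ℝ) ^ (-((N : ℝ) * σ)) := by
          gcongr
          refine le_trans ?_ (hN0 N hN).le
          gcongr
          exact hf.le_crNorm hσ n

/-- The successive differences of the Newton interpolations of `f`. -/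
def wav (J : ℕ) (f : ℤ_[p] → L) : ℕ → ℤ_[p] → L
  | 0 => interp J 0 f
  | N + 1 => interp J (N + 1) f - interp J N f

lemma sum_wav (J : ℕ) (f : ℤ_[p] → L) (N : ℕ) :
    ∑ i ∈ Finset.range (N + 1), wav J f i = interp J N f := by
  induction N with
  | zero => simp [wav]
  | succ N ih => rw [Finset.sum_range_succ, ih, wav, add_sub_cancel]

lemma continuous_wav (J : ℕ) (f : ℤ_[p] → L) (N : ℕ) : Continuous (wav J f N) := by
  cases N with
  | zero => exact continuous_interp _ _ _
  | succ N => exact (continuous_interp _ _ _).sub (continuous_interp _ _ _)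

lemma fwdDiff_iter_sub (h : ℤ_[p]) (i : ℕ) (f g : ℤ_[p] → L) :
    (fwdDiff h)^[i] (f - g) = (fwdDiff h)^[i] f - (fwdDiff h)^[i] g := by
  rw [sub_eq_add_neg, fwdDiff_iter_add, ← neg_one_smul L g, fwdDiff_iter_const_smul, neg_one_smul,
    sub_eq_add_neg]

lemma fwdDiff_iter_wav (J : ℕ) (f : ℤ_[p] → L) (N : ℕ) :
    (fwdDiff ((p ^ N : ℕ) : ℤ_[p]))^[J + 1] (wav J f N) = 0 := by
  cases N with
  | zero => exact fwdDiff_iter_interp J le_rfl f (by omega)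
  | succ N =>
    rw [wav, fwdDiff_iter_sub, fwdDiff_iter_interp J le_rfl f (by omega),
      fwdDiff_iter_interp J (Nat.le_succ N) f (by omega), sub_zero]

lemma interp_wav (J : ℕ) (f : ℤ_[p] → L) (N : ℕ) : interp J N (wav J f N) = wav J f N :=
  interp_eq_self J N (continuous_wav J f N) (fwdDiff_iter_wav J f N)

lemma IsCr.exists_wav_bound {σ : ℝ} (hσ : 0 ≤ σ) {f : ℤ_[p] → L} (hf : IsCr p L σ f) {J : ℕ}
    (hJ : σ < J + 1) : ∃ A : ℕ → ℝ, Tendsto A atTop (𝓝 0) ∧ (∀ N, 0 ≤ A N) ∧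
      (∀ N, A N ≤ (p : ℝ) ^ σ * crNorm p L σ f) ∧
      ∀ N z, ‖wav J f N z‖ ≤ A N * (p : ℝ) ^ (-((N : ℝ) * σ)) := by
  have hp0 := p_pos (p := p)
  have hp1 : (1 : ℝ) ≤ (p : ℝ) ^ σ := Real.one_le_rpow one_lt_p.le hσ
  obtain ⟨A, hA, hA0, hA1, hA2⟩ := hf.exists_fwdDiff_bound hσ (j := J + 1) (by push_cast; exact hJ)
  have hs : ∀ N z, ‖f z - interp J N f z‖ ≤ A N * (p : ℝ) ^ (-((N : ℝ) * σ)) := fun N z =>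
    norm_sub_interp_le J N (hf.continuous hσ) (mul_nonneg (hA0 N) (by positivity)) (hA2 N) z
  refine ⟨fun N => N.casesOn ((p : ℝ) ^ σ * crNorm p L σ f)
    (fun N => (p : ℝ) ^ σ * max (A N) (A (N + 1))), ?_, ?_, ?_, ?_⟩
  · rw [← tendsto_add_atTop_iff_nat 1]
    have := (hA.max ((tendsto_add_atTop_iff_nat 1).2 hA)).const_mul ((p : ℝ) ^ σ)
    simpa using this
  · rintro (_ | N)
    · exact mul_nonneg (by positivity) (crNorm_nonneg _ _)
    · exact mul_nonneg (by positivity) (le_max_of_le_left (hA0 N))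
  · rintro (_ | N)
    · exact le_rfl
    · exact mul_le_mul_of_nonneg_left (max_le (hA1 N) (hA1 _)) (by positivity)
  · rintro (_ | N) z
    · simp only [wav, Nat.cast_zero, zero_mul, neg_zero, Real.rpow_zero, mul_one]
      exact (norm_interp_le J 0 (crNorm_nonneg _ _) (hf.norm_le hσ) z).trans
        (le_mul_of_one_le_left (crNorm_nonneg _ _) hp1)
    · have h1 : wav J f (N + 1) z = (f z - interp J N f z) - (f z - interp J (N + 1) f z) := by
        simp [wav]
      have h2 : (p : ℝ) ^ (-(((N + 1 : ℕ) : ℝ) * σ)) * (p : ℝ) ^ σ =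
          (p : ℝ) ^ (-((N : ℝ) * σ)) := by
        rw [← Real.rpow_add hp0]; congr 1; push_cast; ring
      have h3 : (p : ℝ) ^ σ * max (A N) (A (N + 1)) * (p : ℝ) ^ (-(((N + 1 : ℕ) : ℝ) * σ)) =
          max (A N) (A (N + 1)) * (p : ℝ) ^ (-((N : ℝ) * σ)) := by rw [← h2]; ring
      change _ ≤ (p : ℝ) ^ σ * max (A N) (A (N + 1)) * _
      rw [h3, h1]
      refine (norm_sub_le_max_norm _ _).trans (max_le ((hs N z).trans ?_)
        ((hs (N + 1) z).trans ?_))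
      · gcongr; exact le_max_left _ _
      · have h4 : (p : ℝ) ^ (-(((N + 1 : ℕ) : ℝ) * σ)) ≤ (p : ℝ) ^ (-((N : ℝ) * σ)) := by
          refine Real.rpow_le_rpow_of_exponent_le one_lt_p.le ?_
          push_cast; nlinarith
        exact mul_le_mul (le_max_right _ _) h4 (by positivity) (le_max_of_le_left (hA0 N))

lemma IsCr.tendsto_interp {σ : ℝ} (hσ : 0 ≤ σ) {f : ℤ_[p] → L} (hf : IsCr p L σ f) {J : ℕ}
    (hJ : σ < J + 1) (z : ℤ_[p]) : Tendsto (fun N => interp J N f z) atTop (𝓝 (f z)) := by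
  have hp0 := p_pos (p := p)
  obtain ⟨A, hA, hA0, hA1, hA2⟩ := hf.exists_fwdDiff_bound hσ (j := J + 1) (by push_cast; exact hJ)
  rw [tendsto_iff_norm_sub_tendsto_zero]
  refine squeeze_zero (fun _ => norm_nonneg _) (fun N => ?_) hA
  rw [norm_sub_rev]
  have h1 : (p : ℝ) ^ (-((N : ℝ) * σ)) ≤ 1 :=
    Real.rpow_le_one_of_one_le_of_nonpos one_lt_p.le (by simp; positivity)
  exact (norm_sub_interp_le J N (hf.continuous hσ) (mul_nonneg (hA0 N) (by positivity)) (hA2 N)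
    z).trans (mul_le_of_le_one_right (hA0 N) h1)

lemma IsCr.hasSum_wav {σ : ℝ} (hσ : 0 ≤ σ) {f : ℤ_[p] → L} (hf : IsCr p L σ f)
    {J : ℕ} (hJ : σ < J + 1) (z : ℤ_[p]) : HasSum (fun N => wav J f N z) (f z) := by
  have hp0 := p_pos (p := p)
  obtain ⟨A, hA, hA0, -, hA2⟩ := hf.exists_wav_bound hσ hJ
  have hs : Summable fun N => wav J f N z := by
    refine NonarchimedeanAddGroup.summable_of_tendsto_cofinite_zero ?_
    rw [Nat.cofinite_eq_atTop, tendsto_zero_iff_norm_tendsto_zero]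
    refine squeeze_zero (fun _ => norm_nonneg _) (fun N => ?_) hA
    have h1 : (p : ℝ) ^ (-((N : ℝ) * σ)) ≤ 1 :=
      Real.rpow_le_one_of_one_le_of_nonpos one_lt_p.le (by simp; positivity)
    exact (hA2 N z).trans (mul_le_of_le_one_right (hA0 N) h1)
  convert hs.hasSum
  refine tendsto_nhds_unique (hf.tendsto_interp hσ hJ z) ?_
  have := (tendsto_add_atTop_iff_nat 1).2 hs.hasSum.tendsto_sum_nat
  refine this.congr fun N => ?_
  rw [← sum_wav, Finset.sum_apply]

end Wavelets

section Pairing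

open scoped PowerSeries
open PowerSeries (coeff)

variable {p : ℕ} [hp : Fact p.Prime]
variable {L : Type} [NontriviallyNormedField L] [NormedAlgebra ℚ_[p] L] [IsUltrametricDist L]
  [CompleteSpace L]

/-- The coefficients of `w` are bounded by `C (n + 1) ^ σ`. -/
def Growth (σ C : ℝ) (w : L⟦X⟧) : Prop := ∀ n, ‖coeff n w‖ ≤ C * ((n : ℝ) + 1) ^ σ

lemma Growth.nonneg {L : Type} [NontriviallyNormedField L] {σ C : ℝ} {w : L⟦X⟧}
    (h : Growth σ C w) : 0 ≤ C := by
  have := (norm_nonneg _).trans (h 0)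
  simpa using this

lemma Growth.mono {L : Type} [NontriviallyNormedField L] {σ C σ' C' : ℝ} {w : L⟦X⟧}
    (h : Growth σ C w) (hσ : σ ≤ σ') (hC : C ≤ C') : Growth σ' C' w := fun n => by
  refine (h n).trans ?_
  have := h.nonneg
  have hn : (1 : ℝ) ≤ n + 1 := by linarith [(Nat.cast_nonneg n : (0 : ℝ) ≤ n)]
  have hC0 := this.trans hC
  gcongr

lemma Growth.add {L : Type} [NontriviallyNormedField L] {σ C C' : ℝ} {w w' : L⟦X⟧}
    (h : Growth σ C w) (h' : Growth σ C' w') : Growth σ (C + C') (w + w') := fun n => by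
  rw [map_add, add_mul]
  exact (norm_add_le _ _).trans (add_le_add (h n) (h' n))

lemma Growth.neg {L : Type} [NontriviallyNormedField L] {σ C : ℝ} {w : L⟦X⟧}
    (h : Growth σ C w) : Growth σ C (-w) := fun n => by
  rw [map_neg, norm_neg]
  exact h n

lemma Growth.sub {L : Type} [NontriviallyNormedField L] {σ C C' : ℝ} {w w' : L⟦X⟧}
    (h : Growth σ C w) (h' : Growth σ C' w') : Growth σ (C + C') (w - w') := by
  rw [sub_eq_add_neg]
  exact h.add h'.neg

lemma Growth.mul {L : Type} [NontriviallyNormedField L] [IsUltrametricDist L] {σ C σ' C' : ℝ}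
    (hσ : 0 ≤ σ) (hσ' : 0 ≤ σ') {w w' : L⟦X⟧}
    (h : Growth σ C w) (h' : Growth σ' C' w') : Growth (σ + σ') (C * C') (w * w') := fun n => by
  have h0 := h.nonneg
  have h0' := h'.nonneg
  rw [PowerSeries.coeff_mul]
  refine IsUltrametricDist.norm_sum_le_of_forall_le_of_nonneg (by positivity) fun ij hij => ?_
  have h1 : ij.1 + ij.2 = n := by simpa using hij
  have h2 : (ij.1 : ℝ) ≤ n := by exact_mod_cast (by omega : ij.1 ≤ n)
  have h3 : (ij.2 : ℝ) ≤ n := by exact_mod_cast (by omega : ij.2 ≤ n)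
  rw [norm_mul, Real.rpow_add (by positivity)]
  calc _ ≤ (C * ((ij.1 : ℝ) + 1) ^ σ) * (C' * ((ij.2 : ℝ) + 1) ^ σ') :=
        mul_le_mul (h _) (h' _) (norm_nonneg _) (by positivity)
    _ ≤ (C * ((n : ℝ) + 1) ^ σ) * (C' * ((n : ℝ) + 1) ^ σ') := by gcongr
    _ = _ := by ring

/-- The pairing of a power series (seen as a distribution) with a function. -/
def pair (w : L⟦X⟧) (g : ℤ_[p] → L) : L := ∑' n, coeff n w * mahlerCoeff p L g n

lemma hasSum_pair {σ C : ℝ} (hσ : 0 ≤ σ) {w : L⟦X⟧} (hw : Growth σ C w) {g : ℤ_[p] → L}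
    (hg : IsCr p L σ g) : HasSum (fun n => coeff n w * mahlerCoeff p L g n) (pair w g) := by
  refine Summable.hasSum (NonarchimedeanAddGroup.summable_of_tendsto_cofinite_zero ?_)
  rw [Nat.cofinite_eq_atTop, tendsto_zero_iff_norm_tendsto_zero]
  have := (hg.tendsto hσ).const_mul C
  rw [mul_zero] at this
  refine squeeze_zero (fun _ => norm_nonneg _) (fun n => ?_) this
  rw [norm_mul, ← mul_assoc]
  exact mul_le_mul_of_nonneg_right (hw n) (norm_nonneg _)

lemma norm_pair_le {σ C : ℝ} (hσ : 0 ≤ σ) {w : L⟦X⟧} (hw : Growth σ C w) {g : ℤ_[p] → L}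
    (hg : IsCr p L σ g) : ‖pair w g‖ ≤ C * crNorm p L σ g := by
  refine norm_le_of_hasSum (hasSum_pair hσ hw hg) (mul_nonneg hw.nonneg (crNorm_nonneg _ _))
    fun n => ?_
  rw [norm_mul]
  calc _ ≤ (C * ((n : ℝ) + 1) ^ σ) * ‖mahlerCoeff p L g n‖ :=
        mul_le_mul_of_nonneg_right (hw n) (norm_nonneg _)
    _ ≤ _ := by
      rw [mul_assoc]
      exact mul_le_mul_of_nonneg_left (hg.le_crNorm hσ n) hw.nonneg

lemma pair_add_right {σ C : ℝ} (hσ : 0 ≤ σ) {w : L⟦X⟧} (hw : Growth σ C w) {f g : ℤ_[p] → L}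
    (hf : IsCr p L σ f) (hg : IsCr p L σ g) : pair w (f + g) = pair w f + pair w g := by
  refine (hasSum_pair hσ hw (hf.add hg)).unique ?_
  simpa only [mahlerCoeff_add, mul_add] using (hasSum_pair hσ hw hf).add (hasSum_pair hσ hw hg)

lemma pair_smul_right (w : L⟦X⟧) (c : L) (g : ℤ_[p] → L) : pair w (c • g) = c * pair w g := by
  simp only [pair, mahlerCoeff_smul, mul_left_comm, tsum_mul_left]

lemma pair_zero_right (w : L⟦X⟧) : pair w (0 : ℤ_[p] → L) = 0 := by
  simpa using pair_smul_right w 0 (0 : ℤ_[p] → L)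

lemma pair_sub_right {σ C : ℝ} (hσ : 0 ≤ σ) {w : L⟦X⟧} (hw : Growth σ C w) {f g : ℤ_[p] → L}
    (hf : IsCr p L σ f) (hg : IsCr p L σ g) : pair w (f - g) = pair w f - pair w g := by
  rw [sub_eq_add_neg, ← neg_one_smul L g, pair_add_right hσ hw hf (hg.smul _), pair_smul_right]
  ring

lemma pair_sum_right {σ C : ℝ} (hσ : 0 ≤ σ) {w : L⟦X⟧} (hw : Growth σ C w) {ι : Type*}
    {s : Finset ι} {f : ι → ℤ_[p] → L} (hf : ∀ i ∈ s, IsCr p L σ (f i)) :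
    pair w (∑ i ∈ s, f i) = ∑ i ∈ s, pair w (f i) := by
  induction s using Finset.induction_on with
  | empty => simp [pair_zero_right]
  | insert a s ha ih =>
    rw [Finset.sum_insert ha, Finset.sum_insert ha, pair_add_right hσ hw
      (hf a (Finset.mem_insert_self _ _)) (IsCr.sum fun i hi => hf i (Finset.mem_insert_of_mem hi)),
      ih fun i hi => hf i (Finset.mem_insert_of_mem hi)]

lemma pair_add_left {σ C C' : ℝ} (hσ : 0 ≤ σ) {w w' : L⟦X⟧} (hw : Growth σ C w)
    (hw' : Growth σ C' w') {g : ℤ_[p] → L} (hg : IsCr p L σ g) :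
    pair (w + w') g = pair w g + pair w' g := by
  refine (hasSum_pair hσ (hw.add hw') hg).unique ?_
  simpa only [map_add, add_mul] using (hasSum_pair hσ hw hg).add (hasSum_pair hσ hw' hg)

lemma pair_smul_left (w : L⟦X⟧) (c : L) (g : ℤ_[p] → L) : pair (c • w) g = c * pair w g := by
  simp only [pair, map_smul, smul_eq_mul, mul_assoc, tsum_mul_left]

lemma pair_sub_left {σ C C' : ℝ} (hσ : 0 ≤ σ) {w w' : L⟦X⟧} (hw : Growth σ C w)
    (hw' : Growth σ C' w') {g : ℤ_[p] → L} (hg : IsCr p L σ g) :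
    pair (w - w') g = pair w g - pair w' g := by
  have h : Growth σ C' ((-1 : L) • w') := by rw [neg_one_smul]; exact hw'.neg
  rw [show w - w' = w + (-1 : L) • w' by rw [neg_one_smul, sub_eq_add_neg],
    pair_add_left hσ hw h hg, pair_smul_left]
  ring

lemma mahlerCoeff_bn (m n : ℕ) : mahlerCoeff p L (bn L m) n = if n = m then 1 else 0 := by
  have h := fwdDiff_iter_choose_zero m n
  rw [fwdDiff_iter_eq_sum_shift] at h
  have h2 := congrArg (Int.cast : ℤ → L) h
  rw [mahlerCoeff_eq, fwdDiff_iter_eq_sum_shift]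
  have h3 : ∀ k : ℕ, (0 : ℤ_[p]) + k • 1 = (k : ℤ_[p]) := fun k => by simp
  simp only [h3, bn_natCast]
  push_cast at h2
  simp only [zero_add, smul_eq_mul, mul_one, zsmul_eq_mul] at h2 ⊢
  push_cast
  rw [← h2]
  exact Finset.sum_congr rfl fun x _ => by push_cast; rfl

lemma pair_bn (w : L⟦X⟧) (n : ℕ) : pair w (bn (p := p) L n) = coeff n w := by
  rw [pair, tsum_eq_single n, mahlerCoeff_bn, if_pos rfl, mul_one]
  intro m hm
  rw [mahlerCoeff_bn, if_neg hm, mul_zero]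

lemma isCr_bn {σ : ℝ} (hσ : 0 ≤ σ) (n : ℕ) : IsCr p L σ (bn L n) := by
  refine isCr_of hσ (continuous_bn n) (tendsto_atTop_of_eventually_const (i₀ := n + 1) ?_)
  intro m hm
  rw [mahlerCoeff_bn, if_neg (by omega), norm_zero, mul_zero]

lemma crNorm_le_of_killed (p : ℕ) [Fact p.Prime] (L : Type) [NontriviallyNormedField L]
    [NormedAlgebra ℚ_[p] L] [IsUltrametricDist L] (σ : ℝ) (hσ : 0 ≤ σ) (e : ℕ) :
    ∃ C : ℝ, 0 < C ∧ ∀ (N : ℕ) (f : ℤ_[p] → L) (c : ℝ), 0 ≤ c → (∀ z, ‖f z‖ ≤ c) →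
      (fwdDiff ((p ^ N : ℕ) : ℤ_[p]))^[e] f = 0 →
      crNorm p L σ f ≤ C * (p : ℝ) ^ ((N : ℝ) * σ) * c := by
  obtain ⟨C, hC, h⟩ := exists_bound_of_killed p L σ hσ e
  exact ⟨C, hC, fun N f c hc hf he => crNorm_le (h N f c hc hf he)⟩

lemma isCr_box {σ : ℝ} (hσ : 0 ≤ σ) (a : ℤ_[p]) (N : ℕ) (Q : Polynomial L) :
    IsCr p L σ (box a N Q) := by
  obtain ⟨c, hc⟩ := (isCompact_univ.image (continuous_box a N Q)).isBounded.exists_norm_le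
  exact isCr_of_killed hσ (continuous_box a N Q) (c := c) (fun z => hc _ ⟨z, trivial, rfl⟩)
    (fwdDiff_iter_box a le_rfl (Nat.lt_succ_self _))

lemma isCr_interp {σ : ℝ} (hσ : 0 ≤ σ) (J N : ℕ) (f : ℤ_[p] → L) : IsCr p L σ (interp J N f) :=
  IsCr.sum fun _ _ => IsCr.sum fun _ _ => (isCr_box hσ _ _ _).smul _

lemma isCr_wav {σ : ℝ} (hσ : 0 ≤ σ) (J N : ℕ) (f : ℤ_[p] → L) : IsCr p L σ (wav J f N) := by
  cases N with
  | zero => exact isCr_interp hσ _ _ _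
  | succ N => exact (isCr_interp hσ _ _ _).sub (isCr_interp hσ _ _ _)

lemma IsCr.tendsto_crNorm_sub_interp {σ : ℝ} (hσ : 0 ≤ σ) {f : ℤ_[p] → L} (hf : IsCr p L σ f)
    {J : ℕ} (hJ : σ < J + 1) :
    Tendsto (fun N => crNorm p L σ (f - interp J N f)) atTop (𝓝 0) := by
  have hp0 := p_pos (p := p)
  obtain ⟨A, hA, hA0, -, hA2⟩ := hf.exists_wav_bound hσ hJ
  obtain ⟨C, hC, h⟩ := crNorm_le_of_killed p L σ hσ (J + 1)
  have hw : ∀ N, crNorm p L σ (wav J f N) ≤ C * A N := fun N => by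
    refine (h N _ _ (mul_nonneg (hA0 N) (by positivity)) (hA2 N) (fwdDiff_iter_wav J f N)).trans ?_
    rw [mul_assoc, mul_left_comm ((p : ℝ) ^ _), ← Real.rpow_add hp0, add_neg_cancel, Real.rpow_zero,
      mul_one]
  rw [Metric.tendsto_atTop]
  intro ε hε
  have ht := hA.const_mul C
  rw [mul_zero] at ht
  obtain ⟨N0, hN0⟩ := eventually_atTop.1 (ht.eventually (gt_mem_nhds (half_pos hε)))
  refine ⟨N0, fun N hN => ?_⟩
  rw [dist_zero_right, Real.norm_of_nonneg (crNorm_nonneg _ _)]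
  refine lt_of_le_of_lt (crNorm_le_of_hasSum hσ (F := fun i => wav J f (i + (N + 1))) (fun z => ?_)
    (half_pos hε).le (fun i => isCr_wav hσ _ _ _) fun i => (hw _).trans (hN0 _ (by omega)).le)
    (half_lt_self hε)
  have := (hasSum_nat_add_iff' (N + 1)).2 (hf.hasSum_wav hσ hJ z)
  rwa [← Finset.sum_apply, sum_wav] at this

lemma tendsto_pair_interp {σ C : ℝ} (hσ : 0 ≤ σ) {w : L⟦X⟧} (hw : Growth σ C w) {g : ℤ_[p] → L}
    (hg : IsCr p L σ g) {J : ℕ} (hJ : σ < J + 1) :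
    Tendsto (fun N => pair w (interp J N g)) atTop (𝓝 (pair w g)) := by
  rw [tendsto_iff_norm_sub_tendsto_zero]
  have := (hg.tendsto_crNorm_sub_interp hσ hJ).const_mul C
  rw [mul_zero] at this
  refine squeeze_zero (fun _ => norm_nonneg _) (fun N => ?_) this
  rw [norm_sub_rev, ← pair_sub_right hσ hw hg (isCr_interp hσ _ _ _)]
  exact norm_pair_le hσ hw (hg.sub (isCr_interp hσ _ _ _))

lemma pair_interp {σ C : ℝ} (hσ : 0 ≤ σ) {w : L⟦X⟧} (hw : Growth σ C w) (J N : ℕ)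
    (g : ℤ_[p] → L) : pair w (interp J N g) = ∑ a ∈ Finset.range (p ^ N),
      ∑ i ∈ Finset.range (J + 1), (fwdDiff ((p ^ N : ℕ) : ℤ_[p]))^[i] g (a : ℤ_[p]) *
        pair w (box (a : ℤ_[p]) N (newtonPoly L (a : ℤ_[p]) N i)) := by
  rw [interp, pair_sum_right hσ hw fun a _ => IsCr.sum fun i _ => (isCr_box hσ _ _ _).smul _]
  refine Finset.sum_congr rfl fun a _ => ?_
  rw [pair_sum_right hσ hw fun i _ => (isCr_box hσ _ _ _).smul _]
  exact Finset.sum_congr rfl fun i _ => pair_smul_right _ _ _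

lemma eq_zero_of_pair_box {σ C : ℝ} (hσ : 0 ≤ σ) {w : L⟦X⟧} (hw : Growth σ C w) {J : ℕ}
    (hJ : σ < J + 1) (h : ∀ (a : ℤ_[p]) (N : ℕ) (Q : Polynomial L), Q.natDegree ≤ J →
      pair w (box a (N + 1) Q) = 0) : w = 0 := by
  ext n
  rw [← pair_bn (p := p) w n, map_zero]
  refine tendsto_nhds_unique (tendsto_pair_interp hσ hw (isCr_bn hσ n) hJ)
    (tendsto_const_nhds.congr' ?_)
  filter_upwards [eventually_ge_atTop 1] with N hN
  obtain ⟨N, rfl⟩ := Nat.exists_eq_add_of_le' hN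
  rw [pair_interp hσ hw]
  refine (Finset.sum_eq_zero fun a _ => Finset.sum_eq_zero fun i hi => ?_).symm
  rw [h _ _ _ ((natDegree_newtonPoly_le _ _ _).trans (by simpa [Nat.lt_succ_iff] using hi)),
    mul_zero]

lemma summable_norm_pair {σ C : ℝ} (hσ : 0 ≤ σ) {w : L⟦X⟧} (hw : Growth σ C w) {g : ℤ_[p] → L}
    (hg : IsCr p L (σ + 2) g) : Summable fun n => ‖coeff n w * mahlerCoeff p L g n‖ := by
  have h1 : Summable fun n : ℕ => (C * crNorm p L (σ + 2) g) * (((n + 1 : ℕ) : ℝ) ^ 2)⁻¹ :=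
    ((summable_nat_add_iff 1).2 (Real.summable_nat_pow_inv.2 one_lt_two)).mul_left _
  refine h1.of_nonneg_of_le (fun _ => norm_nonneg _) fun n => ?_
  have h2 := hg.le_crNorm (by positivity) n
  rw [Real.rpow_add (by positivity)] at h2
  have hC := hw.nonneg
  rw [norm_mul, ← div_eq_mul_inv, le_div_iff₀ (by positivity)]
  calc _ ≤ (C * ((n : ℝ) + 1) ^ σ) * ‖mahlerCoeff p L g n‖ * ((n + 1 : ℕ) : ℝ) ^ 2 := by
        gcongr; exact hw n
    _ = C * (((n : ℝ) + 1) ^ σ * ((n : ℝ) + 1) ^ (2 : ℝ) * ‖mahlerCoeff p L g n‖) := by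
        rw [Real.rpow_two]; push_cast; ring
    _ ≤ _ := by gcongr

lemma fwdDiff_iter_add_eq {ι : Type*} (s : Finset ι) {g : ℤ_[p] → L} {u v : ι → ℤ_[p] → L}
    (h : ∀ x y, g (x + y) = ∑ k ∈ s, u k x * v k y) (d : ℤ_[p]) (i j : ℕ) (x y : ℤ_[p]) :
    (fwdDiff d)^[i + j] g (x + y) = ∑ k ∈ s, (fwdDiff d)^[i] (u k) x * (fwdDiff d)^[j] (v k) y := by
  have h1 : ∀ x y, (fwdDiff d)^[i] g (x + y) = ∑ k ∈ s, (fwdDiff d)^[i] (u k) x * v k y := by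
    intro x y
    rw [← fwdDiff_iter_comp_add]
    have : (fun r => g (r + y)) = ∑ k ∈ s, v k y • u k := by
      funext r
      simp [h, Finset.sum_apply, mul_comm]
    rw [this, fwdDiff_iter_finsetSum, Finset.sum_apply]
    simp [fwdDiff_iter_const_smul, mul_comm]
  rw [add_comm i, Function.iterate_add_apply, add_comm x, ← fwdDiff_iter_comp_add]
  have : (fun r => (fwdDiff d)^[i] g (r + x)) = ∑ k ∈ s, (fwdDiff d)^[i] (u k) x • v k := by
    funext r
    rw [add_comm, h1]
    simp [Finset.sum_apply]
  rw [this, fwdDiff_iter_finsetSum, Finset.sum_apply]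
  simp [fwdDiff_iter_const_smul]

lemma pair_mul {σ C σ' C' : ℝ} (hσ : 0 ≤ σ) (hσ' : 0 ≤ σ') {w w' : L⟦X⟧} (hw : Growth σ C w)
    (hw' : Growth σ' C' w') {ι : Type*} (s : Finset ι) {g : ℤ_[p] → L} {u v : ι → ℤ_[p] → L}
    (hu : ∀ k ∈ s, IsCr p L (σ + 2) (u k)) (hv : ∀ k ∈ s, IsCr p L (σ' + 2) (v k))
    (h : ∀ x y, g (x + y) = ∑ k ∈ s, u k x * v k y) :
    pair (w * w') g = ∑ k ∈ s, pair w (u k) * pair w' (v k) := by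
  have h1 : ∀ k ∈ s, pair w (u k) * pair w' (v k) =
      ∑' n, ∑ ij ∈ Finset.HasAntidiagonal.antidiagonal n, (coeff ij.1 w * mahlerCoeff p L (u k) ij.1) *
        (coeff ij.2 w' * mahlerCoeff p L (v k) ij.2) := fun k hk =>
    tsum_mul_tsum_eq_tsum_sum_antidiagonal_of_summable_norm (summable_norm_pair hσ hw (hu k hk))
      (summable_norm_pair hσ' hw' (hv k hk))
  rw [Finset.sum_congr rfl h1, ← Summable.tsum_finsetSum fun k hk =>
    (summable_norm_sum_mul_antidiagonal_of_summable_norm (summable_norm_pair hσ hw (hu k hk))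
      (summable_norm_pair hσ' hw' (hv k hk))).of_norm, pair]
  refine tsum_congr fun n => ?_
  rw [PowerSeries.coeff_mul, Finset.sum_mul, Finset.sum_comm]
  refine Finset.sum_congr rfl fun ij hij => ?_
  have h2 : ij.1 + ij.2 = n := by simpa using hij
  have h3 := fwdDiff_iter_add_eq s h 1 ij.1 ij.2 0 0
  rw [h2, add_zero, ← mahlerCoeff_eq] at h3
  rw [h3, Finset.mul_sum]
  refine Finset.sum_congr rfl fun k _ => ?_
  rw [← mahlerCoeff_eq, ← mahlerCoeff_eq]
  ring

end Pairing

section Amice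

open scoped PowerSeries
open PowerSeries (coeff)

variable {p : ℕ} [hp : Fact p.Prime]
variable {L : Type} [NontriviallyNormedField L] [NormedAlgebra ℚ_[p] L] [IsUltrametricDist L]
  [CompleteSpace L]

/-- A finitely additive system of functionals on polynomials indexed by the balls of `ℤ_p`,
tempered of order `σ`. -/
structure IsSystem (J : ℕ) (σ C : ℝ) (lam : ℤ_[p] → ℕ → Polynomial L →ₗ[L] L) : Prop where
  inv : ∀ {a b : ℤ_[p]} {N : ℕ}, (p : ℤ_[p]) ^ N ∣ a - b → lam a N = lam b N
  add : ∀ (a : ℤ_[p]) (N : ℕ) (Q : Polynomial L), Q.natDegree ≤ J →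
    lam a N Q = ∑ c ∈ Finset.range p, lam (a + c * (p : ℤ_[p]) ^ N) (N + 1) Q
  nonneg : 0 ≤ C
  bound : ∀ (a : ℤ_[p]) (N i : ℕ), i ≤ J →
    ‖lam a N (newtonPoly L a N i)‖ ≤ C * (p : ℝ) ^ ((N : ℝ) * σ)

/-- Riemann sums of a system. -/
def riemann (lam : ℤ_[p] → ℕ → Polynomial L →ₗ[L] L) (J N : ℕ) (g : ℤ_[p] → L) : L :=
  ∑ a ∈ Finset.range (p ^ N), ∑ i ∈ Finset.range (J + 1),
    (fwdDiff ((p ^ N : ℕ) : ℤ_[p]))^[i] g (a : ℤ_[p]) * lam a N (newtonPoly L (a : ℤ_[p]) N i)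

lemma fwdDiff_iter_finset_sum (h : ℤ_[p]) (i : ℕ) {ι : Type*} (s : Finset ι)
    (f : ι → ℤ_[p] → L) (x : ℤ_[p]) :
    (fwdDiff h)^[i] (∑ k ∈ s, f k) x = ∑ k ∈ s, (fwdDiff h)^[i] (f k) x := by
  rw [fwdDiff_iter_finsetSum, Finset.sum_apply]

lemma riemann_sum (lam : ℤ_[p] → ℕ → Polynomial L →ₗ[L] L) (J N : ℕ) {ι : Type*} (s : Finset ι)
    (f : ι → ℤ_[p] → L) : riemann lam J N (∑ k ∈ s, f k) = ∑ k ∈ s, riemann lam J N (f k) := by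
  simp only [riemann, fwdDiff_iter_finset_sum, Finset.sum_mul]
  rw [Finset.sum_comm (s := s)]
  refine Finset.sum_congr rfl fun a _ => ?_
  rw [Finset.sum_comm]

lemma riemann_smul (lam : ℤ_[p] → ℕ → Polynomial L →ₗ[L] L) (J N : ℕ) (c : L) (g : ℤ_[p] → L) :
    riemann lam J N (c • g) = c * riemann lam J N g := by
  simp only [riemann, fwdDiff_iter_const_smul, Pi.smul_apply, smul_eq_mul, Finset.mul_sum, mul_assoc]

lemma riemann_sub (lam : ℤ_[p] → ℕ → Polynomial L →ₗ[L] L) (J N : ℕ) (f g : ℤ_[p] → L) :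
    riemann lam J N (f - g) = riemann lam J N f - riemann lam J N g := by
  simp only [riemann, fwdDiff_iter_sub, Pi.sub_apply, sub_mul, Finset.sum_sub_distrib]

lemma IsSystem.norm_riemann_le {J : ℕ} {σ C : ℝ} {lam : ℤ_[p] → ℕ → Polynomial L →ₗ[L] L}
    (hl : IsSystem J σ C lam) (N : ℕ) {g : ℤ_[p] → L} {c : ℝ} (hc : 0 ≤ c)
    (hg : ∀ z, ‖g z‖ ≤ c) : ‖riemann lam J N g‖ ≤ C * (p : ℝ) ^ ((N : ℝ) * σ) * c := by
  have hC := hl.nonneg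
  have hp0 := p_pos (p := p)
  refine IsUltrametricDist.norm_sum_le_of_forall_le_of_nonneg (by positivity) fun a _ =>
    IsUltrametricDist.norm_sum_le_of_forall_le_of_nonneg (by positivity) fun i hi => ?_
  rw [norm_mul, mul_comm]
  exact mul_le_mul (hl.bound _ _ _ (by simpa [Nat.lt_succ_iff] using hi))
    (norm_fwdDiff_iter_le _ _ hc hg _) (norm_nonneg _) (by positivity)

lemma sum_range_mul {M : Type*} [AddCommMonoid M] (n m : ℕ) (F : ℕ → M) :
    ∑ x ∈ Finset.range (n * m), F x =
      ∑ c ∈ Finset.range m, ∑ b ∈ Finset.range n, F (b + c * n) := by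
  induction m with
  | zero => simp
  | succ m ih =>
    rw [mul_add, mul_one, Finset.sum_range_add, ih, Finset.sum_range_succ]
    congr 1
    exact Finset.sum_congr rfl fun b _ => by rw [add_comm, mul_comm]

lemma IsSystem.sum_eq {J : ℕ} {σ C : ℝ} {lam : ℤ_[p] → ℕ → Polynomial L →ₗ[L] L}
    (hl : IsSystem J σ C lam) (a : ℤ_[p]) {N M : ℕ} (hNM : N ≤ M) {Q : Polynomial L}
    (hQ : Q.natDegree ≤ J) :
    ∑ b ∈ Finset.range (p ^ M), (if (p : ℤ_[p]) ^ N ∣ (b : ℤ_[p]) - a then lam b M Q else 0) =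
      lam a N Q := by
  induction M, hNM using Nat.le_induction with
  | base =>
    obtain ⟨b, hb, y, hy⟩ := exists_natCast_add N a
    rw [Finset.sum_eq_single b]
    · have h : (p : ℤ_[p]) ^ N ∣ (b : ℤ_[p]) - a := ⟨-y, by rw [hy]; ring⟩
      rw [if_pos h, hl.inv h]
    · intro b' hb' hne
      rw [if_neg]
      intro h
      refine hne (dvd_natCast_sub (Finset.mem_range.1 hb') hb (y := 0) ?_)
      have h2 : (p : ℤ_[p]) ^ N ∣ a - b := ⟨y, by rw [hy]; ring⟩
      have := dvd_add h h2
      rw [mul_zero, add_zero]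
      convert this using 1
      ring
    · intro h
      exact absurd (Finset.mem_range.2 hb) h
  | succ M hM ih =>
    rw [← ih, pow_succ p M, sum_range_mul, Finset.sum_comm]
    refine Finset.sum_congr rfl fun b _ => ?_
    have h1 : ∀ c : ℕ, (p : ℤ_[p]) ^ N ∣ ((b + c * p ^ M : ℕ) : ℤ_[p]) - a ↔
        (p : ℤ_[p]) ^ N ∣ (b : ℤ_[p]) - a := fun c => by
      have h2 : (p : ℤ_[p]) ^ N ∣ c * (p : ℤ_[p]) ^ M := (pow_dvd_pow _ hM).mul_left _
      have h3 : ((b + c * p ^ M : ℕ) : ℤ_[p]) - a = (b - a) + c * (p : ℤ_[p]) ^ M := by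
        push_cast; ring
      rw [h3, dvd_add_left h2]
    simp only [h1]
    split_ifs with h
    · rw [hl.add _ _ _ hQ]
      exact Finset.sum_congr rfl fun c _ => by push_cast; rfl
    · simp

lemma poly_eq_of_eval {P Q : Polynomial L} (a : ℤ_[p]) (N : ℕ)
    (h : ∀ y : ℤ_[p], P.eval (iotaL p L ((a + (p : ℤ_[p]) ^ N * y : ℤ_[p]) : ℚ_[p])) =
      Q.eval (iotaL p L ((a + (p : ℤ_[p]) ^ N * y : ℤ_[p]) : ℚ_[p]))) : P = Q := by
  refine Polynomial.eq_of_infinite_eval_eq P Q (Set.Infinite.mono (s := Set.range fun y : ℤ_[p] =>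
    iotaL p L ((a + (p : ℤ_[p]) ^ N * y : ℤ_[p]) : ℚ_[p])) ?_ ?_)
  · rintro _ ⟨y, rfl⟩
    exact h y
  · refine Set.infinite_range_of_injective fun y y' hy => ?_
    have h1 := Subtype.coe_injective ((algebraMap ℚ_[p] L).injective hy)
    have hp0 : (p : ℤ_[p]) ^ N ≠ 0 := pow_ne_zero _ (by exact_mod_cast hp.out.ne_zero)
    exact mul_left_cancel₀ hp0 (add_left_cancel h1)

lemma sum_newtonPoly_box (J : ℕ) (a : ℤ_[p]) {N M : ℕ} (hNM : N ≤ M) {Q : Polynomial L}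
    (hQ : Q.natDegree ≤ J) {b : ℕ} (hb : b < p ^ M) :
    ∑ i ∈ Finset.range (J + 1), (fwdDiff ((p ^ M : ℕ) : ℤ_[p]))^[i] (box a N Q) (b : ℤ_[p]) •
      newtonPoly L (b : ℤ_[p]) M i = if (p : ℤ_[p]) ^ N ∣ (b : ℤ_[p]) - a then Q else 0 := by
  refine poly_eq_of_eval (p := p) (b : ℤ_[p]) M fun y => ?_
  simp only [Polynomial.eval_finsetSum, Polynomial.eval_smul, eval_newtonPoly, smul_eq_mul]
  rw [← interp_apply J M _ hb, interp_eq_self J M (continuous_box a N Q)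
    (fwdDiff_iter_box a hNM (Nat.lt_succ_iff.2 hQ)), box]
  have h2 : (p : ℤ_[p]) ^ N ∣ (p : ℤ_[p]) ^ M * y := (pow_dvd_pow _ hNM).mul_right _
  rw [show (b : ℤ_[p]) + (p : ℤ_[p]) ^ M * y - a = (b - a) + (p : ℤ_[p]) ^ M * y by ring,
    dvd_add_left h2]
  split_ifs <;> simp

lemma IsSystem.riemann_box {J : ℕ} {σ C : ℝ} {lam : ℤ_[p] → ℕ → Polynomial L →ₗ[L] L}
    (hl : IsSystem J σ C lam) (a : ℤ_[p]) {N M : ℕ} (hNM : N ≤ M) {Q : Polynomial L}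
    (hQ : Q.natDegree ≤ J) : riemann lam J M (box a N Q) = lam a N Q := by
  rw [← hl.sum_eq a hNM hQ]
  refine Finset.sum_congr rfl fun b hb => ?_
  have := congrArg (lam b M) (sum_newtonPoly_box J a hNM hQ (Finset.mem_range.1 hb))
  simp only [map_sum, map_smul, smul_eq_mul] at this
  rw [this]
  split_ifs <;> simp

lemma IsSystem.riemann_interp {J : ℕ} {σ C : ℝ} {lam : ℤ_[p] → ℕ → Polynomial L →ₗ[L] L}
    (hl : IsSystem J σ C lam) {N M : ℕ} (hNM : N ≤ M) (g : ℤ_[p] → L) :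
    riemann lam J M (interp J N g) = riemann lam J N g := by
  rw [interp, riemann_sum, riemann]
  refine Finset.sum_congr rfl fun a _ => ?_
  rw [riemann_sum]
  refine Finset.sum_congr rfl fun i hi => ?_
  rw [riemann_smul, hl.riemann_box _ hNM ((natDegree_newtonPoly_le _ _ _).trans
    (by simpa [Nat.lt_succ_iff] using hi))]

lemma IsSystem.norm_riemann_succ_sub {J : ℕ} {σ C : ℝ} {lam : ℤ_[p] → ℕ → Polynomial L →ₗ[L] L}
    (hl : IsSystem J σ C lam) (n N : ℕ) :
    ‖riemann lam J (N + 1) (bn L n) - riemann lam J N (bn L n)‖ ≤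
      C * (p : ℝ) ^ (((N + 1 : ℕ) : ℝ) * σ) * (min 1 (n * ((p : ℝ)⁻¹) ^ N)) ^ (J + 1) := by
  rw [← hl.riemann_interp (Nat.le_succ N) (bn L n), ← riemann_sub]
  exact hl.norm_riemann_le _ (by positivity) (norm_sub_interp_le J N (continuous_bn n)
    (by positivity) fun z => norm_fwdDiff_iter_bn_le _ _ _ _)

/-- The power series with coefficients the Riemann sums of the binomial functions. -/
def approxPS (lam : ℤ_[p] → ℕ → Polynomial L →ₗ[L] L) (J N : ℕ) : L⟦X⟧ :=
  PowerSeries.mk fun n => riemann lam J N (bn L n)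

lemma IsSystem.growth_approxPS {J : ℕ} {σ C : ℝ} (hσ : 0 ≤ σ) (hJ : σ < J + 1)
    {lam : ℤ_[p] → ℕ → Polynomial L →ₗ[L] L} (hl : IsSystem J σ C lam) (N : ℕ) :
    Growth σ (C * (p : ℝ) ^ σ) (approxPS lam J N) := by
  have hp0 := p_pos (p := p)
  have hC := hl.nonneg
  have hp1 : 1 ≤ (p : ℝ) ^ σ := Real.one_le_rpow one_lt_p.le hσ
  intro n
  rw [approxPS, PowerSeries.coeff_mk]
  have hn1 : (1 : ℝ) ≤ ((n : ℝ) + 1) ^ σ := one_le_succ_rpow hσ n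
  induction N with
  | zero =>
    refine (hl.norm_riemann_le 0 zero_le_one (norm_bn_le n)).trans ?_
    rw [Nat.cast_zero, zero_mul, Real.rpow_zero, mul_one, mul_one, mul_assoc]
    exact le_mul_of_one_le_right hC (one_le_mul_of_one_le_of_one_le hp1 hn1)
  | succ N ih =>
    have h1 : ‖riemann lam J (N + 1) (bn L n) - riemann lam J N (bn L n)‖ ≤
        C * (p : ℝ) ^ σ * ((n : ℝ) + 1) ^ σ := by
      refine (hl.norm_riemann_succ_sub n N).trans ?_
      have h2 := min_pow_le_rpow (y := n * ((p : ℝ)⁻¹) ^ N) (σ := σ) (j := J + 1) (by positivity) hσ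
        (by push_cast; exact hJ.le)
      rw [mul_inv_pow_rpow] at h2
      calc _ ≤ C * (p : ℝ) ^ (((N + 1 : ℕ) : ℝ) * σ) * ((n : ℝ) ^ σ * (p : ℝ) ^ (-((N : ℝ) * σ))) := by
            gcongr
        _ = C * (p : ℝ) ^ σ * (n : ℝ) ^ σ := by
            rw [show (p : ℝ) ^ (((N + 1 : ℕ) : ℝ) * σ) = (p : ℝ) ^ σ * (p : ℝ) ^ ((N : ℝ) * σ) by
              rw [← Real.rpow_add hp0]; push_cast; ring_nf]
            have : (p : ℝ) ^ ((N : ℝ) * σ) * (p : ℝ) ^ (-((N : ℝ) * σ)) = 1 := by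
              rw [← Real.rpow_add hp0, add_neg_cancel, Real.rpow_zero]
            linear_combination (C * (p : ℝ) ^ σ * (n : ℝ) ^ σ) * this
        _ ≤ _ := by
            gcongr
            linarith
    have h2 := norm_sub_le_max_norm (riemann lam J (N + 1) (bn L n) - riemann lam J N (bn L n))
      (-riemann lam J N (bn L n))
    rw [sub_neg_eq_add, sub_add_cancel, norm_neg] at h2
    exact h2.trans (max_le h1 ih)

lemma IsSystem.exists_tendsto {J : ℕ} {σ C : ℝ} (hσ : 0 ≤ σ) (hJ : σ < J + 1)
    {lam : ℤ_[p] → ℕ → Polynomial L →ₗ[L] L} (hl : IsSystem J σ C lam) (n : ℕ) :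
    ∃ l : L, Tendsto (fun N => riemann lam J N (bn L n)) atTop (𝓝 l) := by
  have hp0 := p_pos (p := p)
  have hC := hl.nonneg
  refine cauchySeq_tendsto_of_complete (NonarchimedeanAddGroup.cauchySeq_of_tendsto_sub_nhds_zero ?_)
  rw [tendsto_zero_iff_norm_tendsto_zero]
  have hq : (p : ℝ) ^ (σ - (J + 1)) < 1 := Real.rpow_lt_one_of_one_lt_of_neg one_lt_p (by linarith)
  have h1 := (tendsto_pow_atTop_nhds_zero_of_lt_one (by positivity) hq).const_mul
    (C * (p : ℝ) ^ σ * (n : ℝ) ^ (J + 1))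
  rw [mul_zero] at h1
  refine squeeze_zero (fun _ => norm_nonneg _) (fun N => ?_) h1
  refine (hl.norm_riemann_succ_sub n N).trans ?_
  calc _ ≤ C * (p : ℝ) ^ (((N + 1 : ℕ) : ℝ) * σ) * (n * ((p : ℝ)⁻¹) ^ N) ^ (J + 1) := by
        gcongr
        exact min_le_right _ _
    _ = _ := by
        rw [mul_pow, ← pow_mul, Real.rpow_sub hp0, div_pow, ← Real.rpow_natCast ((p : ℝ) ^ σ),
          ← Real.rpow_mul hp0.le, Nat.cast_add, add_mul, Real.rpow_add hp0,
          show (p : ℝ) ^ ((J : ℝ) + 1) = (p : ℝ) ^ (J + 1) by rw [← Real.rpow_natCast]; push_cast; rfl,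
          ← pow_mul, inv_pow, mul_comm (J + 1) N, Nat.cast_one, one_mul, mul_comm (N : ℝ) σ]
        field_simp

/-- Pairing with a smooth enough function is continuous for coefficientwise convergence with
uniform growth. -/
lemma tendsto_pair_of_coeff {σ C : ℝ} (hσ : 0 ≤ σ) {w : ℕ → L⟦X⟧} {w' : L⟦X⟧}
    (hw : ∀ M, Growth σ C (w M)) (h : ∀ n, Tendsto (fun M => coeff n (w M)) atTop (𝓝 (coeff n w')))
    {g : ℤ_[p] → L} (hg : IsCr p L (σ + 2) g) :
    Tendsto (fun M => pair (w M) g) atTop (𝓝 (pair w' g)) := by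
  have hC := (hw 0).nonneg
  have h1 : Summable fun n : ℕ => (C * crNorm p L (σ + 2) g) * (((n + 1 : ℕ) : ℝ) ^ 2)⁻¹ :=
    ((summable_nat_add_iff 1).2 (Real.summable_nat_pow_inv.2 one_lt_two)).mul_left _
  refine tendsto_tsum_of_dominated_convergence h1 (fun n => (h n).mul_const _)
    (Eventually.of_forall fun M n => ?_)
  have h2 := hg.le_crNorm (by positivity) n
  rw [Real.rpow_add (by positivity)] at h2
  rw [norm_mul, ← div_eq_mul_inv, le_div_iff₀ (by positivity)]
  calc _ ≤ (C * ((n : ℝ) + 1) ^ σ) * ‖mahlerCoeff p L g n‖ * ((n + 1 : ℕ) : ℝ) ^ 2 := by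
        gcongr; exact hw M n
    _ = C * (((n : ℝ) + 1) ^ σ * ((n : ℝ) + 1) ^ (2 : ℝ) * ‖mahlerCoeff p L g n‖) := by
        rw [Real.rpow_two]; push_cast; ring
    _ ≤ _ := by gcongr

lemma pair_approxPS (lam : ℤ_[p] → ℕ → Polynomial L →ₗ[L] L) (J N : ℕ) {g : ℤ_[p] → L}
    (hg : Continuous g) : pair (approxPS lam J N) g = riemann lam J N g := by
  refine HasSum.tsum_eq ?_
  simp only [approxPS, PowerSeries.coeff_mk, riemann, Finset.sum_mul]
  refine hasSum_sum fun a _ => hasSum_sum fun i _ => ?_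
  have := (hasSum_fwdDiff_iter hg ((p ^ N : ℕ) : ℤ_[p]) i (a : ℤ_[p])).mul_right
    (lam a N (newtonPoly L (a : ℤ_[p]) N i))
  refine this.congr_fun fun n => ?_
  ring

theorem IsSystem.exists_powerSeries {J : ℕ} {σ C : ℝ} (hσ : 0 ≤ σ) (hJ : σ < J + 1)
    {lam : ℤ_[p] → ℕ → Polynomial L →ₗ[L] L} (hl : IsSystem J σ C lam) :
    ∃ w : L⟦X⟧, Growth σ (C * (p : ℝ) ^ σ) w ∧ ∀ (a : ℤ_[p]) (N : ℕ) (Q : Polynomial L),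
      Q.natDegree ≤ J → pair w (box a N Q) = lam a N Q := by
  choose l hlim using hl.exists_tendsto hσ hJ
  have h1 : ∀ n, Tendsto (fun M => coeff n (approxPS lam J M)) atTop
      (𝓝 (coeff n (PowerSeries.mk l))) := fun n => by
    simpa only [approxPS, PowerSeries.coeff_mk] using hlim n
  refine ⟨PowerSeries.mk l, fun n => ?_, fun a N Q hQ => ?_⟩
  · exact le_of_tendsto (h1 n).norm (Eventually.of_forall fun M => hl.growth_approxPS hσ hJ M n)
  · refine tendsto_nhds_unique (tendsto_pair_of_coeff hσ (hl.growth_approxPS hσ hJ) h1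
      (isCr_box (by positivity) a N Q)) (tendsto_const_nhds.congr' ?_)
    filter_upwards [eventually_ge_atTop N] with M hM
    rw [pair_approxPS _ _ _ (continuous_box a N Q), hl.riemann_box a hM hQ]

end Amice

section Frobenius

open scoped PowerSeries
open PowerSeries (coeff)

variable {p : ℕ} [hp : Fact p.Prime]
variable {L : Type} [NontriviallyNormedField L] [NormedAlgebra ℚ_[p] L] [IsUltrametricDist L]
  [CompleteSpace L]

lemma iotaL_add (x y : ℚ_[p]) : iotaL p L (x + y) = iotaL p L x + iotaL p L y := map_add _ _ _

lemma iotaL_mul (x y : ℚ_[p]) : iotaL p L (x * y) = iotaL p L x * iotaL p L y := map_mul _ _ _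

lemma iotaL_natCast (n : ℕ) : iotaL p L (n : ℚ_[p]) = n := map_natCast _ _

lemma eq_of_pair_box {σ C C' : ℝ} (hσ : 0 ≤ σ) {w w' : L⟦X⟧} (hw : Growth σ C w)
    (hw' : Growth σ C' w') {J : ℕ} (hJ : σ < J + 1)
    (h : ∀ (a : ℤ_[p]) (N : ℕ) (Q : Polynomial L), Q.natDegree ≤ J →
      pair w (box a (N + 1) Q) = pair w' (box a (N + 1) Q)) : w = w' := by
  refine sub_eq_zero.1 (eq_zero_of_pair_box (p := p) hσ (hw.sub hw') hJ fun a N Q hQ => ?_)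
  rw [pair_sub_left hσ hw hw' (isCr_box hσ _ _ _), h a N Q hQ, sub_self]

lemma Growth.X_mul {L : Type} [NontriviallyNormedField L] {σ C : ℝ} (hσ : 0 ≤ σ) {w : L⟦X⟧}
    (h : Growth σ C w) : Growth σ C (PowerSeries.X * w) := fun n => by
  have hC := h.nonneg
  cases n with
  | zero => simpa [PowerSeries.coeff_zero_X_mul] using hC
  | succ n =>
    rw [PowerSeries.coeff_succ_X_mul]
    refine (h n).trans ?_
    gcongr
    linarith

lemma pair_X_mul (w : L⟦X⟧) (g : ℤ_[p] → L) :
    pair (PowerSeries.X * w) g = pair w (fwdDiff 1 g) := by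
  rw [pair, pair, ← (Nat.succ_injective).tsum_eq]
  · refine tsum_congr fun n => ?_
    rw [Nat.succ_eq_add_one, PowerSeries.coeff_succ_X_mul, mahlerCoeff_eq, mahlerCoeff_eq,
      Function.iterate_succ_apply]
  · intro n hn
    cases n with
    | zero => simp at hn
    | succ n => exact ⟨n, rfl⟩

lemma pair_one_add_X_mul {σ C : ℝ} (hσ : 0 ≤ σ) {w : L⟦X⟧} (hw : Growth σ C w) {g : ℤ_[p] → L}
    (hg : IsCr p L σ g) (hg' : IsCr p L σ fun z => g (z + 1)) :
    pair ((1 + PowerSeries.X) * w) g = pair w (fun z => g (z + 1)) := by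
  rw [add_mul, one_mul, pair_add_left hσ hw (hw.X_mul hσ) hg, pair_X_mul,
    show fwdDiff 1 g = (fun z => g (z + 1)) - g from rfl, pair_sub_right hσ hw hg' hg]
  ring

lemma Growth.one_add_X_mul {L : Type} [NontriviallyNormedField L] [IsUltrametricDist L]
    {σ C : ℝ} (hσ : 0 ≤ σ) {w : L⟦X⟧}
    (h : Growth σ C w) : Growth σ C ((1 + PowerSeries.X) * w) := fun n => by
  rw [add_mul, one_mul, map_add]
  exact (IsUltrametricDist.norm_add_le_max _ _).trans (max_le (h n) (h.X_mul hσ n))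

lemma Growth.one_add_X_pow_mul {L : Type} [NontriviallyNormedField L] [IsUltrametricDist L]
    {σ C : ℝ} (hσ : 0 ≤ σ) {w : L⟦X⟧}
    (h : Growth σ C w) (c : ℕ) : Growth σ C ((1 + PowerSeries.X) ^ c * w) := by
  induction c with
  | zero => simpa using h
  | succ c ih => rw [pow_succ', mul_assoc]; exact ih.one_add_X_mul hσ

lemma box_add_right (a c : ℤ_[p]) (N : ℕ) (Q : Polynomial L) (z : ℤ_[p]) :
    box a N Q (z + c) = box (a - c) N (Q.comp (Polynomial.X + Polynomial.C
      (iotaL p L (c : ℚ_[p])))) z := by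
  simp only [box, Polynomial.eval_comp, Polynomial.eval_add, Polynomial.eval_X, Polynomial.eval_C]
  rw [show z + c - a = z - (a - c) by ring, PadicInt.coe_add, iotaL_add]

lemma pair_one_add_X_pow_mul_box {σ C : ℝ} (hσ : 0 ≤ σ) {w : L⟦X⟧} (hw : Growth σ C w) (c : ℕ)
    (a : ℤ_[p]) (N : ℕ) (Q : Polynomial L) :
    pair ((1 + PowerSeries.X) ^ c * w) (box a N Q) = pair w (fun z => box a N Q (z + (c : ℤ_[p]))) := by
  induction c generalizing a Q with
  | zero => simp
  | succ c ih =>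
    rw [pow_succ', mul_assoc, pair_one_add_X_mul hσ (hw.one_add_X_pow_mul hσ c) (isCr_box hσ _ _ _)]
    · simp only [box_add_right _ 1]
      rw [ih]
      simp only [← box_add_right, Nat.cast_add, Nat.cast_one, add_assoc]
    · simp only [box_add_right]
      exact isCr_box hσ _ _ _

lemma coeff_one_add_X_pow (a n : ℕ) :
    coeff n ((1 + PowerSeries.X : L⟦X⟧) ^ a) = (a.choose n : L) := by
  have : (1 + PowerSeries.X : L⟦X⟧) ^ a = (((1 + Polynomial.X) ^ a : Polynomial L) : L⟦X⟧) := by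
    simp
  rw [this, Polynomial.coeff_coe, Polynomial.coeff_one_add_X_pow]

lemma coeff_delta (h a i n : ℕ) :
    coeff n ((1 + PowerSeries.X : L⟦X⟧) ^ a * ((1 + PowerSeries.X) ^ h - 1) ^ i) =
      (fwdDiff (h : ℤ_[p]))^[i] (bn L n) (a : ℤ_[p]) := by
  induction i generalizing a with
  | zero => rw [pow_zero, mul_one, coeff_one_add_X_pow, Function.iterate_zero, id, bn_natCast]
  | succ i ih =>
    rw [Function.iterate_succ_apply', fwdDiff, ← ih, ← Nat.cast_add, ← ih, ← map_sub]
    congr 1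
    ring

/-- The power series `(1 + X) ^ p - 1`. -/
def phiX (p : ℕ) (L : Type) [NontriviallyNormedField L] : L⟦X⟧ := (1 + PowerSeries.X) ^ p - 1

lemma coeff_phiX_pow (i n : ℕ) :
    coeff n (phiX p L ^ i) = (fwdDiff (p : ℤ_[p]))^[i] (bn L n) 0 := by
  have := coeff_delta (p := p) (L := L) p 0 i n
  simpa [phiX] using this

lemma constantCoeff_phiX (p : ℕ) (L : Type) [NontriviallyNormedField L] :
    PowerSeries.constantCoeff (phiX p L) = 0 := by
  simp [phiX]

/-- The endomorphism `X ↦ (1 + X) ^ p - 1` of `L⟦X⟧`. -/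
def frob (p : ℕ) (L : Type) [NontriviallyNormedField L] : L⟦X⟧ →ₐ[L] L⟦X⟧ :=
  PowerSeries.substAlgHom (PowerSeries.HasSubst.of_constantCoeff_zero' (constantCoeff_phiX p L))

lemma frob_X (p : ℕ) (L : Type) [NontriviallyNormedField L] :
    frob p L PowerSeries.X = phiX p L :=
  PowerSeries.substAlgHom_X _

lemma coeff_phiX_pow_eq_zero (p : ℕ) (L : Type) [NontriviallyNormedField L] {i n : ℕ} (h : n < i) :
    coeff n (phiX p L ^ i) = 0 := by
  have h1 : PowerSeries.X ∣ phiX p L := PowerSeries.X_dvd_iff.2 (constantCoeff_phiX p L)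
  exact PowerSeries.X_pow_dvd_iff.1 (pow_dvd_pow_of_dvd h1 i) n h

lemma coeff_frob (p : ℕ) (L : Type) [NontriviallyNormedField L] (w : L⟦X⟧) {n m : ℕ} (h : n < m) :
    coeff n (frob p L w) = ∑ i ∈ Finset.range m, coeff i w * coeff n (phiX p L ^ i) := by
  have h1 := PowerSeries.HasSubst.of_constantCoeff_zero' (constantCoeff_phiX p L)
  rw [frob, PowerSeries.coe_substAlgHom, PowerSeries.coeff_subst' h1, finsum_eq_sum_of_support_subset]
  · rfl
  · intro i hi
    rw [Finset.coe_range, Set.mem_Iio]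
    by_contra hc
    exact hi (by simp only [coeff_phiX_pow_eq_zero p L (show n < i by omega), smul_zero])

lemma norm_coeff_phiX_pow_le (i n : ℕ) : ‖coeff n (phiX p L ^ i)‖ ≤ 1 := by
  rw [coeff_phiX_pow (p := p)]
  exact norm_fwdDiff_iter_le _ _ zero_le_one (norm_bn_le n) _

lemma Growth.frob {σ C : ℝ} (hσ : 0 ≤ σ) {w : L⟦X⟧} (h : Growth σ C w) :
    Growth σ C (frob p L w) := fun n => by
  have hC := h.nonneg
  rw [coeff_frob p L w (Nat.lt_succ_self n)]
  refine IsUltrametricDist.norm_sum_le_of_forall_le_of_nonneg (by positivity) fun i hi => ?_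
  have hi' : (i : ℝ) ≤ n := by exact_mod_cast (by simpa [Nat.lt_succ_iff] using hi : i ≤ n)
  rw [norm_mul]
  calc _ ≤ C * ((i : ℝ) + 1) ^ σ * 1 :=
        mul_le_mul (h i) (norm_coeff_phiX_pow_le i n) (norm_nonneg _) (by positivity)
    _ ≤ _ := by rw [mul_one]; gcongr

lemma Growth.trunc {L : Type} [NontriviallyNormedField L] {σ C : ℝ} {w : L⟦X⟧}
    (h : Growth σ C w) (M : ℕ) : Growth σ C (PowerSeries.trunc M w : L⟦X⟧) := fun n => by
  have hC := h.nonneg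
  rw [Polynomial.coeff_coe, PowerSeries.coeff_trunc]
  split_ifs
  · exact h n
  · rw [norm_zero]; positivity

lemma mahlerCoeff_comp_mul (g : ℤ_[p] → L) (i : ℕ) :
    mahlerCoeff p L (fun z => g ((p : ℤ_[p]) * z)) i = (fwdDiff (p : ℤ_[p]))^[i] g 0 := by
  rw [mahlerCoeff_eq, fwdDiff_iter_eq_sum_shift, fwdDiff_iter_eq_sum_shift]
  refine Finset.sum_congr rfl fun k _ => ?_
  congr 2
  simp [mul_comm]

lemma pair_frob {σ C : ℝ} (hσ : 0 ≤ σ) {w : L⟦X⟧} (hw : Growth σ C w) {g : ℤ_[p] → L}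
    (hg : IsCr p L (σ + 2) g) (hg' : IsCr p L (σ + 2) fun z => g ((p : ℤ_[p]) * z)) :
    pair (frob p L w) g = pair w (fun z => g ((p : ℤ_[p]) * z)) := by
  have h1 := tendsto_pair_of_coeff (p := p) hσ (w := fun M => frob p L (PowerSeries.trunc M w : L⟦X⟧))
    (w' := frob p L w) (fun M => (hw.trunc M).frob hσ) (fun n => by
      refine tendsto_const_nhds.congr' ?_
      filter_upwards [eventually_gt_atTop n] with M hM
      rw [coeff_frob p L _ hM, coeff_frob p L _ hM]
      refine Finset.sum_congr rfl fun i hi => ?_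
      rw [Polynomial.coeff_coe, PowerSeries.coeff_trunc, if_pos (Finset.mem_range.1 hi)]) hg
  have h2 := tendsto_pair_of_coeff (p := p) hσ (w := fun M => (PowerSeries.trunc M w : L⟦X⟧))
    (w' := w) (fun M => hw.trunc M) (fun n => by
      refine tendsto_const_nhds.congr' ?_
      filter_upwards [eventually_gt_atTop n] with M hM
      rw [Polynomial.coeff_coe, PowerSeries.coeff_trunc, if_pos hM]) hg'
  refine tendsto_nhds_unique h1 (h2.congr fun M => ?_)
  have h3 : ∀ n, coeff n (frob p L (PowerSeries.trunc M w : L⟦X⟧)) =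
      ∑ i ∈ Finset.range M, coeff i w * coeff n (phiX p L ^ i) := fun n => by
    rw [coeff_frob p L _ (show n < max M (n + 1) by simp)]
    rw [← Finset.sum_subset (Finset.range_subset_range.2 (le_max_left M (n + 1)))]
    · refine Finset.sum_congr rfl fun i hi => ?_
      rw [Polynomial.coeff_coe, PowerSeries.coeff_trunc, if_pos (Finset.mem_range.1 hi)]
    · intro i _ hi
      rw [Polynomial.coeff_coe, PowerSeries.coeff_trunc, if_neg (by simpa using hi), zero_mul]
  rw [pair, tsum_eq_sum (s := Finset.range M)]
  · symm
    refine HasSum.tsum_eq ?_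
    simp only [h3, Finset.sum_mul]
    refine hasSum_sum fun i hi => ?_
    rw [Polynomial.coeff_coe, PowerSeries.coeff_trunc, if_pos (Finset.mem_range.1 hi),
      mahlerCoeff_comp_mul]
    refine ((hasSum_fwdDiff_iter (hg.continuous (by positivity)) (p : ℤ_[p]) i 0).mul_left
      (coeff i w)).congr_fun fun n => ?_
    rw [coeff_phiX_pow (p := p)]
    ring
  · intro i hi
    rw [Polynomial.coeff_coe, PowerSeries.coeff_trunc, if_neg (by simpa using hi), zero_mul]

lemma dvd_p_mul_iff (a z : ℤ_[p]) (N : ℕ) :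
    (p : ℤ_[p]) ^ (N + 1) ∣ (p : ℤ_[p]) * z - p * a ↔ (p : ℤ_[p]) ^ N ∣ z - a := by
  have hp0 : (p : ℤ_[p]) ≠ 0 := by exact_mod_cast hp.out.ne_zero
  rw [← mul_sub, pow_succ', mul_dvd_mul_iff_left hp0]

lemma box_frob (a c : ℤ_[p]) (N : ℕ) (Q : Polynomial L) (z : ℤ_[p]) :
    box (c + (p : ℤ_[p]) * a) (N + 1) Q ((p : ℤ_[p]) * z + c) = box a N (Q.comp (Polynomial.C (p : L) * Polynomial.X +
      Polynomial.C (iotaL p L (c : ℚ_[p])))) z := by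
  simp only [box, Polynomial.eval_comp, Polynomial.eval_add, Polynomial.eval_X, Polynomial.eval_C,
    Polynomial.eval_mul]
  rw [show (p : ℤ_[p]) * z + c - (c + p * a) = p * z - p * a by ring, dvd_p_mul_iff, PadicInt.coe_add, PadicInt.coe_mul,
    iotaL_add, iotaL_mul, PadicInt.coe_natCast, iotaL_natCast]

lemma box_frob_eq_zero {a c : ℤ_[p]} (h : ¬ (p : ℤ_[p]) ∣ a - c) (N : ℕ) (Q : Polynomial L)
    (z : ℤ_[p]) : box a (N + 1) Q ((p : ℤ_[p]) * z + c) = 0 := by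
  rw [box, if_neg]
  intro h1
  have h2 : (p : ℤ_[p]) ∣ (p : ℤ_[p]) * z + c - a := (dvd_pow_self _ (Nat.succ_ne_zero N)).trans h1
  apply h
  have h3 := dvd_sub (dvd_mul_right (p : ℤ_[p]) z) h2
  convert h3 using 1
  ring

/-- The decomposition of a distribution along the residue classes modulo `p`. -/
theorem eq_sum_frob {σ C C' : ℝ} (hσ : 0 ≤ σ) {w : L⟦X⟧} (hw : Growth σ C w) {wc : ℕ → L⟦X⟧}
    (hwc : ∀ c, Growth σ C' (wc c)) {J : ℕ} (hJ : σ < J + 1)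
    (h : ∀ c < p, ∀ (a : ℤ_[p]) (N : ℕ) (Q : Polynomial L), Q.natDegree ≤ J →
      pair w (box ((c : ℤ_[p]) + (p : ℤ_[p]) * a) (N + 1) Q) = pair (wc c) (box a N (Q.comp (Polynomial.C (p : L) *
        Polynomial.X + Polynomial.C (c : L))))) :
    w = ∑ c ∈ Finset.range p, (1 + PowerSeries.X) ^ c * frob p L (wc c) := by
  have hg : ∀ c, Growth σ C' ((1 + PowerSeries.X) ^ c * frob p L (wc c)) := fun c =>
    ((hwc c).frob hσ).one_add_X_pow_mul hσ c
  have hC := (hwc 0).nonneg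
  have hsum : ∀ s : Finset ℕ, Growth σ C' (∑ c ∈ s, (1 + PowerSeries.X) ^ c * frob p L (wc c)) :=
    fun s n => by
      rw [map_sum]
      exact IsUltrametricDist.norm_sum_le_of_forall_le_of_nonneg (by positivity) fun c _ => hg c n
  have hps : ∀ (s : Finset ℕ) (g : ℤ_[p] → L), IsCr p L σ g →
      pair (∑ c ∈ s, (1 + PowerSeries.X) ^ c * frob p L (wc c)) g =
        ∑ c ∈ s, pair ((1 + PowerSeries.X) ^ c * frob p L (wc c)) g := fun s g hgc => by
    induction s using Finset.induction_on with
    | empty => simp [pair]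
    | insert a s ha ih =>
      rw [Finset.sum_insert ha, Finset.sum_insert ha, pair_add_left hσ (hg a) (hsum s) hgc, ih]
  refine eq_of_pair_box (p := p) hσ hw (hsum _) hJ fun a N Q hQ => ?_
  rw [hps _ _ (isCr_box hσ _ _ _)]
  have h0 : (0 : ℝ) ≤ σ + 2 := by positivity
  have hc0 : ∀ c : ℕ, iotaL p L (((c : ℤ_[p]) : ℚ_[p])) = (c : L) := fun c => by
    rw [PadicInt.coe_natCast, iotaL_natCast]
  have h1 : ∀ c : ℕ, IsCr p L (σ + 2) (fun z => box a (N + 1) Q ((p : ℤ_[p]) * z + (c : ℤ_[p]))) →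
      pair ((1 + PowerSeries.X) ^ c * frob p L (wc c)) (box a (N + 1) Q) =
      pair (wc c) (fun z => box a (N + 1) Q ((p : ℤ_[p]) * z + (c : ℤ_[p]))) := fun c hc => by
    have h2 : IsCr p L (σ + 2) fun z => box a (N + 1) Q (z + (c : ℤ_[p])) := by
      simp only [box_add_right]
      exact isCr_box h0 _ _ _
    rw [pair_one_add_X_pow_mul_box hσ ((hwc c).frob hσ)]
    exact pair_frob (g := fun z => box a (N + 1) Q (z + (c : ℤ_[p]))) hσ (hwc c) h2 hc
  obtain ⟨c, hc, y, hy⟩ := exists_natCast_add 1 a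
  rw [pow_one] at hc hy
  rw [Finset.sum_eq_single c]
  · have h2 : (fun z => box a (N + 1) Q ((p : ℤ_[p]) * z + (c : ℤ_[p]))) = box y N (Q.comp (Polynomial.C (p : L) *
        Polynomial.X + Polynomial.C (c : L))) := by
      funext z
      rw [hy, box_frob, hc0]
    rw [h1 c (by rw [h2]; exact isCr_box h0 _ _ _), h2, hy, h c hc y N Q hQ]
  · intro c' hc' hne
    have h2 : (fun z => box a (N + 1) Q ((p : ℤ_[p]) * z + (c' : ℤ_[p]))) = 0 := by
      funext z
      refine box_frob_eq_zero (fun hd => hne (dvd_natCast_sub (p := p) (N := 1) (y := y)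
        (by simpa using hc) (by simpa using hc') ?_).symm) N Q z
      rw [pow_one, ← hy]
      exact hd
    rw [h1 c' (by rw [h2]; exact isCr_zero _), h2, pair_zero_right]
  · intro hn
    exact absurd (Finset.mem_range.2 hc) hn

end Frobenius

section BoundedQuotient

open scoped PowerSeries
open PowerSeries (coeff)

variable {p : ℕ} [hp : Fact p.Prime]
variable {L : Type} [NontriviallyNormedField L] [NormedAlgebra ℚ_[p] L] [IsUltrametricDist L]
  [CompleteSpace L]

/-- Coefficientwise convergence. -/
def CoeffTendsto {L : Type} [NontriviallyNormedField L] (w : ℕ → L⟦X⟧) (w' : L⟦X⟧) : Prop :=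
  ∀ n, Tendsto (fun N => coeff n (w N)) atTop (𝓝 (coeff n w'))

lemma coeffTendsto_const {L : Type} [NontriviallyNormedField L] (w : L⟦X⟧) :
    CoeffTendsto (fun _ => w) w := fun _ => tendsto_const_nhds

lemma CoeffTendsto.mul {L : Type} [NontriviallyNormedField L] {w v : ℕ → L⟦X⟧} {w' v' : L⟦X⟧}
    (hw : CoeffTendsto w w') (hv : CoeffTendsto v v') :
    CoeffTendsto (fun N => w N * v N) (w' * v') := fun n => by
  simp only [PowerSeries.coeff_mul]
  exact tendsto_finsetSum _ fun ij _ => (hw _).mul (hv _)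

lemma CoeffTendsto.sub {L : Type} [NontriviallyNormedField L] {w v : ℕ → L⟦X⟧} {w' v' : L⟦X⟧}
    (hw : CoeffTendsto w w') (hv : CoeffTendsto v v') :
    CoeffTendsto (fun N => w N - v N) (w' - v') := fun n => by
  simp only [map_sub]
  exact (hw n).sub (hv n)

lemma CoeffTendsto.pow {L : Type} [NontriviallyNormedField L] {w : ℕ → L⟦X⟧} {w' : L⟦X⟧}
    (hw : CoeffTendsto w w') (m : ℕ) : CoeffTendsto (fun N => w N ^ m) (w' ^ m) := by
  induction m with
  | zero => simpa using coeffTendsto_const (1 : L⟦X⟧)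
  | succ m ih => simpa only [pow_succ] using ih.mul hw

lemma CoeffTendsto.frob (p : ℕ) {L : Type} [NontriviallyNormedField L] {w : ℕ → L⟦X⟧} {w' : L⟦X⟧}
    (hw : CoeffTendsto w w') : CoeffTendsto (fun N => frob p L (w N)) (frob p L w') := fun n => by
  simp only [coeff_frob p L _ (Nat.lt_succ_self n)]
  exact tendsto_finsetSum _ fun i _ => (hw _).mul_const _

lemma CoeffTendsto.unique {L : Type} [NontriviallyNormedField L] {w : ℕ → L⟦X⟧} {w' v' : L⟦X⟧}
    (hw : CoeffTendsto w w') (hv : CoeffTendsto w v') : w' = v' := by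
  ext n
  exact tendsto_nhds_unique (hw n) (hv n)

/-- If `w → 0` coefficientwise and `B` is bounded then `w B → 0` coefficientwise. -/
lemma CoeffTendsto.mul_bounded {L : Type} [NontriviallyNormedField L] {w B : ℕ → L⟦X⟧}
    (hw : CoeffTendsto w 0) {K : ℝ} (hB : ∀ N n, ‖coeff n (B N)‖ ≤ K) :
    CoeffTendsto (fun N => w N * B N) 0 := fun n => by
  simp only [PowerSeries.coeff_mul, map_zero]
  rw [← Finset.sum_const_zero (ι := ℕ × ℕ) (s := Finset.HasAntidiagonal.antidiagonal n)]
  refine tendsto_finsetSum _ fun ij _ => ?_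
  have h1 := hw ij.1
  rw [map_zero] at h1
  exact h1.zero_mul_isBoundedUnder_le (isBoundedUnder_of ⟨K, fun N => hB N ij.2⟩)

/-- The power series `log (1 + X) / X`. -/
def logU (L : Type) [NontriviallyNormedField L] : L⟦X⟧ :=
  PowerSeries.mk fun n => (-1) ^ n * ((n : L) + 1)⁻¹

lemma constantCoeff_logU (L : Type) [NontriviallyNormedField L] :
    PowerSeries.constantCoeff (logU L) = 1 := by
  rw [← PowerSeries.coeff_zero_eq_constantCoeff_apply, logU, PowerSeries.coeff_mk]
  simp

lemma logU_mul_inv (L : Type) [NontriviallyNormedField L] : logU L * (logU L)⁻¹ = 1 :=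
  PowerSeries.mul_inv_cancel _ (by rw [constantCoeff_logU]; exact one_ne_zero)

/-- The power series `((1 + X) ^ (p ^ N) - 1) / (p ^ N X)`. -/
def logUApprox (p : ℕ) (L : Type) [NontriviallyNormedField L] (N : ℕ) : L⟦X⟧ :=
  PowerSeries.mk fun n => ((p : L) ^ N)⁻¹ * ((p ^ N).choose (n + 1) : L)

lemma X_mul_logUApprox (N : ℕ) :
    (PowerSeries.X : L⟦X⟧) * logUApprox p L N =
      ((p : L) ^ N)⁻¹ • ((1 + PowerSeries.X) ^ (p ^ N) - 1) := by
  ext n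
  rw [map_smul, map_sub, coeff_one_add_X_pow (L := L)]
  cases n with
  | zero => simp
  | succ n =>
    rw [PowerSeries.coeff_succ_X_mul, logUApprox, PowerSeries.coeff_mk, PowerSeries.coeff_one,
      if_neg (Nat.succ_ne_zero n), sub_zero, smul_eq_mul]

lemma bn_succ_add_one (n : ℕ) (z : ℤ_[p]) : bn L (n + 1) (z + 1) = bn L n z + bn L (n + 1) z := by
  refine congrFun (eq_of_eq_nat (f := fun z : ℤ_[p] => bn L (n + 1) (z + 1))
    (g := fun z => bn L n z + bn L (n + 1) z)
    ((continuous_bn _).comp (continuous_id.add continuous_const))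
    ((continuous_bn _).add (continuous_bn _)) fun m => ?_) z
  have h1 : ((m : ℤ_[p]) + 1) = ((m + 1 : ℕ) : ℤ_[p]) := by push_cast; rfl
  rw [h1, bn_natCast, bn_natCast, bn_natCast, Nat.choose_succ_succ, Nat.cast_add]

lemma bn_neg_one (n : ℕ) : bn L n (-1 : ℤ_[p]) = (-1) ^ n := by
  induction n with
  | zero => simp [bn, binomQ, iotaL]
  | succ n ih =>
    have h := bn_succ_add_one (L := L) n (-1 : ℤ_[p])
    have h0 : bn L (n + 1) (0 : ℤ_[p]) = 0 := by
      have := bn_natCast (p := p) (L := L) (n + 1) 0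
      simpa using this
    rw [neg_add_cancel, h0, ih] at h
    rw [pow_succ]
    linear_combination -h

lemma coeffTendsto_logUApprox : CoeffTendsto (logUApprox p L) (logU L) := fun n => by
  haveI := charZero_L p L
  have h1 : Tendsto (fun N : ℕ => ((p : ℤ_[p]) ^ N - 1)) atTop (𝓝 (0 - 1)) := by
    refine Tendsto.sub_const (tendsto_pow_atTop_nhds_zero_of_norm_lt_one ?_) 1
    rw [PadicInt.norm_p]
    exact inv_lt_one_of_one_lt₀ one_lt_p
  have h2 := ((continuous_bn (p := p) (L := L) n).tendsto _).comp h1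
  rw [zero_sub, bn_neg_one] at h2
  have h3 := h2.mul_const (((n : L) + 1)⁻¹)
  simp only [logU, logUApprox, PowerSeries.coeff_mk]
  refine h3.congr fun N => ?_
  have hp0 : 1 ≤ p ^ N := Nat.one_le_pow _ _ hp.out.pos
  have h4 : ((p : ℤ_[p]) ^ N - 1) = ((p ^ N - 1 : ℕ) : ℤ_[p]) := by
    rw [Nat.cast_sub hp0]; push_cast; rfl
  rw [Function.comp_apply, h4, bn_natCast]
  have h5 := Nat.add_one_mul_choose_eq (p ^ N - 1) n
  rw [Nat.sub_add_cancel hp0] at h5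
  have h6 : (p : L) ^ N * ((p ^ N - 1).choose n : L) = ((p ^ N).choose (n + 1) : L) * (n + 1) := by
    exact_mod_cast h5
  have h7 : (p : L) ^ N ≠ 0 := pow_ne_zero _ pL_ne_zero
  have h8 : (n : L) + 1 ≠ 0 := by exact_mod_cast Nat.succ_ne_zero n
  field_simp
  linear_combination h6

lemma phiX_mul_frob_logU :
    phiX p L * frob p L (logU L) = (p : L) • (PowerSeries.X * logU L) := by
  have h1 := ((coeffTendsto_const (PowerSeries.X : L⟦X⟧)).mul
    (coeffTendsto_logUApprox (p := p) (L := L))).frob p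
  have h2 : CoeffTendsto (fun N => frob p L (PowerSeries.X * logUApprox p L N))
      ((p : L) • (PowerSeries.X * logU L)) := fun n => by
    have h3 := (((coeffTendsto_const (PowerSeries.X : L⟦X⟧)).mul
      (coeffTendsto_logUApprox (p := p) (L := L))) n).comp (tendsto_add_atTop_nat 1)
    rw [map_smul]
    refine (h3.const_smul (p : L)).congr fun N => ?_
    rw [Function.comp_apply, ← map_smul]
    beta_reduce
    have hp0 : (p : L) ≠ 0 := pL_ne_zero
    rw [X_mul_logUApprox, X_mul_logUApprox, map_smul (frob p L), map_sub (frob p L),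
      map_pow (frob p L), map_add (frob p L), map_one (frob p L), frob_X, phiX, add_sub_cancel,
      ← pow_mul, smul_smul, pow_succ' p N]
    congr 3
    rw [pow_succ]
    field_simp
  have h3 := h1.unique h2
  rwa [map_mul, frob_X] at h3

/-- A distribution of order `m` all of whose moments of degree `< m` vanish after multiplication by
`X ^ m` is a bounded measure times `(log (1 + X) / X) ^ m`. -/
theorem exists_bound_mul_logU_inv (p : ℕ) [Fact p.Prime] (L : Type) [NontriviallyNormedField L]
    [NormedAlgebra ℚ_[p] L] [IsUltrametricDist L] [CompleteSpace L] (m : ℕ) :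
    ∃ K : ℝ, 0 < K ∧ ∀ (D : L⟦X⟧) (C : ℝ), Growth m C D →
      (∀ (a : ℤ_[p]) (N : ℕ) (Q : Polynomial L), Q.natDegree < m →
        pair (PowerSeries.X ^ m * D) (box a N Q) = 0) →
      ∀ n, ‖coeff n (D * (logU L)⁻¹ ^ m)‖ ≤ K * C := by
  have hp0 := p_pos (p := p)
  obtain ⟨K, hK, hk⟩ := crNorm_le_of_killed p L (m : ℝ) (Nat.cast_nonneg m) (m + 1)
  refine ⟨K, hK, fun D C hD h0 n => ?_⟩
  have hm : (0 : ℝ) ≤ m := Nat.cast_nonneg m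
  have hC := hD.nonneg
  have hXD : Growth m C (PowerSeries.X ^ m * D) := by
    have : ∀ j : ℕ, Growth m C (PowerSeries.X ^ j * D) := fun j => by
      induction j with
      | zero => simpa using hD
      | succ j ih => rw [pow_succ', mul_assoc]; exact ih.X_mul hm
    exact this m
  let δ : ℕ → ℕ → L := fun N a =>
    pair (PowerSeries.X ^ m * D) (box (a : ℤ_[p]) N (newtonPoly L (a : ℤ_[p]) N m))
  have hδ : ∀ N a, ‖δ N a‖ ≤ C * (K * (p : ℝ) ^ ((N : ℝ) * m)) := fun N a => by
    refine (norm_pair_le hm hXD (isCr_box hm _ _ _)).trans ?_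
    gcongr
    have h1 := hk N (box (a : ℤ_[p]) N (newtonPoly L (a : ℤ_[p]) N m)) 1 zero_le_one (fun z => ?_)
      (fwdDiff_iter_box _ le_rfl (Nat.lt_succ_iff.2 (natDegree_newtonPoly_le _ _ _)))
    · rwa [mul_one] at h1
    · by_cases hz : (p : ℤ_[p]) ^ N ∣ z - a
      · obtain ⟨y, hy⟩ := hz
        rw [show z = a + (p : ℤ_[p]) ^ N * y by rw [← hy]; ring, box_newtonPoly]
        exact norm_bn_le _ _
      · rw [box, if_neg hz, norm_zero]
        exact zero_le_one
  let B : ℕ → L⟦X⟧ := fun N => ∑ a ∈ Finset.range (p ^ N),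
    ((p : L) ^ N) ^ m • δ N a • (1 + PowerSeries.X) ^ a
  have hB : ∀ N j, ‖coeff j (B N)‖ ≤ K * C := fun N j => by
    rw [map_sum]
    refine IsUltrametricDist.norm_sum_le_of_forall_le_of_nonneg (by positivity) fun a _ => ?_
    rw [map_smul, map_smul, smul_eq_mul, smul_eq_mul, norm_mul, norm_mul,
      coeff_one_add_X_pow (L := L), ← bn_natCast (p := p)]
    have h1 : ‖((p : L) ^ N) ^ m‖ * (p : ℝ) ^ ((N : ℝ) * m) = 1 := by
      rw [norm_pow, norm_pow, norm_pL, Real.rpow_mul hp0.le, Real.rpow_natCast, Real.rpow_natCast,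
        ← mul_pow, ← mul_pow, inv_mul_cancel₀ hp0.ne', one_pow, one_pow]
    calc _ ≤ ‖((p : L) ^ N) ^ m‖ * (C * (K * (p : ℝ) ^ ((N : ℝ) * m)) * 1) := by
          gcongr
          · exact hδ N a
          · exact norm_bn_le _ _
      _ = (‖((p : L) ^ N) ^ m‖ * (p : ℝ) ^ ((N : ℝ) * m)) * (K * C) := by ring
      _ = _ := by rw [h1, one_mul]
  have hlim : CoeffTendsto (fun N => logUApprox p L N ^ m * B N) D := fun j => by
    have h1 := tendsto_pair_interp hm hXD (isCr_bn (p := p) (L := L) hm (j + m)) (J := m)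
      (lt_add_one _)
    have e1 : pair (p := p) (PowerSeries.X ^ m * D) (bn L (j + m)) = coeff j D := by
      rw [pair_bn, PowerSeries.coeff_X_pow_mul]
    rw [e1] at h1
    refine h1.congr fun N => ?_
    have e2 : coeff j (logUApprox p L N ^ m * B N) =
        coeff (j + m) ((PowerSeries.X * logUApprox p L N) ^ m * B N) := by
      rw [mul_pow, mul_assoc, PowerSeries.coeff_X_pow_mul]
    rw [e2, X_mul_logUApprox, pair_interp hm hXD, smul_pow, Finset.mul_sum, map_sum]
    refine Finset.sum_congr rfl fun a _ => ?_
    rw [Finset.sum_range_succ, Finset.sum_eq_zero, zero_add]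
    · rw [smul_mul_assoc, mul_smul_comm, mul_smul_comm, smul_smul, map_smul, map_smul,
        mul_comm (((1 + PowerSeries.X : L⟦X⟧) ^ p ^ N - 1) ^ m), coeff_delta (p := p), smul_eq_mul,
        smul_eq_mul, inv_pow, inv_mul_cancel₀ (pow_ne_zero _ (pow_ne_zero _ pL_ne_zero)), one_mul,
        mul_comm]
    · intro i hi
      rw [h0 _ _ _ (lt_of_le_of_lt (natDegree_newtonPoly_le _ _ _) (Finset.mem_range.1 hi)), mul_zero]
  have hv : CoeffTendsto (fun N => (logU L)⁻¹ ^ m * logUApprox p L N ^ m - 1) 0 := by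
    have := ((coeffTendsto_const ((logU L)⁻¹ ^ m)).mul ((coeffTendsto_logUApprox (p := p)
      (L := L)).pow m)).sub (coeffTendsto_const 1)
    rwa [← mul_pow, mul_comm, logU_mul_inv, one_pow, sub_self] at this
  have hB' : CoeffTendsto B (D * (logU L)⁻¹ ^ m) := by
    have h1 := ((coeffTendsto_const ((logU L)⁻¹ ^ m)).mul hlim).sub (hv.mul_bounded hB)
    rw [sub_zero, mul_comm] at h1
    intro j
    refine (h1 j).congr fun N => ?_
    congr 1
    ring
  exact le_of_tendsto (hB' n).norm (Eventually.of_forall fun N => hB N n)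

end BoundedQuotient

section GaussNorm

open scoped PowerSeries
open PowerSeries (coeff)

variable {L : Type} [NontriviallyNormedField L] [IsUltrametricDist L]

/-- All coefficients of `f` have norm at most `C`. -/
def PSBound (C : ℝ) (f : L⟦X⟧) : Prop := ∀ n, ‖coeff n f‖ ≤ C

lemma PSBound.nonneg {C : ℝ} {f : L⟦X⟧} (h : PSBound C f) : 0 ≤ C := (norm_nonneg _).trans (h 0)

lemma PSBound.mono {C D : ℝ} {f : L⟦X⟧} (h : PSBound C f) (hCD : C ≤ D) : PSBound D f :=
  fun n => (h n).trans hCD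

lemma PSBound.add {C D : ℝ} {f g : L⟦X⟧} (hf : PSBound C f) (hg : PSBound D g) :
    PSBound (max C D) (f + g) := fun n => by
  rw [map_add]
  exact (IsUltrametricDist.norm_add_le_max _ _).trans (max_le_max (hf n) (hg n))

lemma PSBound.neg {C : ℝ} {f : L⟦X⟧} (hf : PSBound C f) : PSBound C (-f) := fun n => by
  rw [map_neg, norm_neg]; exact hf n

lemma PSBound.mul {C D : ℝ} {f g : L⟦X⟧} (hf : PSBound C f) (hg : PSBound D g) :
    PSBound (C * D) (f * g) := fun n => by
  rw [PowerSeries.coeff_mul]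
  refine IsUltrametricDist.norm_sum_le_of_forall_le_of_nonneg (mul_nonneg hf.nonneg hg.nonneg)
    fun ij _ => ?_
  rw [norm_mul]
  exact mul_le_mul (hf _) (hg _) (norm_nonneg _) hf.nonneg

lemma PSBound.smul {C : ℝ} {f : L⟦X⟧} (hf : PSBound C f) (c : L) : PSBound (‖c‖ * C) (c • f) :=
  fun n => by
    rw [map_smul, smul_eq_mul, norm_mul]
    exact mul_le_mul_of_nonneg_left (hf n) (norm_nonneg c)

lemma psBound_one : PSBound 1 (1 : L⟦X⟧) := fun n => by
  rw [PowerSeries.coeff_one]; split_ifs <;> simp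

lemma psBound_X : PSBound 1 (PowerSeries.X : L⟦X⟧) := fun n => by
  rw [PowerSeries.coeff_X]; split_ifs <;> simp

lemma norm_sum_lt {ι : Type*} {s : Finset ι} {f : ι → L} {c : ℝ} (hc : 0 < c)
    (h : ∀ i ∈ s, ‖f i‖ < c) : ‖∑ i ∈ s, f i‖ < c := by
  rcases s.eq_empty_or_nonempty with rfl | hs
  · simpa using hc
  · obtain ⟨i, hi, hle⟩ := IsUltrametricDist.exists_norm_finsetSum_le_of_nonempty hs f
    exact hle.trans_lt (h i hi)

/-- `f` is integral, with coefficient of index `n` the first one of norm one. -/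
structure Prim (f : L⟦X⟧) (n : ℕ) : Prop where
  bound : PSBound 1 f
  lt : ∀ i < n, ‖coeff i f‖ < 1
  eq : ‖coeff n f‖ = 1

lemma Prim.unique {f : L⟦X⟧} {n m : ℕ} {c : L} (hf : Prim f n) (hg : Prim (c • f) m) :
    n = m := by
  have hc : ‖c‖ = 1 := by
    have h1 := hg.bound n
    have h2 := hg.eq
    have h3 := hf.bound m
    rw [map_smul, smul_eq_mul, norm_mul] at h1 h2
    rw [hf.eq, mul_one] at h1
    refine le_antisymm h1 ?_
    rw [← h2]
    exact mul_le_of_le_one_right (norm_nonneg _) h3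
  rcases lt_trichotomy n m with h | h | h
  · have := hg.lt n h
    rw [map_smul, smul_eq_mul, norm_mul, hc, hf.eq] at this
    norm_num at this
  · exact h
  · have h1 := hf.lt m h
    have h2 := hg.eq
    rw [map_smul, smul_eq_mul, norm_mul, hc, one_mul] at h2
    exact absurd h2 h1.ne

lemma Prim.mul {f g : L⟦X⟧} {n m : ℕ} (hf : Prim f n) (hg : Prim g m) : Prim (f * g) (n + m) := by
  have key : ∀ i j : ℕ, i < n ∨ j < m → ‖coeff i f * coeff j g‖ < 1 := fun i j h => by
    rw [norm_mul]
    rcases h with h | h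
    · exact mul_lt_one_of_nonneg_of_lt_one_left (norm_nonneg _) (hf.lt i h) (hg.bound j)
    · exact mul_lt_one_of_nonneg_of_lt_one_right (hf.bound i) (norm_nonneg _) (hg.lt j h)
  refine ⟨by simpa using hf.bound.mul hg.bound, fun i hi => ?_, ?_⟩
  · rw [PowerSeries.coeff_mul]
    refine norm_sum_lt one_pos fun ij hij => key _ _ ?_
    rw [Finset.HasAntidiagonal.mem_antidiagonal] at hij
    omega
  · rw [PowerSeries.coeff_mul, ← Finset.add_sum_erase _ _
      (show (n, m) ∈ Finset.HasAntidiagonal.antidiagonal (n + m) by simp)]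
    have h1 : ‖coeff n f * coeff m g‖ = 1 := by rw [norm_mul, hf.eq, hg.eq, one_mul]
    have h2 : ‖∑ x ∈ (Finset.HasAntidiagonal.antidiagonal (n + m)).erase (n, m),
        coeff x.1 f * coeff x.2 g‖ < 1 := by
      refine norm_sum_lt one_pos fun ij hij => key _ _ ?_
      rw [Finset.mem_erase, Finset.HasAntidiagonal.mem_antidiagonal] at hij
      by_contra hcon
      push Not at hcon
      exact hij.1 (Prod.ext (by simp only; omega) (by simp only; omega))
    rw [IsUltrametricDist.norm_add_eq_max_of_norm_ne_norm (by simp only [h1]; exact h2.ne'), h1]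
    exact max_eq_left h2.le

lemma exists_lt_one_bound [ProperSpace L] :
    ∃ ρ : ℝ, 0 < ρ ∧ ρ < 1 ∧ ∀ x : L, ‖x‖ < 1 → ‖x‖ ≤ ρ := by
  have hK : IsCompact (Metric.ball (0 : L) 1) :=
    (isCompact_closedBall (0 : L) 1).of_isClosed_subset (IsUltrametricDist.isClosed_ball 0 1)
      Metric.ball_subset_closedBall
  obtain ⟨x, hx, hmax⟩ := hK.exists_isMaxOn ⟨0, Metric.mem_ball_self one_pos⟩
    continuous_norm.continuousOn
  obtain ⟨y, hy0, hy1⟩ := NormedField.exists_norm_lt_one L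
  have hm : ∀ z : L, ‖z‖ < 1 → ‖z‖ ≤ ‖x‖ := fun z hz => hmax (by simpa using hz)
  exact ⟨‖x‖, hy0.trans_le (hm y hy1), by simpa using hx, hm⟩

lemma exists_prim [ProperSpace L] {f : L⟦X⟧} {C : ℝ} (hf : PSBound C f) (h0 : f ≠ 0) :
    ∃ (c : L) (n : ℕ), c ≠ 0 ∧ Prim (c • f) n ∧ coeff n f ≠ 0 := by
  obtain ⟨ρ, hρ0, hρ1, hρ⟩ := exists_lt_one_bound (L := L)
  have hbdd : BddAbove (Set.range fun n => ‖coeff n f‖) := ⟨C, by rintro _ ⟨n, rfl⟩; exact hf n⟩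
  obtain ⟨n0, hn0⟩ : ∃ n, coeff n f ≠ 0 := by
    by_contra hcon
    push Not at hcon
    exact h0 (PowerSeries.ext fun n => by simpa using hcon n)
  set s := ⨆ n, ‖coeff n f‖ with hs
  have hle : ∀ n, ‖coeff n f‖ ≤ s := fun n => le_ciSup hbdd n
  have hs0 : 0 < s := (norm_pos_iff.2 hn0).trans_le (hle n0)
  obtain ⟨n1, hn1⟩ := exists_lt_of_lt_ciSup (show ρ * s < ⨆ n, ‖coeff n f‖ from
    mul_lt_of_lt_one_left hs0 hρ1)
  have hn1' : 0 < ‖coeff n1 f‖ := (mul_pos hρ0 hs0).trans hn1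
  have hmax : ∀ m, ‖coeff m f‖ ≤ ‖coeff n1 f‖ := fun m => by
    by_contra hcon
    push Not at hcon
    have hm0 : 0 < ‖coeff m f‖ := hn1'.trans hcon
    have h1 := hρ (coeff n1 f / coeff m f) (by rwa [norm_div, div_lt_one hm0])
    rw [norm_div, div_le_iff₀ hm0] at h1
    exact absurd (hn1.trans_le (h1.trans (mul_le_mul_of_nonneg_left (hle m) hρ0.le))) (lt_irrefl _)
  have hc : (coeff n1 f)⁻¹ ≠ 0 := inv_ne_zero (norm_pos_iff.1 hn1')
  have hex : ∃ n, ‖coeff n ((coeff n1 f)⁻¹ • f)‖ = 1 := ⟨n1, by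
    rw [map_smul, smul_eq_mul, inv_mul_cancel₀ (norm_pos_iff.1 hn1'), norm_one]⟩
  have hb : PSBound 1 ((coeff n1 f)⁻¹ • f) := fun m => by
    rw [map_smul, smul_eq_mul, norm_mul, norm_inv, inv_mul_le_one₀ hn1']
    exact hmax m
  refine ⟨(coeff n1 f)⁻¹, Nat.find hex, hc,
    ⟨hb, fun i hi => lt_of_le_of_ne (hb i) (Nat.find_min hex hi), Nat.find_spec hex⟩, fun hz => ?_⟩
  have := Nat.find_spec hex
  rw [map_smul, hz, smul_zero, norm_zero] at this
  exact zero_ne_one this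

lemma psBound_inv {u : L⟦X⟧} (hu : PSBound 1 u) (h0 : ‖PowerSeries.constantCoeff u‖ = 1) :
    PSBound 1 u⁻¹ := fun n => by
  induction n using Nat.strong_induction_on with
  | _ n ih =>
    rw [PowerSeries.coeff_inv]
    split_ifs with hn
    · rw [norm_inv, h0, inv_one]
    · rw [norm_mul, norm_neg, norm_inv, h0, inv_one, one_mul]
      refine IsUltrametricDist.norm_sum_le_of_forall_le_of_nonneg zero_le_one fun ij _ => ?_
      split_ifs with hlt
      · rw [norm_mul]
        exact mul_le_one₀ (hu _) (norm_nonneg _) (ih _ hlt)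
      · simp

end GaussNorm

section WeierstrassDivision

open scoped PowerSeries
open PowerSeries (coeff)

variable {L : Type} [NontriviallyNormedField L] [IsUltrametricDist L]

lemma CoeffTendsto.add {L : Type} [NontriviallyNormedField L] {w v : ℕ → L⟦X⟧} {w' v' : L⟦X⟧}
    (hw : CoeffTendsto w w') (hv : CoeffTendsto v v') :
    CoeffTendsto (fun N => w N + v N) (w' + v') := fun n => by
  simp only [map_add]
  exact (hw n).add (hv n)

lemma PSBound.sum {C : ℝ} (hC : 0 ≤ C) {ι : Type*} {s : Finset ι} {f : ι → L⟦X⟧}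
    (hf : ∀ i ∈ s, PSBound C (f i)) : PSBound C (∑ i ∈ s, f i) := fun n => by
  rw [map_sum]
  exact IsUltrametricDist.norm_sum_le_of_forall_le_of_nonneg hC fun i hi => hf i hi n

lemma exists_coeffTendsto_sum [CompleteSpace L] {ρ : ℝ} (h0 : 0 ≤ ρ) (h1 : ρ < 1) {f : ℕ → L⟦X⟧}
    (hf : ∀ k, PSBound (ρ ^ k) (f k)) :
    ∃ w, CoeffTendsto (fun K => ∑ k ∈ Finset.range K, f k) w ∧ PSBound 1 w := by
  have hs : ∀ n, Summable fun k => coeff n (f k) := fun n =>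
    Summable.of_norm_bounded (summable_geometric_of_lt_one h0 h1) fun k => hf k n
  have ht : CoeffTendsto (fun K => ∑ k ∈ Finset.range K, f k)
      (PowerSeries.mk fun n => ∑' k, coeff n (f k)) := fun n => by
    rw [PowerSeries.coeff_mk]
    simpa only [map_sum] using (hs n).hasSum.tendsto_sum_nat
  refine ⟨_, ht, fun n => le_of_tendsto (ht n).norm (Eventually.of_forall fun K => ?_)⟩
  exact PSBound.sum zero_le_one (fun k _ => (hf k).mono (pow_le_one₀ h0 h1.le)) n

/-- The part of `f` of degree `< n`. -/
def lowPart (n : ℕ) (f : L⟦X⟧) : L⟦X⟧ := PowerSeries.mk fun i => if i < n then coeff i f else 0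

/-- The quotient of the remaining part by `X ^ n`. -/
def highPart (n : ℕ) (f : L⟦X⟧) : L⟦X⟧ := PowerSeries.mk fun i => coeff (i + n) f

lemma lowPart_add_highPart (n : ℕ) (f : L⟦X⟧) :
    lowPart n f + PowerSeries.X ^ n * highPart n f = f := by
  ext i
  rw [map_add, PowerSeries.coeff_X_pow_mul', lowPart, highPart, PowerSeries.coeff_mk]
  by_cases h : i < n
  · rw [if_pos h, if_neg (by omega), add_zero]
  · rw [if_neg h, if_pos (by omega), zero_add, PowerSeries.coeff_mk, Nat.sub_add_cancel (by omega)]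

lemma PSBound.lowPart {C : ℝ} {f : L⟦X⟧} (hf : PSBound C f) (n : ℕ) : PSBound C (lowPart n f) :=
  fun i => by
    rw [Paper.lowPart, PowerSeries.coeff_mk]
    split_ifs
    · exact hf i
    · simpa using hf.nonneg

lemma PSBound.highPart {C : ℝ} {f : L⟦X⟧} (hf : PSBound C f) (n : ℕ) :
    PSBound C (highPart n f) := fun i => by
  rw [Paper.highPart, PowerSeries.coeff_mk]
  exact hf _

theorem Prim.division [ProperSpace L] {g : L⟦X⟧} {n : ℕ} (hg : Prim g n) {x : L⟦X⟧}
    (hx : PSBound 1 x) : ∃ Q R : L⟦X⟧, PSBound 1 Q ∧ PSBound 1 R ∧ (∀ i, n ≤ i → coeff i R = 0) ∧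
      x = Q * g + R := by
  obtain ⟨ρ, hρ0, hρ1, hρ⟩ := exists_lt_one_bound (L := L)
  set u := highPart n g with hu
  have hu0 : ‖PowerSeries.constantCoeff u‖ = 1 := by
    rw [← PowerSeries.coeff_zero_eq_constantCoeff_apply, hu, highPart, PowerSeries.coeff_mk,
      zero_add, hg.eq]
  have hui : PSBound 1 u⁻¹ := psBound_inv (hg.bound.highPart n) hu0
  have huu : u⁻¹ * u = 1 := PowerSeries.inv_mul_cancel _ (by
    rw [← norm_ne_zero_iff, hu0]; exact one_ne_zero)
  have hlow : PSBound ρ (lowPart n g) := fun i => by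
    rw [lowPart, PowerSeries.coeff_mk]
    split_ifs with h
    · exact hρ _ (hg.lt i h)
    · simpa using hρ0.le
  let step : L⟦X⟧ → L⟦X⟧ := fun y => -(u⁻¹ * highPart n y * lowPart n g)
  let xs : ℕ → L⟦X⟧ := fun k => step^[k] x
  have hxs : ∀ k, PSBound (ρ ^ k) (xs k) := fun k => by
    induction k with
    | zero => simpa [xs] using hx
    | succ k ih =>
      have : xs (k + 1) = step (xs k) := Function.iterate_succ_apply' _ _ _
      rw [this]
      have h1 := ((hui.mul (ih.highPart n)).mul hlow).neg
      rwa [one_mul, ← pow_succ] at h1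
  have hstep : ∀ y : L⟦X⟧, y = u⁻¹ * highPart n y * g + lowPart n y + step y := fun y => by
    have e1 := lowPart_add_highPart n y
    have e2 := lowPart_add_highPart n g
    rw [← hu] at e2
    have : step y = -(u⁻¹ * highPart n y * lowPart n g) := rfl
    rw [this]
    linear_combination (-1 : L⟦X⟧) * e1 + u⁻¹ * highPart n y * e2 -
      PowerSeries.X ^ n * highPart n y * huu
  obtain ⟨Q, hQ, hQb⟩ := exists_coeffTendsto_sum hρ0.le hρ1 (f := fun k => u⁻¹ * highPart n (xs k))
    (fun k => by simpa using hui.mul ((hxs k).highPart n))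
  obtain ⟨R, hR, hRb⟩ := exists_coeffTendsto_sum hρ0.le hρ1 (f := fun k => lowPart n (xs k))
    (fun k => (hxs k).lowPart n)
  refine ⟨Q, R, hQb, hRb, fun i hi => ?_, ?_⟩
  · refine tendsto_nhds_unique (hR i) ?_
    refine tendsto_const_nhds.congr fun K => ?_
    rw [map_sum, eq_comm]
    refine Finset.sum_eq_zero fun k _ => ?_
    rw [lowPart, PowerSeries.coeff_mk, if_neg (by omega)]
  · have hpart : ∀ K, x = (∑ k ∈ Finset.range K, u⁻¹ * highPart n (xs k)) * g +
        ∑ k ∈ Finset.range K, lowPart n (xs k) + xs K := fun K => by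
      induction K with
      | zero => simp [xs]
      | succ K ih =>
        have h1 := hstep (xs K)
        have : xs (K + 1) = step (xs K) := Function.iterate_succ_apply' _ _ _
        rw [Finset.sum_range_succ, Finset.sum_range_succ, this]
        linear_combination ih + h1
    have hx0 : CoeffTendsto xs 0 := fun i => by
      rw [map_zero]
      exact squeeze_zero_norm (fun k => hxs k i) (tendsto_pow_atTop_nhds_zero_of_lt_one hρ0.le hρ1)
    have := ((hQ.mul (coeffTendsto_const g)).add hR).add hx0
    rw [add_zero] at this
    refine CoeffTendsto.unique (w := fun _ => x) (coeffTendsto_const x) fun i => ?_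
    refine (this i).congr fun K => ?_
    exact congrArg (coeff i) (hpart K).symm

end WeierstrassDivision

section FrobeniusIdeal

open scoped PowerSeries
open PowerSeries (coeff)

/-- The subring of bounded power series. -/
def bps (L : Type) [NontriviallyNormedField L] [IsUltrametricDist L] : Subring L⟦X⟧ where
  carrier := {f | ∃ C, PSBound C f}
  mul_mem' := fun ⟨_, ha⟩ ⟨_, hb⟩ => ⟨_, ha.mul hb⟩
  one_mem' := ⟨1, psBound_one⟩
  add_mem' := fun ⟨_, ha⟩ ⟨_, hb⟩ => ⟨_, ha.add hb⟩
  zero_mem' := ⟨0, fun n => by simp⟩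
  neg_mem' := fun ⟨_, ha⟩ => ⟨_, ha.neg⟩

variable {p : ℕ} [hp : Fact p.Prime]
variable {L : Type} [NontriviallyNormedField L] [NormedAlgebra ℚ_[p] L] [IsUltrametricDist L]
  [CompleteSpace L]

/-- The power series `φ(X) / X`. -/
def qX (p : ℕ) (L : Type) [NontriviallyNormedField L] : L⟦X⟧ := highPart 1 (phiX p L)

lemma X_mul_qX (p : ℕ) (L : Type) [NontriviallyNormedField L] [IsUltrametricDist L] :
    PowerSeries.X * qX p L = phiX p L := by
  have h := lowPart_add_highPart 1 (phiX p L)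
  rw [pow_one] at h
  have h0 : lowPart 1 (phiX p L) = 0 := by
    ext i
    rw [lowPart, PowerSeries.coeff_mk, map_zero]
    split_ifs with hi
    · obtain rfl : i = 0 := by omega
      rw [PowerSeries.coeff_zero_eq_constantCoeff_apply, constantCoeff_phiX]
    · rfl
  rwa [h0, zero_add] at h

lemma psBound_phiX_pow (i : ℕ) : PSBound 1 (phiX p L ^ i) := fun n => norm_coeff_phiX_pow_le i n

lemma PSBound.frob {C : ℝ} {f : L⟦X⟧} (hf : PSBound C f) : PSBound C (frob p L f) := fun n => by
  rw [coeff_frob p L f (Nat.lt_succ_self n)]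
  refine IsUltrametricDist.norm_sum_le_of_forall_le_of_nonneg hf.nonneg fun i _ => ?_
  rw [norm_mul]
  simpa using mul_le_mul (hf i) (norm_coeff_phiX_pow_le (p := p) i n) (norm_nonneg _) hf.nonneg

lemma norm_natCast_le_one (n : ℕ) : ‖(n : L)‖ ≤ 1 := by
  have := IsUltrametricDist.norm_natCast_le_one L n
  exact this

lemma prim_phiX : Prim (phiX p L) p := by
  have hb : PSBound 1 (phiX p L) := by simpa using psBound_phiX_pow (p := p) (L := L) 1
  have hco : ∀ i, i ≠ 0 → coeff i (phiX p L) = (p.choose i : L) := fun i hi => by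
    rw [phiX, map_sub, PowerSeries.coeff_one, if_neg hi, sub_zero]
    exact coeff_one_add_X_pow p i
  refine ⟨hb, fun i hi => ?_, ?_⟩
  · rcases Nat.eq_zero_or_pos i with rfl | h0
    · rw [PowerSeries.coeff_zero_eq_constantCoeff_apply, constantCoeff_phiX, norm_zero]
      exact one_pos
    · rw [hco i h0.ne']
      obtain ⟨c, hc⟩ := hp.out.dvd_choose_self h0.ne' hi
      rw [hc, Nat.cast_mul, norm_mul, norm_pL]
      refine mul_lt_one_of_nonneg_of_lt_one_left (by positivity) ?_ (norm_natCast_le_one c)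
      exact inv_lt_one_of_one_lt₀ one_lt_p
  · rw [hco p hp.out.ne_zero, Nat.choose_self, Nat.cast_one, norm_one]

lemma prim_phiX_pow (i : ℕ) : Prim (phiX p L ^ i) (p * i) := by
  induction i with
  | zero => rw [pow_zero, mul_zero]; exact ⟨psBound_one, fun i hi => absurd hi (by omega), by simp⟩
  | succ i ih => rw [pow_succ, mul_add, mul_one]; exact ih.mul prim_phiX

lemma Prim.frob {g : L⟦X⟧} {n : ℕ} (hg : Prim g n) : Prim (frob p L g) (p * n) := by
  have key : ∀ i N : ℕ, (i < n ∨ N < p * i) → ‖coeff i g * coeff N (phiX p L ^ i)‖ < 1 :=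
    fun i N h => by
      rw [norm_mul]
      rcases h with h | h
      · exact mul_lt_one_of_nonneg_of_lt_one_left (norm_nonneg _) (hg.lt i h)
          (norm_coeff_phiX_pow_le i N)
      · exact mul_lt_one_of_nonneg_of_lt_one_right (hg.bound i) (norm_nonneg _)
          ((prim_phiX_pow i).lt N h)
  have hp0 := hp.out.pos
  refine ⟨hg.bound.frob, fun N hN => ?_, ?_⟩
  · rw [coeff_frob p L g (Nat.lt_succ_self N)]
    refine norm_sum_lt one_pos fun i _ => key i N ?_
    by_cases h : i < n
    · exact Or.inl h
    · exact Or.inr (hN.trans_le (Nat.mul_le_mul_left p (not_lt.1 h)))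
  · have hn : n ∈ Finset.range (p * n + 1) := by
      rw [Finset.mem_range]; exact Nat.lt_succ_of_le (Nat.le_mul_of_pos_left n hp0)
    rw [coeff_frob p L g (Nat.lt_succ_self (p * n)), ← Finset.add_sum_erase _ _ hn]
    have h1 : ‖coeff n g * coeff (p * n) (phiX p L ^ n)‖ = 1 := by
      rw [norm_mul, hg.eq, (prim_phiX_pow n).eq, one_mul]
    have h2 : ‖∑ i ∈ (Finset.range (p * n + 1)).erase n,
        coeff i g * coeff (p * n) (phiX p L ^ i)‖ < 1 := by
      refine norm_sum_lt one_pos fun i hi => key i _ ?_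
      rcases lt_trichotomy i n with h | h | h
      · exact Or.inl h
      · exact absurd h (Finset.mem_erase.1 hi).1
      · exact Or.inr (Nat.mul_lt_mul_of_pos_left h hp0)
    rw [IsUltrametricDist.norm_add_eq_max_of_norm_ne_norm (by rw [h1]; exact h2.ne'), h1]
    exact max_eq_left h2.le

lemma qX_ne_zero : qX p L ≠ 0 := fun h => by
  have h1 := X_mul_qX p L
  rw [h, mul_zero] at h1
  have h2 := (prim_phiX (p := p) (L := L)).eq
  rw [← h1, map_zero, norm_zero] at h2
  exact zero_ne_one h2

lemma psBound_qX : PSBound 1 (qX p L) := by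
  have := psBound_phiX_pow (p := p) (L := L) 1
  rw [pow_one] at this
  exact this.highPart 1

lemma psBound_qX_pow (m : ℕ) : PSBound 1 (qX p L ^ m) := by
  induction m with
  | zero => simpa using psBound_one (L := L)
  | succ m ih => simpa [pow_succ] using ih.mul psBound_qX

/-- Powers of `φ(X) / X` cancel against `φ(g)` when `g(0) ≠ 0`. -/
lemma exists_eq_frob_mul {g : L⟦X⟧} {C : ℝ} (hg : PSBound C g)
    (h0 : PowerSeries.constantCoeff g ≠ 0) (m : ℕ) {F H : L⟦X⟧} {D E : ℝ} (hF : PSBound D F)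
    (hH : PSBound E H) (h : qX p L ^ m * F = frob p L g * H) :
    ∃ H' : L⟦X⟧, (∃ E', PSBound E' H') ∧ F = frob p L g * H' := by
  induction m generalizing H E with
  | zero => exact ⟨H, ⟨E, hH⟩, by simpa using h⟩
  | succ m ih =>
    set g0 := PowerSeries.constantCoeff g with hg0
    set b := highPart 1 g with hb
    have hgb : g = PowerSeries.C g0 + PowerSeries.X * b := by
      have h1 := lowPart_add_highPart 1 g
      rw [pow_one] at h1
      rw [← h1]
      congr 1
      ext i
      rw [lowPart, PowerSeries.coeff_mk, PowerSeries.coeff_C, hg0,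
        ← PowerSeries.coeff_zero_eq_constantCoeff_apply]
      rcases Nat.eq_zero_or_pos i with rfl | hi
      · simp
      · rw [if_neg (by omega), if_neg (by omega)]
    have hfg : frob p L g = PowerSeries.C g0 + PowerSeries.X * qX p L * frob p L b := by
      rw [hgb, map_add, map_mul, frob_X, X_mul_qX]
      congr 1
      exact (frob p L).commutes g0
    have hcc : PowerSeries.C g0⁻¹ * PowerSeries.C g0 = (1 : L⟦X⟧) := by
      rw [← map_mul, inv_mul_cancel₀ h0, map_one]
    set H1 : L⟦X⟧ := g0⁻¹ • (qX p L ^ m * F + -(PowerSeries.X * frob p L b * H)) with hH1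
    have hqm := psBound_qX_pow (p := p) (L := L) m
    have hHH : H = qX p L * H1 := by
      rw [hH1, PowerSeries.smul_eq_C_mul]
      rw [hfg] at h
      linear_combination (-H) * hcc - PowerSeries.C g0⁻¹ * h
    have hHb := ((hqm.mul hF).add ((psBound_X.mul ((hg.highPart 1).frob (p := p))).mul hH).neg).smul
      g0⁻¹
    refine ih (H := H1) hHb ?_
    · refine mul_left_cancel₀ (qX_ne_zero (p := p) (L := L)) ?_
      rw [hHH] at h
      linear_combination h

theorem one_mem_of_frob [ProperSpace L] (I : Submodule (bps L) L⟦X⟧)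
    (hI : ∀ x ∈ I, ∃ C, PSBound C x) (h0 : ∃ x ∈ I, PowerSeries.constantCoeff x ≠ 0) (m : ℕ)
    (hφ : ∀ x ∈ I, qX p L ^ m * x ∈ Submodule.span (bps L) (frob p L '' (I : Set L⟦X⟧))) :
    1 ∈ I := by
  have hmul : ∀ (b x : L⟦X⟧) (C : ℝ), PSBound C b → x ∈ I → b * x ∈ I := fun b x C hb hx =>
    I.smul_mem (⟨b, C, hb⟩ : bps L) hx
  have hsmul : ∀ (c : L) (x : L⟦X⟧), x ∈ I → c • x ∈ I := fun c x hx => by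
    have := hmul (c • 1) x _ (psBound_one.smul c) hx
    rwa [smul_mul_assoc, one_mul] at this
  have hex : ∃ n, ∃ g ∈ I, Prim g n := by
    obtain ⟨x, hx, hx0⟩ := h0
    obtain ⟨C, hC⟩ := hI x hx
    obtain ⟨c, n, -, hp, -⟩ := exists_prim hC (fun h => hx0 (by rw [h, map_zero]))
    exact ⟨n, _, hsmul c x hx, hp⟩
  set n := Nat.find hex with hn
  obtain ⟨g, hgI, hg⟩ := Nat.find_spec hex
  rw [← hn] at hg
  have hgen : ∀ x ∈ I, ∃ b : L⟦X⟧, (∃ C, PSBound C b) ∧ x = b * g := by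
    have main : ∀ x ∈ I, PSBound 1 x → ∃ b : L⟦X⟧, (∃ C, PSBound C b) ∧ x = b * g :=
      fun x hx hx1 => by
        obtain ⟨Q, R, hQ, hR, hRn, hxe⟩ := hg.division hx1
        refine ⟨Q, ⟨1, hQ⟩, ?_⟩
        by_cases hR0 : R = 0
        · rw [hxe, hR0, add_zero]
        · exfalso
          have hRI : R ∈ I := by
            have : R = x - Q * g := by rw [hxe]; ring
            rw [this]
            exact I.sub_mem hx (hmul Q g 1 hQ hgI)
          obtain ⟨c, i, -, hp, hi⟩ := exists_prim hR hR0
          have h1 : Nat.find hex ≤ i := Nat.find_min' hex ⟨_, hsmul c R hRI, hp⟩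
          exact hi (hRn i h1)
    intro x hx
    by_cases hx0 : x = 0
    · exact ⟨0, ⟨0, fun n => by simp⟩, by rw [hx0, zero_mul]⟩
    obtain ⟨C, hC⟩ := hI x hx
    obtain ⟨c, i, hc, hp, -⟩ := exists_prim hC hx0
    obtain ⟨b, ⟨D, hb⟩, he⟩ := main _ (hsmul c x hx) hp.bound
    refine ⟨c⁻¹ • b, ⟨_, hb.smul c⁻¹⟩, ?_⟩
    rw [smul_mul_assoc, ← he, smul_smul, inv_mul_cancel₀ hc, one_smul]
  have hg0 : PowerSeries.constantCoeff g ≠ 0 := by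
    obtain ⟨x, hx, hx0⟩ := h0
    obtain ⟨b, -, rfl⟩ := hgen x hx
    rw [map_mul] at hx0
    exact right_ne_zero_of_mul hx0
  obtain ⟨H, hH, hHe⟩ : ∃ H : L⟦X⟧, (∃ E, PSBound E H) ∧ qX p L ^ m * g = frob p L g * H := by
    have hspan : ∀ y ∈ Submodule.span (bps L) (frob p L '' (I : Set L⟦X⟧)),
        ∃ H : L⟦X⟧, (∃ E, PSBound E H) ∧ y = frob p L g * H := fun y hy => by
      induction hy using Submodule.span_induction with
      | mem y hy =>
        obtain ⟨x, hx, rfl⟩ := hy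
        obtain ⟨b, ⟨D, hb⟩, rfl⟩ := hgen x hx
        exact ⟨frob p L b, ⟨D, hb.frob⟩, by rw [map_mul, mul_comm]⟩
      | zero => exact ⟨0, ⟨0, fun n => by simp⟩, by rw [mul_zero]⟩
      | add y z _ _ hy hz =>
        obtain ⟨H, ⟨E, hE⟩, rfl⟩ := hy
        obtain ⟨H', ⟨E', hE'⟩, rfl⟩ := hz
        exact ⟨H + H', ⟨_, hE.add hE'⟩, by rw [mul_add]⟩
      | smul c y _ hy =>
        obtain ⟨H, ⟨E, hE⟩, rfl⟩ := hy
        obtain ⟨D, hD⟩ := c.2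
        exact ⟨(c : L⟦X⟧) * H, ⟨_, hD.mul hE⟩, by rw [Subring.smul_def, smul_eq_mul]; ring⟩
    exact hspan _ (hφ g hgI)
  obtain ⟨E, hE⟩ := hH
  obtain ⟨H', ⟨E', hH'⟩, hge⟩ := exists_eq_frob_mul hg.bound hg0 m hg.bound hE hHe
  have hH0 : H' ≠ 0 := fun h => hg0 (by rw [hge, h, mul_zero, map_zero])
  obtain ⟨c, i, hc, hpr, -⟩ := exists_prim hH' hH0
  have h1 : Prim (c • g) (p * n + i) := by
    rw [hge, ← mul_smul_comm]
    exact hg.frob.mul hpr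
  have h2 := hg.unique h1
  have h3 : n = 0 := by
    have := hp.out.two_le
    nlinarith
  rw [h3] at hg
  have hgu : g⁻¹ * g = 1 := PowerSeries.inv_mul_cancel _ hg0
  rw [← hgu]
  exact hmul _ _ 1 (psBound_inv hg.bound (by
    rw [← PowerSeries.coeff_zero_eq_constantCoeff_apply]; exact hg.eq)) hgI

end FrobeniusIdeal

section Balls

open Polynomial

variable {p : ℕ} [hp : Fact p.Prime]
variable {L : Type} [NontriviallyNormedField L] [NormedAlgebra ℚ_[p] L]

lemma padic_norm_eq {x : ℚ_[p]} (hx : x ≠ 0) : ‖x‖ = (p : ℝ) ^ (-x.valuation) :=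
  Padic.norm_eq_zpow_neg_valuation hx

lemma valuation_eq_of_norm_eq {x y : ℚ_[p]} (h : ‖x‖ = ‖y‖) : x.valuation = y.valuation := by
  by_cases hx : x = 0
  · have hy : y = 0 := by rw [hx, norm_zero, eq_comm, norm_eq_zero] at h; exact h
    rw [hx, hy]
  · have hy : y ≠ 0 := by
      intro hy; rw [hy, norm_zero, norm_eq_zero] at h; exact hx h
    rw [padic_norm_eq hx, padic_norm_eq hy] at h
    have := zpow_right_injective₀ (by exact_mod_cast hp.out.pos) (one_lt_p (p := p)).ne' h
    simpa using this

lemma padic_norm_le_iff {x : ℚ_[p]} (hx : x ≠ 0) {n : ℤ} :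
    ‖x‖ ≤ (p : ℝ) ^ (-n) ↔ n ≤ x.valuation := by
  rw [padic_norm_eq hx, zpow_le_zpow_iff_right₀ one_lt_p, neg_le_neg_iff]

lemma valuation_shell {x : ℚ_[p]} {n : ℤ} (h1 : ‖x‖ ≤ (p : ℝ) ^ (-n))
    (h2 : ¬ ‖x‖ ≤ (p : ℝ) ^ (-(n + 1))) : x.valuation = n := by
  have hx : x ≠ 0 := by
    rintro rfl
    refine h2 ?_
    rw [norm_zero]
    exact zpow_nonneg (by positivity) _
  rw [padic_norm_le_iff hx] at h1 h2
  omega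

lemma padic_norm_sub_le {x y z : ℚ_[p]} {c : ℝ} (h1 : ‖x - y‖ ≤ c) (h2 : ‖y - z‖ ≤ c) :
    ‖x - z‖ ≤ c := by
  rw [← sub_add_sub_cancel x y z]
  exact (Padic.nonarchimedean _ _).trans (max_le h1 h2)

lemma padic_norm_natCast_le (c : ℕ) : ‖(c : ℚ_[p])‖ ≤ 1 := by
  have := PadicInt.norm_le_one (c : ℤ_[p])
  rwa [PadicInt.norm_def, PadicInt.coe_natCast] at this

lemma padic_norm_sub_le_iff {b b' z : ℚ_[p]} {c : ℝ} (h : ‖b - b'‖ ≤ c) :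
    ‖z - b‖ ≤ c ↔ ‖z - b'‖ ≤ c :=
  ⟨fun h1 => padic_norm_sub_le h1 h, fun h1 => padic_norm_sub_le h1 (by rwa [norm_sub_rev])⟩

lemma padic_norm_sub_eq {b b' z : ℚ_[p]} {c : ℝ} (h : ‖b - b'‖ ≤ c) (hz : ¬ ‖z - b‖ ≤ c) :
    ‖z - b‖ = ‖z - b'‖ := by
  rw [← sub_add_sub_cancel z b b', Padic.add_eq_max_of_ne (by
    intro he; rw [he] at hz; exact hz h), max_eq_left]
  exact h.trans (not_le.1 hz).le

/-- The function `1_{b + p^n ℤ_p} Q`. -/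
def bE (b : ℚ_[p]) (n : ℤ) : L[X] →ₗ[L] (ℚ_[p] → L) where
  toFun Q := fun z => if ‖z - b‖ ≤ (p : ℝ) ^ (-n) then Q.eval (iotaL p L z) else 0
  map_add' Q R := by
    funext z
    simp only [Pi.add_apply, eval_add]
    split_ifs <;> simp
  map_smul' c Q := by
    funext z
    simp only [Pi.smul_apply, eval_smul, RingHom.id_apply]
    split_ifs <;> simp

/-- The function `ρ^{val (z - b)} Q(z)` restricted to the complement of `b + p^n ℤ_p`. -/
def bH (ρ : L) (b : ℚ_[p]) (n : ℤ) : L[X] →ₗ[L] (ℚ_[p] → L) where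
  toFun Q := fun z => if ‖z - b‖ ≤ (p : ℝ) ^ (-n) then 0 else
    ρ ^ (z - b).valuation * Q.eval (iotaL p L z)
  map_add' Q R := by
    funext z
    simp only [Pi.add_apply, eval_add]
    split_ifs <;> simp [mul_add]
  map_smul' c Q := by
    funext z
    simp only [Pi.smul_apply, eval_smul, RingHom.id_apply, smul_eq_mul]
    split_ifs
    · simp
    · ring

lemma bE_apply (b : ℚ_[p]) (n : ℤ) (Q : L[X]) (z : ℚ_[p]) :
    bE b n Q z = if ‖z - b‖ ≤ (p : ℝ) ^ (-n) then Q.eval (iotaL p L z) else 0 := rfl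

lemma bH_apply (ρ : L) (b : ℚ_[p]) (n : ℤ) (Q : L[X]) (z : ℚ_[p]) :
    bH ρ b n Q z = if ‖z - b‖ ≤ (p : ℝ) ^ (-n) then 0 else
      ρ ^ (z - b).valuation * Q.eval (iotaL p L z) := rfl

lemma bE_congr {b b' : ℚ_[p]} {n : ℤ} (h : ‖b - b'‖ ≤ (p : ℝ) ^ (-n)) (Q : L[X]) :
    bE b n Q = bE b' n Q := by
  funext z
  simp only [bE_apply, padic_norm_sub_le_iff h]

lemma bH_congr (ρ : L) {b b' : ℚ_[p]} {n : ℤ} (h : ‖b - b'‖ ≤ (p : ℝ) ^ (-n)) (Q : L[X]) :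
    bH ρ b n Q = bH ρ b' n Q := by
  funext z
  simp only [bH_apply]
  by_cases hz : ‖z - b‖ ≤ (p : ℝ) ^ (-n)
  · rw [if_pos hz, if_pos ((padic_norm_sub_le_iff h).1 hz)]
  · rw [if_neg hz, if_neg (fun h' => hz ((padic_norm_sub_le_iff h).2 h')),
      valuation_eq_of_norm_eq (padic_norm_sub_eq h hz)]

lemma bH_succ (ρ : L) (b : ℚ_[p]) (n : ℤ) (Q : L[X]) :
    bH ρ b (n + 1) Q = bH ρ b n Q + ρ ^ n • (bE b n Q - bE b (n + 1) Q) := by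
  funext z
  simp only [bH_apply, bE_apply, Pi.add_apply, Pi.smul_apply, Pi.sub_apply, smul_eq_mul]
  by_cases h1 : ‖z - b‖ ≤ (p : ℝ) ^ (-n)
  · by_cases h2 : ‖z - b‖ ≤ (p : ℝ) ^ (-(n + 1))
    · rw [if_pos h1, if_pos h1, if_pos h2, if_pos h2]; ring
    · rw [if_pos h1, if_pos h1, if_neg h2, if_neg h2, valuation_shell h1 h2]; ring
  · have h2 : ¬ ‖z - b‖ ≤ (p : ℝ) ^ (-(n + 1)) := fun h => h1 (h.trans
      (zpow_le_zpow_right₀ one_lt_p.le (by omega)))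
    rw [if_neg h1, if_neg h1, if_neg h2, if_neg h2]; ring

lemma norm_mul_p_zpow_le {y : ℚ_[p]} {n m : ℤ} :
    ‖y * (p : ℚ_[p]) ^ n‖ ≤ (p : ℝ) ^ (-(n + m)) ↔ ‖y‖ ≤ (p : ℝ) ^ (-m) := by
  rw [norm_mul, Padic.norm_p_zpow, show -(n + m) = -m + -n by ring, zpow_add₀ p_pos.ne']
  exact mul_le_mul_iff_left₀ (zpow_pos p_pos _)

lemma bE_split (b : ℚ_[p]) (n : ℤ) (Q : L[X]) :
    bE b n Q = ∑ c ∈ Finset.range p, bE (b + (c : ℚ_[p]) * (p : ℚ_[p]) ^ n) (n + 1) Q := by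
  funext z
  have hp0 : ((p : ℚ_[p]) ^ n) ≠ 0 := zpow_ne_zero _ (by exact_mod_cast hp.out.ne_zero)
  rw [Finset.sum_apply]
  simp only [bE_apply]
  obtain ⟨y, hy⟩ : ∃ y : ℚ_[p], z - b = y * (p : ℚ_[p]) ^ n := ⟨(z - b) / (p : ℚ_[p]) ^ n, by
    field_simp⟩
  have h1 : ∀ c : ℕ, ‖z - (b + (c : ℚ_[p]) * (p : ℚ_[p]) ^ n)‖ ≤ (p : ℝ) ^ (-(n + 1)) ↔
      ‖y - c‖ ≤ (p : ℝ) ^ (-1 : ℤ) := fun c => by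
    rw [← norm_mul_p_zpow_le (y := y - (c : ℚ_[p])) (n := n) (m := 1), sub_mul, ← hy]
    rw [show z - (b + (c : ℚ_[p]) * (p : ℚ_[p]) ^ n) = z - b - c * (p : ℚ_[p]) ^ n by ring]
  have h2 : ‖z - b‖ ≤ (p : ℝ) ^ (-n) ↔ ‖y‖ ≤ 1 := by
    have := norm_mul_p_zpow_le (p := p) (y := y) (n := n) (m := 0)
    rwa [add_zero, neg_zero, zpow_zero, ← hy] at this
  simp only [h1, h2]
  have hone : (p : ℝ) ^ (-1 : ℤ) ≤ 1 := by
    rw [zpow_neg_one]; exact inv_le_one_of_one_le₀ one_lt_p.le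
  have hc1 : ∀ c : ℕ, ‖(c : ℚ_[p])‖ ≤ 1 := fun c =>
    padic_norm_natCast_le c
  split_ifs with h
  · obtain ⟨t, ht⟩ : ∃ t : ℤ_[p], (t : ℚ_[p]) = y := ⟨⟨y, h⟩, rfl⟩
    obtain ⟨a, ha, x, hx⟩ := exists_natCast_add 1 t
    rw [pow_one] at ha hx
    have hx' : y = (a : ℚ_[p]) + p * (x : ℚ_[p]) := by
      rw [← ht, hx, PadicInt.coe_add, PadicInt.coe_mul, PadicInt.coe_natCast, PadicInt.coe_natCast]
    have key : ∀ c ∈ Finset.range p, (‖y - c‖ ≤ (p : ℝ) ^ (-1 : ℤ)) → c = a := fun c hc hle => by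
      have h3 : ‖(t - c : ℤ_[p])‖ ≤ (p : ℝ) ^ (-((1 : ℕ) : ℤ)) := by
        rw [PadicInt.norm_def, PadicInt.coe_sub, PadicInt.coe_natCast, ht]
        exact hle
      rw [PadicInt.norm_le_pow_iff_mem_span_pow, Ideal.mem_span_singleton, hx] at h3
      have := dvd_natCast_sub (p := p) (N := 1) (a := a) (b := c) (y := x) (by simpa using ha)
        (by simpa using hc) (by simpa using h3)
      exact this.symm
    rw [Finset.sum_eq_single_of_mem a (Finset.mem_range.2 ha) fun c hc hne =>
      if_neg fun hle => hne (key c hc hle), if_pos]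
    rw [hx', add_sub_cancel_left, norm_mul, zpow_neg_one, Padic.norm_p]
    exact mul_le_of_le_one_right (by positivity) (PadicInt.norm_le_one x)
  · rw [eq_comm]
    refine Finset.sum_eq_zero fun c _ => if_neg fun hle => h ?_
    have := padic_norm_sub_le (x := y) (y := c) (z := 0) (c := 1) (hle.trans hone) (by simpa using hc1 c)
    simpa using this

/-- The kernel `c₀ ρ^n 1_{b + p^n ℤ_p} + ρ^{val (z - b)} 1_{complement}`, times a polynomial. -/
def kap (c0 ρ : L) (b : ℚ_[p]) (n : ℤ) : L[X] →ₗ[L] (ℚ_[p] → L) :=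
  (c0 * ρ ^ n) • bE b n + bH ρ b n

lemma kap_apply (c0 ρ : L) (b : ℚ_[p]) (n : ℤ) (Q : L[X]) :
    kap c0 ρ b n Q = (c0 * ρ ^ n) • bE b n Q + bH ρ b n Q := rfl

lemma kap_congr (c0 ρ : L) {b b' : ℚ_[p]} {n : ℤ} (h : ‖b - b'‖ ≤ (p : ℝ) ^ (-n)) (Q : L[X]) :
    kap c0 ρ b n Q = kap c0 ρ b' n Q := by
  rw [kap_apply, kap_apply, bE_congr h, bH_congr ρ h]

lemma norm_natCast_mul_zpow_le (b : ℚ_[p]) (c : ℕ) (n : ℤ) :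
    ‖b - (b + (c : ℚ_[p]) * (p : ℚ_[p]) ^ n)‖ ≤ (p : ℝ) ^ (-n) := by
  have hc1 : ‖(c : ℚ_[p])‖ ≤ 1 := padic_norm_natCast_le c
  rw [sub_add_cancel_left, norm_neg, norm_mul, Padic.norm_p_zpow]
  exact mul_le_of_le_one_left (zpow_nonneg (by positivity) _) hc1

lemma kap_split {c0 ρ : L} (hρ : ρ ≠ 0) (hc0 : c0 * ((p : L) - ρ) = p - 1) (b : ℚ_[p]) (n : ℤ)
    (Q : L[X]) : (p : L) • kap c0 ρ b n Q =
      ∑ c ∈ Finset.range p, kap c0 ρ (b + (c : ℚ_[p]) * (p : ℚ_[p]) ^ n) (n + 1) Q := by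
  have h1 : ∀ c ∈ Finset.range p, kap c0 ρ (b + (c : ℚ_[p]) * (p : ℚ_[p]) ^ n) (n + 1) Q =
      (bH ρ b n Q + ρ ^ n • bE b n Q) + (c0 * ρ ^ (n + 1) - ρ ^ n) •
        bE (b + (c : ℚ_[p]) * (p : ℚ_[p]) ^ n) (n + 1) Q := fun c _ => by
    rw [kap_apply, bH_succ, ← bE_congr (norm_natCast_mul_zpow_le b c n),
      ← bH_congr ρ (norm_natCast_mul_zpow_le b c n), smul_sub, sub_smul]
    abel
  rw [Finset.sum_congr rfl h1, Finset.sum_add_distrib, ← Finset.smul_sum, ← bE_split,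
    Finset.sum_const, Finset.card_range, kap_apply, smul_add, ← Nat.cast_smul_eq_nsmul L, smul_add,
    smul_smul, smul_smul, add_comm (_ • bH ρ b n Q), add_right_comm, ← add_smul, zpow_add_one₀ hρ]
  congr 2
  linear_combination ρ ^ n * hc0

/-- Substitution `z ↦ d z + b`. -/
def affT (d b : ℚ_[p]) : (ℚ_[p] → L) →ₗ[L] (ℚ_[p] → L) :=
  LinearMap.funLeft L L fun z => d * z + b

lemma affT_apply (d b : ℚ_[p]) (f : ℚ_[p] → L) (z : ℚ_[p]) :
    affT (L := L) d b f z = f (d * z + b) := rfl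

lemma affT_comp (d b d' b' : ℚ_[p]) (f : ℚ_[p] → L) :
    affT d b (affT d' b' f) = affT (d' * d) (d' * b + b') f := by
  funext z
  simp only [affT_apply]
  congr 1
  ring

lemma affT_one_zero (f : ℚ_[p] → L) : affT 1 0 f = f := by
  funext z
  simp [affT_apply]

lemma affT_norm {d b b' : ℚ_[p]} (hd : d ≠ 0) (n : ℤ) (z : ℚ_[p]) :
    ‖d * z + b - b'‖ ≤ (p : ℝ) ^ (-n) ↔
      ‖z - (b' - b) / d‖ ≤ (p : ℝ) ^ (-(n - d.valuation)) := by
  have h1 : d * z + b - b' = d * (z - (b' - b) / d) := by field_simp; ring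
  rw [h1, norm_mul, padic_norm_eq hd,
    show -n = -d.valuation + -(n - d.valuation) by ring, zpow_add₀ p_pos.ne']
  exact mul_le_mul_iff_right₀ (zpow_pos p_pos _)

/-- The polynomial `Q(d T + b)`. -/
def affP (d b : ℚ_[p]) (Q : L[X]) : L[X] := Q.comp (C (iotaL p L d) * X + C (iotaL p L b))

lemma eval_affP (d b z : ℚ_[p]) (Q : L[X]) :
    (affP d b Q).eval (iotaL p L z) = Q.eval (iotaL p L (d * z + b)) := by
  simp [affP, iotaL]

lemma affT_bE {d : ℚ_[p]} (hd : d ≠ 0) (b b' : ℚ_[p]) (n : ℤ) (Q : L[X]) :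
    affT d b (bE b' n Q) = bE ((b' - b) / d) (n - d.valuation) (affP d b Q) := by
  funext z
  simp only [affT_apply, bE_apply, affT_norm hd, eval_affP]

lemma affT_bH {ρ : L} (hρ : ρ ≠ 0) {d : ℚ_[p]} (hd : d ≠ 0) (b b' : ℚ_[p]) (n : ℤ) (Q : L[X]) :
    affT d b (bH ρ b' n Q) =
      ρ ^ d.valuation • bH ρ ((b' - b) / d) (n - d.valuation) (affP d b Q) := by
  funext z
  simp only [affT_apply, bH_apply, Pi.smul_apply, affT_norm hd, eval_affP, smul_eq_mul]
  split_ifs with h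
  · simp
  · have hz : z - (b' - b) / d ≠ 0 := fun h0 => h (by
      rw [h0, norm_zero]; exact zpow_nonneg (by positivity) _)
    have h1 : d * z + b - b' = d * (z - (b' - b) / d) := by field_simp; ring
    rw [h1, Padic.valuation_mul hd hz, zpow_add₀ hρ]
    ring

lemma affT_kap {c0 ρ : L} (hρ : ρ ≠ 0) {d : ℚ_[p]} (hd : d ≠ 0) (b b' : ℚ_[p]) (n : ℤ) (Q : L[X]) :
    affT d b (kap c0 ρ b' n Q) =
      ρ ^ d.valuation • kap c0 ρ ((b' - b) / d) (n - d.valuation) (affP d b Q) := by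
  rw [kap_apply, map_add, map_smul, affT_bE hd, affT_bH hρ hd, kap_apply, smul_add, smul_smul]
  congr 2
  rw [mul_left_comm, ← zpow_add₀ hρ]
  congr 2
  ring

end Balls

section Systems

open scoped PowerSeries
open PowerSeries (coeff)

variable {p : ℕ} [hp : Fact p.Prime]
variable {L : Type} [NontriviallyNormedField L] [NormedAlgebra ℚ_[p] L] [IsUltrametricDist L]

/-- The monomial `(T - b)^j`. -/
def cpow (L : Type) [NontriviallyNormedField L] [NormedAlgebra ℚ_[p] L] (b : ℚ_[p]) (j : ℕ) :
    Polynomial L := (Polynomial.X - Polynomial.C (iotaL p L b)) ^ j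

lemma natDegree_cpow_le (b : ℚ_[p]) (j : ℕ) : (cpow L b j).natDegree ≤ j := by
  unfold cpow
  refine Polynomial.natDegree_pow_le.trans ?_
  simp [Polynomial.natDegree_X_sub_C]

/-- A compatible family of linear forms on polynomials of degree at most `h` on balls, with
growth of order `σ`. -/
structure GSys (h : ℕ) (σ P : ℝ) (lam : ℚ_[p] → ℤ → Polynomial L →ₗ[L] L) : Prop where
  inv : ∀ {a b : ℚ_[p]} {n : ℤ}, ‖a - b‖ ≤ (p : ℝ) ^ (-n) → lam a n = lam b n
  add : ∀ (b : ℚ_[p]) (n : ℤ) (Q : Polynomial L),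
    lam b n Q = ∑ c ∈ Finset.range p, lam (b + (c : ℚ_[p]) * (p : ℚ_[p]) ^ n) (n + 1) Q
  bound : ∀ (b : ℚ_[p]) (n : ℤ) (j : ℕ), j ≤ h →
    ‖lam b n (cpow L b j)‖ ≤ P * (p : ℝ) ^ ((n : ℝ) * (σ - j))

/-- A constant bounding the coefficients of the binomial polynomials of degree at most `h`. -/
def binomConst (L : Type) [NontriviallyNormedField L] (h : ℕ) : ℝ :=
  ∑ i ∈ Finset.range (h + 1), ∑ j ∈ Finset.range (i + 1),
    ‖((i.factorial : L)⁻¹) * (descPochhammer L i).coeff j‖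

lemma binomConst_nonneg (L : Type) [NontriviallyNormedField L] (h : ℕ) : 0 ≤ binomConst L h :=
  Finset.sum_nonneg fun _ _ => Finset.sum_nonneg fun _ _ => norm_nonneg _

lemma newtonPoly_eq_sum (a : ℤ_[p]) (N i : ℕ) :
    newtonPoly L a N i = ∑ j ∈ Finset.range (i + 1),
      (((i.factorial : L)⁻¹ * (descPochhammer L i).coeff j) * (((p : L) ^ N)⁻¹) ^ j) •
        cpow L (a : ℚ_[p]) j := by
  have h1 : (descPochhammer L i).natDegree ≤ i := by
    rw [descPochhammer_natDegree]
  conv_lhs => rw [newtonPoly, (descPochhammer L i).as_sum_range' (i + 1) (by omega)]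
  rw [← Polynomial.coe_compRingHom_apply, map_sum, Finset.mul_sum]
  refine Finset.sum_congr rfl fun j _ => ?_
  rw [Polynomial.coe_compRingHom_apply, ← Polynomial.C_mul_X_pow_eq_monomial, Polynomial.mul_comp, Polynomial.C_comp,
    Polynomial.X_pow_comp, mul_pow, ← Polynomial.C_pow, cpow, Polynomial.smul_eq_C_mul,
    Polynomial.C_mul, Polynomial.C_mul]
  ring

lemma rpow_zpow_mul (n : ℤ) (x : ℝ) : (p : ℝ) ^ ((n : ℝ) * x) = ((p : ℝ) ^ x) ^ n := by
  rw [mul_comm, Real.rpow_mul p_pos.le, Real.rpow_intCast]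

lemma GSys.nonneg {h : ℕ} {σ P : ℝ} {lam : ℚ_[p] → ℤ → Polynomial L →ₗ[L] L}
    (H : GSys h σ P lam) : 0 ≤ P := by
  have := (norm_nonneg _).trans (H.bound 0 0 0 (Nat.zero_le _))
  simpa using this

lemma GSys.isSystem {h : ℕ} {σ P : ℝ} {lam : ℚ_[p] → ℤ → Polynomial L →ₗ[L] L}
    (H : GSys h σ P lam) :
    IsSystem h σ (binomConst L h * P) (fun (a : ℤ_[p]) (N : ℕ) => lam (a : ℚ_[p]) (N : ℤ)) where
  inv {a b N} hab := by
    refine H.inv ?_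
    rwa [← PadicInt.coe_sub, ← PadicInt.norm_def, PadicInt.norm_le_pow_iff_mem_span_pow,
      Ideal.mem_span_singleton]
  add a N Q _ := by
    rw [H.add]
    simp
  nonneg := mul_nonneg (binomConst_nonneg L h) H.nonneg
  bound a N i hi := by
    have hp0 : (0 : ℝ) < p := p_pos
    rw [newtonPoly_eq_sum, map_sum]
    refine (norm_sum_le _ _).trans ?_
    have h1 : ∀ j ∈ Finset.range (i + 1), ‖lam (a : ℚ_[p]) (N : ℤ)
        ((((i.factorial : L)⁻¹ * (descPochhammer L i).coeff j) * (((p : L) ^ N)⁻¹) ^ j) •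
          cpow L (a : ℚ_[p]) j)‖ ≤
        ‖((i.factorial : L)⁻¹) * (descPochhammer L i).coeff j‖ * (P * (p : ℝ) ^ ((N : ℝ) * σ)) :=
      fun j hj => by
      rw [map_smul, norm_smul, norm_mul _ ((((p : L) ^ N)⁻¹) ^ j), mul_assoc]
      refine mul_le_mul_of_nonneg_left ?_ (norm_nonneg _)
      have hb := H.bound (a : ℚ_[p]) (N : ℤ) j (by have := Finset.mem_range.1 hj; omega)
      refine (mul_le_mul_of_nonneg_left hb (norm_nonneg _)).trans (le_of_eq ?_)
      rw [norm_pow, norm_inv, norm_pow, norm_pL, inv_pow, inv_pow, inv_pow, inv_inv, ← pow_mul, ← Real.rpow_natCast,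
        mul_left_comm, ← Real.rpow_add hp0]
      push_cast
      ring_nf
    refine (Finset.sum_le_sum h1).trans ?_
    rw [← Finset.sum_mul, ← mul_assoc, mul_assoc]
    rw [mul_assoc]
    refine mul_le_mul_of_nonneg_right ?_ (mul_nonneg H.nonneg (Real.rpow_nonneg hp0.le _))
    exact Finset.single_le_sum (f := fun i => ∑ j ∈ Finset.range (i + 1),
      ‖((i.factorial : L)⁻¹) * (descPochhammer L i).coeff j‖)
      (fun _ _ => Finset.sum_nonneg fun _ _ => norm_nonneg _) (Finset.mem_range.2 (by omega))

variable [CompleteSpace L]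

/-- The power series attached to a system of order `σ`. -/
def amice (h : ℕ) (σ : ℝ) (lam : ℚ_[p] → ℤ → Polynomial L →ₗ[L] L) : L⟦X⟧ :=
  if H : ∃ w : L⟦X⟧, (∃ C, Growth σ C w) ∧ ∀ (a : ℤ_[p]) (N : ℕ) (Q : Polynomial L),
    Q.natDegree ≤ h → pair w (box a N Q) = lam a N Q then H.choose else 0

/-- The growth constant of the power series attached to a system. -/
def amiceConst (p : ℕ) (L : Type) [NontriviallyNormedField L] (h : ℕ) (σ : ℝ) : ℝ :=
  binomConst L h * (p : ℝ) ^ σ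

lemma amiceConst_nonneg (p : ℕ) (L : Type) [NontriviallyNormedField L] (h : ℕ) (σ : ℝ) :
    0 ≤ amiceConst p L h σ :=
  mul_nonneg (binomConst_nonneg L h) (Real.rpow_nonneg (Nat.cast_nonneg _) _)

variable {h : ℕ} {σ P : ℝ} {lam : ℚ_[p] → ℤ → Polynomial L →ₗ[L] L}

lemma GSys.exists_growth (H : GSys h σ P lam) (hσ : 0 ≤ σ) (hJ : σ < h + 1) :
    ∃ w : L⟦X⟧, Growth σ (amiceConst p L h σ * P) w ∧
      ∀ (a : ℤ_[p]) (N : ℕ) (Q : Polynomial L), Q.natDegree ≤ h → pair w (box a N Q) = lam a N Q := by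
  obtain ⟨w, h1, h2⟩ := H.isSystem.exists_powerSeries hσ hJ
  refine ⟨w, ?_, h2⟩
  rwa [amiceConst, mul_right_comm]

lemma GSys.pair_amice (H : GSys h σ P lam) (hσ : 0 ≤ σ) (hJ : σ < h + 1)
    (a : ℤ_[p]) (N : ℕ) (Q : Polynomial L) (hQ : Q.natDegree ≤ h) :
    pair (amice h σ lam) (box a N Q) = lam a N Q := by
  obtain ⟨w, h1, h2⟩ := H.exists_growth hσ hJ
  have H' : ∃ w : L⟦X⟧, (∃ C, Growth σ C w) ∧ ∀ (a : ℤ_[p]) (N : ℕ) (Q : Polynomial L),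
    Q.natDegree ≤ h → pair w (box a N Q) = lam a N Q := ⟨w, ⟨_, h1⟩, h2⟩
  rw [amice, dif_pos H']
  exact H'.choose_spec.2 a N Q hQ

lemma eq_amice (hσ : 0 ≤ σ) (hJ : σ < h + 1) {C : ℝ} {w : L⟦X⟧}
    (hw : Growth σ C w) (h2 : ∀ (a : ℤ_[p]) (N : ℕ) (Q : Polynomial L), Q.natDegree ≤ h →
      pair w (box a N Q) = lam a N Q) : w = amice h σ lam := by
  have H' : ∃ w : L⟦X⟧, (∃ C, Growth σ C w) ∧ ∀ (a : ℤ_[p]) (N : ℕ) (Q : Polynomial L),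
    Q.natDegree ≤ h → pair w (box a N Q) = lam a N Q := ⟨w, ⟨_, hw⟩, h2⟩
  rw [amice, dif_pos H']
  obtain ⟨⟨C', hC'⟩, h3⟩ := H'.choose_spec
  refine eq_of_pair_box (p := p) hσ hw hC' hJ fun a N Q hQ => ?_
  rw [h2 _ _ _ hQ, h3 _ _ _ hQ]

lemma GSys.growth_amice (H : GSys h σ P lam) (hσ : 0 ≤ σ) (hJ : σ < h + 1) :
    Growth σ (amiceConst p L h σ * P) (amice h σ lam) := by
  obtain ⟨w, h1, h2⟩ := H.exists_growth hσ hJ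
  rwa [← eq_amice hσ hJ h1 h2]

lemma GSys.amice_add {P' : ℝ} {lam' : ℚ_[p] → ℤ → Polynomial L →ₗ[L] L} (H : GSys h σ P lam)
    (H' : GSys h σ P' lam') (hσ : 0 ≤ σ) (hJ : σ < h + 1) :
    amice h σ (lam + lam') = amice h σ lam + amice h σ lam' := by
  refine (eq_amice hσ hJ ((H.growth_amice hσ hJ).add (H'.growth_amice hσ hJ)) fun a N Q hQ => ?_).symm
  rw [pair_add_left hσ (H.growth_amice hσ hJ) (H'.growth_amice hσ hJ) (isCr_box hσ _ _ _),
    H.pair_amice hσ hJ _ _ _ hQ, H'.pair_amice hσ hJ _ _ _ hQ]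
  rfl

lemma GSys.amice_smul (H : GSys h σ P lam) (hσ : 0 ≤ σ) (hJ : σ < h + 1) (c : L) :
    amice h σ (c • lam) = c • amice h σ lam := by
  have hg : Growth σ (‖c‖ * (amiceConst p L h σ * P)) (c • amice h σ lam) := fun n => by
    rw [PowerSeries.coeff_smul, norm_smul, mul_assoc]
    exact mul_le_mul_of_nonneg_left (H.growth_amice hσ hJ n) (norm_nonneg _)
  refine (eq_amice hσ hJ hg fun a N Q hQ => ?_).symm
  have := pair_smul_left (p := p) (amice h σ lam) c (box a N Q)
  rw [this, H.pair_amice hσ hJ _ _ _ hQ]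
  rfl

lemma natDegree_affP_le (d e : ℚ_[p]) {Q : Polynomial L} (hQ : Q.natDegree ≤ h) :
    (affP d e Q).natDegree ≤ h := by
  unfold affP
  refine Polynomial.natDegree_comp_le.trans ?_
  refine (Nat.mul_le_mul_left _ (?_ : _ ≤ 1)).trans (by rwa [mul_one])
  refine (Polynomial.natDegree_add_le _ _).trans (max_le ?_ (by simp))
  exact (Polynomial.natDegree_C_mul_le _ _).trans Polynomial.natDegree_X_le

lemma GSys.amice_translate {P' : ℝ} {lam' : ℚ_[p] → ℤ → Polynomial L →ₗ[L] L} (H : GSys h σ P lam)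
    (hσ : 0 ≤ σ) (hJ : σ < h + 1)
    (hl : ∀ (b : ℚ_[p]) n Q, lam' b n Q = lam (b - 1) n (affP (1 : ℚ_[p]) 1 Q)) :
    amice h σ lam' = (1 + PowerSeries.X) * amice h σ lam := by
  refine (eq_amice hσ hJ ((H.growth_amice hσ hJ).one_add_X_mul hσ) fun a N Q hQ => ?_).symm
  have h1 := pair_one_add_X_pow_mul_box hσ (H.growth_amice hσ hJ) 1 a N Q
  rw [pow_one] at h1
  rw [h1]
  simp only [box_add_right]
  have h3 : (Q.comp (Polynomial.X + Polynomial.C (iotaL p L (((1 : ℕ) : ℤ_[p]) : ℚ_[p])))) =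
      affP (1 : ℚ_[p]) 1 Q := by
    simp [affP, iotaL]
  rw [h3, hl, H.pair_amice hσ hJ _ _ _ (natDegree_affP_le _ _ hQ)]
  simp

lemma GSys.amice_eq_sum_frob {P' : ℝ} {lamc : ℕ → ℚ_[p] → ℤ → Polynomial L →ₗ[L] L}
    (H : GSys h σ P lam) (Hc : ∀ c, GSys h σ P' (lamc c)) (hσ : 0 ≤ σ) (hJ : σ < h + 1) {η : L}
    (hl : ∀ (c : ℕ) (b : ℚ_[p]) (n : ℤ) Q,
      lam ((c : ℚ_[p]) + (p : ℚ_[p]) * b) (n + 1) Q = η * lamc c b n (affP (p : ℚ_[p]) (c : ℚ_[p]) Q)) :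
    amice h σ lam = η • ∑ c ∈ Finset.range p, (1 + PowerSeries.X) ^ c *
      frob p L (amice h σ (lamc c)) := by
  have hg : ∀ c, Growth σ (‖η‖ * (amiceConst p L h σ * P')) (η • amice h σ (lamc c)) := fun c n => by
    rw [PowerSeries.coeff_smul, norm_smul, mul_assoc]
    exact mul_le_mul_of_nonneg_left ((Hc c).growth_amice hσ hJ n) (norm_nonneg _)
  have key := eq_sum_frob (p := p) hσ (H.growth_amice hσ hJ) hg hJ fun c hc a N Q hQ => ?_
  · rw [key, Finset.smul_sum]
    refine Finset.sum_congr rfl fun c _ => ?_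
    rw [map_smul (frob p L), mul_smul_comm]
  · have h3 : (Q.comp (Polynomial.C (p : L) * Polynomial.X + Polynomial.C (c : L))) =
        affP (p : ℚ_[p]) (c : ℚ_[p]) Q := by
      simp [affP, iotaL]
    have := pair_smul_left (p := p) (amice h σ (lamc c)) η (box a N (affP (p : ℚ_[p]) (c : ℚ_[p]) Q))
    rw [h3, this, H.pair_amice hσ hJ _ _ _ hQ, (Hc c).pair_amice hσ hJ _ _ _ (natDegree_affP_le _ _ hQ)]
    rw [← hl]
    simp

end Systems

section Functionals

open scoped PowerSeries
open PowerSeries (coeff)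

variable {p : ℕ} [hp : Fact p.Prime]
variable {L : Type} [NontriviallyNormedField L] [NormedAlgebra ℚ_[p] L] [IsUltrametricDist L]

/-- The numerical data attached to `(k, α, β)`: here `h = k - 2`, `r = val α`, `s = val β`,
`ρ = α p / β`. -/
structure Params (p : ℕ) [Fact p.Prime] {L : Type} [NontriviallyNormedField L] (h : ℕ) (r s : ℝ)
    (ρ c0 : L) : Prop where
  sum_eq : r + s = h + 1
  s_pos : 0 < s
  s_le : s ≤ r
  norm_rho : ‖ρ‖ = (p : ℝ) ^ (-(r - s + 1))
  rho_ne : ρ ≠ p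
  c0_eq : c0 * ((p : L) - ρ) = p - 1

/-- Boundedness of a functional on the standard functions. -/
structure Bd (h : ℕ) (r s : ℝ) (ρ : L) (μ : (ℚ_[p] → L) →ₗ[L] L) (P : ℝ) : Prop where
  bE_le : ∀ (b : ℚ_[p]) (n : ℤ) (j : ℕ), j ≤ h →
    ‖μ (bE b n (cpow L b j))‖ ≤ P * (p : ℝ) ^ ((n : ℝ) * (r - j))
  bH_le : ∀ (b : ℚ_[p]) (n : ℤ) (j : ℕ), j ≤ h →
    ‖μ (bH ρ b n (cpow L b j))‖ ≤ P * (p : ℝ) ^ ((n : ℝ) * (s - 1 - j))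

variable {h : ℕ} {r s : ℝ} {ρ c0 : L}

lemma Params.r_pos (H : Params p h r s ρ c0) : 0 < r := H.s_pos.trans_le H.s_le

lemma Params.r_lt (H : Params p h r s ρ c0) : r < h + 1 := by
  have := H.sum_eq; have := H.s_pos; linarith

lemma Params.s_lt (H : Params p h r s ρ c0) : s < h + 1 := H.s_le.trans_lt H.r_lt

lemma Params.rho_ne_zero (H : Params p h r s ρ c0) : ρ ≠ 0 := by
  rw [← norm_pos_iff, H.norm_rho]
  exact Real.rpow_pos_of_pos p_pos _

lemma Params.norm_rho_zpow (H : Params p h r s ρ c0) (n : ℤ) :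
    ‖ρ ^ n‖ = (p : ℝ) ^ ((n : ℝ) * (-(r - s + 1))) := by
  rw [norm_zpow, H.norm_rho, rpow_zpow_mul]

lemma norm_pL_zpow (n : ℤ) : ‖(p : L) ^ n‖ = (p : ℝ) ^ (-(n : ℝ)) := by
  rw [norm_zpow, norm_pL, inv_zpow', ← Real.rpow_intCast]
  push_cast
  rfl

variable {μ ν : (ℚ_[p] → L) →ₗ[L] L} {P P' : ℝ}

lemma Bd.nonneg (H : Bd h r s ρ μ P) : 0 ≤ P := by
  have := (norm_nonneg _).trans (H.bE_le 0 0 0 (Nat.zero_le _))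
  simpa using this

lemma Bd.mono (H : Bd h r s ρ μ P) (hP : P ≤ P') : Bd h r s ρ μ P' where
  bE_le b n j hj := (H.bE_le b n j hj).trans (mul_le_mul_of_nonneg_right hP
    (Real.rpow_nonneg p_pos.le _))
  bH_le b n j hj := (H.bH_le b n j hj).trans (mul_le_mul_of_nonneg_right hP
    (Real.rpow_nonneg p_pos.le _))

lemma bd_zero (h : ℕ) (r s : ℝ) (ρ : L) (hP : 0 ≤ P) :
    Bd (p := p) h r s ρ (0 : (ℚ_[p] → L) →ₗ[L] L) P where
  bE_le b n j hj := by
    simpa using mul_nonneg hP (Real.rpow_nonneg p_pos.le _)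
  bH_le b n j hj := by
    simpa using mul_nonneg hP (Real.rpow_nonneg p_pos.le _)

lemma Bd.add (H : Bd h r s ρ μ P) (H' : Bd h r s ρ ν P) : Bd h r s ρ (μ + ν) P where
  bE_le b n j hj := (IsUltrametricDist.norm_add_le_max _ _).trans
    (max_le (H.bE_le b n j hj) (H'.bE_le b n j hj))
  bH_le b n j hj := (IsUltrametricDist.norm_add_le_max _ _).trans
    (max_le (H.bH_le b n j hj) (H'.bH_le b n j hj))

lemma Bd.smul (H : Bd h r s ρ μ P) (c : L) : Bd h r s ρ (c • μ) (‖c‖ * P) where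
  bE_le b n j hj := by
    rw [LinearMap.smul_apply, norm_smul, mul_assoc]
    exact mul_le_mul_of_nonneg_left (H.bE_le b n j hj) (norm_nonneg _)
  bH_le b n j hj := by
    rw [LinearMap.smul_apply, norm_smul, mul_assoc]
    exact mul_le_mul_of_nonneg_left (H.bH_le b n j hj) (norm_nonneg _)

lemma Bd.sum {ι : Type*} {t : Finset ι} {f : ι → (ℚ_[p] → L) →ₗ[L] L} (hP : 0 ≤ P)
    (H : ∀ i ∈ t, Bd h r s ρ (f i) P) : Bd h r s ρ (∑ i ∈ t, f i) P := by
  induction t using Finset.induction_on with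
  | empty => simpa using bd_zero h r s ρ hP
  | insert i t hi ih =>
    rw [Finset.sum_insert hi]
    exact (H i (Finset.mem_insert_self _ _)).add (ih fun j hj => H j (Finset.mem_insert_of_mem hj))

lemma affP_affP (d e d' e' : ℚ_[p]) (Q : Polynomial L) :
    affP d e (affP d' e' Q) = affP (d' * d) (d' * e + e') Q := by
  simp only [affP, Polynomial.comp_assoc, Polynomial.add_comp, Polynomial.mul_comp,
    Polynomial.C_comp, Polynomial.X_comp, iotaL, map_mul, map_add]
  congr 1
  ring

lemma affP_one_zero (Q : Polynomial L) : affP (1 : ℚ_[p]) 0 Q = Q := by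
  simp [affP, iotaL]

lemma affP_cpow {d : ℚ_[p]} (hd : d ≠ 0) (e b : ℚ_[p]) (j : ℕ) :
    affP d e (cpow L b j) = (iotaL p L d) ^ j • cpow L ((b - e) / d) j := by
  have h1 : iotaL p L b = iotaL p L d * iotaL p L ((b - e) / d) + iotaL p L e := by
    simp only [iotaL, ← map_mul, ← map_add]
    congr 1
    field_simp
    ring
  rw [affP, cpow, cpow, Polynomial.pow_comp, Polynomial.sub_comp, Polynomial.X_comp,
    Polynomial.C_comp, Polynomial.smul_eq_C_mul, Polynomial.C_pow, ← mul_pow, h1,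
    Polynomial.C_add, Polynomial.C_mul]
  congr 1
  ring

lemma norm_iotaL_pow {d : ℚ_[p]} (hd : d ≠ 0) (j : ℕ) :
    ‖(iotaL p L d) ^ j‖ = (p : ℝ) ^ (-(d.valuation : ℝ) * j) := by
  rw [norm_pow, norm_iotaL, padic_norm_eq hd, ← Real.rpow_intCast, ← Real.rpow_natCast,
    ← Real.rpow_mul p_pos.le]
  push_cast
  rfl

lemma Bd.comp_affT (hP : Params p h r s ρ c0) (H : Bd h r s ρ μ P) {d : ℚ_[p]} (hd : d ≠ 0)
    (e : ℚ_[p]) : Bd h r s ρ (μ ∘ₗ affT d e) (P * (p : ℝ) ^ (-(d.valuation : ℝ) * r)) where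
  bE_le b n j hj := by
    rw [LinearMap.comp_apply, affT_bE hd, affP_cpow hd, map_smul, map_smul, norm_smul,
      norm_iotaL_pow hd]
    refine (mul_le_mul_of_nonneg_left (H.bE_le _ _ _ hj) (Real.rpow_nonneg p_pos.le _)).trans
      (le_of_eq ?_)
    rw [mul_left_comm, mul_assoc, ← Real.rpow_add p_pos, ← Real.rpow_add p_pos]
    push_cast
    ring_nf
  bH_le b n j hj := by
    rw [LinearMap.comp_apply, affT_bH hP.rho_ne_zero hd, affP_cpow hd, map_smul, map_smul, map_smul,
      norm_smul, norm_smul, norm_iotaL_pow hd, hP.norm_rho_zpow, ← mul_assoc, ← Real.rpow_add p_pos]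
    refine (mul_le_mul_of_nonneg_left (H.bH_le _ _ _ hj) (Real.rpow_nonneg p_pos.le _)).trans
      (le_of_eq ?_)
    rw [mul_left_comm, mul_assoc, ← Real.rpow_add p_pos, ← Real.rpow_add p_pos]
    push_cast
    ring_nf

/-- The first family of linear forms attached to a functional. -/
def lamA (μ : (ℚ_[p] → L) →ₗ[L] L) (b : ℚ_[p]) (n : ℤ) : Polynomial L →ₗ[L] L := μ ∘ₗ bE b n

/-- The second family of linear forms attached to a functional. -/
def lamB (c0 ρ : L) (μ : (ℚ_[p] → L) →ₗ[L] L) (b : ℚ_[p]) (n : ℤ) : Polynomial L →ₗ[L] L :=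
  (p : L) ^ (-n) • (μ ∘ₗ kap c0 ρ b n)

lemma lamA_apply (μ : (ℚ_[p] → L) →ₗ[L] L) (b : ℚ_[p]) (n : ℤ) (Q : Polynomial L) :
    lamA μ b n Q = μ (bE b n Q) := rfl

lemma lamB_apply (c0 ρ : L) (μ : (ℚ_[p] → L) →ₗ[L] L) (b : ℚ_[p]) (n : ℤ) (Q : Polynomial L) :
    lamB c0 ρ μ b n Q = (p : L) ^ (-n) * μ (kap c0 ρ b n Q) := rfl

lemma Bd.gsysA (H : Bd h r s ρ μ P) : GSys h r P (lamA μ) where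
  inv {a b n} hab := by
    refine LinearMap.ext fun Q => ?_
    rw [lamA_apply, lamA_apply, bE_congr hab]
  add b n Q := by
    rw [lamA_apply, bE_split, map_sum]
    rfl
  bound := H.bE_le

lemma Bd.gsysB (hP : Params p h r s ρ c0) (H : Bd h r s ρ μ P) :
    GSys h s (max 1 ‖c0‖ * P) (lamB c0 ρ μ) where
  inv {a b n} hab := by
    refine LinearMap.ext fun Q => ?_
    rw [lamB_apply, lamB_apply, kap_congr c0 ρ hab]
  add b n Q := by
    have hp0 : (p : L) ≠ 0 := pL_ne_zero
    simp only [lamB_apply]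
    rw [← Finset.mul_sum, ← map_sum, ← kap_split hP.rho_ne_zero hP.c0_eq, map_smul, smul_eq_mul,
      ← mul_assoc, neg_add, zpow_add₀ hp0, zpow_neg_one, inv_mul_cancel_right₀ hp0]
  bound b n j hj := by
    have h1 : ‖c0 * ρ ^ n * μ (bE b n (cpow L b j))‖ ≤
        max 1 ‖c0‖ * P * (p : ℝ) ^ ((n : ℝ) * (s - 1 - j)) := by
      rw [norm_mul, norm_mul, hP.norm_rho_zpow]
      calc _ ≤ max 1 ‖c0‖ * (p : ℝ) ^ ((n : ℝ) * (-(r - s + 1))) *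
            (P * (p : ℝ) ^ ((n : ℝ) * (r - j))) := by
            have := Real.rpow_nonneg (p_pos (p := p)).le ((n : ℝ) * (-(r - s + 1)))
            exact mul_le_mul (mul_le_mul_of_nonneg_right (le_max_right _ _) this) (H.bE_le b n j hj)
              (norm_nonneg _) (by positivity)
        _ = _ := by
            rw [mul_mul_mul_comm, ← Real.rpow_add p_pos]
            ring_nf
    have h2 : ‖μ (bH ρ b n (cpow L b j))‖ ≤
        max 1 ‖c0‖ * P * (p : ℝ) ^ ((n : ℝ) * (s - 1 - j)) :=
      (H.bH_le b n j hj).trans (mul_le_mul_of_nonneg_right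
        (le_mul_of_one_le_left H.nonneg (le_max_left _ _)) (Real.rpow_nonneg p_pos.le _))
    rw [lamB_apply, kap_apply, map_add, map_smul, smul_eq_mul, norm_mul, norm_pL_zpow]
    refine (mul_le_mul_of_nonneg_left ((IsUltrametricDist.norm_add_le_max _ _).trans (max_le h1 h2))
      (Real.rpow_nonneg p_pos.le _)).trans (le_of_eq ?_)
    rw [mul_left_comm, ← Real.rpow_add p_pos]
    push_cast
    ring_nf

lemma lamA_comp_affT (μ : (ℚ_[p] → L) →ₗ[L] L) {d : ℚ_[p]} (hd : d ≠ 0) (e b : ℚ_[p]) (n : ℤ)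
    (Q : Polynomial L) :
    lamA (μ ∘ₗ affT d e) b n Q = lamA μ ((b - e) / d) (n - d.valuation) (affP d e Q) := by
  rw [lamA_apply, lamA_apply, LinearMap.comp_apply, affT_bE hd]

lemma lamB_comp_affT (hρ : ρ ≠ 0) (μ : (ℚ_[p] → L) →ₗ[L] L) {d : ℚ_[p]} (hd : d ≠ 0) (e b : ℚ_[p])
    (n : ℤ) (Q : Polynomial L) :
    lamB c0 ρ (μ ∘ₗ affT d e) b n Q =
      (ρ / p) ^ d.valuation * lamB c0 ρ μ ((b - e) / d) (n - d.valuation) (affP d e Q) := by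
  rw [lamB_apply, lamB_apply, LinearMap.comp_apply, affT_kap hρ hd, map_smul, smul_eq_mul, div_zpow,
    show -(n - d.valuation) = d.valuation + -n by ring, zpow_add₀ (pL_ne_zero (p := p))]
  have : (p : L) ^ d.valuation ≠ 0 := zpow_ne_zero _ pL_ne_zero
  field_simp

lemma lamA_add (μ ν : (ℚ_[p] → L) →ₗ[L] L) : lamA (μ + ν) = lamA μ + lamA ν := rfl

lemma lamA_smul (c : L) (μ : (ℚ_[p] → L) →ₗ[L] L) : lamA (c • μ) = c • lamA μ := rfl

/-- Restriction of a functional to `c + pℤ_p`, rescaled. -/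
def subF (c : ℕ) (μ : (ℚ_[p] → L) →ₗ[L] L) : (ℚ_[p] → L) →ₗ[L] L :=
  μ ∘ₗ affT ((p : ℚ_[p])⁻¹) (-(c : ℚ_[p]) * (p : ℚ_[p])⁻¹)

lemma pQ_ne_zero : (p : ℚ_[p]) ≠ 0 := by exact_mod_cast hp.out.ne_zero

lemma lamA_sub (μ : (ℚ_[p] → L) →ₗ[L] L) (c : ℕ) (b : ℚ_[p]) (n : ℤ) (Q : Polynomial L) :
    lamA μ ((c : ℚ_[p]) + (p : ℚ_[p]) * b) (n + 1) Q =
      1 * lamA (subF c μ) b n (affP (p : ℚ_[p]) (c : ℚ_[p]) Q) := by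
  have hp0 := pQ_ne_zero (p := p)
  rw [subF, lamA_comp_affT _ (inv_ne_zero hp0), affP_affP, Padic.valuation_inv, Padic.valuation_p,
    one_mul]
  rw [show (p : ℚ_[p]) * (p : ℚ_[p])⁻¹ = 1 by field_simp,
    show (p : ℚ_[p]) * (-(c : ℚ_[p]) * (p : ℚ_[p])⁻¹) + (c : ℚ_[p]) = 0 by field_simp; ring,
    affP_one_zero, show n - -1 = n + 1 by ring]
  congr 2
  field_simp
  ring

lemma lamB_sub (hρ : ρ ≠ 0) (μ : (ℚ_[p] → L) →ₗ[L] L) (c : ℕ) (b : ℚ_[p]) (n : ℤ)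
    (Q : Polynomial L) :
    lamB c0 ρ μ ((c : ℚ_[p]) + (p : ℚ_[p]) * b) (n + 1) Q =
      (ρ / p) * lamB c0 ρ (subF c μ) b n (affP (p : ℚ_[p]) (c : ℚ_[p]) Q) := by
  have hp0 := pQ_ne_zero (p := p)
  have hpL : (p : L) ≠ 0 := pL_ne_zero (p := p)
  rw [subF, lamB_comp_affT hρ _ (inv_ne_zero hp0), affP_affP, Padic.valuation_inv, Padic.valuation_p]
  rw [show (p : ℚ_[p]) * (p : ℚ_[p])⁻¹ = 1 by field_simp,
    show (p : ℚ_[p]) * (-(c : ℚ_[p]) * (p : ℚ_[p])⁻¹) + (c : ℚ_[p]) = 0 by field_simp; ring,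
    affP_one_zero, show n - -1 = n + 1 by ring, zpow_neg_one, mul_inv_cancel_left₀ (div_ne_zero hρ hpL)]
  congr 2
  field_simp
  ring

lemma Bd.sub (hP : Params p h r s ρ c0) (H : Bd h r s ρ μ P) (c : ℕ) :
    Bd h r s ρ (subF c μ) (P * (p : ℝ) ^ r) := by
  have := H.comp_affT hP (inv_ne_zero (pQ_ne_zero (p := p))) (-(c : ℚ_[p]) * (p : ℚ_[p])⁻¹)
  rw [Padic.valuation_inv, Padic.valuation_p,
    show -((-1 : ℤ) : ℝ) * r = r by push_cast; ring] at this
  exact this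

variable [CompleteSpace L]

/-- The first power series attached to a functional. -/
def wA (h : ℕ) (r : ℝ) (μ : (ℚ_[p] → L) →ₗ[L] L) : L⟦X⟧ := amice h r (lamA μ)

/-- The second power series attached to a functional. -/
def wB (h : ℕ) (s : ℝ) (c0 ρ : L) (μ : (ℚ_[p] → L) →ₗ[L] L) : L⟦X⟧ := amice h s (lamB c0 ρ μ)

lemma Bd.growthA (hP : Params p h r s ρ c0) (H : Bd h r s ρ μ P) :
    Growth r (amiceConst p L h r * P) (wA h r μ) := H.gsysA.growth_amice hP.r_pos.le hP.r_lt

lemma Bd.growthB (hP : Params p h r s ρ c0) (H : Bd h r s ρ μ P) :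
    Growth s (amiceConst p L h s * (max 1 ‖c0‖ * P)) (wB h s c0 ρ μ) :=
  (H.gsysB hP).growth_amice hP.s_pos.le hP.s_lt

lemma Bd.pairA (hP : Params p h r s ρ c0) (H : Bd h r s ρ μ P) (a : ℤ_[p]) (N : ℕ)
    (Q : Polynomial L) (hQ : Q.natDegree ≤ h) : pair (wA h r μ) (box a N Q) = lamA μ a N Q :=
  H.gsysA.pair_amice hP.r_pos.le hP.r_lt a N Q hQ

lemma Bd.pairB (hP : Params p h r s ρ c0) (H : Bd h r s ρ μ P) (a : ℤ_[p]) (N : ℕ)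
    (Q : Polynomial L) (hQ : Q.natDegree ≤ h) :
    pair (wB h s c0 ρ μ) (box a N Q) = lamB c0 ρ μ a N Q :=
  (H.gsysB hP).pair_amice hP.s_pos.le hP.s_lt a N Q hQ

lemma Bd.wA_add (hP : Params p h r s ρ c0) (H : Bd h r s ρ μ P) (H' : Bd h r s ρ ν P') :
    wA h r (μ + ν) = wA h r μ + wA h r ν := by
  rw [wA, lamA_add, H.gsysA.amice_add H'.gsysA hP.r_pos.le hP.r_lt]
  rfl

lemma Bd.wA_smul (hP : Params p h r s ρ c0) (H : Bd h r s ρ μ P) (c : L) :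
    wA h r (c • μ) = c • wA h r μ := by
  rw [wA, lamA_smul, H.gsysA.amice_smul hP.r_pos.le hP.r_lt]
  rfl

lemma Bd.wA_translate (hP : Params p h r s ρ c0) (H : Bd h r s ρ μ P) :
    wA h r (μ ∘ₗ affT 1 1) = (1 + PowerSeries.X) * wA h r μ := by
  refine H.gsysA.amice_translate (P' := P) hP.r_pos.le hP.r_lt fun b n Q => ?_
  rw [lamA_comp_affT _ one_ne_zero, Padic.valuation_one, div_one, sub_zero]

lemma Bd.wA_eq_sum (hP : Params p h r s ρ c0) (H : Bd h r s ρ μ P) :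
    wA h r μ = ∑ c ∈ Finset.range p, (1 + PowerSeries.X) ^ c * frob p L (wA h r (subF c μ)) := by
  have := H.gsysA.amice_eq_sum_frob (fun c => (H.sub hP c).gsysA) hP.r_pos.le hP.r_lt
    (lamA_sub μ)
  rwa [one_smul] at this

lemma Bd.wB_eq_sum (hP : Params p h r s ρ c0) (H : Bd h r s ρ μ P) :
    wB h s c0 ρ μ = (ρ / p) • ∑ c ∈ Finset.range p, (1 + PowerSeries.X) ^ c *
      frob p L (wB h s c0 ρ (subF c μ)) :=
  (H.gsysB hP).amice_eq_sum_frob (fun c => (H.sub hP c).gsysB hP) hP.s_pos.le hP.s_lt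
    (lamB_sub hP.rho_ne_zero μ)

end Functionals

section Det

open scoped PowerSeries
open PowerSeries (coeff)

variable {p : ℕ} [hp : Fact p.Prime] {L : Type} [NontriviallyNormedField L]
  [NormedAlgebra ℚ_[p] L] [IsUltrametricDist L] [CompleteSpace L]

lemma sum_range_reflect_of_periodic {A : Type*} [AddCommMonoid A] (N : ℕ) (F : ℤ_[p] → A)
    (hF : ∀ x y, (p : ℤ_[p]) ^ N ∣ x - y → F x = F y) (c : ℤ_[p]) :
    ∑ b ∈ Finset.range (p ^ N), F b = ∑ b ∈ Finset.range (p ^ N), F (c - b) := by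
  have hd : ∀ z : ℤ_[p], (p : ℤ_[p]) ^ N ∣ z - (z.appr N : ℤ_[p]) := fun z =>
    Ideal.mem_span_singleton.1 (PadicInt.appr_spec N z)
  have hinv : ∀ b ∈ Finset.range (p ^ N),
      (c - (((c - (b : ℤ_[p])).appr N : ℕ) : ℤ_[p])).appr N = b := fun b hb => by
    refine dvd_natCast_sub (p := p) (y := 0) (PadicInt.appr_lt _ _) (Finset.mem_range.1 hb) ?_
    have h1 := hd (c - (b : ℤ_[p]))
    have h2 := hd (c - (((c - (b : ℤ_[p])).appr N : ℕ) : ℤ_[p]))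
    have := dvd_sub h1 h2
    convert this using 1
    ring
  refine Finset.sum_nbij' (fun b => (c - (b : ℤ_[p])).appr N) (fun b => (c - (b : ℤ_[p])).appr N)
    (fun b _ => Finset.mem_range.2 (PadicInt.appr_lt _ _))
    (fun b _ => Finset.mem_range.2 (PadicInt.appr_lt _ _)) hinv hinv fun b _ => hF _ _ ?_
  have h1 := hd (c - (b : ℤ_[p]))
  rw [← dvd_neg]
  convert h1 using 1
  ring

lemma pair_mul_box {σ C σ' C' : ℝ} (hσ : 0 ≤ σ) (hσ' : 0 ≤ σ') {w w' : L⟦X⟧} (hw : Growth σ C w)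
    (hw' : Growth σ' C' w') (c : ℤ_[p]) (N n : ℕ) :
    pair (w * w') (box c N (Polynomial.X ^ n)) =
      ∑ i ∈ Finset.range (n + 1), (n.choose i : L) * ∑ b ∈ Finset.range (p ^ N),
        pair w (box (b : ℤ_[p]) N (Polynomial.X ^ i)) *
          pair w' (box (c - (b : ℤ_[p])) N (Polynomial.X ^ (n - i))) := by
  rw [pair_mul hσ hσ' hw hw' (Finset.range (n + 1) ×ˢ Finset.range (p ^ N))
    (u := fun k => (n.choose k.1 : L) • box (k.2 : ℤ_[p]) N (Polynomial.X ^ k.1))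
    (v := fun k => box (c - (k.2 : ℤ_[p])) N (Polynomial.X ^ (n - k.1)))
    (fun k _ => (isCr_box (by linarith) _ _ _).smul _) (fun k _ => isCr_box (by linarith) _ _ _),
    Finset.sum_product]
  · refine Finset.sum_congr rfl fun i _ => ?_
    rw [Finset.mul_sum]
    refine Finset.sum_congr rfl fun b _ => ?_
    rw [pair_smul_right, mul_assoc]
  · intro x y
    rw [Finset.sum_product_right]
    obtain ⟨b, hb, t, ht⟩ := exists_natCast_add (p := p) N x
    rw [Finset.sum_eq_single b]
    · have h1 : (p : ℤ_[p]) ^ N ∣ x - (b : ℤ_[p]) := ⟨t, by rw [ht]; ring⟩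
      have h2 : (p : ℤ_[p]) ^ N ∣ x + y - c ↔ (p : ℤ_[p]) ^ N ∣ y - (c - (b : ℤ_[p])) := by
        rw [show x + y - c = (x - (b : ℤ_[p])) + (y - (c - (b : ℤ_[p]))) by ring]
        exact dvd_add_right h1
      simp only [box, Pi.smul_apply, if_pos h1, h2, Polynomial.eval_pow, Polynomial.eval_X]
      split_ifs
      · rw [PadicInt.coe_add, iotaL_add, add_pow]
        refine Finset.sum_congr rfl fun i _ => ?_
        rw [smul_eq_mul]; ring
      · simp
    · intro d hd hdb
      refine Finset.sum_eq_zero fun i _ => ?_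
      have : ¬ (p : ℤ_[p]) ^ N ∣ x - (d : ℤ_[p]) := fun h => hdb
        (dvd_natCast_sub (p := p) (y := t) hb (Finset.mem_range.1 hd) (by rwa [← ht])).symm
      simp [box, if_neg this]
    · intro h; exact absurd (Finset.mem_range.2 hb) h

lemma pair_X_pow_mul_box_eq_zero {σ C : ℝ} (hσ : 0 ≤ σ) {w : L⟦X⟧} (hw : Growth σ C w) (m : ℕ)
    (H : ∀ (n N : ℕ) (a : ℤ_[p]), n ≤ m → pair w (box a N (Polynomial.X ^ n)) =
      pair w (box (0 : ℤ_[p]) N (Polynomial.X ^ n)))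
    (a : ℤ_[p]) (N : ℕ) (Q : Polynomial L) (hQ : Q.natDegree ≤ m) :
    pair (PowerSeries.X ^ (m + 1) * w) (box a N Q) = 0 := by
  have hbox : ∀ {w : L⟦X⟧} {C : ℝ}, Growth σ C w → ∀ (a : ℤ_[p]) (N n : ℕ) (R : Polynomial L),
      R.natDegree < n → pair w (box a N R) =
        ∑ i ∈ Finset.range n, R.coeff i * pair w (box a N (Polynomial.X ^ i)) := by
    intro w C hw a N n R hR
    have h1 : box a N R = ∑ i ∈ Finset.range n, R.coeff i • box a N (Polynomial.X ^ i) := by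
      conv_lhs => rw [R.as_sum_range' n hR]
      change boxLin a N _ = _
      rw [map_sum]
      refine Finset.sum_congr rfl fun i _ => ?_
      rw [← mul_one (R.coeff i), ← smul_eq_mul, ← Polynomial.smul_monomial, map_smul,
        Polynomial.monomial_one_right_eq_X_pow, smul_eq_mul, mul_one]
      rfl
    rw [h1, pair_sum_right hσ hw fun i _ => (isCr_box hσ _ _ _).smul _]
    simp only [pair_smul_right]
  have key : ∀ d : ℕ, (∃ C, Growth σ C (PowerSeries.X ^ d * w)) ∧ ∀ (n N : ℕ) (a : ℤ_[p]), n ≤ m →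
      pair (PowerSeries.X ^ d * w) (box a N (Polynomial.X ^ n)) =
        pair (PowerSeries.X ^ d * w) (box (0 : ℤ_[p]) N (Polynomial.X ^ n)) ∧
      (n < d → pair (PowerSeries.X ^ d * w) (box a N (Polynomial.X ^ n)) = 0) := by
    intro d
    induction d with
    | zero => exact ⟨⟨C, by simpa using hw⟩, fun n N a hn => ⟨by simpa using H n N a hn, by simp⟩⟩
    | succ d ih =>
      obtain ⟨⟨C', hC'⟩, ih⟩ := ih
      have hstep : ∀ (n N : ℕ) (a : ℤ_[p]), n ≤ m →
          pair (PowerSeries.X ^ (d + 1) * w) (box a N (Polynomial.X ^ n)) =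
          ∑ i ∈ Finset.range n, (n.choose i : L) *
            pair (PowerSeries.X ^ d * w) (box (0 : ℤ_[p]) N (Polynomial.X ^ i)) := by
        intro n N a hn
        have h1 : fwdDiff 1 (box a N (Polynomial.X ^ n : Polynomial L)) =
            box (a - 1) N ((Polynomial.X + Polynomial.C 1) ^ n) - box a N (Polynomial.X ^ n) := by
          funext z
          rw [fwdDiff, box_add_right]
          simp [iotaL]
        rw [pow_succ', mul_assoc, pair_X_mul, h1, pair_sub_right hσ hC' (isCr_box hσ _ _ _)
          (isCr_box hσ _ _ _), hbox hC' (a - 1) N (n + 1) _ (by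
            rw [Polynomial.natDegree_pow, Polynomial.natDegree_X_add_C]; omega),
          Finset.sum_range_succ, add_sub_assoc, (ih n N (a - 1) hn).1, (ih n N a hn).1]
        simp only [Polynomial.coeff_X_add_C_pow, one_pow, one_mul, Nat.choose_self, Nat.cast_one,
          sub_self, add_zero]
        refine Finset.sum_congr rfl fun i hi => ?_
        rw [(ih i N (a - 1) ((Finset.mem_range.1 hi).le.trans hn)).1]
      refine ⟨⟨_, by rw [pow_succ', mul_assoc]; exact hC'.X_mul hσ⟩, fun n N a hn =>
        ⟨by rw [hstep n N a hn, hstep n N 0 hn], fun hd => ?_⟩⟩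
      rw [hstep n N a hn]
      refine Finset.sum_eq_zero fun i hi => ?_
      have hi' := Finset.mem_range.1 hi
      rw [(ih i N 0 (by omega)).2 (by omega), mul_zero]
  obtain ⟨⟨C', hC'⟩, h1⟩ := key (m + 1)
  rw [hbox hC' a N (m + 1) Q (by omega)]
  refine Finset.sum_eq_zero fun i hi => ?_
  have hi' := Finset.mem_range.1 hi
  rw [(h1 i N a (by omega)).2 hi', mul_zero]

/-- The kernel on `ℤ_p` describing the second family in terms of the first. -/
def kerN (c0 ρ : L) (N : ℕ) (y : ℚ_[p]) : L :=
  if ‖y‖ ≤ (p : ℝ) ^ (-(N : ℤ)) then c0 * ρ ^ N else ρ ^ y.valuation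

lemma dvd_iff_norm_coe_le {N : ℕ} {z : ℤ_[p]} :
    (p : ℤ_[p]) ^ N ∣ z ↔ ‖(z : ℚ_[p])‖ ≤ (p : ℝ) ^ (-(N : ℤ)) := by
  rw [← PadicInt.norm_def, PadicInt.norm_le_pow_iff_mem_span_pow, Ideal.mem_span_singleton]

lemma kap_eq_sum (c0 ρ : L) (a : ℤ_[p]) (N : ℕ) (Q : Polynomial L) :
    kap c0 ρ (a : ℚ_[p]) N Q = ∑ d ∈ Finset.range (p ^ N),
      kerN c0 ρ N ((a : ℚ_[p]) - (d : ℚ_[p])) • bE (d : ℚ_[p]) N Q + bH ρ 0 0 Q := by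
  funext z
  rw [kap_apply, Pi.add_apply, Pi.add_apply, Finset.sum_apply]
  simp only [Pi.smul_apply, smul_eq_mul, bE_apply, bH_apply]
  have hN1 : (p : ℝ) ^ (-(N : ℤ)) ≤ 1 := by
    rw [zpow_neg, zpow_natCast]
    exact inv_le_one_of_one_le₀ (one_le_pow₀ one_lt_p.le)
  have h00 : (p : ℝ) ^ (-(0 : ℤ)) = 1 := by simp
  by_cases hz : ‖z‖ ≤ 1
  · obtain ⟨z, rfl⟩ : ∃ y : ℤ_[p], (y : ℚ_[p]) = z := ⟨⟨z, hz⟩, rfl⟩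
    obtain ⟨b, hb, t, ht⟩ := exists_natCast_add (p := p) N z
    have hzb : ‖(z : ℚ_[p]) - (b : ℚ_[p])‖ ≤ (p : ℝ) ^ (-(N : ℤ)) := by
      have := (dvd_iff_norm_coe_le (p := p) (N := N) (z := z - b)).1 ⟨t, by rw [ht]; ring⟩
      simpa using this
    rw [Finset.sum_eq_single b, if_pos hzb, sub_zero, h00, if_pos (c := ‖(z : ℚ_[p])‖ ≤ 1)
      (PadicInt.norm_le_one z), add_zero, kerN]
    · have h3 : ‖(a : ℚ_[p]) - (b : ℚ_[p])‖ ≤ (p : ℝ) ^ (-(N : ℤ)) ↔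
          ‖(z : ℚ_[p]) - (a : ℚ_[p])‖ ≤ (p : ℝ) ^ (-(N : ℤ)) := by
        rw [norm_sub_rev (z : ℚ_[p])]
        exact padic_norm_sub_le_iff (z := (a : ℚ_[p])) (by rwa [norm_sub_rev])
      by_cases h4 : ‖(z : ℚ_[p]) - (a : ℚ_[p])‖ ≤ (p : ℝ) ^ (-(N : ℤ))
      · rw [if_pos h4, if_pos h4, if_pos (h3.2 h4), add_zero, zpow_natCast]
      · rw [if_neg h4, if_neg h4, if_neg (fun h => h4 (h3.1 h)), mul_zero, zero_add]
        congr 2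
        refine valuation_eq_of_norm_eq ?_
        have h5 : ¬ ‖(a : ℚ_[p]) - (z : ℚ_[p])‖ ≤ (p : ℝ) ^ (-(N : ℤ)) := by
          rwa [norm_sub_rev]
        rw [norm_sub_rev, padic_norm_sub_eq hzb h5]
    · intro d hd hdb
      rw [if_neg, mul_zero]
      intro h
      refine hdb (dvd_natCast_sub (p := p) (y := t) hb (Finset.mem_range.1 hd) ?_).symm
      rw [← ht, dvd_iff_norm_coe_le]
      simpa using h
    · intro h; exact absurd (Finset.mem_range.2 hb) h
  · have hza : ‖z - (a : ℚ_[p])‖ = ‖z‖ := by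
      have := padic_norm_sub_eq (b := (0 : ℚ_[p])) (b' := (a : ℚ_[p])) (z := z) (c := 1)
        (by simpa using PadicInt.norm_le_one a) (by simpa using hz)
      rw [← this, sub_zero]
    rw [if_neg (by rw [hza]; exact fun h => hz (h.trans hN1)), if_neg (by
      rw [hza]; exact fun h => hz (h.trans hN1)), mul_zero, zero_add, Finset.sum_eq_zero, zero_add,
      sub_zero, h00, if_neg hz, valuation_eq_of_norm_eq hza]
    intro d _
    rw [if_neg, mul_zero]
    intro h
    refine hz ?_
    have := padic_norm_sub_le (x := z) (y := (d : ℚ_[p])) (z := 0) (c := 1) (h.trans hN1)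
      (by simpa using padic_norm_natCast_le d)
    simpa using this

variable {h : ℕ} {r s : ℝ} {ρ c0 : L} {μ ν : (ℚ_[p] → L) →ₗ[L] L} {P P' : ℝ}

lemma box_congr {a a' : ℤ_[p]} {N : ℕ} (h : (p : ℤ_[p]) ^ N ∣ a - a') (Q : Polynomial L) :
    box a N Q = box a' N Q := by
  funext z
  have : (p : ℤ_[p]) ^ N ∣ z - a ↔ (p : ℤ_[p]) ^ N ∣ z - a' := by
    rw [show z - a' = (z - a) + (a - a') by ring]
    exact (dvd_add_left h).symm
  simp only [box, this]

/-- A summand of the pairing of a determinant with a monomial on a ball. -/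
def detTerm (p : ℕ) [Fact p.Prime] {L : Type} [NontriviallyNormedField L] [NormedAlgebra ℚ_[p] L]
    (w₁ w₂ v₁ v₂ : L⟦X⟧) (N i j : ℕ) (c : ℤ_[p]) : L :=
  ∑ b ∈ Finset.range (p ^ N),
    (pair w₁ (box (b : ℤ_[p]) N (Polynomial.X ^ i)) *
      pair v₂ (box (c - (b : ℤ_[p])) N (Polynomial.X ^ j)) -
    pair w₂ (box (b : ℤ_[p]) N (Polynomial.X ^ i)) *
      pair v₁ (box (c - (b : ℤ_[p])) N (Polynomial.X ^ j)))

lemma detTerm_eq (hP : Params p h r s ρ c0) (H : Bd h r s ρ μ P) (H' : Bd h r s ρ ν P')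
    (N : ℕ) {i j : ℕ} (hi : i ≤ h) (hj : j ≤ h) (c : ℤ_[p]) :
    detTerm p (wA h r μ) (wB h s c0 ρ μ) (wA h r ν) (wB h s c0 ρ ν) N i j c =
      (p : L) ^ (-(N : ℤ)) *
        ((∑ b ∈ Finset.range (p ^ N), lamA μ (b : ℚ_[p]) N (Polynomial.X ^ i)) *
          ν (bH ρ 0 0 (Polynomial.X ^ j)) -
        (∑ b ∈ Finset.range (p ^ N), lamA ν (b : ℚ_[p]) N (Polynomial.X ^ j)) *
          μ (bH ρ 0 0 (Polynomial.X ^ i))) := by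
  have hdeg : ∀ {i : ℕ}, i ≤ h → (Polynomial.X ^ i : Polynomial L).natDegree ≤ h := fun {i} hi => by
    rwa [Polynomial.natDegree_X_pow]
  have hB : ∀ {μ : (ℚ_[p] → L) →ₗ[L] L} {P : ℝ}, Bd h r s ρ μ P → ∀ {i : ℕ}, i ≤ h → ∀ a : ℤ_[p],
      pair (wB h s c0 ρ μ) (box a N (Polynomial.X ^ i)) = (p : L) ^ (-(N : ℤ)) *
        (∑ d ∈ Finset.range (p ^ N), kerN c0 ρ N ((a : ℚ_[p]) - (d : ℚ_[p])) *
          lamA μ (d : ℚ_[p]) N (Polynomial.X ^ i) + μ (bH ρ 0 0 (Polynomial.X ^ i))) := by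
    intro μ P H i hi a
    rw [H.pairB hP a N _ (hdeg hi), lamB_apply, kap_eq_sum, map_add, map_sum]
    simp only [map_smul, smul_eq_mul, lamA_apply]
  have hA : ∀ {μ : (ℚ_[p] → L) →ₗ[L] L} {P : ℝ}, Bd h r s ρ μ P → ∀ {i : ℕ}, i ≤ h → ∀ b : ℕ,
      pair (wA h r μ) (box (b : ℤ_[p]) N (Polynomial.X ^ i)) =
        lamA μ (b : ℚ_[p]) N (Polynomial.X ^ i) := by
    intro μ P H i hi b
    rw [H.pairA hP _ N _ (hdeg hi), PadicInt.coe_natCast]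
  rw [detTerm, Finset.sum_sub_distrib]
  have h2 : ∑ b ∈ Finset.range (p ^ N), pair (wB h s c0 ρ μ) (box (b : ℤ_[p]) N (Polynomial.X ^ i)) *
      pair (wA h r ν) (box (c - (b : ℤ_[p])) N (Polynomial.X ^ j)) =
      ∑ b ∈ Finset.range (p ^ N),
        pair (wB h s c0 ρ μ) (box (c - (b : ℤ_[p])) N (Polynomial.X ^ i)) *
          pair (wA h r ν) (box (b : ℤ_[p]) N (Polynomial.X ^ j)) := by
    rw [sum_range_reflect_of_periodic N (fun b => pair (wB h s c0 ρ μ) (box b N (Polynomial.X ^ i)) *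
      pair (wA h r ν) (box (c - b) N (Polynomial.X ^ j))) _ c]
    · simp only [sub_sub_cancel]
    · intro x y hxy
      rw [box_congr hxy, box_congr (a := c - x) (a' := c - y)]
      rw [← dvd_neg]
      convert hxy using 1
      ring
  rw [h2]
  simp only [hA H hi, hA H' hj, hB H hi, hB H' hj, PadicInt.coe_sub, PadicInt.coe_natCast]
  simp only [mul_add, add_mul, Finset.sum_add_distrib, Finset.mul_sum, Finset.sum_mul, mul_sub,
    Finset.sum_sub_distrib]
  rw [Finset.sum_comm (s := Finset.range (p ^ N)) (t := Finset.range (p ^ N)) (f := fun b d =>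
    (p : L) ^ (-(N : ℤ)) * (kerN c0 ρ N ((c : ℚ_[p]) - (b : ℚ_[p]) - (d : ℚ_[p])) *
      lamA μ (d : ℚ_[p]) N (Polynomial.X ^ i)) * lamA ν (b : ℚ_[p]) N (Polynomial.X ^ j))]
  have h3 : ∀ x ∈ Finset.range (p ^ N), ∀ y ∈ Finset.range (p ^ N),
      lamA μ (x : ℚ_[p]) N (Polynomial.X ^ i) * ((p : L) ^ (-(N : ℤ)) *
        (kerN c0 ρ N ((c : ℚ_[p]) - (x : ℚ_[p]) - (y : ℚ_[p])) *
          lamA ν (y : ℚ_[p]) N (Polynomial.X ^ j))) =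
      (p : L) ^ (-(N : ℤ)) * (kerN c0 ρ N ((c : ℚ_[p]) - (y : ℚ_[p]) - (x : ℚ_[p])) *
      lamA μ (x : ℚ_[p]) N (Polynomial.X ^ i)) * lamA ν (y : ℚ_[p]) N (Polynomial.X ^ j) := by
    intro x _ y _
    rw [sub_right_comm]
    ring
  rw [Finset.sum_congr rfl fun x hx => Finset.sum_congr rfl (h3 x hx)]
  rw [add_sub_add_left_eq_sub]
  congr 1 <;> refine Finset.sum_congr rfl fun x _ => by ring

/-- The determinant of the two power series attached to two functionals. -/
def detW (h : ℕ) (r s : ℝ) (c0 ρ : L) (μ ν : (ℚ_[p] → L) →ₗ[L] L) : L⟦X⟧ :=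
  wA h r μ * wB h s c0 ρ ν - wB h s c0 ρ μ * wA h r ν

/-- The growth constant of determinants. -/
def detConst (p : ℕ) [Fact p.Prime] (L : Type) [NontriviallyNormedField L] [NormedAlgebra ℚ_[p] L]
    [IsUltrametricDist L] [CompleteSpace L] (h : ℕ) (r s : ℝ) (c0 : L) : ℝ :=
  2 * (amiceConst p L h r * (amiceConst p L h s * max 1 ‖c0‖))

lemma detConst_nonneg (h : ℕ) (r s : ℝ) (c0 : L) : 0 ≤ detConst p L h r s c0 := by
  have h1 := amiceConst_nonneg p L h r
  have h2 := amiceConst_nonneg p L h s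
  rw [detConst]
  positivity

lemma Bd.growth_detW (hP : Params p h r s ρ c0) (H : Bd h r s ρ μ P) (H' : Bd h r s ρ ν P') :
    Growth ((h + 1 : ℕ) : ℝ) (detConst p L h r s c0 * (P * P')) (detW h r s c0 ρ μ ν) := by
  have h1 := (H.growthA hP).mul hP.r_pos.le hP.s_pos.le (H'.growthB hP)
  have h2 := (H.growthB hP).mul hP.s_pos.le hP.r_pos.le (H'.growthA hP)
  rw [add_comm s r] at h2
  refine (h1.sub h2).mono (by rw [hP.sum_eq]; push_cast; rfl) (le_of_eq ?_)
  rw [detConst]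
  ring

lemma Bd.pair_detW (hP : Params p h r s ρ c0) (H : Bd h r s ρ μ P) (H' : Bd h r s ρ ν P')
    (c : ℤ_[p]) (N n : ℕ) :
    pair (detW h r s c0 ρ μ ν) (box c N (Polynomial.X ^ n)) =
      ∑ i ∈ Finset.range (n + 1), (n.choose i : L) *
        detTerm p (wA h r μ) (wB h s c0 ρ μ) (wA h r ν) (wB h s c0 ρ ν) N i (n - i) c := by
  have h1 := (H.growthA hP).mul hP.r_pos.le hP.s_pos.le (H'.growthB hP)
  have h2 := (H.growthB hP).mul hP.s_pos.le hP.r_pos.le (H'.growthA hP)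
  rw [add_comm s r] at h2
  have h0 : 0 ≤ r + s := add_nonneg hP.r_pos.le hP.s_pos.le
  rw [detW, pair_sub_left h0 h1 h2 (isCr_box h0 _ _ _),
    pair_mul_box hP.r_pos.le hP.s_pos.le (H.growthA hP) (H'.growthB hP),
    pair_mul_box hP.s_pos.le hP.r_pos.le (H.growthB hP) (H'.growthA hP), ← Finset.sum_sub_distrib]
  refine Finset.sum_congr rfl fun i _ => ?_
  rw [← mul_sub, ← Finset.sum_sub_distrib]
  rfl

lemma Bd.pair_X_pow_mul_detW (hP : Params p h r s ρ c0) (H : Bd h r s ρ μ P) (H' : Bd h r s ρ ν P')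
    (a : ℤ_[p]) (N : ℕ) (Q : Polynomial L) (hQ : Q.natDegree < h + 1) :
    pair (PowerSeries.X ^ (h + 1) * detW h r s c0 ρ μ ν) (box a N Q) = 0 := by
  refine pair_X_pow_mul_box_eq_zero (Nat.cast_nonneg _) (H.growth_detW hP H') h
    (fun n N a hn => ?_) a N Q (by omega)
  rw [H.pair_detW hP H', H.pair_detW hP H']
  refine Finset.sum_congr rfl fun i hi => ?_
  have hi' := Finset.mem_range.1 hi
  rw [detTerm_eq hP H H' N (by omega) (by omega), detTerm_eq hP H H' N (by omega) (by omega)]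

lemma Bd.detW_eq_zero_of_const (hP : Params p h r s ρ c0) (H : Bd h r s ρ μ P)
    (H' : Bd h r s ρ ν P')
    (h1 : ∀ (a : ℤ_[p]) (N : ℕ), lamA μ (a : ℚ_[p]) N 1 = lamA μ 0 N 1)
    (h2 : ∀ (a : ℤ_[p]) (N : ℕ), lamB c0 ρ μ (a : ℚ_[p]) N 1 = lamB c0 ρ μ 0 N 1)
    (h3 : ∀ (a : ℤ_[p]) (N : ℕ), lamA ν (a : ℚ_[p]) N 1 = lamA ν 0 N 1)
    (h4 : ∀ (a : ℤ_[p]) (N : ℕ), lamB c0 ρ ν (a : ℚ_[p]) N 1 = lamB c0 ρ ν 0 N 1) :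
    detW h r s c0 ρ μ ν = 0 := by
  have hg := H.growth_detW hP H'
  have hdeg : (1 : Polynomial L).natDegree ≤ h := by simp
  have key : ∀ (a : ℤ_[p]) (N : ℕ) (Q : Polynomial L), Q.natDegree ≤ h + 1 →
      pair (PowerSeries.X ^ (h + 2) * detW h r s c0 ρ μ ν) (box a N Q) = 0 := by
    refine pair_X_pow_mul_box_eq_zero (Nat.cast_nonneg _) hg (h + 1) (fun n N a hn => ?_)
    rw [H.pair_detW hP H', H.pair_detW hP H']
    refine Finset.sum_congr rfl fun i hi => ?_
    have hi' := Finset.mem_range.1 hi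
    by_cases hih : i ≤ h ∧ n - i ≤ h
    · rw [detTerm_eq hP H H' N hih.1 hih.2, detTerm_eq hP H H' N hih.1 hih.2]
    · congr 1
      have hA1 : ∀ a : ℤ_[p], pair (wA h r μ) (box a N (Polynomial.X ^ 0)) = lamA μ 0 N 1 :=
        fun a => by rw [pow_zero, H.pairA hP a N 1 hdeg, h1]
      have hB1 : ∀ a : ℤ_[p], pair (wB h s c0 ρ μ) (box a N (Polynomial.X ^ 0)) =
        lamB c0 ρ μ 0 N 1 := fun a => by rw [pow_zero, H.pairB hP a N 1 hdeg, h2]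
      have hA2 : ∀ a : ℤ_[p], pair (wA h r ν) (box a N (Polynomial.X ^ 0)) = lamA ν 0 N 1 :=
        fun a => by rw [pow_zero, H'.pairA hP a N 1 hdeg, h3]
      have hB2 : ∀ a : ℤ_[p], pair (wB h s c0 ρ ν) (box a N (Polynomial.X ^ 0)) =
        lamB c0 ρ ν 0 N 1 := fun a => by rw [pow_zero, H'.pairB hP a N 1 hdeg, h4]
      by_cases hi0 : i = 0
      · subst hi0
        simp only [detTerm, hA1, hB1, Finset.sum_sub_distrib, ← Finset.mul_sum]
        have hper : ∀ (w : L⟦X⟧) (c : ℤ_[p]), ∑ b ∈ Finset.range (p ^ N),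
            pair w (box (c - (b : ℤ_[p])) N (Polynomial.X ^ (n - 0))) =
            ∑ b ∈ Finset.range (p ^ N), pair w (box (b : ℤ_[p]) N (Polynomial.X ^ (n - 0))) :=
          fun w c => (sum_range_reflect_of_periodic N
            (fun b => pair w (box b N (Polynomial.X ^ (n - 0))))
            (fun x y hxy => by rw [box_congr hxy]) c).symm
        rw [hper _ a, hper _ a, hper _ 0, hper _ 0]
      · have hni : n - i = 0 := by omega
        simp only [detTerm, hni, hA2, hB2]
  have hX : ∃ C, Growth ((h + 1 : ℕ) : ℝ) C (PowerSeries.X ^ (h + 2) * detW h r s c0 ρ μ ν) := by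
    generalize h + 2 = d
    induction d with
    | zero => exact ⟨_, by simpa using hg⟩
    | succ d ih =>
      obtain ⟨C, hC⟩ := ih
      exact ⟨C, by rw [pow_succ', mul_assoc]; exact hC.X_mul (Nat.cast_nonneg _)⟩
  obtain ⟨C, hC⟩ := hX
  have := eq_zero_of_pair_box (Nat.cast_nonneg _) hC (J := h + 1) (by push_cast; linarith)
    (fun a N Q hQ => key a (N + 1) Q (by omega))
  exact (mul_eq_zero.1 this).resolve_left (pow_ne_zero _ PowerSeries.X_ne_zero)

end Det

section Family

open scoped PowerSeries
open PowerSeries (coeff)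

variable {p : ℕ} [hp : Fact p.Prime] {L : Type} [NontriviallyNormedField L]
  [NormedAlgebra ℚ_[p] L] [IsUltrametricDist L] [CompleteSpace L]
variable {h : ℕ} {r s : ℝ} {ρ c0 : L} {μ ν : (ℚ_[p] → L) →ₗ[L] L} {P P' : ℝ}

lemma linearMap_poly_eq_sum (φ : Polynomial L →ₗ[L] L) {Q : Polynomial L} {n : ℕ}
    (hQ : Q.natDegree < n) : φ Q = ∑ i ∈ Finset.range n, Q.coeff i * φ (Polynomial.X ^ i) := by
  conv_lhs => rw [Q.as_sum_range' n hQ]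
  rw [map_sum]
  refine Finset.sum_congr rfl fun i _ => ?_
  rw [← mul_one (Q.coeff i), ← smul_eq_mul, ← Polynomial.smul_monomial, map_smul,
    Polynomial.monomial_one_right_eq_X_pow, smul_eq_mul, smul_eq_mul, mul_one]

lemma linearMap_poly_eq_zero {φ : Polynomial L →ₗ[L] L} {Q : Polynomial L} {n : ℕ}
    (hQ : Q.natDegree < n) (hφ : ∀ j < n, φ (Polynomial.X ^ j) = 0) : φ Q = 0 := by
  rw [linearMap_poly_eq_sum φ hQ]
  exact Finset.sum_eq_zero fun i hi => by rw [hφ i (Finset.mem_range.1 hi), mul_zero]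

lemma linearMap_affP_X_pow {φ : Polynomial L →ₗ[L] L} {a : ℕ}
    (hφ : ∀ j < a, φ (Polynomial.X ^ j) = 0) (d e : ℚ_[p]) :
    φ (affP d e (Polynomial.X ^ a)) = (iotaL p L d) ^ a * φ (Polynomial.X ^ a) := by
  rw [linearMap_poly_eq_sum φ (Nat.lt_succ_of_le (natDegree_affP_le d e
    (Polynomial.natDegree_X_pow_le a))), Finset.sum_range_succ, Finset.sum_eq_zero, zero_add]
  · congr 1
    rw [affP, Polynomial.pow_comp, Polynomial.X_comp]
    have := Polynomial.coeff_pow_of_natDegree_le (p := Polynomial.C (iotaL p L d) * Polynomial.X +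
      Polynomial.C (iotaL p L e)) (n := 1) (m := a) (Polynomial.natDegree_linear_le)
    rw [mul_one] at this
    rw [this]
    simp
  · intro i hi
    rw [hφ i (Finset.mem_range.1 hi), mul_zero]

/-- A space of functionals with controlled growth, stable under affine substitutions. -/
structure AffFam (h : ℕ) (r s : ℝ) (ρ : L) (F : Submodule L ((ℚ_[p] → L) →ₗ[L] L)) : Prop where
  exists_bd : ∀ μ ∈ F, ∃ P, Bd h r s ρ μ P
  comp_mem : ∀ μ ∈ F, ∀ d : ℚ_[p], d ≠ 0 → ∀ e, μ ∘ₗ affT d e ∈ F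

variable {F : Submodule L ((ℚ_[p] → L) →ₗ[L] L)}

lemma AffFam.sub_mem (hF : AffFam h r s ρ F) (hμ : μ ∈ F) (c : ℕ) : subF c μ ∈ F :=
  hF.comp_mem μ hμ _ (inv_ne_zero pQ_ne_zero) _

lemma exists_affP_eq (b : ℚ_[p]) (n : ℤ) {a : ℕ} {Q : Polynomial L} (hQ : Q.natDegree < a) :
    ∃ d e : ℚ_[p], d ≠ 0 ∧ (0 - e) / d = b ∧ 0 - d.valuation = n ∧
      ∃ Q' : Polynomial L, Q'.natDegree < a ∧ affP d e Q' = Q := by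
  have hd : (p : ℚ_[p]) ^ (-n) ≠ 0 := zpow_ne_zero _ pQ_ne_zero
  refine ⟨(p : ℚ_[p]) ^ (-n), -b * (p : ℚ_[p]) ^ (-n), hd, by field_simp; ring, by simp,
    affP ((p : ℚ_[p]) ^ (-n))⁻¹ b Q, lt_of_le_of_lt (natDegree_affP_le _ _ le_rfl) hQ, ?_⟩
  rw [affP_affP, inv_mul_cancel₀ hd]
  convert affP_one_zero Q using 2
  field_simp
  ring

lemma AffFam.lamA_eq_zero (hF : AffFam h r s ρ F) {a : ℕ}
    (h0 : ∀ μ ∈ F, ∀ j < a, lamA μ 0 0 (Polynomial.X ^ j) = 0) (hμ : μ ∈ F) (b : ℚ_[p]) (n : ℤ)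
    {Q : Polynomial L} (hQ : Q.natDegree < a) : lamA μ b n Q = 0 := by
  obtain ⟨d, e, hd, rfl, rfl, Q', hQ', rfl⟩ := exists_affP_eq b n hQ
  rw [← lamA_comp_affT μ hd]
  exact linearMap_poly_eq_zero hQ' fun j hj => h0 _ (hF.comp_mem μ hμ d hd e) j hj

lemma AffFam.lamB_eq_zero (hP : Params p h r s ρ c0) (hF : AffFam h r s ρ F) {a : ℕ}
    (h0 : ∀ μ ∈ F, ∀ j < a, lamB c0 ρ μ 0 0 (Polynomial.X ^ j) = 0) (hμ : μ ∈ F) (b : ℚ_[p]) (n : ℤ)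
    {Q : Polynomial L} (hQ : Q.natDegree < a) : lamB c0 ρ μ b n Q = 0 := by
  obtain ⟨d, e, hd, rfl, rfl, Q', hQ', rfl⟩ := exists_affP_eq b n hQ
  have h1 := lamB_comp_affT (c0 := c0) hP.rho_ne_zero μ hd e 0 0 Q'
  rw [linearMap_poly_eq_zero hQ' fun j hj => h0 _ (hF.comp_mem μ hμ d hd e) j hj] at h1
  exact (mul_eq_zero.1 h1.symm).resolve_left
    (zpow_ne_zero _ (div_ne_zero hP.rho_ne_zero (pL_ne_zero (p := p))))

lemma Params.norm_rho_lt_one (hP : Params p h r s ρ c0) : ‖ρ‖ < 1 := by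
  rw [hP.norm_rho]
  refine Real.rpow_lt_one_of_one_lt_of_neg one_lt_p ?_
  have := hP.s_le
  linarith

lemma Params.c0_ne_one (hP : Params p h r s ρ c0) : c0 ≠ 1 := by
  intro h1
  have h2 := hP.c0_eq
  rw [h1, one_mul, sub_right_inj] at h2
  have := hP.norm_rho_lt_one
  rw [h2, norm_one] at this
  exact lt_irrefl _ this

lemma lamA_eq_p_mul (hP : Params p h r s ρ c0) {Q : Polynomial L} {b : ℚ_[p]}
    (h0 : ∀ n, lamB c0 ρ μ b n Q = 0) (n : ℤ) : lamA μ b n Q = p * lamA μ b (n + 1) Q := by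
  have hpL : (p : L) ≠ 0 := pL_ne_zero (p := p)
  have h1 : ∀ n, μ (kap c0 ρ b n Q) = 0 := fun n => by
    have := h0 n
    rw [lamB_apply] at this
    exact (mul_eq_zero.1 this).resolve_left (zpow_ne_zero _ hpL)
  have h2 := h1 n
  have h3 := h1 (n + 1)
  rw [kap_apply, map_add, map_smul, smul_eq_mul] at h2
  rw [kap_apply, bH_succ, map_add, map_add, map_smul, map_smul, map_sub, smul_eq_mul, smul_eq_mul,
    zpow_add_one₀ hP.rho_ne_zero] at h3
  have h4 : (c0 - 1) * ρ ^ n * (lamA μ b n Q - p * lamA μ b (n + 1) Q) = 0 := by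
    rw [lamA_apply, lamA_apply]
    linear_combination h2 - h3 - hP.c0_eq * (ρ ^ n * μ (bE b (n + 1) Q))
  have h5 := (mul_eq_zero.1 h4).resolve_left
    (mul_ne_zero (sub_ne_zero.2 hP.c0_ne_one) (zpow_ne_zero _ hP.rho_ne_zero))
  exact sub_eq_zero.1 h5

lemma lamA_eq_pow_mul (hP : Params p h r s ρ c0) {Q : Polynomial L} {b : ℚ_[p]}
    (h0 : ∀ n, lamB c0 ρ μ b n Q = 0) (N : ℕ) : lamA μ b 0 Q = (p : L) ^ N * lamA μ b N Q := by
  induction N with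
  | zero => simp
  | succ N ih => rw [ih, lamA_eq_p_mul hP h0, pow_succ, mul_assoc]; push_cast; rfl

lemma lamA_zero_congr (a : ℤ_[p]) (Q : Polynomial L) : lamA μ (a : ℚ_[p]) 0 Q = lamA μ 0 0 Q := by
  rw [lamA_apply, lamA_apply, bE_congr (b := (a : ℚ_[p])) (b' := 0)]
  simpa using PadicInt.norm_le_one a

lemma AffFam.detW_eq_zero_of_A (hP : Params p h r s ρ c0) (hF : AffFam h r s ρ F)
    (h0 : ∀ μ ∈ F, lamA μ 0 0 1 = 0) (hμ : μ ∈ F) (hν : ν ∈ F) : detW h r s c0 ρ μ ν = 0 := by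
  obtain ⟨P, H⟩ := hF.exists_bd μ hμ
  obtain ⟨P', H'⟩ := hF.exists_bd ν hν
  have hA : ∀ μ ∈ F, ∀ b n, lamA μ b n 1 = 0 := fun μ hμ b n => by
    refine hF.lamA_eq_zero (a := 1) (fun μ hμ j hj => ?_) hμ b n (by simp)
    rw [Nat.lt_one_iff.1 hj, pow_zero, h0 μ hμ]
  have hB : ∀ μ ∈ F, ∀ (a : ℤ_[p]) (N : ℕ), lamB c0 ρ μ (a : ℚ_[p]) N 1 =
      (p : L) ^ (-(N : ℤ)) * μ (bH ρ 0 0 1) := fun μ hμ a N => by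
    rw [lamB_apply, kap_eq_sum, map_add, map_sum, Finset.sum_eq_zero, zero_add]
    intro d _
    rw [map_smul, ← lamA_apply, hA μ hμ, smul_zero]
  refine H.detW_eq_zero_of_const hP H' (fun a N => ?_) (fun a N => ?_) (fun a N => ?_) fun a N => ?_
  · rw [hA μ hμ, hA μ hμ]
  · have := hB μ hμ 0 N
    rw [PadicInt.coe_zero] at this
    rw [hB μ hμ, this]
  · rw [hA ν hν, hA ν hν]
  · have := hB ν hν 0 N
    rw [PadicInt.coe_zero] at this
    rw [hB ν hν, this]

lemma AffFam.detW_eq_zero_of_B (hP : Params p h r s ρ c0) (hF : AffFam h r s ρ F)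
    (h0 : ∀ μ ∈ F, lamB c0 ρ μ 0 0 1 = 0) (hμ : μ ∈ F) (hν : ν ∈ F) :
    detW h r s c0 ρ μ ν = 0 := by
  obtain ⟨P, H⟩ := hF.exists_bd μ hμ
  obtain ⟨P', H'⟩ := hF.exists_bd ν hν
  have hpL : (p : L) ≠ 0 := pL_ne_zero (p := p)
  have hB : ∀ μ ∈ F, ∀ b n, lamB c0 ρ μ b n 1 = 0 := fun μ hμ b n => by
    refine hF.lamB_eq_zero hP (a := 1) (fun μ hμ j hj => ?_) hμ b n (by simp)
    rw [Nat.lt_one_iff.1 hj, pow_zero, h0 μ hμ]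
  have hA : ∀ μ ∈ F, ∀ (a : ℤ_[p]) (N : ℕ), lamA μ (a : ℚ_[p]) N 1 = lamA μ 0 N 1 :=
    fun μ hμ a N => by
      have h1 := lamA_eq_pow_mul hP (hB μ hμ (a : ℚ_[p])) N
      rw [lamA_zero_congr, lamA_eq_pow_mul hP (hB μ hμ 0) N] at h1
      exact (mul_left_cancel₀ (pow_ne_zero _ hpL) h1).symm
  refine H.detW_eq_zero_of_const hP H' (hA μ hμ) (fun a N => ?_) (hA ν hν) fun a N => ?_
  · rw [hB μ hμ, hB μ hμ]
  · rw [hB ν hν, hB ν hν]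

lemma AffFam.lamA_X_pow_eq_sum (hF : AffFam h r s ρ F) {a : ℕ}
    (h0 : ∀ μ ∈ F, ∀ j < a, lamA μ 0 0 (Polynomial.X ^ j) = 0) (hμ : μ ∈ F) :
    lamA μ 0 0 (Polynomial.X ^ a) =
      (p : L) ^ a * ∑ c ∈ Finset.range p, lamA (subF c μ) 0 0 (Polynomial.X ^ a) := by
  obtain ⟨P, H⟩ := hF.exists_bd μ hμ
  rw [H.gsysA.add 0 0, Finset.mul_sum]
  refine Finset.sum_congr rfl fun c _ => ?_
  have := lamA_sub μ c 0 0 (Polynomial.X ^ a)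
  rw [mul_zero, add_zero, one_mul, linearMap_affP_X_pow (h0 _ (hF.sub_mem hμ c))] at this
  rw [zpow_zero, mul_one, zero_add (c : ℚ_[p]), this]
  simp [iotaL]

lemma AffFam.lamB_X_pow_eq_sum (hP : Params p h r s ρ c0) (hF : AffFam h r s ρ F) {a : ℕ}
    (h0 : ∀ μ ∈ F, ∀ j < a, lamB c0 ρ μ 0 0 (Polynomial.X ^ j) = 0) (hμ : μ ∈ F) :
    lamB c0 ρ μ 0 0 (Polynomial.X ^ a) =
      (ρ / p) * ((p : L) ^ a * ∑ c ∈ Finset.range p, lamB c0 ρ (subF c μ) 0 0 (Polynomial.X ^ a)) := by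
  obtain ⟨P, H⟩ := hF.exists_bd μ hμ
  rw [(H.gsysB hP).add 0 0, Finset.mul_sum, Finset.mul_sum]
  refine Finset.sum_congr rfl fun c _ => ?_
  have := lamB_sub (c0 := c0) hP.rho_ne_zero μ c 0 0 (Polynomial.X ^ a)
  rw [mul_zero, add_zero, linearMap_affP_X_pow (h0 _ (hF.sub_mem hμ c))] at this
  rw [zpow_zero, mul_one, zero_add (c : ℚ_[p]), this]
  simp [iotaL]

lemma AffFam.not_proportional (hP : Params p h r s ρ c0) (hF : AffFam h r s ρ F) {a : ℕ}
    (hA : ∀ μ ∈ F, ∀ j < a, lamA μ 0 0 (Polynomial.X ^ j) = 0)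
    (hB : ∀ μ ∈ F, ∀ j < a, lamB c0 ρ μ 0 0 (Polynomial.X ^ j) = 0)
    (hA' : ∃ μ ∈ F, lamA μ 0 0 (Polynomial.X ^ a) ≠ 0)
    (hB' : ∃ μ ∈ F, lamB c0 ρ μ 0 0 (Polynomial.X ^ a) ≠ 0)
    (hdet : ∀ μ ∈ F, ∀ ν ∈ F, lamA μ 0 0 (Polynomial.X ^ a) * lamB c0 ρ ν 0 0 (Polynomial.X ^ a) =
      lamB c0 ρ μ 0 0 (Polynomial.X ^ a) * lamA ν 0 0 (Polynomial.X ^ a)) : False := by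
  have hpL : (p : L) ≠ 0 := pL_ne_zero (p := p)
  obtain ⟨μ, hμ, hμ0⟩ := hA'
  obtain ⟨ν, hν, hν0⟩ := hB'
  set κ := lamB c0 ρ μ 0 0 (Polynomial.X ^ a) / lamA μ 0 0 (Polynomial.X ^ a) with hκ
  have h1 : ∀ ν ∈ F, lamB c0 ρ ν 0 0 (Polynomial.X ^ a) = κ * lamA ν 0 0 (Polynomial.X ^ a) :=
    fun ν hν => by
      rw [hκ, div_mul_eq_mul_div, eq_div_iff hμ0, mul_comm, hdet μ hμ ν hν]
  have h2 := hF.lamB_X_pow_eq_sum hP hB hν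
  rw [Finset.sum_congr rfl fun c _ => h1 _ (hF.sub_mem hν c), ← Finset.mul_sum, mul_left_comm _ κ,
    ← hF.lamA_X_pow_eq_sum hA hν, ← h1 ν hν] at h2
  have h3 : ρ / p = 1 := mul_right_cancel₀ hν0 (by rw [← h2, one_mul])
  exact hP.rho_ne (by rwa [div_eq_one_iff_eq hpL] at h3)

lemma AffFam.exists_lamB_ne_zero (hP : Params p h r s ρ c0) (hF : AffFam h r s ρ F)
    (h0 : ∃ μ ∈ F, ∃ j ≤ h, lamA μ 0 0 (Polynomial.X ^ j) ≠ 0) :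
    ∃ μ ∈ F, ∃ j ≤ h, lamB c0 ρ μ 0 0 (Polynomial.X ^ j) ≠ 0 := by
  by_contra! hB
  obtain ⟨μ, hμ, j, hj, hne⟩ := h0
  obtain ⟨P, H⟩ := hF.exists_bd μ hμ
  have hB' : ∀ b n {Q : Polynomial L}, Q.natDegree ≤ h → lamB c0 ρ μ b n Q = 0 := fun b n Q hQ =>
    hF.lamB_eq_zero hP (a := h + 1) (fun μ hμ j hj => hB μ hμ j (by omega)) hμ b n (by omega)
  have h1 : ∀ b : ℚ_[p], lamA μ b 0 (cpow L b h) = 0 := by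
    intro b
    have hle : ∀ N : ℕ, ‖lamA μ b 0 (cpow L b h)‖ ≤ P * ((p : ℝ) ^ (r - h - 1)) ^ N := by
      intro N
      rw [lamA_eq_pow_mul hP (fun n => hB' b n (natDegree_cpow_le b h)) N, norm_mul, norm_pow,
        norm_pL]
      have h2 := H.bE_le b N h le_rfl
      rw [← lamA_apply] at h2
      refine (mul_le_mul_of_nonneg_left h2 (by positivity)).trans (le_of_eq ?_)
      rw [rpow_zpow_mul, zpow_natCast, mul_left_comm, ← mul_pow, Real.rpow_sub_one p_pos.ne']
      congr 2
      field_simp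
    have hlim : Tendsto (fun N : ℕ => P * ((p : ℝ) ^ (r - h - 1)) ^ N) atTop (𝓝 (P * 0)) :=
      (tendsto_pow_atTop_nhds_zero_of_lt_one (Real.rpow_nonneg p_pos.le _)
        (Real.rpow_lt_one_of_one_lt_of_neg one_lt_p (by have := hP.r_lt; linarith))).const_mul P
    rw [mul_zero] at hlim
    exact norm_le_zero_iff.1 (ge_of_tendsto' hlim hle)
  haveI := charZero_L p L
  let R : Polynomial L := ∑ i ∈ Finset.range (h + 1), Polynomial.monomial (h - i)
    ((h.choose i : L) * lamA μ 0 0 (Polynomial.X ^ i))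
  have hR : ∀ c : ℕ, R.eval (-(c : L)) = 0 := by
    intro c
    have h2 := h1 ((c : ℤ_[p]) : ℚ_[p])
    rw [lamA_zero_congr, cpow, sub_eq_add_neg, add_pow, map_sum] at h2
    rw [← h2, Polynomial.eval_finsetSum]
    refine Finset.sum_congr rfl fun i _ => ?_
    rw [Polynomial.eval_monomial, ← Polynomial.C_neg, ← Polynomial.C_pow, ← Polynomial.C_eq_natCast,
      mul_comm _ (Polynomial.C (h.choose i : L)), ← Polynomial.smul_eq_C_mul, map_smul, smul_eq_mul,
      mul_comm _ (Polynomial.C _), ← Polynomial.smul_eq_C_mul, map_smul, smul_eq_mul]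
    simp only [iotaL, PadicInt.coe_natCast, map_natCast]
    ring
  have hR0 : R = 0 := by
    refine Polynomial.eq_zero_of_infinite_isRoot R (Set.infinite_of_injective_forall_mem
      (f := fun c : ℕ => -(c : L)) (fun a b hab => by simpa using hab) fun c => hR c)
  have h3 : R.coeff (h - j) = (h.choose j : L) * lamA μ 0 0 (Polynomial.X ^ j) := by
    simp only [R, Polynomial.finsetSum_coeff, Polynomial.coeff_monomial]
    rw [Finset.sum_eq_single j, if_pos rfl]
    · intro i hi hij
      have := Finset.mem_range.1 hi
      exact if_neg (by omega)
    · intro hj'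
      exact absurd (Finset.mem_range.2 (by omega)) hj'
  rw [hR0, Polynomial.coeff_zero] at h3
  exact mul_ne_zero (by exact_mod_cast (Nat.choose_pos hj).ne') hne h3.symm

lemma AffFam.exists_detW_ne_zero (hP : Params p h r s ρ c0) (hF : AffFam h r s ρ F)
    (h0 : ∃ μ ∈ F, ∃ j ≤ h, lamA μ 0 0 (Polynomial.X ^ j) ≠ 0) :
    ∃ μ ∈ F, ∃ ν ∈ F, detW h r s c0 ρ μ ν ≠ 0 := by
  by_contra! hdet
  have hexB := hF.exists_lamB_ne_zero hP h0
  have hA0 : ∃ j, ∃ μ ∈ F, j ≤ h ∧ lamA μ 0 0 (Polynomial.X ^ j) ≠ 0 := by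
    obtain ⟨μ, hμ, j, hj, hne⟩ := h0; exact ⟨j, μ, hμ, hj, hne⟩
  have hB0 : ∃ j, ∃ μ ∈ F, j ≤ h ∧ lamB c0 ρ μ 0 0 (Polynomial.X ^ j) ≠ 0 := by
    obtain ⟨μ, hμ, j, hj, hne⟩ := hexB; exact ⟨j, μ, hμ, hj, hne⟩
  obtain ⟨μa, hμa, hah, hμa0⟩ := Nat.find_spec hA0
  obtain ⟨μb, hμb, hbh, hμb0⟩ := Nat.find_spec hB0
  have hAlt : ∀ μ ∈ F, ∀ j < Nat.find hA0, lamA μ 0 0 (Polynomial.X ^ j) = 0 := fun μ hμ j hj => by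
    by_contra hne
    exact Nat.find_min hA0 hj ⟨μ, hμ, by omega, hne⟩
  have hBlt : ∀ μ ∈ F, ∀ j < Nat.find hB0, lamB c0 ρ μ 0 0 (Polynomial.X ^ j) = 0 :=
    fun μ hμ j hj => by
      by_contra hne
      exact Nat.find_min hB0 hj ⟨μ, hμ, by omega, hne⟩
  revert hah hμa0 hAlt hbh hμb0 hBlt
  generalize Nat.find hA0 = a
  generalize Nat.find hB0 = b
  intro hah hμa0 hbh hμb0 hAlt hBlt
  have hpA : ∀ μ ∈ F, ∀ j ≤ a, pair (wA h r μ) (box (0 : ℤ_[p]) 0 (Polynomial.X ^ j)) =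
      lamA μ 0 0 (Polynomial.X ^ j) := fun μ hμ j hj => by
    obtain ⟨P, H⟩ := hF.exists_bd μ hμ
    rw [H.pairA hP 0 0 _ ((Polynomial.natDegree_X_pow_le j).trans (by omega))]
    simp
  have hpB : ∀ μ ∈ F, ∀ j ≤ b, pair (wB h s c0 ρ μ) (box (0 : ℤ_[p]) 0 (Polynomial.X ^ j)) =
      lamB c0 ρ μ 0 0 (Polynomial.X ^ j) := fun μ hμ j hj => by
    obtain ⟨P, H⟩ := hF.exists_bd μ hμ
    rw [H.pairB hP 0 0 _ ((Polynomial.natDegree_X_pow_le j).trans (by omega))]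
    simp
  haveI := charZero_L p L
  have hcross : ∀ μ ∈ F, ∀ ν ∈ F, lamA μ 0 0 (Polynomial.X ^ a) * lamB c0 ρ ν 0 0 (Polynomial.X ^ b) =
      lamB c0 ρ μ 0 0 (Polynomial.X ^ b) * lamA ν 0 0 (Polynomial.X ^ a) := by
    intro μ hμ ν hν
    obtain ⟨P, H⟩ := hF.exists_bd μ hμ
    obtain ⟨P', H'⟩ := hF.exists_bd ν hν
    have h1 := congrArg (fun w => pair w (box (0 : ℤ_[p]) 0 (Polynomial.X ^ (a + b)))) 
      (sub_eq_zero.1 (hdet μ hμ ν hν))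
    rw [pair_mul_box hP.r_pos.le hP.s_pos.le (H.growthA hP) (H'.growthB hP),
      pair_mul_box hP.s_pos.le hP.r_pos.le (H.growthB hP) (H'.growthA hP)] at h1
    simp only [pow_zero, Finset.range_one, Finset.sum_singleton, Nat.cast_zero, sub_zero] at h1
    rw [Finset.sum_eq_single a, Finset.sum_eq_single b, add_tsub_cancel_left, add_tsub_cancel_right,
      hpA μ hμ a le_rfl, hpB ν hν b le_rfl, hpB μ hμ b le_rfl, hpA ν hν a le_rfl,
      Nat.choose_symm_add] at h1
    · exact mul_left_cancel₀ (by exact_mod_cast (Nat.choose_pos (by omega)).ne') h1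
    · intro i hi hib
      have hi' := Finset.mem_range.1 hi
      rcases lt_or_gt_of_ne hib with hlt | hlt
      · rw [hpB μ hμ i hlt.le, hBlt μ hμ i hlt, zero_mul, mul_zero]
      · rw [hpA ν hν (a + b - i) (by omega), hAlt ν hν _ (by omega), mul_zero, mul_zero]
    · intro h'; exact absurd (Finset.mem_range.2 (by omega)) h'
    · intro i hi hia
      have hi' := Finset.mem_range.1 hi
      rcases lt_or_gt_of_ne hia with hlt | hlt
      · rw [hpA μ hμ i hlt.le, hAlt μ hμ i hlt, zero_mul, mul_zero]
      · rw [hpB ν hν (a + b - i) (by omega), hBlt ν hν _ (by omega), mul_zero, mul_zero]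
    · intro h'; exact absurd (Finset.mem_range.2 (by omega)) h'
  have hu0 : ((1 + p : ℕ) : ℚ_[p]) ≠ 0 := by
    exact_mod_cast (by omega : 1 + p ≠ 0)
  have huv : ((1 + p : ℕ) : ℚ_[p]).valuation = 0 := by
    rw [Padic.valuation_natCast]
    have : ¬ p ∣ 1 + p := fun h => hp.out.one_lt.ne' (Nat.dvd_one.1 ((Nat.dvd_add_left dvd_rfl).1 h))
    simp [padicValNat.eq_zero_of_not_dvd this]
  have hab : a = b := by
    have hne : lamA μa 0 0 (Polynomial.X ^ a) * lamB c0 ρ μb 0 0 (Polynomial.X ^ b) ≠ 0 :=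
      mul_ne_zero hμa0 hμb0
    have h1 := hcross _ (hF.comp_mem μa hμa _ hu0 0) μb hμb
    rw [lamA_comp_affT μa hu0, lamB_comp_affT hP.rho_ne_zero μa hu0, huv, sub_zero, zero_div,
      sub_zero, zpow_zero, one_mul, linearMap_affP_X_pow (hAlt μa hμa),
      linearMap_affP_X_pow (hBlt μa hμa), mul_assoc, mul_assoc, ← hcross μa hμa μb hμb] at h1
    have h2 := mul_right_cancel₀ hne h1
    simp only [iotaL, map_natCast] at h2
    exact Nat.pow_right_injective (a := 1 + p) (by have := hp.out.pos; omega) (by exact_mod_cast h2)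
  subst hab
  exact hF.not_proportional hP hAlt hBlt ⟨μa, hμa, hμa0⟩ ⟨μb, hμb, hμb0⟩ hcross

lemma coeff_zero_eq_pair (w : L⟦X⟧) :
    PowerSeries.constantCoeff w = pair w (box (0 : ℤ_[p]) 0 (1 : Polynomial L)) := by
  rw [← PowerSeries.coeff_zero_eq_constantCoeff_apply, ← pair_bn (p := p) w 0]
  congr 1
  funext z
  simp [bn, binomQ, box, iotaL]

lemma AffFam.exists_constantCoeff_detW_ne_zero (hP : Params p h r s ρ c0) (hF : AffFam h r s ρ F)
    (h0 : ∃ μ ∈ F, ∃ j ≤ h, lamA μ 0 0 (Polynomial.X ^ j) ≠ 0) :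
    ∃ μ ∈ F, ∃ ν ∈ F, PowerSeries.constantCoeff (detW h r s c0 ρ μ ν) ≠ 0 := by
  obtain ⟨μ₀, hμ₀, ν₀, hν₀, hne⟩ := hF.exists_detW_ne_zero hP h0
  by_contra! hdet
  have hA : ∃ μ ∈ F, lamA μ 0 0 (Polynomial.X ^ 0) ≠ 0 := by
    by_contra! hA
    exact hne (hF.detW_eq_zero_of_A hP (by simpa using hA) hμ₀ hν₀)
  have hB : ∃ μ ∈ F, lamB c0 ρ μ 0 0 (Polynomial.X ^ 0) ≠ 0 := by
    by_contra! hB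
    exact hne (hF.detW_eq_zero_of_B hP (by simpa using hB) hμ₀ hν₀)
  have hcA : ∀ μ ∈ F, PowerSeries.constantCoeff (wA h r μ) = lamA μ 0 0 1 := fun μ hμ => by
    obtain ⟨P, H⟩ := hF.exists_bd μ hμ
    rw [coeff_zero_eq_pair (p := p), H.pairA hP 0 0 _ (by simp)]
    simp
  have hcB : ∀ μ ∈ F, PowerSeries.constantCoeff (wB h s c0 ρ μ) = lamB c0 ρ μ 0 0 1 := fun μ hμ => by
    obtain ⟨P, H⟩ := hF.exists_bd μ hμ
    rw [coeff_zero_eq_pair (p := p), H.pairB hP 0 0 _ (by simp)]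
    simp
  refine hF.not_proportional hP (a := 0) (fun _ _ _ h => absurd h (Nat.not_lt_zero _))
    (fun _ _ _ h => absurd h (Nat.not_lt_zero _)) hA hB fun μ hμ ν hν => ?_
  have := hdet μ hμ ν hν
  rw [detW, map_sub, map_mul, map_mul, hcA μ hμ, hcB ν hν, hcB μ hμ, hcA ν hν] at this
  rw [pow_zero]
  exact sub_eq_zero.1 this

end Family

section Ideal

open scoped PowerSeries
open PowerSeries (coeff)

variable {p : ℕ} [hp : Fact p.Prime]
variable {L : Type} [NontriviallyNormedField L] [NormedAlgebra ℚ_[p] L] [IsUltrametricDist L]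
  [CompleteSpace L]
variable {h : ℕ} {r s : ℝ} {ρ c0 : L} {μ ν : (ℚ_[p] → L) →ₗ[L] L} {P P' : ℝ}
variable {F : Submodule L ((ℚ_[p] → L) →ₗ[L] L)}

/-- The normalized determinant of two functionals, which has bounded coefficients. -/
def eW (h : ℕ) (r s : ℝ) (c0 ρ : L) (μ ν : (ℚ_[p] → L) →ₗ[L] L) : L⟦X⟧ :=
  detW h r s c0 ρ μ ν * (logU L)⁻¹ ^ (h + 1)

lemma exists_psBound_eW (hP : Params p h r s ρ c0) :
    ∃ K : ℝ, 0 ≤ K ∧ ∀ (μ ν : (ℚ_[p] → L) →ₗ[L] L) (P P' : ℝ), Bd h r s ρ μ P → Bd h r s ρ ν P' →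
      PSBound (K * (P * P')) (eW h r s c0 ρ μ ν) := by
  obtain ⟨K, hK, hb⟩ := exists_bound_mul_logU_inv p L (h + 1)
  refine ⟨K * detConst p L h r s c0, mul_nonneg hK.le (detConst_nonneg h r s c0),
    fun μ ν P P' H H' n => ?_⟩
  have := hb _ _ (H.growth_detW hP H') (H.pair_X_pow_mul_detW hP H') n
  rwa [← mul_assoc] at this

lemma eW_mul_wA (μ m m' : (ℚ_[p] → L) →ₗ[L] L) :
    eW h r s c0 ρ m m' * wA h r μ =
      eW h r s c0 ρ μ m' * wA h r m + eW h r s c0 ρ m μ * wA h r m' := by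
  rw [eW, eW, eW, detW, detW, detW]
  ring

lemma qX_mul_logU : qX p L * frob p L (logU L) = (p : L) • logU L := by
  have h1 := phiX_mul_frob_logU (p := p) (L := L)
  rw [← X_mul_qX, mul_assoc, ← mul_smul_comm] at h1
  exact mul_left_cancel₀ PowerSeries.X_ne_zero h1

lemma qX_mul_logU_inv : qX p L * (logU L)⁻¹ = (p : L) • frob p L (logU L)⁻¹ := by
  have h2 : frob p L (logU L) * frob p L (logU L)⁻¹ = 1 := by
    rw [← map_mul, logU_mul_inv, map_one]
  calc qX p L * (logU L)⁻¹
      = (qX p L * frob p L (logU L)) * (logU L)⁻¹ * frob p L (logU L)⁻¹ := by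
        linear_combination (-(qX p L * (logU L)⁻¹)) * h2
    _ = (p : L) • frob p L (logU L)⁻¹ := by
        rw [qX_mul_logU, smul_mul_assoc, logU_mul_inv, smul_mul_assoc, one_mul]

lemma Bd.detW_eq_sum (hP : Params p h r s ρ c0) (H : Bd h r s ρ μ P) (H' : Bd h r s ρ ν P') :
    detW h r s c0 ρ μ ν = (ρ / p) • ∑ c ∈ Finset.range p, ∑ c' ∈ Finset.range p,
      (1 + PowerSeries.X) ^ (c + c') * frob p L (detW h r s c0 ρ (subF c μ) (subF c' ν)) := by
  rw [detW, H.wA_eq_sum hP, H'.wB_eq_sum hP, H.wB_eq_sum hP, H'.wA_eq_sum hP, mul_smul_comm,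
    smul_mul_assoc, ← smul_sub, Finset.sum_mul_sum, Finset.sum_mul_sum, ← Finset.sum_sub_distrib]
  congr 1
  refine Finset.sum_congr rfl fun c _ => ?_
  rw [← Finset.sum_sub_distrib]
  refine Finset.sum_congr rfl fun c' _ => ?_
  rw [detW, map_sub, map_mul, map_mul, pow_add]
  ring

lemma Bd.eW_eq_sum (hP : Params p h r s ρ c0) (H : Bd h r s ρ μ P) (H' : Bd h r s ρ ν P') :
    qX p L ^ (h + 1) * eW h r s c0 ρ μ ν = ∑ c ∈ Finset.range p, ∑ c' ∈ Finset.range p,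
      (((p : L) ^ (h + 1) * (ρ / p)) • (1 + PowerSeries.X) ^ (c + c')) *
        frob p L (eW h r s c0 ρ (subF c μ) (subF c' ν)) := by
  have h1 : qX p L ^ (h + 1) * eW h r s c0 ρ μ ν =
      detW h r s c0 ρ μ ν * ((p : L) ^ (h + 1) • (frob p L (logU L)⁻¹) ^ (h + 1)) := by
    rw [← smul_pow, ← qX_mul_logU_inv, eW, mul_pow]
    ring
  rw [h1, H.detW_eq_sum hP H', smul_mul_assoc, mul_smul_comm, smul_smul, Finset.sum_mul,
    Finset.smul_sum, mul_comm (ρ / (p : L))]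
  refine Finset.sum_congr rfl fun c _ => ?_
  rw [Finset.sum_mul, Finset.smul_sum]
  refine Finset.sum_congr rfl fun c' _ => ?_
  rw [eW, map_mul, map_pow, smul_mul_assoc, mul_assoc]

lemma Bd.sub' (H : Bd h r s ρ μ P) (H' : Bd h r s ρ ν P) : Bd h r s ρ (μ - ν) P := by
  have := H.add ((H'.smul (-1)).mono (P' := P) (by simp))
  rwa [show ((-1 : L) • ν) = -ν from neg_one_smul L ν, ← sub_eq_add_neg] at this

lemma AffFam.exists_X_pow_mul (hP : Params p h r s ρ c0) (hF : AffFam h r s ρ F) (hμ : μ ∈ F)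
    (H : Bd h r s ρ μ P) (i : ℕ) :
    ∃ κ ∈ F, Bd h r s ρ κ P ∧ wA h r κ = PowerSeries.X ^ i * wA h r μ := by
  induction i with
  | zero => exact ⟨μ, hμ, H, by simp⟩
  | succ i ih =>
    obtain ⟨κ, hκ, Hκ, hw⟩ := ih
    have h1 : Bd h r s ρ (κ ∘ₗ affT 1 1) P := by
      simpa using Hκ.comp_affT hP one_ne_zero 1
    refine ⟨κ ∘ₗ affT 1 1 - κ, F.sub_mem (hF.comp_mem κ hκ 1 one_ne_zero 1) hκ, h1.sub' Hκ, ?_⟩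
    have h2 : wA h r (κ ∘ₗ affT 1 1 - κ) = wA h r (κ ∘ₗ affT 1 1) + wA h r ((-1 : L) • κ) := by
      rw [← h1.wA_add hP (Hκ.smul (-1)), show ((-1 : L) • κ) = -κ from neg_one_smul L κ,
        sub_eq_add_neg]
    rw [h2, Hκ.wA_translate hP, Hκ.wA_smul hP, hw, neg_one_smul]
    ring

lemma Bd.wA_sum (hP : Params p h r s ρ c0) (hP0 : 0 ≤ P) {ι : Type*} (t : Finset ι)
    (f : ι → (ℚ_[p] → L) →ₗ[L] L) (hf : ∀ i, Bd h r s ρ (f i) P) :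
    wA h r (∑ i ∈ t, f i) = ∑ i ∈ t, wA h r (f i) := by
  induction t using Finset.induction_on with
  | empty =>
    have := (bd_zero h r s ρ hP0 (p := p) (L := L)).wA_smul hP 0
    simpa using this
  | insert a t ha ih =>
    rw [Finset.sum_insert ha, Finset.sum_insert ha, (hf a).wA_add hP
      (Bd.sum hP0 fun i _ => hf i), ih]

lemma AffFam.exists_mul (hP : Params p h r s ρ c0) (hF : AffFam h r s ρ F) (hμ : μ ∈ F)
    (H : Bd h r s ρ μ P) {b : L⟦X⟧} {D : ℝ} (hb : PSBound D b) (T : ℕ) :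
    ∃ κ ∈ F, Bd h r s ρ κ (D * P) ∧ ∀ n < T, coeff n (wA h r κ) = coeff n (b * wA h r μ) := by
  choose κ hκ Hκ hw using hF.exists_X_pow_mul hP hμ H
  have hb' : ∀ i, Bd h r s ρ (coeff i b • κ i) (D * P) := fun i =>
    ((Hκ i).smul _).mono (mul_le_mul_of_nonneg_right (hb i) H.nonneg)
  have h0 : 0 ≤ D * P := mul_nonneg hb.nonneg H.nonneg
  refine ⟨∑ i ∈ Finset.range T, coeff i b • κ i, F.sum_mem fun i _ => F.smul_mem _ (hκ i),
    Bd.sum h0 fun i _ => hb' i, fun n hn => ?_⟩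
  rw [Bd.wA_sum hP h0 _ _ hb', map_sum, PowerSeries.coeff_mul,
    Finset.Nat.sum_antidiagonal_eq_sum_range_succ (fun i j => coeff i b * coeff j (wA h r μ)),
    ← Finset.sum_subset (Finset.range_subset_range.2 (Nat.succ_le_of_lt hn))]
  · refine Finset.sum_congr rfl fun i hi => ?_
    have hi' := Finset.mem_range.1 hi
    rw [(Hκ i).wA_smul hP, map_smul, hw, PowerSeries.coeff_X_pow_mul', if_pos (by omega),
      smul_eq_mul]
  · intro i hi hi2
    have hi' : ¬ i < n + 1 := fun h => hi2 (Finset.mem_range.2 h)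
    rw [(Hκ i).wA_smul hP, map_smul, hw, PowerSeries.coeff_X_pow_mul', if_neg (by omega), smul_zero]

/-- The ideal generated by the normalized determinants of a family. -/
def detIdeal (h : ℕ) (r s : ℝ) (c0 ρ : L) (F : Submodule L ((ℚ_[p] → L) →ₗ[L] L)) :
    Submodule (bps L) L⟦X⟧ :=
  Submodule.span (bps L) {x | ∃ m ∈ F, ∃ m' ∈ F, x = eW h r s c0 ρ m m'}

lemma bps_smul_def (b : bps L) (x : L⟦X⟧) : b • x = (b : L⟦X⟧) * x := rfl

lemma AffFam.exists_of_mem_detIdeal (hP : Params p h r s ρ c0) (hF : AffFam h r s ρ F) {x : L⟦X⟧}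
    (hx : x ∈ detIdeal h r s c0 ρ F) :
    ∃ C : ℝ, 0 ≤ C ∧ ∀ (ν : (ℚ_[p] → L) →ₗ[L] L) (P : ℝ), Bd h r s ρ ν P → ∀ T : ℕ,
      ∃ κ ∈ F, Bd h r s ρ κ (C * P) ∧ ∀ n < T, coeff n (wA h r κ) = coeff n (x * wA h r ν) := by
  induction hx using Submodule.span_induction with
  | mem x hx =>
    obtain ⟨m, hm, m', hm', rfl⟩ := hx
    obtain ⟨K, hK, hKb⟩ := exists_psBound_eW (L := L) hP
    obtain ⟨Q, HQ⟩ := hF.exists_bd m hm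
    obtain ⟨Q', HQ'⟩ := hF.exists_bd m' hm'
    refine ⟨K * (Q * Q'), mul_nonneg hK (mul_nonneg HQ.nonneg HQ'.nonneg), fun ν P H T => ?_⟩
    obtain ⟨κ, hκ, Hκ, h1⟩ := hF.exists_mul hP hm HQ (hKb _ _ _ _ H HQ') T
    obtain ⟨κ', hκ', Hκ', h1'⟩ := hF.exists_mul hP hm' HQ' (hKb _ _ _ _ HQ H) T
    refine ⟨κ + κ', F.add_mem hκ hκ', (Hκ.mono (by apply le_of_eq; ring)).add
      (Hκ'.mono (by apply le_of_eq; ring)), fun n hn => ?_⟩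
    rw [Hκ.wA_add hP Hκ', map_add, h1 n hn, h1' n hn, eW_mul_wA ν m m', map_add]
  | zero =>
    refine ⟨0, le_rfl, fun ν P H T => ⟨0, F.zero_mem, bd_zero h r s ρ (by simp), fun n _ => ?_⟩⟩
    have := (bd_zero h r s ρ le_rfl (p := p) (L := L)).wA_smul hP 0
    rw [zero_smul, zero_smul] at this
    rw [this, zero_mul]
  | add x y _ _ ihx ihy =>
    obtain ⟨C, hC, hx⟩ := ihx
    obtain ⟨C', hC', hy⟩ := ihy
    refine ⟨max C C', hC.trans (le_max_left _ _), fun ν P H T => ?_⟩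
    obtain ⟨κ, hκ, Hκ, h1⟩ := hx ν P H T
    obtain ⟨κ', hκ', Hκ', h1'⟩ := hy ν P H T
    refine ⟨κ + κ', F.add_mem hκ hκ',
      (Hκ.mono (mul_le_mul_of_nonneg_right (le_max_left _ _) H.nonneg)).add
      (Hκ'.mono (mul_le_mul_of_nonneg_right (le_max_right _ _) H.nonneg)), fun n hn => ?_⟩
    rw [Hκ.wA_add hP Hκ', map_add, h1 n hn, h1' n hn, add_mul, map_add]
  | smul b x _ ih =>
    obtain ⟨C, hC, hx⟩ := ih
    obtain ⟨D, hD⟩ := b.2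
    refine ⟨D * C, mul_nonneg hD.nonneg hC, fun ν P H T => ?_⟩
    obtain ⟨κ, hκ, Hκ, h1⟩ := hx ν P H T
    obtain ⟨κ', hκ', Hκ', h1'⟩ := hF.exists_mul hP hκ Hκ hD T
    refine ⟨κ', hκ', Hκ'.mono (by apply le_of_eq; ring), fun n hn => ?_⟩
    rw [h1' n hn, bps_smul_def, mul_assoc, PowerSeries.coeff_mul, PowerSeries.coeff_mul]
    refine Finset.sum_congr rfl fun ij hij => ?_
    have := Finset.HasAntidiagonal.mem_antidiagonal.1 hij
    rw [h1 ij.2 (by omega)]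

lemma AffFam.one_mem_detIdeal [ProperSpace L] (hP : Params p h r s ρ c0) (hF : AffFam h r s ρ F)
    (h0 : ∃ μ ∈ F, ∃ j ≤ h, lamA μ 0 0 (Polynomial.X ^ j) ≠ 0) :
    1 ∈ detIdeal h r s c0 ρ F := by
  obtain ⟨K, hK, hKb⟩ := exists_psBound_eW (L := L) hP
  refine one_mem_of_frob (p := p) _ ?_ ?_ (h + 1) ?_
  · intro x hx
    induction hx using Submodule.span_induction with
    | mem x hx =>
      obtain ⟨m, hm, m', hm', rfl⟩ := hx
      obtain ⟨Q, HQ⟩ := hF.exists_bd m hm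
      obtain ⟨Q', HQ'⟩ := hF.exists_bd m' hm'
      exact ⟨_, hKb _ _ _ _ HQ HQ'⟩
    | zero => exact (bps L).zero_mem
    | add x y _ _ hx hy => exact (bps L).add_mem hx hy
    | smul b x _ hx => exact (bps L).mul_mem b.2 hx
  · obtain ⟨m, hm, m', hm', hne⟩ := hF.exists_constantCoeff_detW_ne_zero hP h0
    refine ⟨eW h r s c0 ρ m m', Submodule.subset_span ⟨m, hm, m', hm', rfl⟩, ?_⟩
    rw [eW, map_mul, map_pow, PowerSeries.constantCoeff_inv, constantCoeff_logU, inv_one, one_pow,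
      mul_one]
    exact hne
  · intro x hx
    induction hx using Submodule.span_induction with
    | mem x hx =>
      obtain ⟨m, hm, m', hm', rfl⟩ := hx
      obtain ⟨Q, HQ⟩ := hF.exists_bd m hm
      obtain ⟨Q', HQ'⟩ := hF.exists_bd m' hm'
      rw [HQ.eW_eq_sum hP HQ']
      refine Submodule.sum_mem _ fun c _ => Submodule.sum_mem _ fun c' _ => ?_
      have hb : (((p : L) ^ (h + 1) * (ρ / p)) • (1 + PowerSeries.X : L⟦X⟧) ^ (c + c')) ∈ bps L := by
        have h1 : (1 + PowerSeries.X : L⟦X⟧) ^ (c + c') ∈ bps L :=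
          (bps L).pow_mem ((bps L).add_mem ⟨1, psBound_one⟩ ⟨1, psBound_X⟩) _
        obtain ⟨C, hC⟩ := h1
        exact ⟨_, hC.smul _⟩
      exact Submodule.smul_mem _ (⟨_, hb⟩ : bps L) (Submodule.subset_span ⟨_, Submodule.subset_span
        ⟨_, hF.sub_mem hm c, _, hF.sub_mem hm' c', rfl⟩, rfl⟩)
    | zero => rw [mul_zero]; exact Submodule.zero_mem _
    | add x y _ _ hx hy => rw [mul_add]; exact Submodule.add_mem _ hx hy
    | smul b x _ hx =>
      rw [bps_smul_def, mul_left_comm, ← bps_smul_def]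
      exact Submodule.smul_mem _ b hx

/-- Functionals in a nontrivial affine family approximate every bounded functional on finitely many
polynomials supported on balls. -/
theorem AffFam.exists_approx_int [ProperSpace L] (hP : Params p h r s ρ c0) (hF : AffFam h r s ρ F)
    (h0 : ∃ μ ∈ F, ∃ j ≤ h, lamA μ 0 0 (Polynomial.X ^ j) ≠ 0) :
    ∃ C : ℝ, 0 ≤ C ∧ ∀ (ν : (ℚ_[p] → L) →ₗ[L] L) (P : ℝ), Bd h r s ρ ν P →
      ∃ κ : ℕ → (ℚ_[p] → L) →ₗ[L] L, (∀ T, κ T ∈ F ∧ Bd h r s ρ (κ T) (C * P)) ∧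
        ∀ (a : ℤ_[p]) (N : ℕ) (Q : Polynomial L), Q.natDegree ≤ h →
          Tendsto (fun T => lamA (κ T) a N Q) atTop (𝓝 (lamA ν a N Q)) := by
  obtain ⟨C, hC, hx⟩ := hF.exists_of_mem_detIdeal hP (hF.one_mem_detIdeal hP h0)
  refine ⟨C, hC, fun ν P H => ?_⟩
  choose κ hκ Hκ hc using hx ν P H
  refine ⟨κ, fun T => ⟨hκ T, Hκ T⟩, fun a N Q hQ => ?_⟩
  have h1 := tendsto_pair_of_coeff hP.r_pos.le (fun T => (Hκ T).growthA hP) (w' := wA h r ν)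
    (fun n => by
      refine tendsto_atTop_of_eventually_const (i₀ := n + 1) fun T hT => ?_
      rw [hc T n (by omega), one_mul]) (isCr_box (by linarith [hP.r_pos]) a N Q)
  rw [H.pairA hP a N Q hQ] at h1
  refine h1.congr fun T => ?_
  rw [(Hκ T).pairA hP a N Q hQ]

end Ideal

section Approx

variable {p : ℕ} [hp : Fact p.Prime]
variable {L : Type} [NontriviallyNormedField L] [NormedAlgebra ℚ_[p] L] [IsUltrametricDist L]
  [CompleteSpace L]
variable {h : ℕ} {r s : ℝ} {ρ c0 : L} {μ ν : (ℚ_[p] → L) →ₗ[L] L} {P P' : ℝ}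
variable {F : Submodule L ((ℚ_[p] → L) →ₗ[L] L)}

/-- The span of the polynomials of degree at most `h` supported on balls. -/
def spanE (p : ℕ) [Fact p.Prime] (L : Type) [NontriviallyNormedField L] [NormedAlgebra ℚ_[p] L]
    (h : ℕ) : Submodule L (ℚ_[p] → L) :=
  Submodule.span L {f | ∃ (b : ℚ_[p]) (n : ℤ) (Q : Polynomial L), Q.natDegree ≤ h ∧ f = bE b n Q}

/-- The span of the polynomials of degree at most `h` supported on balls inside `ℤ_p`. -/
def spanEInt (p : ℕ) [Fact p.Prime] (L : Type) [NontriviallyNormedField L] [NormedAlgebra ℚ_[p] L]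
    (h : ℕ) : Submodule L (ℚ_[p] → L) :=
  Submodule.span L {f | ∃ (a : ℤ_[p]) (N : ℕ) (Q : Polynomial L), Q.natDegree ≤ h ∧ f = bE a N Q}

lemma valuation_p_pow_inv (M : ℕ) : (((p : ℚ_[p]) ^ M)⁻¹).valuation = -(M : ℤ) := by
  rw [Padic.valuation_inv, Padic.valuation_pow, Padic.valuation_p, mul_one]

lemma exists_affT_mem_spanEInt {f : ℚ_[p] → L} (hf : f ∈ spanE p L h) :
    ∃ M0 : ℕ, ∀ M ≥ M0, affT ((p : ℚ_[p]) ^ M)⁻¹ 0 f ∈ spanEInt p L h := by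
  induction hf using Submodule.span_induction with
  | mem f hf =>
    obtain ⟨b, n, Q, hQ, rfl⟩ := hf
    obtain ⟨M1, hM1⟩ := pow_unbounded_of_one_lt ‖b‖ (one_lt_p (p := p))
    refine ⟨max M1 n.natAbs, fun M hM => ?_⟩
    have hd : ((p : ℚ_[p]) ^ M)⁻¹ ≠ 0 := inv_ne_zero (pow_ne_zero _ pQ_ne_zero)
    rw [affT_bE hd, valuation_p_pow_inv]
    have h1 : ‖(b - 0) / ((p : ℚ_[p]) ^ M)⁻¹‖ ≤ 1 := by
      rw [sub_zero, div_inv_eq_mul, norm_mul, norm_pow, Padic.norm_p, inv_pow]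
      rw [mul_inv_le_iff₀ (pow_pos p_pos _), one_mul]
      exact hM1.le.trans (pow_le_pow_right₀ one_lt_p.le ((le_max_left _ _).trans hM))
    have h2 : n - -(M : ℤ) = ((n + M).toNat : ℤ) := by
      have := (le_max_right M1 n.natAbs).trans hM
      omega
    refine Submodule.subset_span ⟨⟨_, h1⟩, (n + M).toNat, _, 
      natDegree_affP_le ((p : ℚ_[p]) ^ M)⁻¹ 0 hQ, ?_⟩
    rw [h2]
  | zero => exact ⟨0, fun M _ => by rw [map_zero]; exact Submodule.zero_mem _⟩
  | add f g _ _ hf hg =>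
    obtain ⟨M0, h0⟩ := hf
    obtain ⟨M1, h1⟩ := hg
    refine ⟨max M0 M1, fun M hM => ?_⟩
    rw [map_add]
    exact Submodule.add_mem _ (h0 M ((le_max_left _ _).trans hM))
      (h1 M ((le_max_right _ _).trans hM))
  | smul c f _ hf =>
    obtain ⟨M0, h0⟩ := hf
    refine ⟨M0, fun M hM => ?_⟩
    rw [map_smul]
    exact Submodule.smul_mem _ c (h0 M hM)

lemma comp_affT_comp_affT (κ : (ℚ_[p] → L) →ₗ[L] L) {d : ℚ_[p]} (hd : d ≠ 0) (f : ℚ_[p] → L) :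
    (κ ∘ₗ affT d 0) (affT d⁻¹ 0 f) = κ f := by
  rw [LinearMap.comp_apply, affT_comp, inv_mul_cancel₀ hd]
  simp [affT_one_zero]

/-- Functionals in a nontrivial affine family approximate every bounded functional on polynomials
supported on balls. -/
theorem AffFam.exists_approx [ProperSpace L] (hP : Params p h r s ρ c0)
    (hF : AffFam h r s ρ F) (h0 : ∃ μ ∈ F, ∃ f ∈ spanE p L h, μ f ≠ 0) :
    ∃ C : ℝ, 0 ≤ C ∧ ∀ (ν : (ℚ_[p] → L) →ₗ[L] L) (P : ℝ), Bd h r s ρ ν P → ∀ f ∈ spanE p L h,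
      ∀ ε > 0, ∃ κ ∈ F, Bd h r s ρ κ (C * P) ∧ ‖ν f - κ f‖ < ε := by
  have h1 : ∃ μ ∈ F, ∃ j ≤ h, lamA μ 0 0 (Polynomial.X ^ j) ≠ 0 := by
    by_contra hcon
    push Not at hcon
    obtain ⟨μ, hμ, f, hf, hne⟩ := h0
    refine hne ?_
    have : spanE p L h ≤ LinearMap.ker μ := Submodule.span_le.2 (by
      rintro _ ⟨b, n, Q, hQ, rfl⟩
      exact hF.lamA_eq_zero (a := h + 1) (fun μ hμ j hj => hcon μ hμ j (by omega)) hμ b n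
        (by omega))
    exact this hf
  obtain ⟨C, hC, hx⟩ := hF.exists_approx_int hP h1
  refine ⟨C, hC, fun ν P H f hf ε hε => ?_⟩
  obtain ⟨M, hM⟩ := exists_affT_mem_spanEInt hf
  have hM := hM M le_rfl
  have hd : (p : ℚ_[p]) ^ M ≠ 0 := pow_ne_zero _ pQ_ne_zero
  obtain ⟨κ, hκ, ht⟩ := hx _ _ (H.comp_affT hP hd 0)
  have ht' : ∀ g ∈ spanEInt p L h, Tendsto (fun T => κ T g) atTop
      (𝓝 ((ν ∘ₗ affT ((p : ℚ_[p]) ^ M) 0) g)) := fun g hg => by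
    induction hg using Submodule.span_induction with
    | mem g hg =>
      obtain ⟨a, N, Q, hQ, rfl⟩ := hg
      exact ht a N Q hQ
    | zero => simp only [map_zero]; exact tendsto_const_nhds
    | add g g' _ _ hg hg' => simp only [map_add]; exact hg.add hg'
    | smul c g _ hg => simp only [map_smul]; exact hg.const_smul c
  have h2 := ht' _ hM
  rw [comp_affT_comp_affT ν hd] at h2
  obtain ⟨T, hT⟩ := ((Metric.tendsto_atTop.1 h2) ε hε)
  have hT := hT T le_rfl
  refine ⟨κ T ∘ₗ affT ((p : ℚ_[p]) ^ M)⁻¹ 0, hF.comp_mem _ (hκ T).1 _ (inv_ne_zero hd) 0, ?_, ?_⟩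
  · refine ((hκ T).2.comp_affT hP (inv_ne_zero hd) 0).mono (le_of_eq ?_)
    rw [valuation_p_pow_inv, Padic.valuation_pow, Padic.valuation_p, mul_assoc, mul_assoc,
      ← Real.rpow_add p_pos]
    have : -(((M : ℕ) * 1 : ℤ) : ℝ) * r + -((-(M : ℤ) : ℤ) : ℝ) * r = 0 := by push_cast; ring
    rw [this, Real.rpow_zero, mul_one]
  · rw [dist_eq_norm] at hT
    rw [norm_sub_rev]
    exact hT

end Approx

section HahnBanach

variable {L : Type} [NontriviallyNormedField L] [IsUltrametricDist L]
variable {V : Type*} [AddCommGroup V] [Module L V]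

/-- An ultrametric seminorm, as a mere function. -/
structure UltraSeminorm (L : Type) [NontriviallyNormedField L] {V : Type*} [AddCommGroup V]
    [Module L V] (N : V → ℝ) : Prop where
  nonneg : ∀ x, 0 ≤ N x
  add_le : ∀ x y, N (x + y) ≤ max (N x) (N y)
  smul_le : ∀ (c : L) x, N (c • x) ≤ ‖c‖ * N x

variable {N : V → ℝ}

lemma UltraSeminorm.le_smul (hN : UltraSeminorm L N) {c : L} (hc : c ≠ 0) (x y : V) :
    ‖c‖ * N (c⁻¹ • x + y) ≤ N (x + c • y) := by
  have h1 := hN.smul_le c⁻¹ (x + c • y)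
  rw [smul_add, smul_smul, inv_mul_cancel₀ hc, one_smul, norm_inv] at h1
  rwa [← le_div_iff₀' (norm_pos_iff.2 hc), div_eq_inv_mul]

lemma UltraSeminorm.neg_le (hN : UltraSeminorm L N) (x : V) : N (-x) ≤ N x := by
  simpa using hN.smul_le (-1) x

lemma UltraSeminorm.sub_le (hN : UltraSeminorm L N) (x y : V) : N (x - y) ≤ max (N x) (N y) := by
  rw [sub_eq_add_neg]
  exact (hN.add_le _ _).trans (max_le_max le_rfl (hN.neg_le y))

lemma UltraSeminorm.supSpanSingleton_le (hN : UltraSeminorm L N) (f : V →ₗ.[L] L)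
    (hf : ∀ x : f.domain, ‖f x‖ ≤ N x) {y : V} {t : L} (hy : y ∉ f.domain)
    (ht : ∀ x : f.domain, ‖f x + t‖ ≤ N (x + y)) :
    ∀ x : (f.supSpanSingleton y t hy).domain, ‖f.supSpanSingleton y t hy x‖ ≤ N x := by
  rintro ⟨z, hz⟩
  rcases Submodule.mem_sup.1 hz with ⟨x, hx, y', hy', rfl⟩
  rcases Submodule.mem_span_singleton.1 hy' with ⟨c, rfl⟩
  rw [LinearPMap.supSpanSingleton_apply_mk _ _ _ _ _ hx]
  by_cases hc : c = 0
  · subst hc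
    simpa using hf ⟨x, hx⟩
  · have h1 := ht (c⁻¹ • ⟨x, hx⟩)
    rw [f.map_smul] at h1
    have h2 : f ⟨x, hx⟩ + c • t = c * (c⁻¹ • f ⟨x, hx⟩ + t) := by
      rw [smul_eq_mul, smul_eq_mul, mul_add, ← mul_assoc, mul_inv_cancel₀ hc, one_mul]
    simp only [RingHom.id_apply]
    rw [h2, norm_mul]
    exact (mul_le_mul_of_nonneg_left h1 (norm_nonneg c)).trans (hN.le_smul hc x y)

lemma UltraSeminorm.exists_ext_step [ProperSpace L] (hN : UltraSeminorm L N) (f : V →ₗ.[L] L)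
    (hf : ∀ x : f.domain, ‖f x‖ ≤ N x) (y : V) :
    ∃ t : L, ∀ x : f.domain, ‖f x + t‖ ≤ N (x + y) := by
  have hpair : ∀ x x' : f.domain, N (x + y) ≤ N (x' + y) → ‖f x - f x'‖ ≤ N (x' + y) :=
    fun x x' h => by
      rw [← f.map_sub]
      refine (hf _).trans ?_
      have := hN.sub_le (x + y) (x' + y)
      rw [add_sub_add_right_eq_sub, max_eq_right h] at this
      exact this
  have key : (Metric.closedBall (-f 0) (N ((0 : f.domain) + y)) ∩ ⋂ x : f.domain,
      Metric.closedBall (-f x) (N (x + y))).Nonempty := by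
    refine IsCompact.inter_iInter_nonempty (isCompact_closedBall _ _) _
      (fun x => Metric.isClosed_closedBall) fun u => ?_
    obtain ⟨x0, hx0, hmin⟩ := (insert 0 u).exists_min_image (fun x : f.domain => N (x + y))
      ⟨0, Finset.mem_insert_self _ _⟩
    have hall : ∀ x ∈ insert 0 u, -f x0 ∈ Metric.closedBall (-f x) (N (x + y)) := fun x hx => by
      rw [Metric.mem_closedBall, dist_eq_norm, neg_sub_neg, norm_sub_rev]
      exact hpair x0 x (hmin x hx)
    exact ⟨-f x0, hall 0 (Finset.mem_insert_self _ _), Set.mem_iInter₂.2 fun x hx =>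
      hall x (Finset.mem_insert_of_mem hx)⟩
  obtain ⟨t, -, ht⟩ := key
  refine ⟨t, fun x => ?_⟩
  have := Set.mem_iInter.1 ht x
  rw [Metric.mem_closedBall, dist_eq_norm, sub_neg_eq_add, add_comm] at this
  exact this

theorem UltraSeminorm.exists_ext [ProperSpace L] (hN : UltraSeminorm L N) (f : V →ₗ.[L] L)
    (hf : ∀ x : f.domain, ‖f x‖ ≤ N x) :
    ∃ μ : V →ₗ[L] L, (∀ x, ‖μ x‖ ≤ N x) ∧ ∀ x : f.domain, μ x = f x := by
  set S := {g : V →ₗ.[L] L | ∀ x : g.domain, ‖g x‖ ≤ N x}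
  have hSc : ∀ c, c ⊆ S → IsChain (· ≤ ·) c → ∀ y ∈ c, ∃ ub ∈ S, ∀ z ∈ c, z ≤ ub := by
    intro c hcs c_chain y hy
    have cne : c.Nonempty := ⟨y, hy⟩
    have hcd : DirectedOn (· ≤ ·) c := c_chain.directedOn
    refine ⟨LinearPMap.sSup c hcd, ?_, fun _ ↦ LinearPMap.le_sSup hcd⟩
    rintro ⟨x, hx⟩
    have hdir : DirectedOn (· ≤ ·) (LinearPMap.domain '' c) :=
      directedOn_image.2 (hcd.mono LinearPMap.domain_mono.monotone)
    rcases (Submodule.mem_sSup_of_directed (cne.image _) hdir).1 hx with ⟨_, ⟨g, hgc, rfl⟩, hgx⟩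
    have : g ≤ LinearPMap.sSup c hcd := LinearPMap.le_sSup _ hgc
    have h2 : LinearPMap.sSup c hcd ⟨x, hx⟩ = g ⟨x, hgx⟩ := (this.2 rfl).symm
    rw [h2]
    exact hcs hgc ⟨x, hgx⟩
  obtain ⟨q, hfq, hq⟩ := zorn_le_nonempty₀ S hSc f hf
  have htop : q.domain = ⊤ := by
    by_contra hne
    obtain ⟨y, -, hy⟩ : ∃ y ∈ (⊤ : Submodule L V), y ∉ q.domain :=
      SetLike.exists_of_lt (lt_top_iff_ne_top.2 hne)
    obtain ⟨t, ht⟩ := hN.exists_ext_step q hq.prop y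
    have h1 := hN.supSpanSingleton_le q hq.prop hy ht
    have h2 := hq.le_of_ge (y := q.supSpanSingleton y t hy) h1 (q.left_le_sup _ _)
    have h3 := LinearPMap.domain_mono.monotone h2
    rw [LinearPMap.domain_supSpanSingleton, sup_le_iff, Submodule.span_le,
      Set.singleton_subset_iff] at h3
    exact hy h3.2
  have hmem : ∀ x, x ∈ q.domain := fun x => htop ▸ Submodule.mem_top
  refine ⟨q.toFun ∘ₗ LinearMap.codRestrict q.domain LinearMap.id hmem, fun x => hq.prop ⟨x, hmem x⟩,
    fun x => ?_⟩
  exact (hfq.2 rfl).symm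

/-- The ultrametric Hahn–Banach separation theorem over a locally compact field. -/
theorem UltraSeminorm.exists_separating [ProperSpace L] (hN : UltraSeminorm L N)
    (F : Submodule L V) {x : V} {δ : ℝ} (hδ : 0 < δ) (hx : ∀ f ∈ F, δ ≤ N (x - f)) :
    ∃ μ : V →ₗ[L] L, (∀ v, ‖μ v‖ ≤ δ⁻¹ * N v) ∧ (∀ f ∈ F, μ f = 0) ∧ μ x = 1 := by
  have hN' : UltraSeminorm L fun v => δ⁻¹ * N v :=
    { nonneg := fun v => mul_nonneg (inv_nonneg.2 hδ.le) (hN.nonneg v)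
      add_le := fun v w => by
        rw [← mul_max_of_nonneg _ _ (inv_nonneg.2 hδ.le)]
        exact mul_le_mul_of_nonneg_left (hN.add_le v w) (inv_nonneg.2 hδ.le)
      smul_le := fun c v => by
        rw [mul_left_comm]
        exact mul_le_mul_of_nonneg_left (hN.smul_le c v) (inv_nonneg.2 hδ.le) }
  have hxF : x ∉ F := fun hmem => by
    have h1 := hx x hmem
    rw [sub_self] at h1
    have h2 := hN.smul_le (0 : L) x
    rw [zero_smul, norm_zero, zero_mul] at h2
    linarith
  set f : V →ₗ.[L] L := ⟨F, 0⟩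
  have hf : ∀ v : f.domain, ‖f v‖ ≤ δ⁻¹ * N v := fun v => by
    have : f v = 0 := rfl
    rw [this, norm_zero]
    exact hN'.nonneg _
  have hb := hN'.supSpanSingleton_le f hf (y := x) (t := 1) hxF fun v => by
    have h0 : f v = 0 := rfl
    rw [h0, zero_add, norm_one, ← div_eq_inv_mul, one_le_div hδ]
    have := hx (-v) (F.neg_mem v.2)
    rwa [sub_neg_eq_add, add_comm] at this
  obtain ⟨μ, hμ, he⟩ := hN'.exists_ext _ hb
  refine ⟨μ, hμ, fun w hw => ?_, ?_⟩
  · have h1 := he ⟨w, Submodule.mem_sup_left hw⟩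
    rw [LinearPMap.supSpanSingleton_apply_mk_of_mem f _ _ hw] at h1
    exact h1
  · have h1 := he ⟨x, Submodule.mem_sup_right (Submodule.mem_span_singleton_self x)⟩
    rw [LinearPMap.supSpanSingleton_apply_self] at h1
    exact h1

end HahnBanach

section BanachSpace

variable {p : ℕ} [hp : Fact p.Prime] {L : Type} [NontriviallyNormedField L]
  [NormedAlgebra ℚ_[p] L] [IsUltrametricDist L] [CompleteSpace L]
variable {h : ℕ} {r s : ℝ} {ρ c0 : L} {η η' : ℝ}

open Polynomial

/-- `g` lies in the ball of radius `η` of `C^r(ℤ_p, L)`. -/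
def CB (r η : ℝ) (g : ℤ_[p] → L) : Prop := IsCr p L r g ∧ crNorm p L r g ≤ η

lemma CB.nonneg {g : ℤ_[p] → L} (hg : CB r η g) : 0 ≤ η := (crNorm_nonneg r g).trans hg.2

lemma CB.mono {g : ℤ_[p] → L} (hg : CB r η g) (hη : η ≤ η') : CB r η' g := ⟨hg.1, hg.2.trans hη⟩

lemma CB.add (hr : 0 ≤ r) {f g : ℤ_[p] → L} (hf : CB r η f) (hg : CB r η g) : CB r η (f + g) :=
  ⟨hf.1.add hg.1, (crNorm_add_le hr hf.1 hg.1).trans (max_le hf.2 hg.2)⟩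

lemma CB.smul (hr : 0 ≤ r) {f : ℤ_[p] → L} (hf : CB r η f) (c : L) : CB r (‖c‖ * η) (c • f) :=
  ⟨hf.1.smul c, (crNorm_smul_le hr hf.1 c).trans (mul_le_mul_of_nonneg_left hf.2 (norm_nonneg c))⟩

lemma CB.zero (hr : 0 ≤ r) (hη : 0 ≤ η) : CB r η (0 : ℤ_[p] → L) := by
  refine ⟨isCr_zero r, ?_⟩
  have := crNorm_smul_le hr (isCr_zero (p := p) (L := L) r) 0
  rw [norm_zero, zero_mul, smul_zero] at this
  exact this.trans hη

/-- `f` lies in the ball of radius `η` of the Banach space of functions `f` such that `f(pz)` and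
`ρ^{val z} z^h f(1/z)` are of class `C^r` on `ℤ_p`. -/
def BB (h : ℕ) (r : ℝ) (ρ : L) (η : ℝ) (f : ℚ_[p] → L) : Prop :=
  CB r η (fun z : ℤ_[p] => f ((p : ℚ_[p]) * (z : ℚ_[p]))) ∧
    ∃ g : ℤ_[p] → L, CB r η g ∧ ∀ z : ℤ_[p], z ≠ 0 →
      g z = ρ ^ ((z : ℚ_[p]).valuation) * (iotaL p L (z : ℚ_[p])) ^ h * f ((z : ℚ_[p])⁻¹)

lemma BB.nonneg {f : ℚ_[p] → L} (hf : BB h r ρ η f) : 0 ≤ η := hf.1.nonneg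

lemma BB.mono {f : ℚ_[p] → L} (hf : BB h r ρ η f) (hη : η ≤ η') : BB h r ρ η' f := by
  obtain ⟨h1, g, hg, h2⟩ := hf
  exact ⟨h1.mono hη, g, hg.mono hη, h2⟩

lemma BB.add (hr : 0 ≤ r) {f f' : ℚ_[p] → L} (hf : BB h r ρ η f) (hf' : BB h r ρ η f') :
    BB h r ρ η (f + f') := by
  obtain ⟨h1, g, hg, h2⟩ := hf
  obtain ⟨h1', g', hg', h2'⟩ := hf'
  refine ⟨h1.add hr h1', g + g', hg.add hr hg', fun z hz => ?_⟩
  rw [Pi.add_apply, Pi.add_apply, h2 z hz, h2' z hz, mul_add]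

lemma BB.smul (hr : 0 ≤ r) {f : ℚ_[p] → L} (hf : BB h r ρ η f) (c : L) :
    BB h r ρ (‖c‖ * η) (c • f) := by
  obtain ⟨h1, g, hg, h2⟩ := hf
  refine ⟨h1.smul hr c, c • g, hg.smul hr c, fun z hz => ?_⟩
  rw [Pi.smul_apply, Pi.smul_apply, h2 z hz, smul_eq_mul, smul_eq_mul, mul_left_comm]

lemma BB.neg (hr : 0 ≤ r) {f : ℚ_[p] → L} (hf : BB h r ρ η f) : BB h r ρ η (-f) := by
  have := hf.smul hr (-1)
  rwa [norm_neg, norm_one, one_mul, neg_one_smul] at this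

lemma BB.sub (hr : 0 ≤ r) {f f' : ℚ_[p] → L} (hf : BB h r ρ η f) (hf' : BB h r ρ η f') :
    BB h r ρ η (f - f') := by
  rw [sub_eq_add_neg]
  exact hf.add hr (hf'.neg hr)

lemma BB.zero (hr : 0 ≤ r) (hη : 0 ≤ η) : BB h r ρ η (0 : ℚ_[p] → L) :=
  ⟨CB.zero hr hη, 0, CB.zero hr hη, fun z _ => by simp⟩

lemma BB.sum (hr : 0 ≤ r) (hη : 0 ≤ η) {ι : Type*} {f : ι → ℚ_[p] → L} (t : Finset ι)
    (hf : ∀ i ∈ t, BB h r ρ η (f i)) : BB h r ρ η (∑ i ∈ t, f i) := by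
  induction t using Finset.induction_on with
  | empty => exact BB.zero hr hη
  | insert i t hi ih =>
    rw [Finset.sum_insert hi]
    exact (hf i (Finset.mem_insert_self i t)).add hr
      (ih fun j hj => hf j (Finset.mem_insert_of_mem hj))

lemma BB.of_hasSum (hr : 0 ≤ r) {f : ℚ_[p] → L} {G : ℕ → ℚ_[p] → L}
    (hG : ∀ z, HasSum (fun N => G N z) (f z)) {A : ℕ → ℝ} (hA : Tendsto A atTop (𝓝 0))
    (hAη : ∀ N, A N ≤ η) (hB : ∀ N, BB h r ρ (A N) (G N)) : BB h r ρ η f := by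
  choose h1 g hg h2 using hB
  have hη : 0 ≤ η := (h1 0).nonneg.trans (hAη 0)
  refine ⟨⟨isCr_of_hasSum hr (fun z => hG _) hA (fun N => (h1 N).1) (fun N => (h1 N).2),
    crNorm_le_of_hasSum hr (fun z => hG _) hη (fun N => (h1 N).1)
      (fun N => (h1 N).2.trans (hAη N))⟩, fun z => ∑' N, g N z, ?_, fun z hz => ?_⟩
  · have hs : ∀ z, HasSum (fun N => g N z) (∑' N, g N z) := fun z => by
      refine Summable.hasSum (NonarchimedeanAddGroup.summable_of_tendsto_cofinite_zero ?_)
      rw [Nat.cofinite_eq_atTop]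
      exact squeeze_zero_norm (fun N => ((hg N).1.norm_le hr z).trans (hg N).2) hA
    exact ⟨isCr_of_hasSum hr hs hA (fun N => (hg N).1) (fun N => (hg N).2),
      crNorm_le_of_hasSum hr hs hη (fun N => (hg N).1) (fun N => (hg N).2.trans (hAη N))⟩
  · have := (hG (z : ℚ_[p])⁻¹).mul_left (ρ ^ ((z : ℚ_[p]).valuation) * (iotaL p L (z : ℚ_[p])) ^ h)
    rw [← this.tsum_eq]
    exact tsum_congr fun N => h2 N z hz

/-- The polynomial function `Q` is bounded by `c` on the ball `b + p^n ℤ_p`. -/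
def SupLe (b : ℚ_[p]) (n : ℤ) (Q : L[X]) (c : ℝ) : Prop :=
  ∀ z : ℚ_[p], ‖z - b‖ ≤ (p : ℝ) ^ (-n) → ‖Q.eval (iotaL p L z)‖ ≤ c

lemma SupLe.nonneg {b : ℚ_[p]} {n : ℤ} {Q : L[X]} {c : ℝ} (hQ : SupLe b n Q c) : 0 ≤ c :=
  (norm_nonneg _).trans (hQ b (by rw [sub_self, norm_zero]; exact zpow_nonneg p_pos.le _))

lemma supLe_cpow (b : ℚ_[p]) (n : ℤ) (j : ℕ) :
    SupLe b n (cpow L b j) ((p : ℝ) ^ (-((n : ℝ) * j))) := by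
  intro z hz
  have h1 : (cpow L b j).eval (iotaL p L z) = (iotaL p L (z - b)) ^ j := by
    simp [cpow, iotaL]
  rw [h1, norm_pow, norm_iotaL, ← mul_neg_one, mul_assoc, mul_neg_one, rpow_zpow_mul,
    Real.rpow_neg p_pos.le, inv_zpow', Real.rpow_natCast, ← zpow_natCast, ← zpow_natCast,
    zpow_comm, zpow_natCast, zpow_natCast]
  exact pow_le_pow_left₀ (norm_nonneg _) hz j

lemma SupLe.affP {d : ℚ_[p]} (hd : d ≠ 0) {b' : ℚ_[p]} (b : ℚ_[p]) {n : ℤ} {Q : L[X]} {c : ℝ}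
    (hQ : SupLe b' n Q c) : SupLe ((b' - b) / d) (n - d.valuation) (affP d b Q) c := by
  intro z hz
  rw [eval_affP]
  exact hQ _ ((affT_norm hd n z).2 hz)

lemma SupLe.subball {b b' : ℚ_[p]} {n n' : ℤ} {Q : L[X]} {c : ℝ} (hQ : SupLe b n Q c)
    (hb : ‖b' - b‖ ≤ (p : ℝ) ^ (-n)) (hn : n ≤ n') : SupLe b' n' Q c := fun z hz =>
  hQ z (padic_norm_sub_le (hz.trans (zpow_le_zpow_right₀ one_lt_p.le (by omega))) hb)

lemma pow_mul_eval_inv {Q : L[X]} (hQ : Q.natDegree ≤ h) {x : L} (hx : x ≠ 0) :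
    x ^ h * Q.eval x⁻¹ = (reflect h Q).eval x := by
  haveI := invertibleOfNonzero (inv_ne_zero hx)
  have := eval₂_reflect_mul_pow (RingHom.id L) x⁻¹ h Q hQ
  rw [invOf_eq_inv, inv_inv] at this
  rw [← eval₂_id (p := Q), ← this, ← eval₂_id (p := reflect h Q), mul_left_comm, ← mul_pow,
    mul_inv_cancel₀ hx, one_pow, mul_one]

lemma natDegree_reflect_le' {Q : L[X]} (hQ : Q.natDegree ≤ h) : (reflect h Q).natDegree ≤ h :=
  natDegree_reflect_le.trans (max_le le_rfl hQ)

lemma valuation_eq_of_mem_ball {a z : ℚ_[p]} (ha : a ≠ 0) {N : ℤ} (hN : a.valuation < N)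
    (hz : ‖z - a‖ ≤ (p : ℝ) ^ (-N)) : z.valuation = a.valuation ∧ ‖z‖ = ‖a‖ ∧ z ≠ 0 := by
  have h1 : ‖z - a‖ < ‖a‖ := by
    refine hz.trans_lt ?_
    rw [padic_norm_eq ha]
    exact zpow_lt_zpow_right₀ one_lt_p (by omega)
  have h2 : ‖z‖ = ‖a‖ := by
    rw [← sub_add_cancel z a, Padic.add_eq_max_of_ne h1.ne, max_eq_right h1.le]
  exact ⟨valuation_eq_of_norm_eq h2, h2, by rw [← norm_ne_zero_iff, h2, norm_ne_zero_iff]; exact ha⟩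

lemma inv_mem_ball_iff {a z : ℚ_[p]} (ha : a ≠ 0) (hz : z ≠ 0) {N : ℤ} (hN : a.valuation < N) :
    ‖z⁻¹ - a‖ ≤ (p : ℝ) ^ (-N) ↔ ‖z - a⁻¹‖ ≤ (p : ℝ) ^ (-(N - 2 * a.valuation)) := by
  have key : ∀ {a z : ℚ_[p]}, a ≠ 0 → z ≠ 0 → ∀ {N : ℤ}, a.valuation < N →
      ‖z⁻¹ - a‖ ≤ (p : ℝ) ^ (-N) → ‖z - a⁻¹‖ ≤ (p : ℝ) ^ (-(N - 2 * a.valuation)) := by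
    intro a z ha hz N hN h1
    have h2 := (valuation_eq_of_mem_ball ha hN h1).2.1
    have h3 : z - a⁻¹ = -((z⁻¹ - a) * z * a⁻¹) := by field_simp; ring
    rw [norm_inv] at h2
    have h4 : ‖z‖ = ‖a‖⁻¹ := by rw [← h2, inv_inv]
    rw [h3, norm_neg, norm_mul, norm_mul, norm_inv, h4, padic_norm_eq ha, ← zpow_neg, mul_assoc,
      ← zpow_add₀ p_pos.ne', show -(N - 2 * a.valuation) = -N + (- -a.valuation + - -a.valuation) by
        ring, zpow_add₀ p_pos.ne' (-N)]
    exact mul_le_mul_of_nonneg_right h1 (zpow_nonneg p_pos.le _)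
  refine ⟨key ha hz hN, fun h1 => ?_⟩
  have := key (inv_ne_zero ha) (inv_ne_zero hz) (N := N - 2 * a.valuation)
    (by rw [Padic.valuation_inv]; omega) (by rwa [inv_inv])
  rw [Padic.valuation_inv, inv_inv] at this
  exact this.trans (le_of_eq (by ring_nf))

/-- Inversion of a function supported on a ball not containing `0`. -/
lemma inversion_bE (hρ : ρ ≠ 0) {a z : ℚ_[p]} (ha : a ≠ 0) (hz : z ≠ 0) {N : ℤ}
    (hN : a.valuation < N) {Q : L[X]} (hQ : Q.natDegree ≤ h) :
    ρ ^ z.valuation * (iotaL p L z) ^ h * bE a N Q z⁻¹ =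
      ρ ^ (-a.valuation) * bE a⁻¹ (N - 2 * a.valuation) (reflect h Q) z := by
  rw [bE_apply, bE_apply]
  by_cases h1 : ‖z⁻¹ - a‖ ≤ (p : ℝ) ^ (-N)
  · rw [if_pos h1, if_pos ((inv_mem_ball_iff ha hz hN).1 h1)]
    have h2 := (valuation_eq_of_mem_ball ha hN h1).1
    rw [Padic.valuation_inv] at h2
    have h3 : iotaL p L z ≠ 0 := by rw [← norm_ne_zero_iff, norm_iotaL, norm_ne_zero_iff]; exact hz
    rw [← h2, neg_neg, mul_assoc, ← pow_mul_eval_inv hQ h3]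
    simp [iotaL]
  · rw [if_neg h1, if_neg (fun h2 => h1 ((inv_mem_ball_iff ha hz hN).2 h2)), mul_zero, mul_zero]

lemma SupLe.reflect {a : ℚ_[p]} (ha : a ≠ 0) {N : ℤ} (hN : a.valuation < N) {Q : L[X]}
    (hQ : Q.natDegree ≤ h) {c : ℝ} (hc : SupLe a N Q c) :
    SupLe a⁻¹ (N - 2 * a.valuation) (reflect h Q) (‖a‖⁻¹ ^ h * c) := by
  intro z hz
  have h0 := valuation_eq_of_mem_ball (inv_ne_zero ha) (by rw [Padic.valuation_inv]; omega) hz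
  have h3 : iotaL p L z ≠ 0 := by
    rw [← norm_ne_zero_iff, norm_iotaL, norm_ne_zero_iff]; exact h0.2.2
  rw [← pow_mul_eval_inv hQ h3, norm_mul, norm_pow, norm_iotaL, h0.2.1, norm_inv]
  refine mul_le_mul_of_nonneg_left ?_ (by positivity)
  have := hc z⁻¹ ((inv_mem_ball_iff ha h0.2.2 hN).2 hz)
  rwa [show iotaL p L z⁻¹ = (iotaL p L z)⁻¹ by simp [iotaL]] at this

/-- A locally polynomial function on `ℤ_p` lies in a ball of `C^r` controlled by its sup norm. -/
lemma exists_box_bound (p : ℕ) [Fact p.Prime] (L : Type) [NontriviallyNormedField L]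
    [NormedAlgebra ℚ_[p] L] [IsUltrametricDist L] [CompleteSpace L] (h : ℕ) {r : ℝ} (hr : 0 ≤ r) :
    ∃ C : ℝ, 0 < C ∧ ∀ (a : ℤ_[p]) (N : ℕ) (Q : L[X]) (c : ℝ), Q.natDegree ≤ h →
      SupLe (a : ℚ_[p]) N Q c → CB r (C * ((p : ℝ) ^ ((N : ℝ) * r) * c)) (box a N Q) := by
  obtain ⟨C, hC, H⟩ := crNorm_le_of_killed p L r hr (h + 1)
  refine ⟨C, hC, fun a N Q c hQ hc => ⟨isCr_box hr a N Q, ?_⟩⟩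
  rw [← mul_assoc]
  refine H N _ c hc.nonneg (fun z => ?_) (fwdDiff_iter_box a le_rfl (by omega))
  unfold box
  split_ifs with h1
  · refine hc _ ?_
    rw [← PadicInt.coe_sub]
    exact dvd_iff_norm_coe_le.1 h1
  · rw [norm_zero]; exact hc.nonneg

lemma bE_coe (a z : ℤ_[p]) (N : ℕ) (Q : L[X]) : bE (a : ℚ_[p]) (N : ℤ) Q (z : ℚ_[p]) = box a N Q z := by
  unfold box
  rw [bE_apply, ← PadicInt.coe_sub]
  simp only [dvd_iff_norm_coe_le]

end BanachSpace

section Atoms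

variable {p : ℕ} [hp : Fact p.Prime] {L : Type} [NontriviallyNormedField L]
  [NormedAlgebra ℚ_[p] L] [IsUltrametricDist L] [CompleteSpace L]
variable {h : ℕ} {r s : ℝ} {ρ c0 : L} {η η' : ℝ}

open Polynomial

lemma padic_norm_inv_pow {b : ℚ_[p]} (hb : b ≠ 0) (j : ℕ) :
    ‖b‖⁻¹ ^ j = (p : ℝ) ^ ((b.valuation : ℝ) * j) := by
  rw [rpow_zpow_mul, Real.rpow_natCast, padic_norm_eq hb, zpow_neg, inv_inv, ← zpow_natCast,
    ← zpow_natCast, zpow_comm]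

lemma Params.inversion_norm (hP : Params p h r s ρ c0) {b : ℚ_[p]} (hb : b ≠ 0) (n : ℤ) (c : ℝ) :
    ‖ρ ^ (-b.valuation)‖ * ((p : ℝ) ^ (((n - 2 * b.valuation : ℤ) : ℝ) * r) * (‖b‖⁻¹ ^ h * c)) =
      (p : ℝ) ^ ((n : ℝ) * r) * c := by
  rw [hP.norm_rho_zpow, padic_norm_inv_pow hb, ← mul_assoc, ← mul_assoc, mul_assoc (_ ^ _),
    ← Real.rpow_add p_pos, ← Real.rpow_add p_pos]
  congr 2
  push_cast
  linear_combination (-(b.valuation : ℝ)) * hP.sum_eq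

lemma norm_p_mul_coe_le (z : ℤ_[p]) : ‖(p : ℚ_[p]) * (z : ℚ_[p])‖ ≤ (p : ℝ) ^ (-1 : ℤ) := by
  rw [norm_mul, Padic.norm_p, zpow_neg_one]
  exact mul_le_of_le_one_right (inv_nonneg.2 p_pos.le) z.norm_le_one

lemma bE_inv_eq_zero {b : ℚ_[p]} (hb : ‖b‖ ≤ (p : ℝ) ^ (-1 : ℤ)) {n : ℤ} (hn : 1 ≤ n) (Q : L[X])
    {z : ℤ_[p]} (hz : z ≠ 0) : bE b n Q ((z : ℚ_[p])⁻¹) = 0 := by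
  rw [bE_apply, if_neg]
  intro h3
  have hz0 : (z : ℚ_[p]) ≠ 0 := by rwa [ne_eq, PadicInt.coe_eq_zero]
  have h4 : ‖(z : ℚ_[p])⁻¹‖ ≤ (p : ℝ) ^ (-1 : ℤ) := by
    have := Padic.nonarchimedean ((z : ℚ_[p])⁻¹ - b) b
    rw [sub_add_cancel] at this
    exact this.trans (max_le (h3.trans (zpow_le_zpow_right₀ one_lt_p.le (by omega))) hb)
  have h5 : (1 : ℝ) ≤ ‖(z : ℚ_[p])⁻¹‖ := by
    rw [norm_inv]; exact one_le_inv_iff₀.2 ⟨norm_pos_iff.2 hz0, z.norm_le_one⟩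
  have h6 : (p : ℝ) ^ (-1 : ℤ) < 1 := by rw [zpow_neg_one]; exact inv_lt_one_of_one_lt₀ one_lt_p
  linarith

lemma bE_p_mul_eq_zero {b : ℚ_[p]} (hb : ¬ ‖b‖ ≤ (p : ℝ) ^ (-1 : ℤ)) (hb0 : b ≠ 0) {n : ℤ}
    (hn : b.valuation < n) (Q : L[X]) (z : ℤ_[p]) : bE b n Q ((p : ℚ_[p]) * (z : ℚ_[p])) = 0 := by
  rw [bE_apply, if_neg]
  intro h5
  exact hb ((valuation_eq_of_mem_ball hb0 hn h5).2.1 ▸ norm_p_mul_coe_le z)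

lemma bH_p_mul_eq_zero (ρ : L) {n : ℤ} (hn : n ≤ 1) (Q : L[X]) (z : ℤ_[p]) :
    bH ρ 0 n Q ((p : ℚ_[p]) * (z : ℚ_[p])) = 0 := by
  rw [bH_apply, if_pos]
  rw [sub_zero]
  exact (norm_p_mul_coe_le z).trans (zpow_le_zpow_right₀ one_lt_p.le (by omega))

lemma Params.exists_bE_bound_of_ball (hP : Params p h r s ρ c0) :
    ∃ C : ℝ, 0 < C ∧ ∀ (b : ℚ_[p]) (n : ℤ) (Q : L[X]) (c : ℝ), Q.natDegree ≤ h → SupLe b n Q c →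
      (1 ≤ n ∨ (p : ℝ) ^ (-n) < ‖b‖) → BB h r ρ (C * ((p : ℝ) ^ ((n : ℝ) * r) * c)) (bE b n Q) := by
  have hr : 0 ≤ r := hP.r_pos.le
  obtain ⟨C, hC, H⟩ := exists_box_bound p L h hr
  refine ⟨C, hC, fun b n Q c hQ hc hn => ?_⟩
  have hc0 := hc.nonneg
  have hη : 0 ≤ C * ((p : ℝ) ^ ((n : ℝ) * r) * c) := by positivity
  have hpQ : (p : ℚ_[p]) ≠ 0 := pQ_ne_zero
  by_cases hb : ‖b‖ ≤ (p : ℝ) ^ (-1 : ℤ)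
  · have hn1 : 1 ≤ n := by
      rcases hn with hn | hn
      · exact hn
      · have := (zpow_lt_zpow_iff_right₀ (one_lt_p (p := p))).1 (hn.trans_le hb)
        omega
    obtain ⟨N, rfl⟩ : ∃ N : ℕ, n = N + 1 := ⟨(n - 1).toNat, by omega⟩
    have hbp : ‖b / (p : ℚ_[p])‖ ≤ 1 := by
      rw [norm_div, Padic.norm_p, div_inv_eq_mul]
      rw [zpow_neg_one] at hb
      exact (mul_le_mul_of_nonneg_right hb p_pos.le).trans_eq (inv_mul_cancel₀ p_pos.ne')
    obtain ⟨a, ha⟩ : ∃ a : ℤ_[p], (a : ℚ_[p]) = b / (p : ℚ_[p]) := ⟨⟨_, hbp⟩, rfl⟩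
    have h1 := hc.affP hpQ 0
    have h2 : ((N : ℤ) + 1 - (p : ℚ_[p]).valuation) = (N : ℤ) := by rw [Padic.valuation_p]; ring
    rw [sub_zero, ← ha, h2] at h1
    refine ⟨?_, 0, CB.zero hr hη, fun z hz => ?_⟩
    · have h3 := H a N (affP (p : ℚ_[p]) 0 Q) c (natDegree_affP_le _ _ hQ) h1
      have h4 : (fun z : ℤ_[p] => bE b ((N : ℤ) + 1) Q ((p : ℚ_[p]) * (z : ℚ_[p]))) =
          box a N (affP (p : ℚ_[p]) 0 Q) := by
        funext z
        have h5 := congrFun (affT_bE (L := L) hpQ 0 b ((N : ℤ) + 1) Q) (z : ℚ_[p])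
        rw [affT_apply, add_zero, sub_zero, h2, ← ha, bE_coe] at h5
        exact h5
      rw [h4]
      refine h3.mono (mul_le_mul_of_nonneg_left (mul_le_mul_of_nonneg_right ?_ hc0) hC.le)
      refine Real.rpow_le_rpow_of_exponent_le one_lt_p.le (mul_le_mul_of_nonneg_right ?_ hr)
      push_cast
      linarith
    · rw [bE_inv_eq_zero hb hn1 Q hz, mul_zero]; rfl
  · have hb0 : b ≠ 0 := by
      rintro rfl; rw [norm_zero] at hb; exact hb (zpow_nonneg p_pos.le _)
    have hv : b.valuation ≤ 0 := by
      rw [padic_norm_le_iff hb0] at hb; omega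
    have hn1 : b.valuation < n := by
      rcases hn with hn | hn
      · omega
      · rw [padic_norm_eq hb0, zpow_lt_zpow_iff_right₀ one_lt_p] at hn; omega
    obtain ⟨N, hN⟩ : ∃ N : ℕ, n - 2 * b.valuation = N := ⟨(n - 2 * b.valuation).toNat, by omega⟩
    have hbi : ‖b⁻¹‖ ≤ 1 := by
      have := (padic_norm_le_iff (inv_ne_zero hb0) (n := 0)).2 (by rw [Padic.valuation_inv]; omega)
      simpa using this
    obtain ⟨a, ha⟩ : ∃ a : ℤ_[p], (a : ℚ_[p]) = b⁻¹ := ⟨⟨_, hbi⟩, rfl⟩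
    have h1 := hc.reflect hb0 hn1 hQ
    rw [hN, ← ha] at h1
    have h2 := (H a N _ _ (natDegree_reflect_le' hQ) h1).smul hr (ρ ^ (-b.valuation))
    refine ⟨?_, ρ ^ (-b.valuation) • box a N (reflect h Q), h2.mono (le_of_eq ?_), fun z hz => ?_⟩
    · have h4 : (fun z : ℤ_[p] => bE b n Q ((p : ℚ_[p]) * (z : ℚ_[p]))) = 0 :=
        funext (bE_p_mul_eq_zero hb hb0 hn1 Q)
      rw [h4]
      exact CB.zero hr hη
    · rw [← hP.inversion_norm hb0 n c, hN, Int.cast_natCast, mul_left_comm]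
    · have hz0 : (z : ℚ_[p]) ≠ 0 := by rwa [ne_eq, PadicInt.coe_eq_zero]
      rw [inversion_bE hP.rho_ne_zero hb0 hz0 hn1 hQ, Pi.smul_apply, smul_eq_mul, ← bE_coe, hN, ha]

/-- Bound for polynomials supported on a ball which is either small or away from `0`. -/
lemma Params.exists_bE_bound (hP : Params p h r s ρ c0) (n0 : ℤ) :
    ∃ C : ℝ, 0 < C ∧ ∀ (b : ℚ_[p]) (n : ℤ) (Q : L[X]) (c : ℝ), Q.natDegree ≤ h → SupLe b n Q c →
      (n0 ≤ n ∨ (p : ℝ) ^ (-n) < ‖b‖) → BB h r ρ (C * ((p : ℝ) ^ ((n : ℝ) * r) * c)) (bE b n Q) := by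
  have hr : 0 ≤ r := hP.r_pos.le
  obtain ⟨C, hC, H⟩ := hP.exists_bE_bound_of_ball
  have key : ∀ m : ℕ, ∃ C : ℝ, 0 < C ∧ ∀ (b : ℚ_[p]) (n : ℤ) (Q : L[X]) (c : ℝ),
      Q.natDegree ≤ h → SupLe b n Q c → 1 - (m : ℤ) ≤ n →
      BB h r ρ (C * ((p : ℝ) ^ ((n : ℝ) * r) * c)) (bE b n Q) := by
    intro m
    induction m with
    | zero => exact ⟨C, hC, fun b n Q c hQ hc hn => H b n Q c hQ hc (Or.inl (by simpa using hn))⟩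
    | succ m ih =>
      obtain ⟨C', hC', H'⟩ := ih
      have hpr : (1 : ℝ) ≤ (p : ℝ) ^ r := Real.one_le_rpow one_lt_p.le hr
      refine ⟨C' * (p : ℝ) ^ r, by positivity, fun b n Q c hQ hc hn => ?_⟩
      have hc0 := hc.nonneg
      have e1 : C' * (p : ℝ) ^ r * ((p : ℝ) ^ ((n : ℝ) * r) * c) =
          C' * ((p : ℝ) ^ (((n + 1 : ℤ) : ℝ) * r) * c) := by
        push_cast
        rw [add_mul, one_mul, Real.rpow_add p_pos]; ring
      rw [e1, bE_split]
      refine BB.sum hr (by positivity) _ fun i _ => H' _ _ Q c hQ (hc.subball ?_ (by omega))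
        (by push_cast at hn; omega)
      rw [norm_sub_rev]
      exact norm_natCast_mul_zpow_le b i n
  obtain ⟨C', hC', H'⟩ := key (1 - n0).toNat
  refine ⟨max C C', lt_max_of_lt_left hC, fun b n Q c hQ hc hn => ?_⟩
  have hc0 := hc.nonneg
  rcases hn with hn | hn
  · exact (H' b n Q c hQ hc (by omega)).mono
      (mul_le_mul_of_nonneg_right (le_max_right _ _) (by positivity))
  · exact (H b n Q c hQ hc (Or.inr hn)).mono
      (mul_le_mul_of_nonneg_right (le_max_left _ _) (by positivity))

lemma bH_zero_inversion (ρ : L) {n : ℤ} {Q : L[X]} (hQ : Q.natDegree ≤ h) {N : ℕ}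
    (hN : 1 - n = N) {z : ℤ_[p]} (hz : z ≠ 0) (hρ : ρ ≠ 0) :
    ρ ^ ((z : ℚ_[p]).valuation) * (iotaL p L (z : ℚ_[p])) ^ h * bH ρ 0 n Q ((z : ℚ_[p])⁻¹) =
      box 0 N (reflect h Q) z := by
  have hz0 : (z : ℚ_[p]) ≠ 0 := by rwa [ne_eq, PadicInt.coe_eq_zero]
  have h3 : iotaL p L (z : ℚ_[p]) ≠ 0 := by
    rw [← norm_ne_zero_iff, norm_iotaL, norm_ne_zero_iff]; exact hz0
  rw [← bE_coe, bE_apply, bH_apply]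
  simp only [PadicInt.coe_zero, sub_zero, padic_norm_le_iff (inv_ne_zero hz0),
    padic_norm_le_iff hz0, Padic.valuation_inv]
  by_cases h1 : n ≤ -(z : ℚ_[p]).valuation
  · rw [if_pos h1, if_neg (by omega), mul_zero]
  · rw [if_neg h1, if_pos (by omega), mul_mul_mul_comm, ← zpow_add₀ hρ, add_neg_cancel, zpow_zero,
      one_mul, ← pow_mul_eval_inv hQ h3]
    simp [iotaL]

/-- Bound for the functions supported at infinity. -/
lemma Params.exists_bH_bound_of_ball (hP : Params p h r s ρ c0) :
    ∃ C : ℝ, 0 < C ∧ ∀ (b : ℚ_[p]) (n : ℤ) (j : ℕ), j ≤ h → n ≤ 1 → ‖b‖ ≤ (p : ℝ) ^ (-n) →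
      BB h r ρ (C * (p : ℝ) ^ ((n : ℝ) * (s - 1 - j))) (bH ρ b n (cpow L b j)) := by
  have hr : 0 ≤ r := hP.r_pos.le
  obtain ⟨C, hC, H⟩ := exists_box_bound p L h hr
  refine ⟨C * (p : ℝ) ^ ((h : ℝ) + 1), by have := p_pos (p := p); positivity,
    fun b n j hj hn hb => ?_⟩
  obtain ⟨N, hN⟩ : ∃ N : ℕ, 1 - n = N := ⟨(1 - n).toNat, by omega⟩
  have hQ : (cpow L b j).natDegree ≤ h := (natDegree_cpow_le b j).trans hj
  have hη : 0 ≤ C * (p : ℝ) ^ ((h : ℝ) + 1) * (p : ℝ) ^ ((n : ℝ) * (s - 1 - j)) := by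
    have := p_pos (p := p); positivity
  have hsup : SupLe ((0 : ℤ_[p]) : ℚ_[p]) N (reflect h (cpow L b j))
      ((p : ℝ) ^ (-((N : ℝ) * ((h : ℝ) - j)))) := by
    intro z hz
    rw [PadicInt.coe_zero, sub_zero] at hz
    have e0 : ((p : ℝ) ^ (-((N : ℝ) * ((h : ℝ) - j)))) = ((p : ℝ) ^ (-(N : ℤ))) ^ (h - j) := by
      rw [← Nat.cast_sub hj, ← mul_neg_one, mul_assoc, mul_neg_one, ← Int.cast_natCast N,
        rpow_zpow_mul, Real.rpow_neg p_pos.le, inv_zpow', Real.rpow_natCast, ← zpow_natCast,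
        ← zpow_natCast, zpow_comm]
    have e1 : reflect h (cpow L b j) = X ^ (h - j) * (1 - Polynomial.C (iotaL p L b) * X) ^ j := by
      have e2 : ∀ i : ℕ, reflect i (cpow L b i) = (1 - Polynomial.C (iotaL p L b) * X) ^ i := by
        intro i
        induction i with
        | zero => simp [cpow]
        | succ i ih =>
          have e3 : cpow L b (i + 1) = cpow L b i * (X - Polynomial.C (iotaL p L b)) := pow_succ _ _
          rw [e3, reflect_mul _ _ (natDegree_cpow_le b i) (natDegree_X_sub_C_le _), ih, pow_succ,
            reflect_sub, reflect_one_X, reflect_C, pow_one]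
      conv_lhs => rw [show h = (h - j) + j by omega, ← one_mul (cpow L b j)]
      rw [reflect_mul _ _ (by simp) (natDegree_cpow_le b j), e2, reflect_one]
    rw [e0, e1, eval_mul, eval_pow, eval_pow, norm_mul, norm_pow, norm_pow, eval_X, norm_iotaL]
    refine (mul_le_mul (pow_le_pow_left₀ (norm_nonneg _) hz _) (pow_le_one₀ (norm_nonneg _) ?_)
      (by positivity) (by positivity)).trans_eq (mul_one _)
    have e4 : eval (iotaL p L z) (1 - Polynomial.C (iotaL p L b) * X) = 1 - iotaL p L (b * z) := by
      simp [iotaL]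
    rw [e4]
    rw [sub_eq_add_neg]
    refine (IsUltrametricDist.norm_add_le_max _ _).trans (max_le (by simp) ?_)
    rw [norm_neg, norm_iotaL, norm_mul]
    refine (mul_le_mul hb hz (norm_nonneg _) (zpow_nonneg p_pos.le _)).trans ?_
    rw [← zpow_add₀ p_pos.ne']
    exact zpow_le_one_of_nonpos₀ one_lt_p.le (by omega)
  have h1 := H 0 N _ _ (natDegree_reflect_le' hQ) hsup
  rw [bH_congr ρ (b' := 0) (by rwa [sub_zero])]
  refine ⟨?_, box 0 N (reflect h (cpow L b j)), h1.mono ?_, fun z hz => ?_⟩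
  · have h4 : (fun z : ℤ_[p] => bH ρ 0 n (cpow L b j) ((p : ℚ_[p]) * (z : ℚ_[p]))) = 0 :=
      funext (bH_p_mul_eq_zero ρ hn _)
    rw [h4]
    exact CB.zero hr hη
  · rw [mul_assoc, ← Real.rpow_add p_pos, ← Real.rpow_add p_pos]
    refine mul_le_mul_of_nonneg_left (Real.rpow_le_rpow_of_exponent_le one_lt_p.le ?_) hC.le
    have e5 : (N : ℝ) = 1 - n := by exact_mod_cast hN.symm
    have e6 := hP.sum_eq
    have e7 := hP.s_pos
    have e8 : (j : ℝ) ≤ h := by exact_mod_cast hj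
    have e9 : (N : ℝ) * r + -((N : ℝ) * ((h : ℝ) - j)) = (1 - s + j) + n * (s - 1 - j) := by
      rw [e5]
      linear_combination (1 - (n : ℝ)) * e6
    rw [e9]
    linarith
  · exact (bH_zero_inversion ρ hQ hN hz hP.rho_ne_zero).symm

end Atoms

section Decomposition

variable {p : ℕ} [hp : Fact p.Prime] {L : Type} [NontriviallyNormedField L]
  [NormedAlgebra ℚ_[p] L] [IsUltrametricDist L] [CompleteSpace L]
variable {h : ℕ} {r s : ℝ} {ρ c0 : L} {η η' : ℝ}

open Polynomial

lemma Params.exists_bH_bound (hP : Params p h r s ρ c0) (m0 n1 : ℤ) :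
    ∃ C : ℝ, 0 < C ∧ ∀ (b : ℚ_[p]) (n : ℤ) (j : ℕ), j ≤ h → n ≤ n1 → ‖b‖ ≤ (p : ℝ) ^ (-m0) →
      BB h r ρ (C * (p : ℝ) ^ ((n : ℝ) * (s - 1 - j))) (bH ρ b n (cpow L b j)) := by
  have hr : 0 ≤ r := hP.r_pos.le
  have key : ∀ m : ℕ, ∃ C : ℝ, 0 < C ∧ ∀ (b : ℚ_[p]) (n : ℤ) (j : ℕ), j ≤ h →
      n ≤ min m0 1 + m → ‖b‖ ≤ (p : ℝ) ^ (-m0) →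
      BB h r ρ (C * (p : ℝ) ^ ((n : ℝ) * (s - 1 - j))) (bH ρ b n (cpow L b j)) := by
    intro m
    induction m with
    | zero =>
      obtain ⟨C, hC, H⟩ := hP.exists_bH_bound_of_ball
      refine ⟨C, hC, fun b n j hj hn hb => H b n j hj ?_ (hb.trans ?_)⟩
      · have := min_le_right m0 1; push_cast at hn; omega
      · refine zpow_le_zpow_right₀ one_lt_p.le ?_
        have := min_le_left m0 1; push_cast at hn; omega
    | succ m ih =>
      obtain ⟨C, hC, H⟩ := ih
      obtain ⟨D, hD, HD⟩ := hP.exists_bE_bound (min m0 1 + m)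
      have hp0 := p_pos (p := p)
      have hph : (1 : ℝ) ≤ (p : ℝ) ^ ((h : ℝ) + 1) := Real.one_le_rpow one_lt_p.le (by positivity)
      refine ⟨max C (D * (p : ℝ) ^ r) * (p : ℝ) ^ ((h : ℝ) + 1), by positivity,
        fun b n j hj hn hb => ?_⟩
      rcases (show n ≤ min m0 1 + m ∨ n = min m0 1 + m + 1 by push_cast at hn; omega) with h1 | h1
      · refine (H b n j hj h1 hb).mono (mul_le_mul_of_nonneg_right ?_ (by positivity))
        exact (le_max_left _ _).trans (le_mul_of_one_le_right (by positivity) hph)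
      · set n' : ℤ := min m0 1 + m with hn'
        have hjh : (j : ℝ) ≤ h := by exact_mod_cast hj
        have e1 : max C (D * (p : ℝ) ^ r) * (p : ℝ) ^ ((n' : ℝ) * (s - 1 - j)) ≤
            max C (D * (p : ℝ) ^ r) * (p : ℝ) ^ ((h : ℝ) + 1) *
              (p : ℝ) ^ ((n : ℝ) * (s - 1 - j)) := by
          rw [mul_assoc, ← Real.rpow_add p_pos]
          refine mul_le_mul_of_nonneg_left (Real.rpow_le_rpow_of_exponent_le one_lt_p.le ?_)
            (by positivity)
          rw [h1]; push_cast
          have := hP.s_pos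
          linarith
        refine BB.mono ?_ e1
        have hEb : ∀ n'' : ℤ, n' ≤ n'' → n'' ≤ n' + 1 →
            BB h r ρ (D * (p : ℝ) ^ r * (p : ℝ) ^ ((n' : ℝ) * (r - j))) (bE b n'' (cpow L b j)) := by
          intro n'' hn1 hn2
          refine (HD b n'' _ _ ((natDegree_cpow_le b j).trans hj) (supLe_cpow b n'' j)
            (Or.inl hn1)).mono ?_
          rw [mul_assoc, ← Real.rpow_add p_pos, ← Real.rpow_add p_pos]
          refine mul_le_mul_of_nonneg_left (Real.rpow_le_rpow_of_exponent_le one_lt_p.le ?_) hD.le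
          rcases (show n'' = n' ∨ n'' = n' + 1 by omega) with h2 | h2
          · rw [h2]; linarith
          · rw [h2]; push_cast
            have : (0 : ℝ) ≤ j := j.cast_nonneg
            linarith
        rw [h1, bH_succ]
        refine ((H b n' j hj le_rfl hb).mono (mul_le_mul_of_nonneg_right (le_max_left _ _)
          (by positivity))).add hr ((((hEb n' le_rfl (by omega)).sub hr
            (hEb (n' + 1) (by omega) le_rfl)).smul hr _).mono ?_)
        rw [hP.norm_rho_zpow, mul_left_comm, ← Real.rpow_add p_pos]
        refine mul_le_mul (le_max_right _ _) (le_of_eq ?_) (by positivity) (by positivity)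
        congr 1
        ring
  obtain ⟨C, hC, H⟩ := key (n1 - min m0 1).toNat
  exact ⟨C, hC, fun b n j hj hn hb => H b n j hj (by omega) hb⟩

/-- The coefficients of a polynomial are controlled by its values on a ball. -/
lemma exists_coeff_bound (p : ℕ) [Fact p.Prime] (L : Type) [NontriviallyNormedField L]
    [NormedAlgebra ℚ_[p] L] [IsUltrametricDist L] [CompleteSpace L] (h : ℕ) :
    ∃ C : ℝ, 0 < C ∧ ∀ (b : ℚ_[p]) (n : ℤ) (Q : L[X]) (c : ℝ), Q.natDegree ≤ h → SupLe b n Q c →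
      ∃ q : ℕ → L, Q = ∑ j ∈ Finset.range (h + 1), q j • cpow L b j ∧
        ∀ j ≤ h, ‖q j‖ ≤ C * ((p : ℝ) ^ ((n : ℝ) * j) * c) := by
  haveI := charZero_L p L
  set C : ℝ := ∑ i ∈ Finset.range (h + 1), ∑ j ∈ Finset.range (h + 1),
    ‖(newtonPoly L (0 : ℤ_[p]) 0 i).coeff j‖ with hC
  have hC0 : 0 ≤ C := Finset.sum_nonneg fun i _ => Finset.sum_nonneg fun j _ => norm_nonneg _
  refine ⟨C + 1, by positivity, fun b n Q c hQ hc => ?_⟩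
  have hc0 := hc.nonneg
  have hd : ((p : ℚ_[p]) ^ n) ≠ 0 := zpow_ne_zero _ pQ_ne_zero
  set Q' := affP ((p : ℚ_[p]) ^ n) b Q with hQ'
  have hdeg : Q'.natDegree ≤ h := natDegree_affP_le _ _ hQ
  have h1 : SupLe (0 : ℚ_[p]) 0 Q' c := by
    have := hc.affP hd b
    rwa [sub_self, zero_div, Padic.valuation_zpow, Padic.valuation_p, mul_one, sub_self] at this
  have hbox : ∀ y : ℤ_[p], box 0 0 Q' y = Q'.eval (iotaL p L (y : ℚ_[p])) := fun y => by simp [box]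
  have h2 : interp h 0 (box (0 : ℤ_[p]) 0 Q') = box (0 : ℤ_[p]) 0 Q' :=
    interp_eq_self h 0 (continuous_box 0 0 Q') (fwdDiff_iter_box 0 le_rfl (by omega))
  have h3 : Q' = ∑ i ∈ Finset.range (h + 1), (fwdDiff ((p ^ 0 : ℕ) : ℤ_[p]))^[i] (box (0 : ℤ_[p]) 0 Q') 0 •
      newtonPoly L (0 : ℤ_[p]) 0 i := by
    refine eq_of_infinite_eval_eq _ _ (Set.Infinite.mono (s := Set.range fun m : ℕ => (m : L)) ?_
      (Set.infinite_range_of_injective Nat.cast_injective))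
    rintro _ ⟨m, rfl⟩
    have h4 := congrFun h2 (((0 : ℕ) : ℤ_[p]) + (p : ℤ_[p]) ^ 0 * (m : ℤ_[p]))
    rw [interp_apply h 0 _ (by simp)] at h4
    have h5 : ((0 : ℕ) : ℤ_[p]) + (p : ℤ_[p]) ^ 0 * (m : ℤ_[p]) = (m : ℤ_[p]) := by simp
    have h6 : iotaL p L ((m : ℤ_[p]) : ℚ_[p]) = (m : L) := by simp [iotaL]
    rw [h5, hbox, h6] at h4
    rw [Set.mem_ofPred_eq, ← h4, eval_finsetSum]
    refine Finset.sum_congr rfl fun i _ => ?_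
    have h7 := eval_newtonPoly (L := L) (0 : ℤ_[p]) (m : ℤ_[p]) 0 i
    rw [pow_zero, one_mul, zero_add, h6] at h7
    rw [eval_smul, h7, smul_eq_mul, Nat.cast_zero]
  have h8 : ∀ j ≤ h, ‖Q'.coeff j‖ ≤ C * c := by
    intro j hj
    rw [h3, finsetSum_coeff, hC, Finset.sum_mul]
    refine (norm_sum_le _ _).trans (Finset.sum_le_sum fun i _ => ?_)
    rw [coeff_smul, smul_eq_mul, norm_mul, mul_comm]
    refine mul_le_mul (Finset.single_le_sum (f := fun j =>
      ‖(newtonPoly L (0 : ℤ_[p]) 0 i).coeff j‖) (fun _ _ => norm_nonneg _)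
      (Finset.mem_range.2 (by omega))) ?_ (norm_nonneg _)
      (Finset.sum_nonneg fun j _ => norm_nonneg _)
    refine norm_fwdDiff_iter_le _ i hc0 (fun z => ?_) 0
    rw [hbox]
    exact h1 _ (by simpa using z.norm_le_one)
  refine ⟨fun j => (taylor (iotaL p L b) Q).coeff j, ?_, fun j hj => ?_⟩
  · conv_lhs => rw [← sum_taylor_eq Q (iotaL p L b)]
    rw [sum_over_range' _ _ (h + 1) (by rw [natDegree_taylor]; omega)]
    · exact Finset.sum_congr rfl fun j _ => by rw [← smul_eq_C_mul]; rfl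
    · simp
  · have h9 : Q'.coeff j = (taylor (iotaL p L b) Q).coeff j *
        (iotaL p L ((p : ℚ_[p]) ^ n)) ^ j := by
      rw [← comp_C_mul_X_coeff, taylor_apply, comp_assoc]
      simp [hQ', affP]
    have h10 := h8 j hj
    rw [h9, norm_mul, norm_pow, norm_iotaL, Padic.norm_p_zpow] at h10
    have h11 : (p : ℝ) ^ ((n : ℝ) * j) * ((p : ℝ) ^ (-n)) ^ j = 1 := by
      rw [rpow_zpow_mul, Real.rpow_natCast, ← zpow_natCast, ← zpow_natCast, zpow_comm, ← mul_zpow,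
        ← zpow_add₀ p_pos.ne', add_neg_cancel, zpow_zero, one_zpow]
    have h12 : (0 : ℝ) ≤ (p : ℝ) ^ ((n : ℝ) * j) := Real.rpow_nonneg p_pos.le _
    calc ‖(taylor (iotaL p L b) Q).coeff j‖
        = (p : ℝ) ^ ((n : ℝ) * j) * (‖(taylor (iotaL p L b) Q).coeff j‖ * ((p : ℝ) ^ (-n)) ^ j) := by
          rw [mul_left_comm, h11, mul_one]
      _ ≤ (p : ℝ) ^ ((n : ℝ) * j) * (C * c) := mul_le_mul_of_nonneg_left h10 h12
      _ ≤ (C + 1) * ((p : ℝ) ^ ((n : ℝ) * j) * c) := by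
          have := mul_nonneg h12 hc0
          linarith

/-- A function of `ℤ_p` equal to its interpolation of level `N` is a sum of polynomials of degree
at most `h` on the classes modulo `p^N`. -/
lemma exists_box_decomp {u : ℤ_[p] → L} {N : ℕ} (hu : interp h N u = u) {c : ℝ}
    (hc : ∀ z, ‖u z‖ ≤ c) : ∃ Q : ℕ → L[X], (∀ a, (Q a).natDegree ≤ h) ∧
      (∀ a < p ^ N, SupLe ((a : ℤ_[p]) : ℚ_[p]) N (Q a) c) ∧
      u = ∑ a ∈ Finset.range (p ^ N), box (a : ℤ_[p]) N (Q a) := by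
  refine ⟨fun a => ∑ i ∈ Finset.range (h + 1), (fwdDiff ((p ^ N : ℕ) : ℤ_[p]))^[i] u (a : ℤ_[p]) •
    newtonPoly L (a : ℤ_[p]) N i, fun a => ?_, fun a ha z hz => ?_, ?_⟩
  · refine natDegree_sum_le_of_forall_le _ _ fun i hi => (natDegree_smul_le _ _).trans
      ((natDegree_newtonPoly_le _ _ _).trans ?_)
    rw [Finset.mem_range] at hi
    omega
  · have hz1 : ‖z‖ ≤ 1 := by
      have := Padic.nonarchimedean (z - ((a : ℤ_[p]) : ℚ_[p])) ((a : ℤ_[p]) : ℚ_[p])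
      rw [sub_add_cancel] at this
      exact this.trans (max_le (hz.trans (zpow_le_one_of_nonpos₀ one_lt_p.le (by omega)))
        (a : ℤ_[p]).norm_le_one)
    obtain ⟨z, rfl⟩ : ∃ y : ℤ_[p], (y : ℚ_[p]) = z := ⟨⟨z, hz1⟩, rfl⟩
    rw [← PadicInt.coe_sub, ← dvd_iff_norm_coe_le] at hz
    obtain ⟨y, hy⟩ := hz
    have h1 : z = (a : ℤ_[p]) + (p : ℤ_[p]) ^ N * y := by rw [← hy]; ring
    have h2 := hc z
    rw [← hu, h1, interp_apply h N u ha] at h2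
    rw [h1, eval_finsetSum]
    simpa only [eval_smul, eval_newtonPoly, smul_eq_mul] using h2
  · conv_lhs => rw [← hu]
    unfold interp
    refine Finset.sum_congr rfl fun a _ => ?_
    exact ((map_sum (boxLin (L := L) (a : ℤ_[p]) N) _ _).trans
      (Finset.sum_congr rfl fun i _ => map_smul (boxLin (L := L) (a : ℤ_[p]) N) _ _)).symm

end Decomposition

section AtomicDecomposition

variable {p : ℕ} [hp : Fact p.Prime] {L : Type} [NontriviallyNormedField L]
  [NormedAlgebra ℚ_[p] L] [IsUltrametricDist L] [CompleteSpace L]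
variable {h : ℕ} {r s : ℝ} {ρ c0 : L} {η η' : ℝ}

open Polynomial

/-- Atoms of size `η`: polynomials on a ball which is small or away from `0`, and multiples of the
functions `z ↦ ρ^{val z} z^l` on the complement of a large ball. -/
inductive IsAtom (h : ℕ) (r s : ℝ) (ρ : L) (η : ℝ) : (ℚ_[p] → L) → Prop
  | ball (b : ℚ_[p]) (n : ℤ) (Q : L[X]) (c : ℝ) (hQ : Q.natDegree ≤ h) (hc : SupLe b n Q c)
      (hn : 1 ≤ n ∨ (p : ℝ) ^ (-n) < ‖b‖) (hη : (p : ℝ) ^ ((n : ℝ) * r) * c ≤ η) :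
      IsAtom h r s ρ η (bE b n Q)
  | infinity (n : ℤ) (l : ℕ) (c : L) (hl : l ≤ h) (hn : n ≤ 1)
      (hη : ‖c‖ * (p : ℝ) ^ ((n : ℝ) * (s - 1 - l)) ≤ η) :
      IsAtom h r s ρ η (c • bH ρ (0 : ℚ_[p]) n (cpow L (0 : ℚ_[p]) l))

/-- The finite sums of atoms of size `η`. -/
def atomGroup (p : ℕ) [Fact p.Prime] {L : Type} [NontriviallyNormedField L]
    [NormedAlgebra ℚ_[p] L] (h : ℕ) (r s : ℝ) (ρ : L) (η : ℝ) : AddSubgroup (ℚ_[p] → L) :=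
  AddSubgroup.closure {g | IsAtom h r s ρ η g}

lemma IsAtom.mem {g : ℚ_[p] → L} (hg : IsAtom h r s ρ η g) : g ∈ atomGroup p h r s ρ η :=
  AddSubgroup.subset_closure hg

lemma IsAtom.mono {g : ℚ_[p] → L} (hg : IsAtom h r s ρ η g) (hη : η ≤ η') :
    IsAtom h r s ρ η' g := by
  cases hg with
  | ball b n Q c hQ hc hn h1 => exact IsAtom.ball b n Q c hQ hc hn (h1.trans hη)
  | infinity n l c hl hn h1 => exact IsAtom.infinity n l c hl hn (h1.trans hη)

lemma atomGroup_mono (hη : η ≤ η') : atomGroup p h r s ρ η ≤ atomGroup p h r s ρ η' :=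
  AddSubgroup.closure_mono fun _ hg => IsAtom.mono hg hη

lemma exists_lift_zero (hr : 0 ≤ r) {u : ℤ_[p] → L} {N : ℕ} (hu : interp h N u = u) {A : ℝ}
    (hA : ∀ z, ‖u z‖ ≤ A * (p : ℝ) ^ (-((N : ℝ) * r))) :
    ∃ g ∈ atomGroup p h r s ρ ((p : ℝ) ^ r * A),
      (∀ y : ℤ_[p], g ((p : ℚ_[p]) * (y : ℚ_[p])) = u y) ∧
      ∀ w : ℤ_[p], w ≠ 0 → g ((w : ℚ_[p])⁻¹) = 0 := by
  obtain ⟨Q, hQ, hsup, hsum⟩ := exists_box_decomp hu hA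
  have hpi : ((p : ℚ_[p])⁻¹) ≠ 0 := inv_ne_zero pQ_ne_zero
  have hv : ((N : ℤ) - ((p : ℚ_[p])⁻¹).valuation) = N + 1 := by
    rw [Padic.valuation_inv, Padic.valuation_p]; ring
  set b : ℕ → ℚ_[p] := fun a => (((a : ℤ_[p]) : ℚ_[p]) - 0) / (p : ℚ_[p])⁻¹ with hb
  have hb1 : ∀ a, ‖b a‖ ≤ (p : ℝ) ^ (-1 : ℤ) := fun a => by
    have := norm_p_mul_coe_le (p := p) (a : ℤ_[p])
    show ‖(((a : ℤ_[p]) : ℚ_[p]) - 0) / (p : ℚ_[p])⁻¹‖ ≤ _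
    rwa [sub_zero, div_inv_eq_mul, mul_comm]
  have hT : ∀ a, bE (b a) ((N : ℤ) + 1) (affP (p : ℚ_[p])⁻¹ 0 (Q a)) =
      affT (p : ℚ_[p])⁻¹ 0 (bE ((a : ℤ_[p]) : ℚ_[p]) N (Q a)) := fun a => by
    rw [affT_bE hpi, hv]
  refine ⟨∑ a ∈ Finset.range (p ^ N), bE (b a) ((N : ℤ) + 1) (affP (p : ℚ_[p])⁻¹ 0 (Q a)),
    sum_mem fun a ha => ?_, fun y => ?_, fun w hw => ?_⟩
  · have h1 := (hsup a (Finset.mem_range.1 ha)).affP hpi 0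
    rw [hv] at h1
    refine (IsAtom.ball _ _ _ _ (natDegree_affP_le _ _ (hQ a)) h1 (Or.inl (by omega)) ?_).mem
    rw [mul_left_comm, mul_comm A, ← Real.rpow_add p_pos]
    refine le_of_eq ?_
    push_cast
    ring_nf
  · rw [hsum, Finset.sum_apply, Finset.sum_apply]
    refine Finset.sum_congr rfl fun a _ => ?_
    rw [hT, affT_apply, add_zero, inv_mul_cancel_left₀ pQ_ne_zero, bE_coe]
  · rw [Finset.sum_apply]
    exact Finset.sum_eq_zero fun a _ => bE_inv_eq_zero (hb1 a) (by omega) _ hw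

lemma Params.exists_lift_infinity (hP : Params p h r s ρ c0) :
    ∃ C : ℝ, 1 ≤ C ∧ ∀ (u : ℤ_[p] → L) (N : ℕ) (A : ℝ), interp h N u = u → 0 ≤ A →
      (∀ z, ‖u z‖ ≤ A * (p : ℝ) ^ (-((N : ℝ) * r))) →
      ∃ g ∈ atomGroup p h r s ρ (C * A),
        (∀ y : ℤ_[p], g ((p : ℚ_[p]) * (y : ℚ_[p])) = 0) ∧
        ∀ w : ℤ_[p], w ≠ 0 →
          ρ ^ ((w : ℚ_[p]).valuation) * (iotaL p L (w : ℚ_[p])) ^ h * g ((w : ℚ_[p])⁻¹) = u w := by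
  obtain ⟨C, hC, HC⟩ := exists_coeff_bound p L h
  have hp0 := p_pos (p := p)
  have hr := hP.r_pos.le
  refine ⟨max 1 (C * (p : ℝ) ^ (h : ℝ)), le_max_left _ _, fun u N A hu hA0 hA => ?_⟩
  obtain ⟨Q, hQ, hsup, hsum⟩ := exists_box_decomp hu hA
  set I : (ℚ_[p] → L) → ℤ_[p] → L := fun g w =>
    ρ ^ ((w : ℚ_[p]).valuation) * (iotaL p L (w : ℚ_[p])) ^ h * g ((w : ℚ_[p])⁻¹) with hI
  have key : ∀ a ∈ Finset.range (p ^ N),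
      ∃ g ∈ atomGroup p h r s ρ (max 1 (C * (p : ℝ) ^ (h : ℝ)) * A),
        (∀ y : ℤ_[p], g ((p : ℚ_[p]) * (y : ℚ_[p])) = 0) ∧
        ∀ w : ℤ_[p], w ≠ 0 → I g w = box (a : ℤ_[p]) N (Q a) w := by
    intro a ha
    rw [Finset.mem_range] at ha
    rcases Nat.eq_zero_or_pos a with rfl | ha0
    · have hs0 := hsup 0 ha
      rw [Nat.cast_zero, PadicInt.coe_zero] at hs0
      obtain ⟨q, hq, hqb⟩ := HC 0 N (Q 0) _ (hQ 0) hs0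
      have hN : (1 : ℤ) - (1 - (N : ℤ)) = N := by ring
      have hrefl : reflect h (Q 0) = ∑ j ∈ Finset.range (h + 1), q j • cpow L (0 : ℚ_[p]) (h - j) := by
        rw [hq]
        have : ∀ t : Finset ℕ, t ⊆ Finset.range (h + 1) →
            reflect h (∑ j ∈ t, q j • cpow L (0 : ℚ_[p]) j) =
              ∑ j ∈ t, q j • cpow L (0 : ℚ_[p]) (h - j) := by
          intro t
          induction t using Finset.induction_on with
          | empty => simp
          | insert j t hj ih =>
            intro hsub
            have hjh : j ≤ h := by
              have := hsub (Finset.mem_insert_self j t)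
              rw [Finset.mem_range] at this; omega
            rw [Finset.sum_insert hj, Finset.sum_insert hj, reflect_add,
              ih (fun x hx => hsub (Finset.mem_insert_of_mem hx)), smul_eq_C_mul, smul_eq_C_mul]
            congr 1
            simp [cpow, iotaL, revAt_le hjh]
        exact this _ le_rfl
      refine ⟨bH ρ 0 (1 - (N : ℤ)) (reflect h (Q 0)), ?_, fun y => bH_p_mul_eq_zero ρ (by omega) _ y,
        fun w hw => ?_⟩
      · rw [hrefl, map_sum]
        refine sum_mem fun j hj => ?_
        rw [map_smul]
        have hjh : j ≤ h := by rw [Finset.mem_range] at hj; omega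
        refine (IsAtom.infinity _ _ _ (Nat.sub_le h j) (by omega) ?_).mem
        refine (mul_le_mul_of_nonneg_right (hqb j hjh) (by positivity)).trans ?_
        have e1 : C * ((p : ℝ) ^ (((N : ℤ) : ℝ) * j) * (A * (p : ℝ) ^ (-((N : ℝ) * r)))) *
            (p : ℝ) ^ (((1 - (N : ℤ) : ℤ) : ℝ) * (s - 1 - ((h - j : ℕ) : ℝ))) =
            C * (p : ℝ) ^ ((j : ℝ) - r) * A := by
          have e2 : (p : ℝ) ^ ((j : ℝ) - r) = (p : ℝ) ^ (((N : ℤ) : ℝ) * j) *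
              (p : ℝ) ^ (-((N : ℝ) * r)) *
              (p : ℝ) ^ (((1 - (N : ℤ) : ℤ) : ℝ) * (s - 1 - ((h - j : ℕ) : ℝ))) := by
            rw [← Real.rpow_add p_pos, ← Real.rpow_add p_pos]
            congr 1
            push_cast [Nat.cast_sub hjh]
            linear_combination (-(1 - (N : ℝ))) * hP.sum_eq
          rw [e2]; ring
        rw [e1]
        refine mul_le_mul_of_nonneg_right (le_trans ?_ (le_max_right _ _)) hA0
        refine mul_le_mul_of_nonneg_left (Real.rpow_le_rpow_of_exponent_le one_lt_p.le ?_) hC.le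
        have : (j : ℝ) ≤ h := by exact_mod_cast hjh
        linarith
      · rw [hI, Nat.cast_zero]
        dsimp only
        rw [bH_zero_inversion ρ (natDegree_reflect_le' (hQ 0)) hN hw hP.rho_ne_zero,
          reflect_reflect]
    · haveI : CharZero ℚ_[p] := inferInstance
      have ha1 : (((a : ℤ_[p]) : ℚ_[p])) ≠ 0 := by
        rw [PadicInt.coe_natCast]; exact_mod_cast ha0.ne'
      set a' : ℚ_[p] := ((a : ℤ_[p]) : ℚ_[p]) with ha'
      have hval : a'.valuation < N := by
        by_contra hcon
        have h1 := (padic_norm_le_iff ha1).2 (not_lt.1 hcon)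
        rw [ha', ← dvd_iff_norm_coe_le] at h1
        have h2 := dvd_natCast_sub (p := p) (N := N) (a := a) (b := 0) ha (pow_pos hp.out.pos N) (y := 0)
          (by simpa using h1)
        omega
      have hval0 : 0 ≤ a'.valuation := by
        have h1 : ‖a'‖ ≤ (p : ℝ) ^ (-(0 : ℤ)) := by
          rw [neg_zero, zpow_zero]; exact (a : ℤ_[p]).norm_le_one
        exact (padic_norm_le_iff ha1).1 h1
      have hvi : a'⁻¹.valuation = -a'.valuation := Padic.valuation_inv a'
      have hsr := (hsup a ha).reflect ha1 hval (hQ a)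
      refine ⟨bE a'⁻¹ (N - 2 * a'.valuation) (ρ ^ (-a'.valuation) • reflect h (Q a)), ?_,
        fun y => bE_p_mul_eq_zero ?_ (inv_ne_zero ha1) (by omega) _ y, fun w hw => ?_⟩
      · refine (IsAtom.ball _ _ _ (‖ρ ^ (-a'.valuation)‖ * (‖a'‖⁻¹ ^ h *
          (A * (p : ℝ) ^ (-((N : ℝ) * r)))))
          ((natDegree_smul_le _ _).trans (natDegree_reflect_le' (hQ a))) (fun z hz => ?_)
          (Or.inr ?_) ?_).mem
        · rw [eval_smul, smul_eq_mul, norm_mul]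
          exact mul_le_mul_of_nonneg_left (hsr z hz) (norm_nonneg _)
        · rw [padic_norm_eq (inv_ne_zero ha1), hvi]
          exact zpow_lt_zpow_right₀ one_lt_p (by omega)
        · rw [mul_left_comm, hP.inversion_norm ha1, Int.cast_natCast, mul_left_comm,
            ← Real.rpow_add p_pos, add_neg_cancel, Real.rpow_zero]
          exact mul_le_mul_of_nonneg_right (le_max_left _ _) hA0 |>.trans' (by linarith)
      · rw [padic_norm_le_iff (inv_ne_zero ha1)]; omega
      · have hw0 : (w : ℚ_[p]) ≠ 0 := by rwa [ne_eq, PadicInt.coe_eq_zero]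
        have h1 := inversion_bE hP.rho_ne_zero (inv_ne_zero ha1) hw0
          (N := N - 2 * a'.valuation) (by omega)
          ((natDegree_smul_le (ρ ^ (-a'.valuation)) _).trans (natDegree_reflect_le' (hQ a)))
        rw [hI]
        dsimp only
        rw [h1, hvi, inv_inv, neg_neg, show (N : ℤ) - 2 * a'.valuation - 2 * -a'.valuation = N by ring,
          smul_eq_C_mul, reflect_C_mul, reflect_reflect, ← smul_eq_C_mul, map_smul, Pi.smul_apply,
          smul_eq_mul, ← mul_assoc, ← zpow_add₀ hP.rho_ne_zero, add_neg_cancel, zpow_zero, one_mul,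
          ha', bE_coe]
  choose! g hg1 hg2 hg3 using key
  refine ⟨∑ a ∈ Finset.range (p ^ N), g a, sum_mem hg1, fun y => ?_, fun w hw => ?_⟩
  · rw [Finset.sum_apply]
    exact Finset.sum_eq_zero fun a ha => hg2 a ha y
  · rw [hsum, Finset.sum_apply, Finset.sum_apply, Finset.mul_sum]
    exact Finset.sum_congr rfl fun a ha => hg3 a ha w hw

/-- Atomic decomposition. -/
theorem Params.exists_atomic (hP : Params p h r s ρ c0) :
    ∃ C : ℝ, 0 < C ∧ ∀ (η : ℝ) (f : ℚ_[p] → L), BB h r ρ η f →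
      ∃ (G : ℕ → ℚ_[p] → L) (A : ℕ → ℝ), Tendsto A atTop (𝓝 0) ∧ (∀ N, 0 ≤ A N) ∧
        (∀ N, A N ≤ C * η) ∧ (∀ N, G N ∈ atomGroup p h r s ρ (A N)) ∧
        ∀ z, HasSum (fun N => G N z) (f z) := by
  have hp0 := p_pos (p := p)
  have hr := hP.r_pos.le
  obtain ⟨C, hC, HC⟩ := hP.exists_lift_infinity
  have hpr : (1 : ℝ) ≤ (p : ℝ) ^ r := Real.one_le_rpow one_lt_p.le hr
  refine ⟨C * (p : ℝ) ^ r * (p : ℝ) ^ r, by positivity, fun η f ⟨⟨hf1, hf1n⟩, g, ⟨hg, hgn⟩, hfg⟩ => ?_⟩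
  have hη : 0 ≤ η := (crNorm_nonneg _ _).trans hf1n
  obtain ⟨A₁, hA₁, hA₁0, hA₁n, hw₁⟩ := hf1.exists_wav_bound hr hP.r_lt
  obtain ⟨A₂, hA₂, hA₂0, hA₂n, hw₂⟩ := hg.exists_wav_bound hr hP.r_lt
  choose G₁ hG₁ hG₁z hG₁i using fun N => exists_lift_zero (s := s) (ρ := ρ) hr
    (interp_wav h _ N) (hw₁ N)
  choose G₂ hG₂ hG₂z hG₂i using fun N => HC _ N (A₂ N) (interp_wav h g N) (hA₂0 N) (hw₂ N)
  refine ⟨fun N => G₁ N + G₂ N, fun N => C * (p : ℝ) ^ r * max (A₁ N) (A₂ N), ?_,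
    fun N => mul_nonneg (by positivity) (le_max_of_le_left (hA₁0 N)), fun N => ?_, fun N => ?_, ?_⟩
  · have := (hA₁.max hA₂).const_mul (C * (p : ℝ) ^ r)
    rwa [max_self, mul_zero] at this
  · show C * (p : ℝ) ^ r * max (A₁ N) (A₂ N) ≤ C * (p : ℝ) ^ r * (p : ℝ) ^ r * η
    rw [mul_assoc (C * (p : ℝ) ^ r)]
    refine mul_le_mul_of_nonneg_left (max_le ?_ ?_) (by positivity)
    · exact (hA₁n N).trans (mul_le_mul_of_nonneg_left hf1n (by positivity))
    · exact (hA₂n N).trans (mul_le_mul_of_nonneg_left hgn (by positivity))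
  · refine add_mem (atomGroup_mono ?_ (hG₁ N)) (atomGroup_mono ?_ (hG₂ N))
    · show (p : ℝ) ^ r * A₁ N ≤ C * (p : ℝ) ^ r * max (A₁ N) (A₂ N)
      rw [mul_assoc]
      refine (mul_le_mul_of_nonneg_left (le_max_left _ (A₂ N)) (by positivity)).trans ?_
      exact le_mul_of_one_le_left (mul_nonneg (by positivity) (le_max_of_le_left (hA₁0 N))) hC
    · refine mul_le_mul (le_mul_of_one_le_right (by positivity) hpr) (le_max_right _ _) (hA₂0 N)
        (by positivity)
  · intro z
    by_cases hz : ‖z‖ ≤ (p : ℝ) ^ (-1 : ℤ)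
    · have hzp : ‖z / (p : ℚ_[p])‖ ≤ 1 := by
        rw [norm_div, Padic.norm_p, div_inv_eq_mul]
        rw [zpow_neg_one] at hz
        exact (mul_le_mul_of_nonneg_right hz hp0.le).trans_eq (inv_mul_cancel₀ hp0.ne')
      obtain ⟨y, hy⟩ : ∃ y : ℤ_[p], (y : ℚ_[p]) = z / (p : ℚ_[p]) := ⟨⟨_, hzp⟩, rfl⟩
      have hzy : z = (p : ℚ_[p]) * (y : ℚ_[p]) := by rw [hy, mul_div_cancel₀ _ pQ_ne_zero]
      rw [hzy]
      simp only [Pi.add_apply, hG₁z, hG₂z, add_zero]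
      exact hf1.hasSum_wav hr hP.r_lt y
    · have hz0 : z ≠ 0 := by
        rintro rfl; rw [norm_zero] at hz; exact hz (zpow_nonneg hp0.le _)
      have hzi : ‖z⁻¹‖ ≤ 1 := by
        rw [padic_norm_le_iff hz0] at hz
        have := (padic_norm_le_iff (inv_ne_zero hz0) (n := 0)).2 (by rw [Padic.valuation_inv]; omega)
        simpa using this
      obtain ⟨w, hw⟩ : ∃ w : ℤ_[p], (w : ℚ_[p]) = z⁻¹ := ⟨⟨_, hzi⟩, rfl⟩
      have hzw : z = (w : ℚ_[p])⁻¹ := by rw [hw, inv_inv]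
      have hwQ : (w : ℚ_[p]) ≠ 0 := by rw [hw]; exact inv_ne_zero hz0
      have hw0 : w ≠ 0 := by rwa [ne_eq, ← PadicInt.coe_eq_zero]
      have hfac : ρ ^ ((w : ℚ_[p]).valuation) * (iotaL p L (w : ℚ_[p])) ^ h ≠ 0 := by
        refine mul_ne_zero (zpow_ne_zero _ hP.rho_ne_zero) (pow_ne_zero _ ?_)
        rw [← norm_ne_zero_iff, norm_iotaL, norm_ne_zero_iff]; exact hwQ
      rw [hzw]
      simp only [Pi.add_apply, hG₁i _ w hw0, zero_add]
      have h1 := hg.hasSum_wav hr hP.r_lt w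
      rw [hfg w hw0] at h1
      simp only [← hG₂i _ w hw0] at h1
      exact (hasSum_mul_left_iff hfac).1 h1

end AtomicDecomposition

section BoundedFunctionals

variable {p : ℕ} [hp : Fact p.Prime] {L : Type} [NontriviallyNormedField L]
  [NormedAlgebra ℚ_[p] L] [IsUltrametricDist L] [CompleteSpace L]
variable {h : ℕ} {r s : ℝ} {ρ c0 : L} {η η' : ℝ} {μ : (ℚ_[p] → L) →ₗ[L] L} {K : ℝ}

open Polynomial

/-- The function `z ↦ ρ^{val (z - b)} (z - b)^j`, extended by `0`. -/
def spc (ρ : L) (b : ℚ_[p]) (j : ℕ) : ℚ_[p] → L := fun z =>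
  if z = b then 0 else ρ ^ (z - b).valuation * (iotaL p L (z - b)) ^ j

/-- `μ` is bounded by `K` on the Banach space of `BB`. -/
def FB (h : ℕ) (r : ℝ) (ρ : L) (μ : (ℚ_[p] → L) →ₗ[L] L) (K : ℝ) : Prop :=
  ∀ (η : ℝ) (f : ℚ_[p] → L), BB h r ρ η f → ‖μ f‖ ≤ K * η

/-- `μ` vanishes on the functions `z^l`, `l < r`, and `spc ρ b j`, `s - 1 < j ≤ h`. -/
structure KillsGen (h : ℕ) (r s : ℝ) (ρ : L) (μ : (ℚ_[p] → L) →ₗ[L] L) : Prop where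
  mono_eq : ∀ l : ℕ, (l : ℝ) < r → μ (monomialFun p L l) = 0
  spc_eq : ∀ (b : ℚ_[p]) (j : ℕ), j ≤ h → s - 1 < j → μ (spc ρ b j) = 0

lemma hasSum_telescope {u : ℕ → L} {a : L} (hu : Tendsto u atTop (𝓝 a)) :
    HasSum (fun m => u (m + 1) - u m) (a - u 0) := by
  have h1 : Tendsto (fun m => u (m + 1) - u m) atTop (𝓝 0) := by
    simpa using (hu.comp (tendsto_add_atTop_nat 1)).sub hu
  have h2 : Summable fun m => u (m + 1) - u m := by
    refine NonarchimedeanAddGroup.summable_of_tendsto_cofinite_zero ?_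
    rwa [Nat.cofinite_eq_atTop]
  have h3 := h2.hasSum.tendsto_sum_nat
  simp only [Finset.sum_range_sub] at h3
  rw [tendsto_nhds_unique (hu.sub_const (u 0)) h3]
  exact h2.hasSum

lemma tendsto_rpow_shift {x : ℝ} (hx : x < 0) (a C : ℝ) :
    Tendsto (fun m : ℕ => C * (p : ℝ) ^ ((a + m) * x)) atTop (𝓝 0) := by
  have h1 : ∀ m : ℕ, C * (p : ℝ) ^ ((a + m) * x) = C * (p : ℝ) ^ (a * x) * ((p : ℝ) ^ x) ^ m := by
    intro m
    rw [add_mul, Real.rpow_add p_pos, mul_comm (m : ℝ),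
      Real.rpow_mul p_pos.le x, Real.rpow_natCast, mul_assoc]
  simp only [h1]
  rw [← mul_zero (C * (p : ℝ) ^ (a * x))]
  exact (tendsto_pow_atTop_nhds_zero_of_lt_one (Real.rpow_nonneg p_pos.le _)
    (Real.rpow_lt_one_of_one_lt_of_neg one_lt_p hx)).const_mul _

lemma mul_rpow_le {x a a' C : ℝ} (hC : 0 ≤ C) (h : a * x ≤ a' * x) :
    C * (p : ℝ) ^ (a * x) ≤ C * (p : ℝ) ^ (a' * x) :=
  mul_le_mul_of_nonneg_left (Real.rpow_le_rpow_of_exponent_le one_lt_p.le h) hC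

lemma eval_cpow (b z : ℚ_[p]) (j : ℕ) : (cpow L b j).eval (iotaL p L z) = (iotaL p L (z - b)) ^ j := by
  simp [cpow, iotaL]

/-- The shells of the monomials are bounded. -/
lemma Params.exists_shell_bound (hP : Params p h r s ρ c0) :
    ∃ C : ℝ, 0 < C ∧ ∀ (n : ℤ) (l : ℕ), l ≤ h →
      BB h r ρ (C * (p : ℝ) ^ ((n : ℝ) * (r - l)))
        (bE (0 : ℚ_[p]) n (cpow L (0 : ℚ_[p]) l) - bE (0 : ℚ_[p]) (n + 1) (cpow L (0 : ℚ_[p]) l)) := by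
  obtain ⟨C, hC, HC⟩ := hP.exists_bE_bound 0
  have hp0 := p_pos (p := p)
  refine ⟨C * (p : ℝ) ^ r, by positivity, fun n l hl => ?_⟩
  rw [bE_split, ← Finset.add_sum_erase _ _ (Finset.mem_range.2 hp.out.pos), Nat.cast_zero, zero_mul,
    add_zero, add_sub_cancel_left]
  refine BB.sum hP.r_pos.le (by positivity) _ fun c hc => ?_
  rw [Finset.mem_erase, Finset.mem_range] at hc
  have hc1 : ‖(c : ℚ_[p])‖ = 1 := by
    rw [Padic.norm_natCast_eq_one_iff]
    exact Nat.coprime_of_lt_prime (by omega) hc.2 hp.out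
  have hb : ‖(0 : ℚ_[p]) + (c : ℚ_[p]) * (p : ℚ_[p]) ^ n‖ = (p : ℝ) ^ (-n) := by
    rw [zero_add, norm_mul, hc1, one_mul, Padic.norm_p_zpow]
  have h1 : SupLe ((0 : ℚ_[p]) + (c : ℚ_[p]) * (p : ℚ_[p]) ^ n) (n + 1) (cpow L (0 : ℚ_[p]) l) _ :=
    (supLe_cpow (L := L) (0 : ℚ_[p]) n l).subball (by rw [sub_zero, hb]) (by omega)
  refine (HC _ _ _ _ ((natDegree_cpow_le _ _).trans hl) h1 (Or.inr ?_)).mono (le_of_eq ?_)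
  · rw [hb]; exact zpow_lt_zpow_right₀ one_lt_p (by omega)
  · rw [← Real.rpow_add p_pos, mul_assoc, ← Real.rpow_add p_pos]
    congr 2
    push_cast; ring

lemma Params.exists_mono_sub_bound (hP : Params p h r s ρ c0) :
    ∃ C : ℝ, 0 < C ∧ ∀ (n : ℤ) (l : ℕ), (l : ℝ) < r →
      BB h r ρ (C * (p : ℝ) ^ ((n : ℝ) * (r - l)))
        (monomialFun p L l - bE (0 : ℚ_[p]) n (cpow L (0 : ℚ_[p]) l)) := by
  obtain ⟨C, hC, HC⟩ := hP.exists_shell_bound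
  refine ⟨C, hC, fun n l hl => ?_⟩
  have hlh : l ≤ h := by
    have := hP.r_lt
    have : (l : ℝ) < h + 1 := by linarith
    exact_mod_cast Nat.lt_succ_iff.1 (by exact_mod_cast this)
  have hx : (l : ℝ) - r < 0 := by linarith
  refine BB.of_hasSum hP.r_pos.le (G := fun m : ℕ => bE (0 : ℚ_[p]) (n - (m + 1 : ℕ)) (cpow L (0 : ℚ_[p]) l) -
    bE (0 : ℚ_[p]) (n - (m : ℕ)) (cpow L (0 : ℚ_[p]) l)) (fun z => ?_)
    (tendsto_rpow_shift (p := p) hx (1 - n) C) (fun m => ?_) (fun m => ?_)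
  · have h1 : Tendsto (fun m : ℕ => bE (0 : ℚ_[p]) (n - (m : ℕ)) (cpow L (0 : ℚ_[p]) l) z) atTop
        (𝓝 (monomialFun p L l z)) := by
      refine tendsto_const_nhds.congr' ?_
      filter_upwards [eventually_ge_atTop (n - z.valuation).toNat] with m hm
      rw [bE_apply, eval_cpow, if_pos, sub_zero]
      · rfl
      · rcases eq_or_ne z 0 with rfl | hz
        · rw [sub_zero, norm_zero]; exact zpow_nonneg p_pos.le _
        · rw [sub_zero, padic_norm_le_iff hz]; omega
    have h2 := hasSum_telescope h1
    rwa [Nat.cast_zero, sub_zero] at h2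
  · rw [show (n : ℝ) * (r - l) = (-n) * (l - r) by ring]
    refine mul_rpow_le hC.le (mul_le_mul_of_nonpos_right ?_ hx.le)
    have : (0 : ℝ) ≤ m := m.cast_nonneg
    linarith
  · have h1 := HC (n - (m + 1 : ℕ)) l hlh
    rw [show n - ((m + 1 : ℕ) : ℤ) + 1 = n - (m : ℕ) by push_cast; ring] at h1
    refine h1.mono (le_of_eq ?_)
    congr 2; push_cast; ring

lemma Params.exists_bE_step_bound (hP : Params p h r s ρ c0) :
    ∃ C : ℝ, 0 < C ∧ ∀ (b : ℚ_[p]) (n : ℤ) (j : ℕ), j ≤ h → (1 ≤ n ∨ (p : ℝ) ^ (-n) < ‖b‖) →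
      BB h r ρ (C * (p : ℝ) ^ ((n : ℝ) * (s - 1 - j)))
        (ρ ^ n • (bE b n (cpow L b j) - bE b (n + 1) (cpow L b j))) := by
  obtain ⟨C, hC, HC⟩ := hP.exists_bE_bound 1
  have hp0 := p_pos (p := p)
  refine ⟨C * (p : ℝ) ^ r, by positivity, fun b n j hj hn => ?_⟩
  have hd := (natDegree_cpow_le (L := L) b j).trans hj
  have h1 := HC b n _ _ hd (supLe_cpow b n j) hn
  have h2 := HC b (n + 1) _ _ hd ((supLe_cpow b n j).subball
    (by rw [sub_self, norm_zero]; exact zpow_nonneg hp0.le _) (by omega))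
    (hn.imp (by omega) fun h => lt_of_le_of_lt (zpow_le_zpow_right₀ one_lt_p.le (by omega)) h)
  have h3 : (p : ℝ) ^ ((n : ℝ) * r) ≤ (p : ℝ) ^ (((n + 1 : ℤ) : ℝ) * r) := by
    refine Real.rpow_le_rpow_of_exponent_le one_lt_p.le (mul_le_mul_of_nonneg_right ?_ hP.r_pos.le)
    push_cast; linarith
  have h4 := ((h1.mono (by gcongr)).sub hP.r_pos.le h2).smul hP.r_pos.le (ρ ^ n)
  refine h4.mono (le_of_eq ?_)
  rw [hP.norm_rho_zpow, mul_left_comm, mul_assoc C, ← Real.rpow_add p_pos, ← Real.rpow_add p_pos,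
    ← Real.rpow_add p_pos]
  congr 2
  push_cast; ring

lemma Params.exists_spc_sub_bound (hP : Params p h r s ρ c0) :
    ∃ C : ℝ, 0 < C ∧ ∀ (b : ℚ_[p]) (n : ℤ) (j : ℕ), j ≤ h → s - 1 < j →
      (1 ≤ n ∨ (p : ℝ) ^ (-n) < ‖b‖) →
      BB h r ρ (C * (p : ℝ) ^ ((n : ℝ) * (s - 1 - j))) (spc ρ b j - bH ρ b n (cpow L b j)) := by
  obtain ⟨C, hC, HC⟩ := hP.exists_bE_step_bound
  refine ⟨C, hC, fun b n j hj hjs hn => ?_⟩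
  have hx : s - 1 - (j : ℝ) < 0 := by linarith
  refine BB.of_hasSum hP.r_pos.le (G := fun m : ℕ => bH ρ b (n + (m + 1 : ℕ)) (cpow L b j) -
    bH ρ b (n + (m : ℕ)) (cpow L b j)) (fun z => ?_)
    (tendsto_rpow_shift (p := p) hx n C) (fun m => ?_) (fun m => ?_)
  · have h1 : Tendsto (fun m : ℕ => bH ρ b (n + (m : ℕ)) (cpow L b j) z) atTop
        (𝓝 (spc ρ b j z)) := by
      refine tendsto_const_nhds.congr' ?_
      filter_upwards [eventually_ge_atTop ((z - b).valuation + 1 - n).toNat] with m hm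
      rw [bH_apply, eval_cpow, spc]
      rcases eq_or_ne z b with rfl | hz
      · rw [if_pos rfl, if_pos]
        rw [sub_self, norm_zero]; exact zpow_nonneg p_pos.le _
      · rw [if_neg hz, if_neg]
        rw [padic_norm_le_iff (sub_ne_zero.2 hz)]; omega
    have h2 := hasSum_telescope h1
    rwa [Nat.cast_zero, add_zero] at h2
  · refine mul_rpow_le hC.le (mul_le_mul_of_nonpos_right ?_ hx.le)
    have : (0 : ℝ) ≤ m := m.cast_nonneg
    linarith
  · have h1 := HC b (n + (m : ℕ)) j hj (hn.imp (by omega) fun h =>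
      lt_of_le_of_lt (zpow_le_zpow_right₀ one_lt_p.le (by omega)) h)
    have h2 : bH ρ b (n + (m + 1 : ℕ)) (cpow L b j) - bH ρ b (n + (m : ℕ)) (cpow L b j) =
        ρ ^ (n + (m : ℕ)) • (bE b (n + (m : ℕ)) (cpow L b j) -
          bE b (n + (m : ℕ) + 1) (cpow L b j)) := by
      rw [Nat.cast_succ, ← add_assoc, bH_succ, add_sub_cancel_left]
    rw [h2]
    refine h1.mono (le_of_eq ?_)
    push_cast; rfl

lemma exists_norm_le_zpow (b : ℚ_[p]) (n : ℤ) : ∃ m : ℤ, m ≤ n ∧ ‖b‖ ≤ (p : ℝ) ^ (-m) := by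
  rcases eq_or_ne b 0 with rfl | hb
  · exact ⟨n, le_rfl, by rw [norm_zero]; exact zpow_nonneg p_pos.le _⟩
  · exact ⟨min n b.valuation, min_le_left _ _, (padic_norm_le_iff hb).2 (min_le_right _ _)⟩

lemma Params.exists_BB_mono (hP : Params p h r s ρ c0) {l : ℕ} (hl : (l : ℝ) < r) :
    ∃ η, BB h r ρ η (monomialFun p L l) := by
  obtain ⟨C, hC, HC⟩ := hP.exists_mono_sub_bound
  obtain ⟨C', hC', HC'⟩ := hP.exists_bE_bound 0
  have hlh : l ≤ h := by
    have := hP.r_lt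
    have : (l : ℝ) < h + 1 := by linarith
    exact_mod_cast Nat.lt_succ_iff.1 (by exact_mod_cast this)
  have h1 := HC 0 l hl
  have h2 := HC' 0 0 _ _ ((natDegree_cpow_le _ _).trans hlh) (supLe_cpow (L := L) (0 : ℚ_[p]) 0 l)
    (Or.inl le_rfl)
  have h3 := (h1.mono (le_max_left _ _)).add hP.r_pos.le (h2.mono (le_max_right _ _))
  rw [sub_add_cancel] at h3
  exact ⟨_, h3⟩

lemma Params.exists_BB_spc (hP : Params p h r s ρ c0) (b : ℚ_[p]) {j : ℕ} (hj : j ≤ h)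
    (hjs : s - 1 < j) : ∃ η, BB h r ρ η (spc ρ b j) := by
  obtain ⟨C, hC, HC⟩ := hP.exists_spc_sub_bound
  obtain ⟨m, hm, hbm⟩ := exists_norm_le_zpow b 1
  obtain ⟨C', hC', HC'⟩ := hP.exists_bH_bound m 1
  have h3 := ((HC b 1 j hj hjs (Or.inl le_rfl)).mono (le_max_left _ _)).add hP.r_pos.le
    ((HC' b 1 j hj le_rfl hbm).mono (le_max_right _ _))
  rw [sub_add_cancel] at h3
  exact ⟨_, h3⟩

lemma FB.norm_le (hμ : FB h r ρ μ K) {C x : ℝ} {f : ℚ_[p] → L} (hf : BB h r ρ (C * x) f) :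
    ‖μ f‖ ≤ K * C * x := (hμ _ _ hf).trans_eq (mul_assoc _ _ _).symm

lemma FB.exists_bd_zero (hP : Params p h r s ρ c0) (hK : 0 ≤ K) (hμ : FB h r ρ μ K)
    (hg : KillsGen h r s ρ μ) : ∃ P : ℝ, 0 ≤ P ∧ ∀ (n : ℤ) (l : ℕ), n ≤ 0 → l ≤ h →
      ‖μ (bE (0 : ℚ_[p]) n (cpow L (0 : ℚ_[p]) l))‖ ≤ P * (p : ℝ) ^ ((n : ℝ) * (r - l)) := by
  obtain ⟨C, hC, HC⟩ := hP.exists_mono_sub_bound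
  obtain ⟨C', hC', HC'⟩ := hP.exists_bE_bound 0
  obtain ⟨C₁, hC₁, HC₁⟩ := hP.exists_shell_bound
  have hp0 := p_pos (p := p)
  refine ⟨K * max C (max C' C₁), by positivity, fun n l hn hl => ?_⟩
  rcases lt_or_ge (l : ℝ) r with hlr | hlr
  · have h1 := hμ.norm_le (HC n l hlr)
    rw [map_sub, hg.mono_eq l hlr, zero_sub, norm_neg] at h1
    exact h1.trans (by gcongr; exact le_max_left _ _)
  · induction n, hn using Int.leInductionDown with
    | base =>
      have h2 := HC' 0 0 _ _ ((natDegree_cpow_le _ _).trans hl) (supLe_cpow (L := L) (0 : ℚ_[p]) 0 l)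
        (Or.inl le_rfl)
      refine (hμ.norm_le h2).trans ?_
      rw [Int.cast_zero, zero_mul, zero_mul, neg_zero, zero_mul, Real.rpow_zero, one_mul]
      gcongr
      exact (le_max_left _ _).trans (le_max_right _ _)
    | pred n hn ih =>
      have h1 := hμ.norm_le (HC₁ (n - 1) l hl)
      rw [sub_add_cancel] at h1
      rw [← sub_add_cancel (bE (0 : ℚ_[p]) (n - 1) (cpow L (0 : ℚ_[p]) l))
        (bE (0 : ℚ_[p]) n (cpow L (0 : ℚ_[p]) l)), map_add]
      refine (IsUltrametricDist.norm_add_le_max _ _).trans (max_le (h1.trans ?_) (ih.trans ?_))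
      · gcongr
        exact (le_max_right _ _).trans (le_max_right _ _)
      · refine mul_rpow_le (by positivity) (mul_le_mul_of_nonpos_right ?_ (by linarith))
        push_cast; linarith

lemma FB.exists_bd_bE (hP : Params p h r s ρ c0) (hK : 0 ≤ K) (hμ : FB h r ρ μ K)
    (hg : KillsGen h r s ρ μ) : ∃ P : ℝ, 0 ≤ P ∧ ∀ (b : ℚ_[p]) (n : ℤ) (j : ℕ), j ≤ h →
      ‖μ (bE b n (cpow L b j))‖ ≤ P * (p : ℝ) ^ ((n : ℝ) * (r - j)) := by
  obtain ⟨P, hP0, HP⟩ := hμ.exists_bd_zero hP hK hg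
  obtain ⟨C', hC', HC'⟩ := hP.exists_bE_bound 0
  obtain ⟨C, hC, HC⟩ := exists_coeff_bound p L h
  have hp0 := p_pos (p := p)
  refine ⟨max (K * C') (C * P), by positivity, fun b n j hj => ?_⟩
  have hd := (natDegree_cpow_le (L := L) b j).trans hj
  by_cases hn : 0 ≤ n ∨ (p : ℝ) ^ (-n) < ‖b‖
  · refine (hμ.norm_le (HC' b n _ _ hd (supLe_cpow b n j) hn)).trans ?_
    rw [← Real.rpow_add p_pos, show (n : ℝ) * r + -(n * j) = n * (r - j) by ring]
    gcongr
    exact le_max_left _ _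
  · push Not at hn
    have hb : ‖b - 0‖ ≤ (p : ℝ) ^ (-n) := by rw [sub_zero]; exact hn.2
    rw [bE_congr hb]
    have h1 := (supLe_cpow (L := L) b n j).subball (b' := 0) (n' := n) (by rwa [← norm_neg, neg_sub])
      le_rfl
    obtain ⟨q, hq, hqb⟩ := HC 0 n _ _ hd h1
    rw [hq, map_sum, map_sum]
    refine IsUltrametricDist.norm_sum_le_of_forall_le_of_nonneg (by positivity) fun l hl => ?_
    have hlh : l ≤ h := by rw [Finset.mem_range] at hl; omega
    rw [map_smul, map_smul, norm_smul]
    refine (mul_le_mul (hqb l hlh) (HP n l hn.1.le hlh) (norm_nonneg _) (by positivity)).trans ?_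
    have e : C * ((p : ℝ) ^ ((n : ℝ) * l) * (p : ℝ) ^ (-((n : ℝ) * j))) *
        (P * (p : ℝ) ^ ((n : ℝ) * (r - l))) = C * P * (p : ℝ) ^ ((n : ℝ) * (r - j)) := by
      rw [show (n : ℝ) * (r - j) = n * l + -(n * j) + n * (r - l) by ring, Real.rpow_add p_pos,
        Real.rpow_add p_pos]
      ring
    rw [e]
    gcongr
    exact le_max_right _ _

/-- A bounded functional which vanishes on the generators satisfies `Bd`. -/
theorem FB.exists_bd (hP : Params p h r s ρ c0) (hK : 0 ≤ K) (hμ : FB h r ρ μ K)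
    (hg : KillsGen h r s ρ μ) : ∃ P : ℝ, Bd h r s ρ μ P := by
  obtain ⟨P, hP0, HP⟩ := hμ.exists_bd_bE hP hK hg
  obtain ⟨C, hC, HC⟩ := hP.exists_bH_bound_of_ball
  obtain ⟨C₁, hC₁, HC₁⟩ := hP.exists_spc_sub_bound
  have hp0 := p_pos (p := p)
  have hr := hP.r_pos
  have hpr : (1 : ℝ) ≤ (p : ℝ) ^ r := Real.one_le_rpow one_lt_p.le hr.le
  set M := max (P * (p : ℝ) ^ r) (max (K * C) (K * C₁)) with hM
  have hM0 : 0 ≤ M := le_max_of_le_left (by positivity)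
  have hPM : P ≤ M := (le_mul_of_one_le_right hP0 hpr).trans (le_max_left _ _)
  have hA : ∀ (b : ℚ_[p]) (n : ℤ) (j : ℕ), j ≤ h → n ≤ 1 → ‖b‖ ≤ (p : ℝ) ^ (-n) →
      ‖μ (bH ρ b n (cpow L b j))‖ ≤ M * (p : ℝ) ^ ((n : ℝ) * (s - 1 - j)) := by
    intro b n j hj hn hb
    refine (hμ.norm_le (HC b n j hj hn hb)).trans ?_
    gcongr
    exact (le_max_left _ _).trans (le_max_right _ _)
  refine ⟨M, fun b n j hj => (HP b n j hj).trans (by gcongr), fun b n j hj => ?_⟩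
  by_cases hc : n ≤ 1 ∧ ‖b‖ ≤ (p : ℝ) ^ (-n)
  · exact hA b n j hj hc.1 hc.2
  rcases lt_or_ge (s - 1) (j : ℝ) with hjs | hjs
  · have hn : 1 ≤ n ∨ (p : ℝ) ^ (-n) < ‖b‖ := by
      by_contra hcon
      push Not at hcon
      exact hc ⟨hcon.1.le, hcon.2⟩
    have h1 := hμ.norm_le (HC₁ b n j hj hjs hn)
    rw [map_sub, hg.spc_eq b j hj hjs, zero_sub, norm_neg] at h1
    refine h1.trans ?_
    gcongr
    exact (le_max_right _ _).trans (le_max_right _ _)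
  · obtain ⟨m, hm, hbm⟩ := exists_norm_le_zpow b (min 1 n)
    have hmn : m ≤ n := hm.trans (min_le_right _ _)
    clear hc
    induction n, hmn using Int.leInduction with
    | base => exact hA b m j hj (hm.trans (min_le_left _ _)) hbm
    | succ n hn ih =>
      have hm1 : m ≤ 1 := hm.trans (min_le_left _ _)
      have ih := ih (le_min hm1 hn)
      have hmono : M * (p : ℝ) ^ ((n : ℝ) * (s - 1 - j)) ≤
          M * (p : ℝ) ^ (((n + 1 : ℤ) : ℝ) * (s - 1 - j)) :=
        mul_rpow_le hM0 (mul_le_mul_of_nonneg_right (by push_cast; linarith) (by linarith))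
      rw [bH_succ, map_add, map_smul, map_sub]
      refine (IsUltrametricDist.norm_add_le_max _ _).trans (max_le (ih.trans hmono) ?_)
      refine le_trans ?_ hmono
      have h1 := HP b n j hj
      have h2 := HP b (n + 1) j hj
      have h3 : ‖μ (bE b n (cpow L b j)) - μ (bE b (n + 1) (cpow L b j))‖ ≤
          P * (p : ℝ) ^ r * (p : ℝ) ^ ((n : ℝ) * (r - j)) := by
        rw [sub_eq_add_neg]
        refine (IsUltrametricDist.norm_add_le_max _ _).trans (max_le (h1.trans ?_) ?_)
        · gcongr
          exact le_mul_of_one_le_right hP0 hpr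
        · rw [norm_neg]
          refine h2.trans ?_
          rw [mul_assoc, ← Real.rpow_add p_pos]
          refine mul_le_mul_of_nonneg_left (Real.rpow_le_rpow_of_exponent_le one_lt_p.le ?_) hP0
          have : (0 : ℝ) ≤ j := j.cast_nonneg
          push_cast; linarith
      rw [norm_smul, hP.norm_rho_zpow]
      refine (mul_le_mul_of_nonneg_left h3 (by positivity)).trans ?_
      rw [mul_left_comm, ← Real.rpow_add p_pos,
        show (n : ℝ) * (-(r - s + 1)) + n * (r - j) = n * (s - 1 - j) by ring]
      gcongr
      exact le_max_left _ _

end BoundedFunctionals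

section Continuity

variable {p : ℕ} [hp : Fact p.Prime] {L : Type} [NontriviallyNormedField L]
  [NormedAlgebra ℚ_[p] L] [IsUltrametricDist L] [CompleteSpace L]
variable {h : ℕ} {r s : ℝ} {ρ c0 : L} {η η' : ℝ} {μ : (ℚ_[p] → L) →ₗ[L] L} {K : ℝ}

open Polynomial

lemma atomGroup_induction {q : (ℚ_[p] → L) → Prop} (hA : ∀ g, IsAtom h r s ρ η g → q g) (h0 : q 0)
    (hadd : ∀ f g, q f → q g → q (f + g)) (hneg : ∀ f, q f → q (-f)) {g : ℚ_[p] → L}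
    (hg : g ∈ atomGroup p h r s ρ η) : q g :=
  AddSubgroup.closure_induction (fun x hx => hA x hx) h0 (fun x y _ _ hx hy => hadd x y hx hy)
    (fun x _ hx => hneg x hx) hg

lemma Params.exists_atom_BB (hP : Params p h r s ρ c0) :
    ∃ C : ℝ, 0 < C ∧ ∀ (η : ℝ) (g : ℚ_[p] → L), 0 ≤ η → g ∈ atomGroup p h r s ρ η →
      BB h r ρ (C * η) g := by
  obtain ⟨C, hC, HC⟩ := hP.exists_bE_bound 1
  obtain ⟨C', hC', HC'⟩ := hP.exists_bH_bound_of_ball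
  have hr := hP.r_pos.le
  refine ⟨max C C', by positivity, fun η g hη hg => ?_⟩
  refine atomGroup_induction (fun g hg => ?_) (BB.zero hr (by positivity))
    (fun f g hf hg => hf.add hr hg) (fun f hf => hf.neg hr) hg
  cases hg with
  | ball b n Q c hQ hc hn h1 =>
    have hc0 := hc.nonneg
    exact (HC b n Q c hQ hc hn).mono (mul_le_mul (le_max_left _ _) h1
      (mul_nonneg (Real.rpow_nonneg p_pos.le _) hc0) (by positivity))
  | infinity n l c hl hn h1 =>
    refine ((HC' 0 n l hl hn ?_).smul hr c).mono ?_
    · rw [norm_zero]; exact zpow_nonneg p_pos.le _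
    · rw [mul_left_comm]
      exact mul_le_mul (le_max_right _ _) h1 (mul_nonneg (norm_nonneg _)
        (Real.rpow_nonneg p_pos.le _)) (by positivity)

/-- A bounded functional is controlled by its values on the atoms. -/
lemma Params.exists_FB_of_atoms (hP : Params p h r s ρ c0) :
    ∃ C : ℝ, 0 < C ∧ ∀ (μ : (ℚ_[p] → L) →ₗ[L] L) (K K' : ℝ), FB h r ρ μ K → 0 ≤ K' →
      (∀ η g, IsAtom h r s ρ η g → ‖μ g‖ ≤ K' * η) → FB h r ρ μ (K' * C) := by
  obtain ⟨C, hC, HC⟩ := hP.exists_atomic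
  obtain ⟨C₁, hC₁, HC₁⟩ := hP.exists_atom_BB
  have hr := hP.r_pos.le
  refine ⟨C, hC, fun μ K K' hμ hK' hat η f hf => ?_⟩
  obtain ⟨G, A, hA, hA0, hAη, hG, hs⟩ := HC η f hf
  have hη := hf.nonneg
  have hat' : ∀ N, ‖μ (G N)‖ ≤ K' * A N := fun N => by
    have hKA : 0 ≤ K' * A N := mul_nonneg hK' (hA0 N)
    refine atomGroup_induction (q := fun g => ‖μ g‖ ≤ K' * A N) (fun g hg => hat _ g hg) ?_
      (fun f g hf hg => ?_) (fun f hf => ?_) (hG N)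
    · rwa [map_zero, norm_zero]
    · rw [map_add]; exact (IsUltrametricDist.norm_add_le_max _ _).trans (max_le hf hg)
    · rwa [map_neg, norm_neg]
  refine le_of_forall_pos_le_add fun δ hδ => ?_
  set ε := δ / (|K| * C₁ + 1) with hε
  have hε0 : 0 < ε := by positivity
  obtain ⟨M, hM⟩ := eventually_atTop.1 (hA.eventually (gt_mem_nhds hε0))
  have hR : BB h r ρ (C₁ * ε) (f - ∑ N ∈ Finset.range M, G N) := by
    refine BB.of_hasSum hr (G := fun N => G (N + M)) (A := fun N => C₁ * A (N + M)) (fun z => ?_) ?_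
      (fun N => ?_) (fun N => HC₁ _ _ (hA0 _) (hG _))
    · have := (hasSum_nat_add_iff' M).2 (hs z)
      rwa [Pi.sub_apply, Finset.sum_apply]
    · have := (hA.comp (tendsto_add_atTop_nat M)).const_mul C₁
      rwa [mul_zero] at this
    · exact mul_le_mul_of_nonneg_left (hM _ (by omega)).le hC₁.le
  have h1 : ‖μ (f - ∑ N ∈ Finset.range M, G N)‖ ≤ δ := by
    refine (hμ _ _ hR).trans ?_
    calc K * (C₁ * ε) ≤ |K| * (C₁ * ε) := mul_le_mul_of_nonneg_right (le_abs_self K) (by positivity)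
      _ ≤ (|K| * C₁ + 1) * ε := by rw [add_mul, one_mul, mul_assoc]; linarith
      _ = δ := by rw [hε]; field_simp
  have h2 : ‖μ (∑ N ∈ Finset.range M, G N)‖ ≤ K' * C * η := by
    rw [map_sum]
    refine IsUltrametricDist.norm_sum_le_of_forall_le_of_nonneg (by positivity) fun N _ => ?_
    rw [mul_assoc]
    exact (hat' N).trans (mul_le_mul_of_nonneg_left (hAη N) hK')
  rw [← sub_add_cancel f (∑ N ∈ Finset.range M, G N), map_add]
  refine (IsUltrametricDist.norm_add_le_max _ _).trans (max_le (h1.trans ?_) (h2.trans ?_))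
  · have : 0 ≤ K' * C * η := by positivity
    linarith
  · linarith

/-- Affine substitutions are bounded. -/
lemma Params.exists_affT_bound (hP : Params p h r s ρ c0) {d : ℚ_[p]} (hd : d ≠ 0) (e : ℚ_[p]) :
    ∃ C : ℝ, 0 < C ∧ ∀ (η : ℝ) (f : ℚ_[p] → L), BB h r ρ η f → BB h r ρ (C * η) (affT d e f) := by
  set v := d.valuation with hv
  obtain ⟨C₀, hC₀, HC₀⟩ := hP.exists_atomic
  obtain ⟨C, hC, HC⟩ := hP.exists_bE_bound (min 1 (e.valuation + 1) - v)
  obtain ⟨m, -, hm⟩ := exists_norm_le_zpow ((0 - e) / d) 0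
  obtain ⟨C', hC', HC'⟩ := hP.exists_bH_bound m (1 - v)
  have hr := hP.r_pos.le
  have hp0 := p_pos (p := p)
  have hρ := norm_pos_iff.2 (zpow_ne_zero v hP.rho_ne_zero)
  set D := max (C * (p : ℝ) ^ (-(v : ℝ) * r)) (C' * (‖ρ ^ v‖ * (p : ℝ) ^ (-(v : ℝ) * (s - 1)))) with hD
  have hD0 : 0 < D := by positivity
  have key : ∀ (η : ℝ) (g : ℚ_[p] → L), 0 ≤ η → g ∈ atomGroup p h r s ρ η →
      BB h r ρ (D * η) (affT d e g) := by
    intro η g hη hg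
    refine atomGroup_induction (q := fun g => BB h r ρ (D * η) (affT d e g)) (fun g hg => ?_)
      ?_ (fun f g hf hg => ?_) (fun f hf => ?_) hg
    · cases hg with
      | ball b n Q c hQ hc hn h1 =>
        rw [affT_bE hd]
        refine (HC _ _ _ c (natDegree_affP_le _ _ hQ) (hc.affP hd e) ?_).mono ?_
        · rw [← hv]
          rcases hn with hn | hn
          · left; have := min_le_left 1 (e.valuation + 1); omega
          · by_cases hbe : ‖b - e‖ ≤ (p : ℝ) ^ (-n)
            · left
              have he : ¬ ‖e‖ ≤ (p : ℝ) ^ (-n) := fun he => by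
                have := padic_norm_sub_le (z := 0) hbe (by rwa [sub_zero])
                rw [sub_zero] at this
                exact absurd hn (not_lt.2 this)
              have he0 : e ≠ 0 := by
                rintro rfl; rw [norm_zero] at he; exact he (zpow_nonneg hp0.le _)
              rw [padic_norm_le_iff he0] at he
              have := min_le_right 1 (e.valuation + 1); omega
            · right
              rw [norm_div, padic_norm_eq hd, ← hv, lt_div_iff₀ (zpow_pos hp0 _),
                ← zpow_add₀ hp0.ne', show -(n - v) + -v = -n by ring]
              exact not_le.1 hbe
        · rw [← hv]
          push_cast
          rw [show ((n : ℝ) - v) * r = -(v : ℝ) * r + n * r by ring, Real.rpow_add p_pos, mul_assoc,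
            ← mul_assoc C]
          exact mul_le_mul (le_max_left _ _) h1 (mul_nonneg (by positivity) hc.nonneg) hD0.le
      | infinity n l c hl hn h1 =>
        rw [map_smul, affT_bH hP.rho_ne_zero hd, affP_cpow hd, map_smul, ← hv]
        refine ((((HC' _ (n - v) l hl (by omega) hm).smul hr _).smul hr _).smul hr _).mono ?_
        rw [norm_iotaL_pow hd, ← hv]
        have e1 : ‖c‖ * (‖ρ ^ v‖ * ((p : ℝ) ^ (-(v : ℝ) * l) *
            (C' * (p : ℝ) ^ (((n - v : ℤ) : ℝ) * (s - 1 - l))))) =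
            C' * (‖ρ ^ v‖ * (p : ℝ) ^ (-(v : ℝ) * (s - 1))) *
              (‖c‖ * (p : ℝ) ^ ((n : ℝ) * (s - 1 - l))) := by
          have : (p : ℝ) ^ (-(v : ℝ) * l) * (p : ℝ) ^ (((n - v : ℤ) : ℝ) * (s - 1 - l)) =
              (p : ℝ) ^ (-(v : ℝ) * (s - 1)) * (p : ℝ) ^ ((n : ℝ) * (s - 1 - l)) := by
            rw [← Real.rpow_add p_pos, ← Real.rpow_add p_pos]
            congr 1; push_cast; ring
          linear_combination ‖c‖ * ‖ρ ^ v‖ * C' * this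
        rw [e1]
        exact mul_le_mul (le_max_right _ _) h1 (by positivity) hD0.le
    · rw [map_zero]; exact BB.zero hr (by positivity)
    · rw [map_add]; exact hf.add hr hg
    · rw [map_neg]; exact hf.neg hr
  refine ⟨D * C₀, by positivity, fun η f hf => ?_⟩
  obtain ⟨G, A, hA, hA0, hAη, hG, hs⟩ := HC₀ η f hf
  refine BB.of_hasSum hr (G := fun N => affT d e (G N)) (A := fun N => D * A N)
    (fun z => hs (d * z + e)) ?_ (fun N => ?_) (fun N => key _ _ (hA0 N) (hG N))
  · simpa using hA.const_mul D
  · rw [mul_assoc]; exact mul_le_mul_of_nonneg_left (hAη N) hD0.le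

/-- The norm of a bounded functional is controlled by its constant in `Bd`. -/
lemma Params.exists_bd_FB (hP : Params p h r s ρ c0) :
    ∃ C : ℝ, 0 < C ∧ ∀ (κ : (ℚ_[p] → L) →ₗ[L] L) (K P : ℝ), FB h r ρ κ K → Bd h r s ρ κ P →
      FB h r ρ κ (C * P) := by
  obtain ⟨C, hC, HC⟩ := hP.exists_FB_of_atoms
  obtain ⟨C', hC', HC'⟩ := exists_coeff_bound p L h
  have hp0 := p_pos (p := p)
  refine ⟨max 1 C' * C, by positivity, fun κ K P hκ hb => ?_⟩
  have hP0 := hb.nonneg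
  rw [mul_right_comm]
  refine HC κ K _ hκ (by positivity) fun η g hg => ?_
  cases hg with
  | ball b n Q c hQ hc hn h1 =>
    obtain ⟨q, hq, hqb⟩ := HC' b n Q c hQ hc
    have hc0 := hc.nonneg
    have hη0 : 0 ≤ η := le_trans (by positivity) h1
    rw [hq, map_sum, map_sum]
    refine IsUltrametricDist.norm_sum_le_of_forall_le_of_nonneg (by positivity) fun l hl => ?_
    have hlh : l ≤ h := by rw [Finset.mem_range] at hl; omega
    rw [map_smul, map_smul, norm_smul]
    refine (mul_le_mul (hqb l hlh) (hb.bE_le b n l hlh) (norm_nonneg _) (by positivity)).trans ?_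
    have e : C' * ((p : ℝ) ^ ((n : ℝ) * l) * c) * (P * (p : ℝ) ^ ((n : ℝ) * (r - l))) =
        C' * P * ((p : ℝ) ^ ((n : ℝ) * r) * c) := by
      rw [show (n : ℝ) * r = n * l + n * (r - l) by ring, Real.rpow_add p_pos]
      ring
    rw [e]
    gcongr
    exact le_max_right _ _
  | infinity n l c hl hn h1 =>
    rw [map_smul, norm_smul]
    have h2 := mul_le_mul_of_nonneg_left (hb.bH_le 0 n l hl) (norm_nonneg c)
    rw [mul_left_comm] at h2
    have hη0 : 0 ≤ η := le_trans (by positivity) h1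
    refine h2.trans (mul_le_mul ?_ h1 (by positivity) (by positivity))
    exact le_mul_of_one_le_left hP0 (le_max_left _ _)

lemma bE_mem_spanE (b : ℚ_[p]) (n : ℤ) {Q : L[X]} (hQ : Q.natDegree ≤ h) :
    bE b n Q ∈ spanE p L h := Submodule.subset_span ⟨b, n, Q, hQ, rfl⟩

lemma eq_zero_of_forall_zpow {x : L} {P y : ℝ} (hy : y ≠ 0)
    (hx : ∀ n : ℤ, ‖x‖ ≤ P * (p : ℝ) ^ ((n : ℝ) * y)) : x = 0 := by
  rw [← norm_le_zero_iff]
  rcases lt_or_gt_of_ne hy with h1 | h1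
  · refine ge_of_tendsto' (tendsto_rpow_shift (p := p) h1 0 P) fun m => ?_
    simpa using hx m
  · refine ge_of_tendsto' (tendsto_rpow_shift (p := p) (neg_neg_of_pos h1) 0 P) fun m => ?_
    simpa using hx (-m)

/-- A bounded functional which vanishes on the generators and on the locally polynomial functions
with compact support is zero. -/
theorem FB.eq_zero (hP : Params p h r s ρ c0) (hK : 0 ≤ K) (hμ : FB h r ρ μ K)
    (hg : KillsGen h r s ρ μ) (hE : ∀ f ∈ spanE p L h, μ f = 0) {f : ℚ_[p] → L}
    (hf : BB h r ρ η f) : μ f = 0 := by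
  haveI := charZero_L p L
  obtain ⟨P, hb⟩ := hμ.exists_bd hP hK hg
  have hstep : ∀ (b : ℚ_[p]) (n : ℤ) (Q : L[X]), Q.natDegree ≤ h →
      μ (bH ρ b (n + 1) Q) = μ (bH ρ b n Q) := fun b n Q hQ => by
    rw [bH_succ, map_add, map_smul, map_sub, hE _ (bE_mem_spanE b n hQ),
      hE _ (bE_mem_spanE b (n + 1) hQ), sub_zero, smul_zero, add_zero]
  have hind : ∀ (b : ℚ_[p]) (n : ℤ) (Q : L[X]), Q.natDegree ≤ h →
      μ (bH ρ b n Q) = μ (bH ρ b 0 Q) := fun b n Q hQ => by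
    induction n using Int.induction_on with
    | zero => rfl
    | succ n ih => rw [hstep b n Q hQ, ih]
    | pred n ih => rw [← ih, ← hstep b (-n - 1) Q hQ, sub_add_cancel]
  have hz : ∀ (b : ℚ_[p]) (l : ℕ), l ≤ h → s - 1 - (l : ℝ) ≠ 0 → μ (bH ρ b 0 (cpow L b l)) = 0 := by
    intro b l hl hs
    refine eq_zero_of_forall_zpow (p := p) (P := P) hs fun n => ?_
    rw [← hind b n _ ((natDegree_cpow_le b l).trans hl)]
    exact hb.bH_le b n l hl
  have hall : ∀ l : ℕ, l ≤ h → μ (bH ρ (0 : ℚ_[p]) 0 (cpow L (0 : ℚ_[p]) l)) = 0 := by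
    intro l hl
    by_cases hs : s - 1 - (l : ℝ) = 0
    · have hl1 : l + 1 ≤ h := by
        have h1 := hP.sum_eq
        have h2 := hP.s_le
        have h3 : (2 : ℝ) * (l + 1) ≤ h + 1 := by linarith
        have h4 : 2 * (l + 1) ≤ h + 1 := by exact_mod_cast h3
        omega
      have h1 := hz 1 (l + 1) hl1 (by push_cast; linarith)
      have hcong : ‖(1 : ℚ_[p]) - 0‖ ≤ (p : ℝ) ^ (-(0 : ℤ)) := by simp
      rw [bH_congr ρ hcong] at h1
      have h2 := linearMap_poly_eq_sum (μ ∘ₗ bH ρ (0 : ℚ_[p]) 0) (Q := cpow L (1 : ℚ_[p]) (l + 1))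
        (n := l + 2) (by have := natDegree_cpow_le (L := L) (1 : ℚ_[p]) (l + 1); omega)
      rw [LinearMap.comp_apply, h1] at h2
      have hX : ∀ i : ℕ, (X : L[X]) ^ i = cpow L (0 : ℚ_[p]) i := fun i => by simp [cpow, iotaL]
      rw [Finset.sum_eq_single l (fun i hi hil => ?_) (fun hl => absurd (by simp) hl)] at h2
      · have h3 : (cpow L (1 : ℚ_[p]) (l + 1)).coeff l ≠ 0 := by
          rw [cpow, sub_eq_add_neg, ← C_neg, coeff_X_add_C_pow]
          simp only [iotaL, map_one, Nat.choose_succ_self_right, add_tsub_cancel_left, pow_one]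
          rw [neg_one_mul, neg_ne_zero]
          exact_mod_cast Nat.succ_ne_zero l
        have h4 := (mul_eq_zero.1 h2.symm).resolve_left h3
        rwa [LinearMap.comp_apply, hX] at h4
      · rw [Finset.mem_range] at hi
        rw [LinearMap.comp_apply, hX, hz 0 i (by omega), mul_zero]
        intro h5
        have : (i : ℝ) = l := by linarith
        exact hil (by exact_mod_cast this)
    · exact hz 0 l hl hs
  obtain ⟨C, hC, HC⟩ := hP.exists_FB_of_atoms
  have h0 := HC μ K 0 hμ le_rfl (fun η g hg => ?_) η f hf
  · rw [zero_mul, zero_mul] at h0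
    exact norm_le_zero_iff.1 h0
  · rw [zero_mul, norm_le_zero_iff]
    cases hg with
    | ball b n Q c hQ hc hn h1 => exact hE _ (bE_mem_spanE b n hQ)
    | infinity n l c hl hn h1 =>
      rw [map_smul, hind _ _ _ ((natDegree_cpow_le _ _).trans hl), hall l hl, smul_zero]

lemma Params.exists_BB_of_mem_spanE (hP : Params p h r s ρ c0) {f : ℚ_[p] → L}
    (hf : f ∈ spanE p L h) : ∃ η, BB h r ρ η f := by
  refine Submodule.span_induction ?_ ⟨0, BB.zero hP.r_pos.le le_rfl⟩ ?_ ?_ hf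
  · rintro _ ⟨b, n, Q, hQ, rfl⟩
    obtain ⟨C, hC, HC⟩ := hP.exists_bE_bound n
    obtain ⟨c, hc⟩ : ∃ c, SupLe b n Q c := by
      obtain ⟨c, hc⟩ := (isCompact_closedBall b ((p : ℝ) ^ (-n))).exists_bound_of_continuousOn
        (f := fun z => Q.eval (iotaL p L z)) (Q.continuous.comp continuous_iotaL).continuousOn
      exact ⟨c, fun z hz => hc z (by rwa [Metric.mem_closedBall, dist_eq_norm])⟩
    exact ⟨_, HC b n Q c hQ hc (Or.inl le_rfl)⟩
  · rintro f g - - ⟨η, hf⟩ ⟨η', hg⟩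
    exact ⟨_, (hf.mono (le_max_left η η')).add hP.r_pos.le (hg.mono (le_max_right η η'))⟩
  · rintro c f - ⟨η, hf⟩
    exact ⟨_, hf.smul hP.r_pos.le c⟩

end Continuity

section Link

variable {p : ℕ} [hp : Fact p.Prime] {L : Type} [NontriviallyNormedField L]
  [NormedAlgebra ℚ_[p] L] [IsUltrametricDist L] [CompleteSpace L]
variable {k : ℕ} {α β : L} {f g : ℚ_[p] → L} {η : ℝ}

lemma valL_ne_zero {x : L} (hx : valL p L x ≠ 0) : x ≠ 0 := by
  rintro rfl
  simp [valL] at hx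

lemma norm_eq_rpow_valL {x : L} (hx : x ≠ 0) : ‖x‖ = (p : ℝ) ^ (-valL p L x) := by
  rw [valL, neg_neg, Real.rpow_logb p_pos one_lt_p.ne' (norm_pos_iff.2 hx)]

lemma Hyps.params (H : Hyps p L k α β) :
    Params p (k - 2) (valL p L α) (valL p L β) (α * (p : L) / β)
      (((p : L) - 1) / ((p : L) - α * (p : L) / β)) := by
  obtain ⟨hk, hne, hα, hβ, hsum, hle⟩ := H
  have hα0 := valL_ne_zero hα.ne'
  have hβ0 := valL_ne_zero hβ.ne'
  have hρ : α * (p : L) / β ≠ p := fun h => by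
    rw [div_eq_iff hβ0, mul_comm] at h
    exact hne (mul_left_cancel₀ (pL_ne_zero (p := p)) h)
  refine ⟨?_, hβ, hle, ?_, hρ, div_mul_cancel₀ _ (sub_ne_zero.2 hρ.symm)⟩
  · rw [hsum, Nat.cast_sub hk]
    push_cast
    ring
  · rw [norm_div, norm_mul, norm_eq_rpow_valL (p := p) hα0, norm_eq_rpow_valL (p := p) hβ0,
      norm_pL (p := p), ← Real.rpow_neg_one, ← Real.rpow_add p_pos, ← Real.rpow_sub p_pos]
    congr 1
    ring

lemma MemB.ext2_spec (hf : MemB p L k α β f) : Ext2 p L k α β f (ext2 p L k α β f) := by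
  rw [ext2, dif_pos hf.2]
  exact hf.2.choose_spec

lemma MemB.bb (hf : MemB p L k α β f) :
    BB (k - 2) (valL p L α) (α * (p : L) / β) (bNorm p L k α β f) f :=
  ⟨⟨hf.1, le_max_left _ _⟩, _, ⟨hf.ext2_spec.1, le_max_right _ _⟩, hf.ext2_spec.2⟩

lemma BB.memB (hf : BB (k - 2) (valL p L α) (α * (p : L) / β) η f) : MemB p L k α β f :=
  ⟨hf.1.1, hf.2.choose, hf.2.choose_spec.1.1, hf.2.choose_spec.2⟩

lemma IsCr.eq_of_eq_off_zero {σ : ℝ} (hσ : 0 ≤ σ) {u v : ℤ_[p] → L} (hu : IsCr p L σ u)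
    (hv : IsCr p L σ v) (h : ∀ z, z ≠ 0 → u z = v z) : u = v := by
  have ht : Tendsto (fun n : ℕ => (p : ℤ_[p]) ^ n) atTop (𝓝 0) :=
    tendsto_pow_atTop_nhds_zero_of_norm_lt_one
      (by rw [PadicInt.norm_p]; exact inv_lt_one_of_one_lt₀ one_lt_p)
  have h0 : u 0 = v 0 := by
    refine tendsto_nhds_unique (((hu.continuous hσ).tendsto 0).comp ht) ?_
    refine (((hv.continuous hσ).tendsto 0).comp ht).congr fun n => (h _ ?_).symm
    exact pow_ne_zero _ (by exact_mod_cast hp.out.ne_zero)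
  funext z
  by_cases hz : z = 0
  · rw [hz, h0]
  · exact h z hz

lemma BB.bNorm_le (hr : 0 ≤ valL p L α)
    (hf : BB (k - 2) (valL p L α) (α * (p : L) / β) η f) : bNorm p L k α β f ≤ η := by
  have hs := hf.memB.ext2_spec
  obtain ⟨h1, g, hg, h3⟩ := hf
  have he : ext2 p L k α β f = g :=
    hs.1.eq_of_eq_off_zero hr hg.1 fun z hz => (hs.2 z hz).trans (h3 z hz).symm
  refine max_le h1.2 ?_
  rw [he]
  exact hg.2

/-- The Banach space `B(α)` as a subspace of the space of functions on `ℚ_p`. -/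
def subB (p : ℕ) [Fact p.Prime] {L : Type} [NontriviallyNormedField L] [NormedAlgebra ℚ_[p] L]
    [IsUltrametricDist L] [CompleteSpace L] (k : ℕ) (α β : L) (hr : 0 ≤ valL p L α) :
    Submodule L (ℚ_[p] → L) where
  carrier := {f | MemB p L k α β f}
  add_mem' hf hg := ((hf.bb.mono (le_max_left _ _)).add hr (hg.bb.mono (le_max_right _ _))).memB
  zero_mem' := (BB.zero hr le_rfl).memB
  smul_mem' c _ hf := (hf.bb.smul hr c).memB

lemma ultraSeminorm_bNorm (hr : 0 ≤ valL p L α) :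
    UltraSeminorm L fun f : subB p k α β hr => bNorm p L k α β f where
  nonneg f := (MemB.bb f.2).nonneg
  add_le f g := (((MemB.bb f.2).mono (le_max_left _ _)).add hr
    ((MemB.bb g.2).mono (le_max_right _ _))).bNorm_le hr
  smul_le c f := ((MemB.bb f.2).smul hr c).bNorm_le hr

/-- A function of `B(α)` at positive distance from a subspace is separated from it by a bounded
functional. -/
lemma exists_FB_separating [ProperSpace L] (hr : 0 ≤ valL p L α) {W : Submodule L (ℚ_[p] → L)}
    (hW : ∀ f ∈ W, MemB p L k α β f) (hg : MemB p L k α β g) {ε : ℝ} (hε : 0 < ε)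
    (hd : ∀ f ∈ W, ε ≤ bNorm p L k α β (g - f)) :
    ∃ (μ : (ℚ_[p] → L) →ₗ[L] L) (K : ℝ), 0 ≤ K ∧
      FB (k - 2) (valL p L α) (α * (p : L) / β) μ K ∧ (∀ f ∈ W, μ f = 0) ∧ μ g = 1 := by
  obtain ⟨μ, h1, h2, h3⟩ := (ultraSeminorm_bNorm (k := k) (β := β) hr).exists_separating
    (W.comap (subB p k α β hr).subtype) (x := ⟨g, hg⟩) hε fun f hf => hd _ hf
  obtain ⟨ν, hν⟩ := LinearMap.exists_extend μ
  have hν' : ∀ f (hf : MemB p L k α β f), ν f = μ ⟨f, hf⟩ := fun f hf => by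
    rw [← hν]
    rfl
  refine ⟨ν, ε⁻¹, (inv_pos.2 hε).le, fun η f hf => ?_, fun f hf => ?_, ?_⟩
  · rw [hν' f hf.memB]
    exact (h1 _).trans (mul_le_mul_of_nonneg_left (hf.bNorm_le hr) (inv_pos.2 hε).le)
  · rw [hν' f (hW f hf)]
    exact h2 _ hf
  · rw [hν' g hg, h3]

lemma Hyps.exponent_bounds (H : Hyps p L k α β) {j : ℕ} (hj : (j : ℝ) < valL p L α) :
    j ≤ k - 2 ∧ k - 2 - j ≤ k - 2 ∧ valL p L β - 1 < ((k - 2 - j : ℕ) : ℝ) := by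
  have h1 := H.params.sum_eq
  have h2 := H.params.s_pos
  have h3 : j < k - 2 + 1 := by
    have : (j : ℝ) < (k - 2 : ℕ) + 1 := by linarith
    exact_mod_cast this
  have h4 : j ≤ k - 2 := by omega
  refine ⟨h4, by omega, ?_⟩
  rw [Nat.cast_sub h4]
  linarith

lemma Hyps.memB_of_mem_lGen (H : Hyps p L k α β) (hf : f ∈ lGen p L k α β) :
    MemB p L k α β f := by
  obtain ⟨j, hj, rfl | ⟨a, rfl⟩⟩ := hf
  · obtain ⟨η, hη⟩ := H.params.exists_BB_mono hj
    exact hη.memB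
  · obtain ⟨-, h1, h2⟩ := H.exponent_bounds hj
    obtain ⟨η, hη⟩ := H.params.exists_BB_spc a h1 h2
    exact hη.memB

lemma Hyps.killsGen (H : Hyps p L k α β) {μ : (ℚ_[p] → L) →ₗ[L] L}
    (hμ : ∀ f ∈ lGen p L k α β, μ f = 0) :
    KillsGen (k - 2) (valL p L α) (valL p L β) (α * (p : L) / β) μ where
  mono_eq l hl := hμ _ ⟨l, hl, Or.inl rfl⟩
  spc_eq b j hj hs := by
    refine hμ _ ⟨k - 2 - j, ?_, Or.inr ⟨b, ?_⟩⟩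
    · have h1 := H.params.sum_eq
      rw [Nat.cast_sub hj]
      linarith
    · funext z
      rw [specFun, show k - 2 - (k - 2 - j) = j by omega]
      rfl

/-- The functions of `B(α)` are approximated by sums of locally polynomial functions with compact
support and of elements of the span of the generators of `L(α)`. -/
lemma Hyps.exists_approx [ProperSpace L] (H : Hyps p L k α β) (hf : MemB p L k α β f) {ε : ℝ}
    (hε : 0 < ε) : ∃ u ∈ spanE p L (k - 2), ∃ v ∈ Submodule.span L (lGen p L k α β),
      bNorm p L k α β (f - (u + v)) < ε := by
  have hr := H.params.r_pos.le
  by_contra hcon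
  push Not at hcon
  have hsub : spanE p L (k - 2) ⊔ Submodule.span L (lGen p L k α β) ≤ subB p k α β hr := by
    refine sup_le (fun u hu => ?_) (Submodule.span_le.2 fun u hu => H.memB_of_mem_lGen hu)
    obtain ⟨η, hη⟩ := H.params.exists_BB_of_mem_spanE hu
    exact hη.memB
  obtain ⟨μ, K, hK, hμ, h0, h1⟩ := exists_FB_separating hr hsub hf hε fun w hw => by
    obtain ⟨u, hu, v, hv, rfl⟩ := Submodule.mem_sup.1 hw
    exact hcon u hu v hv
  have h2 := hμ.eq_zero H.params hK
    (H.killsGen fun u hu => h0 u (Submodule.mem_sup_right (Submodule.subset_span hu)))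
    (fun u hu => h0 u (Submodule.mem_sup_left hu)) hf.bb
  rw [h1] at h2
  exact one_ne_zero h2

/-- The functionals which are bounded on `B(α)` and vanish on `S`. -/
def annih (k : ℕ) (α β : L) (S : Set (ℚ_[p] → L)) : Submodule L ((ℚ_[p] → L) →ₗ[L] L) where
  carrier := {μ | (∃ K, 0 ≤ K ∧ FB (k - 2) (valL p L α) (α * (p : L) / β) μ K) ∧ ∀ f ∈ S, μ f = 0}
  add_mem' := by
    rintro μ ν ⟨⟨K, hK, hμ⟩, h1⟩ ⟨⟨K', hK', hν⟩, h2⟩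
    refine ⟨⟨K + K', add_nonneg hK hK', fun η f hf => ?_⟩, fun f hf => ?_⟩
    · rw [LinearMap.add_apply, add_mul]
      exact (norm_add_le _ _).trans (add_le_add (hμ η f hf) (hν η f hf))
    · rw [LinearMap.add_apply, h1 f hf, h2 f hf, add_zero]
  zero_mem' := ⟨⟨0, le_rfl, fun η f hf => by simp⟩, fun f _ => rfl⟩
  smul_mem' := by
    rintro c μ ⟨⟨K, hK, hμ⟩, h1⟩
    refine ⟨⟨‖c‖ * K, by positivity, fun η f hf => ?_⟩, fun f hf => ?_⟩
    · rw [LinearMap.smul_apply, norm_smul, mul_assoc]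
      exact mul_le_mul_of_nonneg_left (hμ η f hf) (norm_nonneg c)
    · rw [LinearMap.smul_apply, h1 f hf, smul_zero]

lemma affT_eq_smul_gAct (hα : α ≠ 0) {d : ℚ_[p]} (e : ℚ_[p]) :
    affT d e f = α ^ d.valuation • gAct p L k α β !![1, -e; 0, d] f := by
  funext z
  rw [affT_apply, Pi.smul_apply, gAct]
  simp [det2, iotaL, mul_inv_cancel_left₀ (zpow_ne_zero _ hα)]

lemma Hyps.affFam (H : Hyps p L k α β) {S : Set (ℚ_[p] → L)} (hL : lGen p L k α β ⊆ S)
    (hsmul : ∀ c : L, ∀ f ∈ S, c • f ∈ S)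
    (hact : ∀ m : Matrix (Fin 2) (Fin 2) ℚ_[p], det2 p m ≠ 0 → m 1 0 = 0 →
        ∀ f ∈ S, gAct p L k α β m f ∈ S) :
    AffFam (k - 2) (valL p L α) (valL p L β) (α * (p : L) / β) (annih k α β S) where
  exists_bd := by
    rintro μ ⟨⟨K, hK, hμ⟩, h1⟩
    exact hμ.exists_bd H.params hK (H.killsGen fun f hf => h1 f (hL hf))
  comp_mem := by
    rintro μ ⟨⟨K, hK, hμ⟩, h1⟩ d hd e
    obtain ⟨C, hC, h2⟩ := H.params.exists_affT_bound hd e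
    refine ⟨⟨K * C, by positivity, fun η f hf => ?_⟩, fun f hf => h1 _ ?_⟩
    · rw [mul_assoc]
      exact hμ _ _ (h2 η f hf)
    · rw [affT_eq_smul_gAct (k := k) (β := β) (valL_ne_zero H.params.r_pos.ne')]
      exact hsmul _ _ (hact _ (by simpa [det2] using hd) (by simp) f hf)

end Link

/-- `Π(V) = B(α)/L(α)` is topologically irreducible already as a representation
of the Borel subgroup `B(ℚ_p)` of upper triangular matrices: a closed subspace
stable under all upper triangular `g ∈ GL₂(ℚ_p)` is `0` or `Π`. -/
theorem statement13 (p : ℕ) [Fact p.Prime] (L : Type) [NontriviallyNormedField L]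
    [NormedAlgebra ℚ_[p] L] [FiniteDimensional ℚ_[p] L] [IsUltrametricDist L]
    (k : ℕ) (α β : L) (h : Hyps p L k α β) :
    ∀ S : Set (ℚ_[p] → L),
      (∀ f ∈ S, MemB p L k α β f) →
      (∀ f : ℚ_[p] → L, MemLalpha p L k α β f → f ∈ S) →
      (∀ f ∈ S, ∀ g ∈ S, f + g ∈ S) →
      (∀ c : L, ∀ f ∈ S, c • f ∈ S) →
      (∀ m : Matrix (Fin 2) (Fin 2) ℚ_[p], det2 p m ≠ 0 → m 1 0 = 0 →
        ∀ f ∈ S, gAct p L k α β m f ∈ S) →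
      (∀ f : ℚ_[p] → L, MemB p L k α β f →
        (∀ ε : ℝ, 0 < ε → ∃ g ∈ S, bNorm p L k α β (f - g) < ε) → f ∈ S) →
      (∀ f ∈ S, MemLalpha p L k α β f) ∨ (∀ f : ℚ_[p] → L, MemB p L k α β f → f ∈ S) := by
  intro S hSB hLS hadd hsmul hact hclosed
  haveI : ProperSpace L := FiniteDimensional.proper ℚ_[p] L
  have hr := h.params.r_pos.le
  by_contra hcon
  push Not at hcon
  obtain ⟨⟨f, hfS, hfL⟩, g, hg, hgS⟩ := hcon
  have hbN0 : bNorm p L k α β 0 ≤ 0 := (BB.zero hr le_rfl).bNorm_le hr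
  have hgen : ∀ u ∈ Submodule.span L (lGen p L k α β), MemB p L k α β u := fun u hu =>
    (Submodule.span_le (p := subB p k α β hr)).2 (fun v hv => h.memB_of_mem_lGen hv) hu
  have hspanS : ∀ u ∈ Submodule.span L (lGen p L k α β), u ∈ S := fun u hu =>
    hLS u ⟨hgen u hu, fun ε hε => ⟨u, hu, by rw [sub_self]; exact hbN0.trans_lt hε⟩⟩
  have hLgen : lGen p L k α β ⊆ S := fun u hu => hspanS u (Submodule.subset_span hu)
  let W : Submodule L (ℚ_[p] → L) :=
    { carrier := S
      add_mem' := fun {a b} ha hb => hadd a ha b hb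
      zero_mem' := hspanS 0 (zero_mem _)
      smul_mem' := hsmul }
  have hF := h.affFam hLgen hsmul hact
  obtain ⟨ε, hε, hdg⟩ : ∃ ε : ℝ, 0 < ε ∧ ∀ u ∈ W, ε ≤ bNorm p L k α β (g - u) := by
    by_contra hc
    push Not at hc
    exact hgS (hclosed g hg hc)
  obtain ⟨μ, K, hK, hμ, hμS, hμg⟩ := exists_FB_separating hr (W := W) hSB hg hε hdg
  have hμE : ∃ μ ∈ annih k α β S, ∃ u ∈ spanE p L (k - 2), μ u ≠ 0 := by
    refine ⟨μ, ⟨⟨K, hK, hμ⟩, hμS⟩, ?_⟩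
    by_contra hc
    push Not at hc
    have h0 := hμ.eq_zero h.params hK (h.killsGen fun u hu => hμS u (hLgen hu)) hc hg.bb
    rw [hμg] at h0
    exact one_ne_zero h0
  obtain ⟨C, hC, happ⟩ := hF.exists_approx h.params hμE
  obtain ⟨δ, hδ, hdf⟩ : ∃ δ : ℝ, 0 < δ ∧
      ∀ u ∈ Submodule.span L (lGen p L k α β), δ ≤ bNorm p L k α β (f - u) := by
    by_contra hc
    push Not at hc
    exact hfL ⟨hSB f hfS, hc⟩
  obtain ⟨ν, K', hK', hν, hνL, hνf⟩ := exists_FB_separating hr hgen (hSB f hfS) hδ hdf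
  obtain ⟨P, hP⟩ := hν.exists_bd h.params hK'
    (h.killsGen fun u hu => hνL u (Submodule.subset_span hu))
  obtain ⟨C', hC', hFB⟩ := h.params.exists_bd_FB
  have hP0 := hP.nonneg
  obtain ⟨M, hM⟩ : ∃ M, M = K' + C' * (C * P) + 1 := ⟨_, rfl⟩
  have hMp : 0 ≤ C' * (C * P) := by positivity
  have hM0 : 0 < M := by rw [hM]; positivity
  obtain ⟨u, hu, v, hv, huv⟩ := h.exists_approx (hSB f hfS) (inv_pos.2 hM0)
  obtain ⟨κ, ⟨⟨K'', -, hκ⟩, hκS⟩, hκb, hκu⟩ := happ ν P hP u hu 1 one_pos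
  have hκ' := hFB κ K'' _ hκ hκb
  have hw : BB (k - 2) (valL p L α) (α * (p : L) / β) (bNorm p L k α β (f - (u + v)))
      (f - (u + v)) := by
    refine MemB.bb ((subB p k α β hr).sub_mem (hSB f hfS)
      ((subB p k α β hr).add_mem ?_ (hgen v hv)))
    obtain ⟨η, hη⟩ := h.params.exists_BB_of_mem_spanE hu
    exact hη.memB
  have key : ∀ (τ : (ℚ_[p] → L) →ₗ[L] L) (D : ℝ), D < M →
      FB (k - 2) (valL p L α) (α * (p : L) / β) τ D → ‖τ (f - (u + v))‖ < 1 := fun τ D hD hτ => by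
    have h1 := hw.nonneg
    refine (hτ _ _ hw).trans_lt ?_
    calc D * bNorm p L k α β (f - (u + v)) ≤ M * bNorm p L k α β (f - (u + v)) := by gcongr
      _ < M * M⁻¹ := by gcongr
      _ = 1 := mul_inv_cancel₀ hM0.ne'
  have h1 := key ν K' (by linarith) hν
  have h2 := key κ _ (by linarith) hκ'
  have h3 : ν f = ν (f - (u + v)) + ((ν u - κ u) - κ (f - (u + v))) := by
    simp only [map_sub, map_add, hνL v hv, hκS v (hspanS v hv), hκS f hfS]
    ring
  have h4 : ‖ν f‖ < 1 := by
    rw [h3]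
    refine (IsUltrametricDist.norm_add_le_max _ _).trans_lt (max_lt h1 ?_)
    rw [sub_eq_add_neg (ν u - κ u)]
    exact (IsUltrametricDist.norm_add_le_max _ _).trans_lt (max_lt hκu (by rwa [norm_neg]))
  rw [hνf, norm_one] at h4
  exact lt_irrefl _ h4

end Paper

end
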